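/- A function φ ∈ BMO(ℝ^n) belongs to VMO(ℝ^n) if and only if there exist φ_0, φ_1, …, φ_n ∈ BUC(ℝ^n) (bounded uniformly continuous) such that φ = φ_0 + Σ_{j=1}^n R_j(φ_j), where R_j are the Riesz transforms extended to L^∞. -/

import Mathlib

open MeasureTheory Real Set Filter

/-- Open axis-parallel cube with corner `c` and side length `l`. -/
def cube {n : ℕ} (c : EuclideanSpace ℝ (Fin n)) (l : ℝ) : Set (EuclideanSpace ℝ (Fin n)) :=
  {x | ∀ i, x i ∈ Set.Ioo (c i) (c i + l)}

/-- Mean of `f` over the cube with corner `c` and side length `l`. -/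
noncomputable def cubeAvg {n : ℕ} (f : EuclideanSpace ℝ (Fin n) → ℝ)
    (c : EuclideanSpace ℝ (Fin n)) (l : ℝ) : ℝ :=
  (∫ x in cube c l, f x) / l ^ n

/-- Mean oscillation of `f` over the cube with corner `c` and side length `l`. -/
noncomputable def cubeOsc {n : ℕ} (f : EuclideanSpace ℝ (Fin n) → ℝ)
    (c : EuclideanSpace ℝ (Fin n)) (l : ℝ) : ℝ :=
  (∫ x in cube c l, |f x - cubeAvg f c l|) / l ^ n

/-- `f ∈ BMO(ℝⁿ)`. -/
def IsBMO {n : ℕ} (f : EuclideanSpace ℝ (Fin n) → ℝ) : Prop :=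
  LocallyIntegrable f ∧ ∃ C, ∀ c l, 0 < l → cubeOsc f c l ≤ C

/-- `f ∈ VMO(ℝⁿ)`. -/
def IsVMO {n : ℕ} (f : EuclideanSpace ℝ (Fin n) → ℝ) : Prop :=
  IsBMO f ∧ ∀ ε > (0 : ℝ), ∃ δ > (0 : ℝ), ∀ c l, 0 < l → l ≤ δ → cubeOsc f c l ≤ ε

/-- The `BMO` seminorm `‖f‖_*`. -/
noncomputable def bmoNorm {n : ℕ} (f : EuclideanSpace ℝ (Fin n) → ℝ) : ℝ :=
  sInf {C : ℝ | 0 ≤ C ∧ ∀ c l, 0 < l → cubeOsc f c l ≤ C}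

/-- Riesz kernel `K_j(x) = c_n x_j / |x|^{n+1}` with `c_n = Γ((n+1)/2)/π^((n+1)/2)`. -/
noncomputable def rieszK (n : ℕ) (j : Fin n) (x : EuclideanSpace ℝ (Fin n)) : ℝ :=
  (Real.Gamma (((n : ℝ) + 1) / 2) / Real.pi ^ (((n : ℝ) + 1) / 2)) * x j / ‖x‖ ^ (n + 1)

/-- `ε`-truncation of the Riesz transform of `φ ∈ L²`:
`∫_{|x-y| ≥ ε} K_j(x-y) φ(y) dy`. -/
noncomputable def rieszTruncL2 {n : ℕ} (j : Fin n) (φ : EuclideanSpace ℝ (Fin n) → ℝ)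
    (x : EuclideanSpace ℝ (Fin n)) (ε : ℝ) : ℝ :=
  ∫ y in {y : EuclideanSpace ℝ (Fin n) | ε ≤ dist x y}, rieszK n j (x - y) * φ y

/-- `ε`-truncation of the Riesz transform extended to `L^∞`:
`∫_{|x-y| ≥ ε} (K_j(x-y) - K_j(-y) χ_{|y| ≥ 1}(y)) φ(y) dy`. -/
noncomputable def rieszTruncLinf {n : ℕ} (j : Fin n) (φ : EuclideanSpace ℝ (Fin n) → ℝ)
    (x : EuclideanSpace ℝ (Fin n)) (ε : ℝ) : ℝ :=
  ∫ y in {y : EuclideanSpace ℝ (Fin n) | ε ≤ dist x y},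
    (rieszK n j (x - y) - (if 1 ≤ ‖y‖ then rieszK n j (-y) else 0)) * φ y

/-- `g` is the principal-value Riesz transform (extended to `L^∞`) of `φ`, a.e. -/
def IsRieszTransformLinf {n : ℕ} (j : Fin n) (φ g : EuclideanSpace ℝ (Fin n) → ℝ) : Prop :=
  ∀ᵐ x : EuclideanSpace ℝ (Fin n),
    Tendsto (fun ε => rieszTruncLinf j φ x ε) (nhdsWithin 0 (Set.Ioi 0)) (nhds (g x))

set_option linter.unusedVariables false
set_option linter.unusedSimpArgs false

/-! ## Part A: cubes and mean oscillation -/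

abbrev Eu (n : ℕ) := EuclideanSpace ℝ (Fin n)

theorem cube_eq_preimage {n : ℕ} (c : Eu n) (l : ℝ) :
    cube c l = (@WithLp.ofLp 2 (Fin n → ℝ)) ⁻¹'
      (Set.univ.pi fun i => Set.Ioo (c i) (c i + l)) := by
  ext x; simp [cube]

theorem measurableSet_cube {n : ℕ} (c : Eu n) (l : ℝ) : MeasurableSet (cube c l) := by
  rw [cube_eq_preimage]
  exact (PiLp.volume_preserving_ofLp (Fin n)).measurable
    (MeasurableSet.univ_pi fun i => measurableSet_Ioo)

theorem volume_cube {n : ℕ} (c : Eu n) {l : ℝ} (hl : 0 ≤ l) :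
    volume (cube c l) = ENNReal.ofReal (l ^ n) := by
  rw [cube_eq_preimage, (PiLp.volume_preserving_ofLp (Fin n)).measure_preimage
    (MeasurableSet.univ_pi fun i => measurableSet_Ioo).nullMeasurableSet, Real.volume_pi_Ioo]
  simp [ENNReal.ofReal_pow hl]

theorem volume_real_cube {n : ℕ} (c : Eu n) {l : ℝ} (hl : 0 ≤ l) :
    volume.real (cube c l) = l ^ n := by
  rw [Measure.real, volume_cube c hl, ENNReal.toReal_ofReal (by positivity)]

theorem volume_cube_lt_top {n : ℕ} (c : Eu n) (l : ℝ) : volume (cube c l) < ⊤ := by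
  rw [cube_eq_preimage, (PiLp.volume_preserving_ofLp (Fin n)).measure_preimage
    (MeasurableSet.univ_pi fun i => measurableSet_Ioo).nullMeasurableSet, Real.volume_pi_Ioo]
  exact ENNReal.prod_lt_top (by simp)

instance {n : ℕ} (c : Eu n) (l : ℝ) : IsFiniteMeasure (volume.restrict (cube c l)) :=
  ⟨by simpa using volume_cube_lt_top c l⟩

theorem cube_subset_closedBall {n : ℕ} (c : Eu n) {l : ℝ} (hl : 0 ≤ l) :
    cube c l ⊆ Metric.closedBall c (l * √n) := by
  intro x hx
  rw [Metric.mem_closedBall, EuclideanSpace.dist_eq]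
  apply Real.sqrt_le_iff.2 ⟨by positivity, ?_⟩
  calc ∑ i, dist (x i) (c i) ^ 2 ≤ ∑ i : Fin n, l ^ 2 := by
        apply Finset.sum_le_sum
        intro i _
        have := hx i
        rw [Real.dist_eq, sq_abs]
        rw [mem_Ioo] at this
        nlinarith [this.1, this.2]
    _ = (l * √n) ^ 2 := by
        rw [mul_pow, Real.sq_sqrt (by positivity)]; simp [mul_comm]

theorem ball_subset_cube {n : ℕ} (x : Eu n) {r : ℝ} :
    Metric.ball x r ⊆ cube (WithLp.toLp 2 fun i => x i - r) (2 * r) := by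
  intro y hy i
  have h1 : |y i - x i| < r := by
    have h2 := PiLp.norm_apply_le (y - x) i
    rw [Metric.mem_ball, dist_eq_norm] at hy
    have h3 : ‖(y - x) i‖ = |y i - x i| := by simp
    linarith
  rw [abs_lt] at h1
  simp only [mem_Ioo]
  constructor <;> linarith [h1.1, h1.2]

theorem integrableOn_cube {n : ℕ} {f : Eu n → ℝ} (hf : LocallyIntegrable f) (c : Eu n) (l : ℝ) :
    IntegrableOn f (cube c l) := by
  rcases le_or_gt 0 l with hl | hl
  · exact (hf.integrableOn_isCompact (isCompact_closedBall c (l * √n))).mono_set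
      (cube_subset_closedBall c hl)
  · refine (hf.integrableOn_isCompact (isCompact_closedBall c 1)).mono_set ?_
    rcases Nat.eq_zero_or_pos n with rfl | hn
    · intro x _; simp [Subsingleton.elim x c]
    · intro x hx
      have := hx ⟨0, hn⟩
      simp at this; linarith [this.1, this.2]

theorem cube_nonempty_vol {n : ℕ} {l : ℝ} (hl : 0 < l) : (0:ℝ) < l ^ n := by positivity

/-- translation -/
theorem setIntegral_cube_sub {n : ℕ} (f : Eu n → ℝ) (c z : Eu n) (l : ℝ) :
    ∫ x in cube c l, f (x - z) = ∫ x in cube (c - z) l, f x := by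
  have h := (measurePreserving_sub_right (volume : Measure (Eu n)) z).setIntegral_preimage_emb
    (MeasurableEquiv.subRight z).measurableEmbedding f (cube (c - z) l)
  rw [← h]
  congr 2
  ext x
  simp [cube, sub_lt_iff_lt_add, sub_add_eq_add_sub]

/-- half open cube -/
def hcube {n : ℕ} (c : Eu n) (l : ℝ) : Set (Eu n) :=
  {x | ∀ i, x i ∈ Set.Ico (c i) (c i + l)}

theorem hcube_eq_preimage {n : ℕ} (c : Eu n) (l : ℝ) :
    hcube c l = (@WithLp.ofLp 2 (Fin n → ℝ)) ⁻¹'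
      (Set.univ.pi fun i => Set.Ico (c i) (c i + l)) := by
  ext x; simp [hcube]

theorem measurableSet_hcube {n : ℕ} (c : Eu n) (l : ℝ) : MeasurableSet (hcube c l) := by
  rw [hcube_eq_preimage]
  exact (PiLp.volume_preserving_ofLp (Fin n)).measurable
    (MeasurableSet.univ_pi fun i => measurableSet_Ico)

theorem cube_ae_eq_hcube {n : ℕ} (c : Eu n) (l : ℝ) :
    cube c l =ᵐ[volume] hcube c l := by
  rw [cube_eq_preimage, hcube_eq_preimage]
  apply (PiLp.volume_preserving_ofLp (Fin n)).quasiMeasurePreserving.preimage_ae_eq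
  rw [volume_pi]
  exact (Measure.univ_pi_Ioo_ae_eq_Icc (f := fun i => c i) (g := fun i => c i + l)).trans
    (Measure.univ_pi_Ico_ae_eq_Icc (f := fun i => c i) (g := fun i => c i + l)).symm

/-- corner of the child cube -/
noncomputable def childC {n : ℕ} (c : Eu n) (l : ℝ) (e : Fin n → Bool) : Eu n :=
  WithLp.toLp 2 fun i => c i + if e i then l / 2 else 0

theorem setIntegral_cube_split {n : ℕ} {f : Eu n → ℝ} (c : Eu n) {l : ℝ} (hl : 0 < l)
    (hf : IntegrableOn f (cube c l)) :
    ∫ x in cube c l, f x = ∑ e : Fin n → Bool, ∫ x in cube (childC c l e) (l / 2), f x := by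
  have key : hcube c l = ⋃ e : Fin n → Bool, hcube (childC c l e) (l / 2) := by
    ext x
    simp only [hcube, mem_iUnion, mem_ofPred_eq, childC]
    constructor
    · intro h
      refine ⟨fun i => decide (c i + l / 2 ≤ x i), fun i => ?_⟩
      have := h i
      simp only [mem_Ico] at this ⊢
      by_cases h2 : c i + l / 2 ≤ x i
      · have e : (decide (c i + l / 2 ≤ x i)) = true := by simpa using h2
        simp only [e, if_true]
        constructor <;> linarith [this.1, this.2]
      · have e : (decide (c i + l / 2 ≤ x i)) = false := by simpa using h2
        simp only [e, Bool.false_eq_true, if_false]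
        push Not at h2
        constructor <;> linarith [this.1, this.2]
    · rintro ⟨e, he⟩ i
      have := he i
      simp only [mem_Ico] at this ⊢
      cases h : e i <;> simp [h] at this <;> constructor <;> linarith [this.1, this.2]
  rw [setIntegral_congr_set (cube_ae_eq_hcube c l), key, integral_iUnion_fintype]
  · apply Finset.sum_congr rfl
    intro e _
    rw [setIntegral_congr_set (cube_ae_eq_hcube _ _)]
  · intro e; exact measurableSet_hcube _ _
  · intro e e' hee
    rw [Function.onFun, Set.disjoint_left]
    intro x hx hx'
    apply hee
    funext i
    have h1 := hx i
    have h2 := hx' i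
    simp only [childC, mem_Ico] at h1 h2
    cases h : e i <;> cases h' : e' i <;> simp [h, h'] at h1 h2 ⊢ <;> linarith [h1.1, h1.2, h2.1, h2.2]
  · intro e
    have h1 : IntegrableOn f (hcube c l) := hf.congr_set_ae (cube_ae_eq_hcube c l).symm
    rw [key] at h1
    exact h1.mono_set (subset_iUnion (fun e => hcube (childC c l e) (l / 2)) e)

theorem childC_subset {n : ℕ} (c : Eu n) {l : ℝ} (hl : 0 < l) (e : Fin n → Bool) :
    cube (childC c l e) (l / 2) ⊆ cube c l := by
  intro x hx i
  have := hx i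
  simp only [childC, mem_Ioo] at this ⊢
  cases h : e i <;> simp [h] at this <;> constructor <;> linarith [this.1, this.2]

theorem cubeAvg_mul {n : ℕ} (f : Eu n → ℝ) (c : Eu n) {l : ℝ} (hl : 0 < l) :
    ∫ x in cube c l, f x = cubeAvg f c l * l ^ n := by
  have := cube_nonempty_vol (n := n) hl
  rw [cubeAvg, div_mul_cancel₀ _ this.ne']

theorem cubeOsc_mul {n : ℕ} (f : Eu n → ℝ) (c : Eu n) {l : ℝ} (hl : 0 < l) :
    ∫ x in cube c l, |f x - cubeAvg f c l| = cubeOsc f c l * l ^ n := by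
  have := cube_nonempty_vol (n := n) hl
  rw [cubeOsc, div_mul_cancel₀ _ this.ne']

theorem setIntegral_cube_const {n : ℕ} (a : ℝ) (c : Eu n) {l : ℝ} (hl : 0 < l) :
    ∫ x in cube c l, a = a * l ^ n := by
  rw [setIntegral_const, volume_real_cube c hl.le, smul_eq_mul, mul_comm]

theorem integrableOn_cube_const {n : ℕ} (a : ℝ) (c : Eu n) (l : ℝ) :
    IntegrableOn (fun _ => a) (cube c l) := integrable_const a

theorem abs_cubeAvg_sub_le {n : ℕ} {f : Eu n → ℝ} {c : Eu n} {l : ℝ} (hl : 0 < l)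
    (hf : IntegrableOn f (cube c l)) (a : ℝ) :
    |cubeAvg f c l - a| * l ^ n ≤ ∫ x in cube c l, |f x - a| := by
  have h0 := cube_nonempty_vol (n := n) hl
  have h1 : ∫ x in cube c l, (f x - a) = (cubeAvg f c l - a) * l ^ n := by
    rw [integral_sub hf (integrableOn_cube_const a c l), setIntegral_cube_const a c hl,
      cubeAvg_mul f c hl]; ring
  have h2 : |cubeAvg f c l - a| * l ^ n = |∫ x in cube c l, (f x - a)| := by
    rw [h1, abs_mul, abs_of_pos h0]
  rw [h2]
  exact abs_integral_le_integral_abs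

theorem cubeOsc_le_two {n : ℕ} {f : Eu n → ℝ} {c : Eu n} {l : ℝ} (hl : 0 < l)
    (hf : IntegrableOn f (cube c l)) (a : ℝ) :
    cubeOsc f c l * l ^ n ≤ 2 * ∫ x in cube c l, |f x - a| := by
  have h0 := cube_nonempty_vol (n := n) hl
  rw [← cubeOsc_mul f c hl]
  have hi : IntegrableOn (fun x => |f x - a|) (cube c l) :=
    (hf.sub (integrableOn_cube_const a c l)).abs
  calc ∫ x in cube c l, |f x - cubeAvg f c l|
      ≤ ∫ x in cube c l, (|f x - a| + |cubeAvg f c l - a|) := by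
        apply integral_mono ((hf.sub (integrableOn_cube_const _ c l)).abs)
          (hi.add (integrableOn_cube_const _ c l))
        intro x
        have := abs_sub_le (f x) a (cubeAvg f c l)
        rw [abs_sub_comm a] at this
        exact this
    _ = (∫ x in cube c l, |f x - a|) + |cubeAvg f c l - a| * l ^ n := by
        rw [integral_add hi (integrableOn_cube_const _ c l), setIntegral_cube_const _ c hl]
    _ ≤ _ := by have := abs_cubeAvg_sub_le hl hf a; linarith

/-- nested cubes -/
theorem abs_cubeAvg_sub_cubeAvg_le {n : ℕ} {f : Eu n → ℝ} {c c' : Eu n} {l l' : ℝ} (hl : 0 < l)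
    (hl' : 0 < l') (hsub : cube c' l' ⊆ cube c l) (hf : IntegrableOn f (cube c l)) :
    |cubeAvg f c' l' - cubeAvg f c l| * l' ^ n ≤ cubeOsc f c l * l ^ n := by
  rw [← cubeOsc_mul f c hl]
  refine (abs_cubeAvg_sub_le hl' (hf.mono_set hsub) (cubeAvg f c l)).trans ?_
  apply setIntegral_mono_set
  · exact (hf.sub (integrableOn_cube_const _ c l)).abs
  · exact ae_of_all _ fun x => abs_nonneg _
  · exact hsub.eventuallyLE

theorem cubeOsc_nonneg {n : ℕ} (f : Eu n → ℝ) (c : Eu n) {l : ℝ} (hl : 0 < l) :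
    0 ≤ cubeOsc f c l := by
  apply div_nonneg (integral_nonneg fun x => abs_nonneg _) (by positivity)

/-- `BMO` with bound `b` -/
def BMOB {n : ℕ} (f : Eu n → ℝ) (b : ℝ) : Prop :=
  LocallyIntegrable f ∧ ∀ c l, 0 < l → cubeOsc f c l ≤ b

theorem BMOB.nonneg {n : ℕ} {f : Eu n → ℝ} {b : ℝ} (h : BMOB f b) : 0 ≤ b :=
  (cubeOsc_nonneg f 0 one_pos).trans (h.2 0 1 one_pos)

theorem BMOB.mono {n : ℕ} {f : Eu n → ℝ} {b b' : ℝ} (h : BMOB f b) (hb : b ≤ b') : BMOB f b' :=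
  ⟨h.1, fun c l hl => (h.2 c l hl).trans hb⟩

theorem BMOB.of_forall {n : ℕ} {f : Eu n → ℝ} {b : ℝ} (hf : LocallyIntegrable f)
    (h : ∀ c l, 0 < l → ∃ a, ∫ x in cube c l, |f x - a| ≤ b * l ^ n) : BMOB f (2 * b) := by
  refine ⟨hf, fun c l hl => ?_⟩
  obtain ⟨a, ha⟩ := h c l hl
  have h0 := cube_nonempty_vol (n := n) hl
  have := cubeOsc_le_two hl (integrableOn_cube hf c l) a
  nlinarith [this]

theorem cubeOsc_add_le {n : ℕ} {f g : Eu n → ℝ} {c : Eu n} {l : ℝ} (hl : 0 < l)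
    (hf : IntegrableOn f (cube c l)) (hg : IntegrableOn g (cube c l)) :
    cubeOsc (fun x => f x + g x) c l ≤ cubeOsc f c l + cubeOsc g c l := by
  have h0 := cube_nonempty_vol (n := n) hl
  have e : cubeAvg (fun x => f x + g x) c l = cubeAvg f c l + cubeAvg g c l := by
    rw [cubeAvg, integral_add hf hg, add_div]; rfl
  rw [← mul_le_mul_iff_left₀ h0, add_mul, ← cubeOsc_mul _ _ hl, ← cubeOsc_mul _ _ hl,
    ← cubeOsc_mul _ _ hl, e]
  have i1 := (hf.sub (integrableOn_cube_const (cubeAvg f c l) c l)).abs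
  have i2 := (hg.sub (integrableOn_cube_const (cubeAvg g c l) c l)).abs
  have := integral_add i1 i2
  simp only [Pi.sub_apply] at this
  rw [← this]
  apply integral_mono
  · exact ((hf.add hg).sub (integrableOn_cube_const _ c l)).abs
  · exact i1.add i2
  · intro x
    simp only [Pi.sub_apply]
    calc |f x + g x - (cubeAvg f c l + cubeAvg g c l)|
        = |(f x - cubeAvg f c l) + (g x - cubeAvg g c l)| := by congr 1; ring
      _ ≤ _ := abs_add_le _ _

theorem cubeOsc_neg {n : ℕ} (f : Eu n → ℝ) (c : Eu n) (l : ℝ) :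
    cubeOsc (fun x => - f x) c l = cubeOsc f c l := by
  have e : cubeAvg (fun x => - f x) c l = - cubeAvg f c l := by
    rw [cubeAvg, integral_neg, neg_div]; rfl
  rw [cubeOsc, e, cubeOsc]
  congr 2
  funext x
  rw [← abs_neg]; congr 1; ring

theorem BMOB.add {n : ℕ} {f g : Eu n → ℝ} {b b' : ℝ} (h : BMOB f b) (h' : BMOB g b') :
    BMOB (fun x => f x + g x) (b + b') :=
  ⟨h.1.add h'.1, fun c l hl => (cubeOsc_add_le hl (integrableOn_cube h.1 c l)
    (integrableOn_cube h'.1 c l)).trans (add_le_add (h.2 c l hl) (h'.2 c l hl))⟩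

theorem BMOB.neg {n : ℕ} {f : Eu n → ℝ} {b : ℝ} (h : BMOB f b) :
    BMOB (fun x => - f x) b :=
  ⟨h.1.neg, fun c l hl => by rw [cubeOsc_neg]; exact h.2 c l hl⟩

theorem BMOB.sub {n : ℕ} {f g : Eu n → ℝ} {b b' : ℝ} (h : BMOB f b) (h' : BMOB g b') :
    BMOB (fun x => f x - g x) (b + b') := by
  simpa [sub_eq_add_neg] using h.add h'.neg

/-- truncation at height `N` -/
noncomputable def trunc (N : ℝ) (y : ℝ) : ℝ := max (min y N) (-N)

theorem trunc_lip (N x y : ℝ) : |trunc N x - trunc N y| ≤ |x - y| := by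
  unfold trunc
  refine (abs_max_sub_max_le_abs _ _ _).trans ?_
  have h := abs_min_sub_min_le_max x N y N
  simpa using h

theorem trunc_cont (N : ℝ) : Continuous (trunc N) := by unfold trunc; fun_prop

theorem trunc_le {N : ℝ} (hN : 0 ≤ N) (x : ℝ) : |trunc N x| ≤ N := by
  unfold trunc
  rw [abs_le]; constructor
  · exact le_max_right _ _
  · exact max_le (min_le_right _ _) (by linarith)

theorem trunc_abs_le {N : ℝ} (hN : 0 ≤ N) (x : ℝ) : |trunc N x| ≤ |x| := by
  have := trunc_lip N x 0
  have h0 : trunc N 0 = 0 := by unfold trunc; simp [hN]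
  simpa [h0] using this

theorem trunc_eq {N x : ℝ} (h : |x| ≤ N) : trunc N x = x := by
  rw [abs_le] at h
  unfold trunc
  rw [min_eq_left h.2, max_eq_left h.1]

theorem BMOB.trunc {n : ℕ} {f : Eu n → ℝ} {b : ℝ} (h : BMOB f b) {N : ℝ} (hN : 0 ≤ N) :
    BMOB (fun x => trunc N (f x)) (2 * b) := by
  have hl : LocallyIntegrable (fun x => _root_.trunc N (f x)) := by
    refine h.1.mono ((trunc_cont N).comp_aestronglyMeasurable h.1.aestronglyMeasurable) ?_
    exact ae_of_all _ fun x => trunc_abs_le hN _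
  apply BMOB.of_forall hl
  intro c l hl'
  refine ⟨_root_.trunc N (cubeAvg f c l), ?_⟩
  calc ∫ x in cube c l, |_root_.trunc N (f x) - _root_.trunc N (cubeAvg f c l)|
      ≤ ∫ x in cube c l, |f x - cubeAvg f c l| := by
        apply integral_mono
        · exact ((integrableOn_cube hl c l).sub (integrableOn_cube_const _ c l)).abs
        · exact ((integrableOn_cube h.1 c l).sub (integrableOn_cube_const _ c l)).abs
        · intro x; exact trunc_lip _ _ _
    _ = cubeOsc f c l * l ^ n := cubeOsc_mul f c hl'
    _ ≤ _ := by have := h.2 c l hl'; gcongr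

/-- integral bounds propagate from small cubes to all bigger cubes -/
theorem setIntegral_cube_le_of_small {n : ℕ} {g : Eu n → ℝ} (hg : LocallyIntegrable g)
    {A δ : ℝ} (hδ : 0 < δ)
    (h : ∀ c l, 0 < l → l ≤ δ → δ / 2 < l → ∫ x in cube c l, g x ≤ A * l ^ n) :
    ∀ c l, δ / 2 < l → ∫ x in cube c l, g x ≤ A * l ^ n := by
  have key : ∀ m : ℕ, ∀ c l, δ / 2 < l → l ≤ δ * 2 ^ m → ∫ x in cube c l, g x ≤ A * l ^ n := by
    intro m
    induction m with
    | zero => intro c l h1 h2; exact h c l (by linarith) (by simpa using h2) h1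
    | succ m ih =>
      intro c l h1 h2
      rcases le_or_gt l δ with h3 | h3
      · exact h c l (by linarith) h3 h1
      have hl : 0 < l := by linarith
      rw [setIntegral_cube_split c hl (integrableOn_cube hg c l)]
      calc _ ≤ ∑ e : Fin n → Bool, A * (l / 2) ^ n := by
            apply Finset.sum_le_sum
            intro e _
            apply ih _ _ (by linarith)
            rw [pow_succ] at h2; linarith
        _ = A * l ^ n := by
            simp [Finset.sum_const, Finset.card_univ, div_pow]
            field_simp
  intro c l hl
  obtain ⟨m, hm⟩ := pow_unbounded_of_one_lt (l / δ) (one_lt_two)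
  refine key m c l hl ?_
  rw [div_lt_iff₀ hδ] at hm
  linarith

/-- oscillation zero implies a.e. constant -/
theorem ae_const_of_osc_zero {n : ℕ} {f : Eu n → ℝ} (h : BMOB f 0) :
    ∃ a, ∀ᵐ x, f x = a := by
  -- exhaustion by cubes
  let Q : ℕ → Set (Eu n) := fun k => cube (WithLp.toLp 2 fun _ => -((k:ℝ)+1)) (2 * ((k:ℝ)+1))
  have hQ : ∀ k, ∀ᵐ x, x ∈ Q k → f x = cubeAvg f (WithLp.toLp 2 fun _ => -((k:ℝ)+1)) (2 * ((k:ℝ)+1)) := by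
    intro k
    have hl : (0:ℝ) < 2 * ((k:ℝ)+1) := by positivity
    have h0 : cubeOsc f (WithLp.toLp 2 fun _ => -((k:ℝ)+1)) (2 * ((k:ℝ)+1)) = 0 :=
      le_antisymm (h.2 _ _ hl) (cubeOsc_nonneg _ _ hl)
    have h1 := cubeOsc_mul f (WithLp.toLp 2 fun _ => -((k:ℝ)+1)) hl
    have hintg : IntegrableOn (fun x => |f x - cubeAvg f (WithLp.toLp 2 fun _ => -((k:ℝ)+1))
      (2 * ((k:ℝ)+1))|) (cube (WithLp.toLp 2 fun _ => -((k:ℝ)+1)) (2 * ((k:ℝ)+1))) :=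
      ((integrableOn_cube h.1 _ _).sub (integrableOn_cube_const _ _ _)).abs
    rw [h0, zero_mul, integral_eq_zero_iff_of_nonneg (fun x => abs_nonneg _) hintg] at h1
    have h2 := (ae_restrict_iff' (measurableSet_cube _ _)).1 h1
    filter_upwards [h2] with x hx hxQ
    have := hx hxQ
    simpa [sub_eq_zero] using this
  have hmono : ∀ k, Q 0 ⊆ Q k := by
    intro k x hx i
    have := hx i
    simp only [mem_Ioo] at this ⊢
    have hk : (0:ℝ) ≤ k := by positivity
    push_cast at this
    constructor <;> linarith [this.1, this.2]
  have hc : ∀ k : ℕ, cubeAvg f (WithLp.toLp 2 fun _ => -((k:ℝ)+1)) (2 * ((k:ℝ)+1)) =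
      cubeAvg f (WithLp.toLp 2 fun _ => -(((0:ℕ):ℝ)+1)) (2 * (((0:ℕ):ℝ)+1)) := by
    intro k
    by_contra hne
    have h3 : ∀ᵐ x : Eu n, x ∉ Q 0 := by
      filter_upwards [hQ k, hQ 0] with x hx hx0 hxm
      exact hne ((hx (hmono k hxm)).symm.trans (hx0 hxm))
    have h4 : volume (Q 0) = 0 := by
      rw [ae_iff] at h3; simpa using h3
    simp only [Q] at h4
    rw [volume_cube _ (by norm_num)] at h4
    norm_num at h4
  refine ⟨cubeAvg f (WithLp.toLp 2 fun _ => -(((0:ℕ):ℝ)+1)) (2 * (((0:ℕ):ℝ)+1)), ?_⟩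
  · filter_upwards [ae_all_iff.2 hQ] with x hx
    obtain ⟨k, hk⟩ := exists_nat_gt ‖x‖
    rw [hx k ?_, hc k]
    intro i
    have h5 := PiLp.norm_apply_le x i
    rw [Real.norm_eq_abs] at h5
    have h6 := abs_le.1 (h5.trans hk.le)
    simp only [mem_Ioo]
    constructor <;> linarith [h6.1, h6.2]

set_option linter.unusedVariables false

/-! ## Part B: kernels -/

abbrev Vu (n : ℕ) := EuclideanSpace ℝ (Option (Fin n))

/-- the point `(t, x)` of the half space -/
noncomputable def pt {n : ℕ} (x : Eu n) (t : ℝ) : Vu n :=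
  WithLp.toLp 2 (fun o => Option.elim o t (fun j => x j))

@[simp] theorem pt_none {n : ℕ} (x : Eu n) (t : ℝ) : pt x t none = t := rfl
@[simp] theorem pt_some {n : ℕ} (x : Eu n) (t : ℝ) (j : Fin n) : pt x t (some j) = x j := rfl

theorem pt_sub {n : ℕ} (x y : Eu n) (t s : ℝ) : pt x t - pt y s = pt (x - y) (t - s) := by
  ext o; cases o <;> simp

theorem pt_neg {n : ℕ} (x : Eu n) (t : ℝ) : pt (-x) (-t) = - pt x t := by
  ext o; cases o <;> simp

theorem pt_smul {n : ℕ} (x : Eu n) (t r : ℝ) : pt (r • x) (r * t) = r • pt x t := by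
  ext o; cases o <;> simp

theorem norm_pt_sq {n : ℕ} (x : Eu n) (t : ℝ) : ‖pt x t‖ ^ 2 = ‖x‖ ^ 2 + t ^ 2 := by
  rw [EuclideanSpace.norm_sq_eq, EuclideanSpace.norm_sq_eq, Fintype.sum_option]
  simp; ring

theorem norm_le_norm_pt {n : ℕ} (x : Eu n) (t : ℝ) : ‖x‖ ≤ ‖pt x t‖ := by
  have := norm_pt_sq x t
  nlinarith [norm_nonneg x, norm_nonneg (pt x t), sq_nonneg t]

theorem abs_le_norm_pt {n : ℕ} (x : Eu n) (t : ℝ) : |t| ≤ ‖pt x t‖ := by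
  have := norm_pt_sq x t
  exact abs_le_of_sq_le_sq (by nlinarith [sq_nonneg ‖x‖]) (norm_nonneg _) |> abs_le.2 ∘ abs_le.1

theorem norm_pt_le {n : ℕ} (x : Eu n) (t : ℝ) : ‖pt x t‖ ≤ ‖x‖ + |t| := by
  have := norm_pt_sq x t
  have h := sq_abs t
  nlinarith [norm_nonneg x, norm_nonneg (pt x t), abs_nonneg t,
    mul_nonneg (norm_nonneg x) (abs_nonneg t)]

theorem norm_pt_pos {n : ℕ} (x : Eu n) {t : ℝ} (ht : 0 < t) : 0 < ‖pt x t‖ :=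
  lt_of_lt_of_le (abs_pos.2 ht.ne') (abs_le_norm_pt x t)

theorem half_le_norm_pt {n : ℕ} (x : Eu n) {t : ℝ} (ht : 0 ≤ t) :
    t + ‖x‖ ≤ 2 * ‖pt x t‖ := by
  have := norm_le_norm_pt x t
  have := abs_le_norm_pt x t
  rw [abs_of_nonneg ht] at this
  linarith

theorem continuous_pt {n : ℕ} : Continuous (fun z : Eu n × ℝ => pt z.1 z.2) := by
  unfold pt
  refine (PiLp.continuous_toLp 2 _).comp (continuous_pi fun o => ?_)
  cases o with
  | none => exact continuous_snd
  | some j => simp only [Option.elim]; fun_prop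

@[fun_prop]
theorem Continuous.pt' {n : ℕ} {α : Type*} [TopologicalSpace α] {f : α → Eu n} {g : α → ℝ}
    (hf : Continuous f) (hg : Continuous g) : Continuous (fun a => pt (f a) (g a)) :=
  continuous_pt.comp (hf.prodMk hg)

/-- components of the conjugate Poisson system (unnormalised) -/
noncomputable def Hk {n : ℕ} (k : Option (Fin n)) (ξ : Vu n) : ℝ := ξ k / ‖ξ‖ ^ (n + 1)

theorem measurable_Hk {n : ℕ} (k : Option (Fin n)) : Measurable (Hk (n := n) k) := by
  unfold Hk; fun_prop

theorem Hk_neg {n : ℕ} (k : Option (Fin n)) (ξ : Vu n) : Hk k (-ξ) = - Hk k ξ := by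
  simp [Hk, neg_div]

theorem abs_Hk_le {n : ℕ} (k : Option (Fin n)) (ξ : Vu n) : |Hk k ξ| ≤ (‖ξ‖ ^ n)⁻¹ := by
  unfold Hk
  rw [abs_div, abs_pow, abs_norm]
  have h1 : |ξ k| ≤ ‖ξ‖ := by simpa using PiLp.norm_apply_le ξ k
  rcases (norm_nonneg ξ).eq_or_lt with h | h
  · rw [← h]; simp
  · rw [div_le_iff₀ (by positivity), pow_succ, ← mul_assoc, inv_mul_cancel₀ (by positivity), one_mul]
    exact h1

theorem continuousAt_Hk {n : ℕ} (k : Option (Fin n)) {ξ : Vu n} (h : ξ ≠ 0) :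
    ContinuousAt (Hk k) ξ := by
  unfold Hk
  have : ‖ξ‖ ^ (n+1) ≠ 0 := pow_ne_zero _ (norm_ne_zero_iff.2 h)
  fun_prop (disch := assumption)

theorem inv_pow_sub_le {a b m : ℝ} (N : ℕ) (hm : 0 < m) (ha : m ≤ a) (hb : m ≤ b) :
    b * |1 / a ^ (N+1) - 1 / b ^ (N+1)| ≤ (N + 1) * |a - b| / m ^ (N+1) := by
  have ha0 : 0 < a := hm.trans_le ha
  have hb0 : 0 < b := hm.trans_le hb
  have e : 1 / a ^ (N+1) - 1 / b ^ (N+1) = (b ^ (N+1) - a ^ (N+1)) / (a ^ (N+1) * b ^ (N+1)) := by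
    field_simp
  have h := abs_pow_sub_pow_le b a (N+1)
  rw [abs_of_pos ha0, abs_of_pos hb0] at h
  simp only [Nat.add_sub_cancel] at h
  rw [e, abs_div, abs_of_pos (by positivity : 0 < a ^ (N+1) * b ^ (N+1)), abs_sub_comm a b,
    ← mul_div_assoc, div_le_div_iff₀ (by positivity) (by positivity)]
  have h3 : b * max b a ^ N * m ^ (N+1) ≤ a ^ (N+1) * b ^ (N+1) := by
    rcases le_total a b with hab | hab
    · rw [max_eq_left hab]
      calc b * b ^ N * m ^ (N+1) ≤ b * b ^ N * a ^ (N+1) := by gcongr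
        _ = _ := by ring
    · rw [max_eq_right hab]
      calc b * a ^ N * m ^ (N+1) = a ^ N * b * (m ^ N * m) := by ring
        _ ≤ a ^ N * b * (b ^ N * a) := by gcongr
        _ = _ := by ring
  calc b * |b ^ (N+1) - a ^ (N+1)| * m ^ (N+1)
      ≤ b * (|b - a| * (N+1 : ℕ) * max b a ^ N) * m ^ (N+1) := by gcongr
    _ = (N + 1) * |b - a| * (b * max b a ^ N * m ^ (N+1)) := by push_cast; ring
    _ ≤ (N + 1) * |b - a| * (a ^ (N+1) * b ^ (N+1)) := by gcongr

theorem abs_Hk_sub_le {n : ℕ} (k : Option (Fin n)) {ξ ζ : Vu n} {m : ℝ} (hm : 0 < m)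
    (h1 : m ≤ ‖ξ‖) (h2 : m ≤ ‖ζ‖) :
    |Hk k ξ - Hk k ζ| ≤ (n + 2) * ‖ξ - ζ‖ / m ^ (n+1) := by
  have hc : |ζ k| ≤ ‖ζ‖ := by simpa using PiLp.norm_apply_le ζ k
  have hd : |ξ k - ζ k| ≤ ‖ξ - ζ‖ := by simpa using PiLp.norm_apply_le (ξ - ζ) k
  have hx : 0 < ‖ξ‖ := hm.trans_le h1
  have e : Hk k ξ - Hk k ζ = (ξ k - ζ k) / ‖ξ‖ ^ (n+1) +
      ζ k * (1 / ‖ξ‖ ^ (n+1) - 1 / ‖ζ‖ ^ (n+1)) := by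
    unfold Hk; ring
  rw [e]
  refine (abs_add_le _ _).trans ?_
  rw [abs_div, abs_mul, abs_of_pos (by positivity : 0 < ‖ξ‖ ^ (n+1))]
  have t1 : |ξ k - ζ k| / ‖ξ‖ ^ (n+1) ≤ ‖ξ - ζ‖ / m ^ (n+1) := by gcongr
  have t2 : |ζ k| * |1 / ‖ξ‖ ^ (n+1) - 1 / ‖ζ‖ ^ (n+1)| ≤ (n + 1) * ‖ξ - ζ‖ / m ^ (n+1) :=
    calc _ ≤ ‖ζ‖ * |1 / ‖ξ‖ ^ (n+1) - 1 / ‖ζ‖ ^ (n+1)| := by gcongr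
      _ ≤ _ := inv_pow_sub_le n hm h1 h2
      _ ≤ _ := by gcongr; exact abs_norm_sub_norm_le ξ ζ
  calc _ ≤ ‖ξ - ζ‖ / m ^ (n+1) + (n + 1) * ‖ξ - ζ‖ / m ^ (n+1) := add_le_add t1 t2
    _ = _ := by ring

/-- the basic weight -/
noncomputable def env {n : ℕ} (r : ℝ) (z : Eu n) : ℝ := r / (r + ‖z‖) ^ (n + 1)

theorem env_pos {n : ℕ} {r : ℝ} (hr : 0 < r) (z : Eu n) : 0 < env r z := by
  unfold env; positivity

theorem env_neg {n : ℕ} (r : ℝ) (z : Eu n) : env r (-z) = env r z := by simp [env]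

theorem continuous_env {n : ℕ} {r : ℝ} (hr : 0 < r) : Continuous (env (n := n) r) := by
  unfold env
  have : ∀ z : Eu n, (r + ‖z‖) ^ (n+1) ≠ 0 := fun z => by positivity
  fun_prop (disch := assumption)

theorem env_scale {n : ℕ} {r : ℝ} (hr : 0 < r) (z : Eu n) :
    env r z = r⁻¹ ^ n * env 1 (r⁻¹ • z) := by
  unfold env
  rw [norm_smul, Real.norm_eq_abs, abs_of_pos (by positivity : 0 < r⁻¹)]
  have : 1 + r⁻¹ * ‖z‖ = r⁻¹ * (r + ‖z‖) := by field_simp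
  rw [this, mul_pow]
  have : 0 < r + ‖z‖ := by positivity
  simp only [inv_pow, pow_succ]
  field_simp

theorem integrable_env_one {n : ℕ} : Integrable (env (n := n) 1) := by
  have h := integrable_one_add_norm (E := Eu n) (μ := volume) (r := (n : ℝ) + 1) (by simp)
  refine h.congr (ae_of_all _ fun z => ?_)
  simp only [env]
  rw [Real.rpow_neg (by positivity), one_div]
  congr 1
  have : (n : ℝ) + 1 = ((n + 1 : ℕ) : ℝ) := by push_cast; ring
  rw [this, Real.rpow_natCast]

theorem integrable_env {n : ℕ} {r : ℝ} (hr : 0 < r) : Integrable (env (n := n) r) := by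
  have : env (n := n) r = fun z => r⁻¹ ^ n * env 1 (r⁻¹ • z) := by
    ext z; exact env_scale hr z
  rw [this]
  exact (integrable_env_one.comp_smul (by positivity)).const_mul _

theorem integral_scale {n : ℕ} (f : Eu n → ℝ) {r : ℝ} (hr : 0 < r) :
    ∫ z : Eu n, r⁻¹ ^ n * f (r⁻¹ • z) = ∫ z, f z := by
  rw [integral_const_mul, Measure.integral_comp_smul]
  simp only [finrank_euclideanSpace, Fintype.card_fin, smul_eq_mul]
  rw [abs_of_pos (by positivity)]
  have : r ^ n ≠ 0 := by positivity
  field_simp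

/-- total mass of `env` -/
noncomputable def envC (n : ℕ) : ℝ := ∫ z : Eu n, env 1 z

theorem integral_env {n : ℕ} {r : ℝ} (hr : 0 < r) : ∫ z : Eu n, env r z = envC n := by
  simp_rw [env_scale hr]
  exact integral_scale _ hr

theorem envC_pos (n : ℕ) : 0 < envC n := by
  unfold envC
  rw [integral_pos_iff_support_of_nonneg (fun z => (env_pos one_pos z).le) integrable_env_one]
  have : Function.support (env (n := n) 1) = univ := by
    ext z; simp [(env_pos one_pos z).ne']
  rw [this]; exact Measure.measure_univ_pos.2 (NeZero.ne _)

theorem integral_env_sub {n : ℕ} {r : ℝ} (hr : 0 < r) (x : Eu n) :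
    ∫ z : Eu n, env r (x - z) = envC n := by
  rw [integral_sub_left_eq_self (fun z => env r z) volume x, integral_env hr]

theorem integrable_env_sub {n : ℕ} {r : ℝ} (hr : 0 < r) (x : Eu n) :
    Integrable (fun z => env r (x - z)) := (integrable_env hr).comp_sub_left x

/-- the Poisson kernel (unnormalised) -/
theorem pk_le {n : ℕ} {t : ℝ} (ht : 0 < t) (x : Eu n) :
    Hk none (pt x t) ≤ 2 ^ (n+1) * env t x := by
  unfold Hk env
  rw [pt_none, ← mul_div_assoc, div_le_div_iff₀ (by have := norm_pt_pos x ht; positivity) (by positivity)]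
  have := half_le_norm_pt x ht.le
  calc t * (t + ‖x‖) ^ (n+1) ≤ t * (2 * ‖pt x t‖) ^ (n+1) := by gcongr
    _ = _ := by ring

theorem pk_pos {n : ℕ} {t : ℝ} (ht : 0 < t) (x : Eu n) : 0 < Hk none (pt x t) := by
  have := norm_pt_pos x ht
  unfold Hk; rw [pt_none]; positivity

theorem Hk_scale {n : ℕ} (k : Option (Fin n)) {t : ℝ} (ht : 0 < t) (x : Eu n) (s : ℝ) :
    Hk k (pt x (t * s)) = t⁻¹ ^ n * Hk k (pt (t⁻¹ • x) s) := by
  have e : pt x (t * s) = t • pt (t⁻¹ • x) s := by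
    rw [← pt_smul, smul_smul, mul_inv_cancel₀ ht.ne', one_smul]
  rw [e]; unfold Hk
  rw [norm_smul, Real.norm_eq_abs, abs_of_pos ht]
  simp only [PiLp.smul_apply, smul_eq_mul]
  rw [mul_pow, pow_succ t n, inv_pow]
  field_simp

theorem continuous_Hk_pt {n : ℕ} (k : Option (Fin n)) {t : ℝ} (ht : 0 < t) :
    Continuous (fun x : Eu n => Hk k (pt x t)) := by
  rw [continuous_iff_continuousAt]; intro x
  exact (continuousAt_Hk k (norm_pos_iff.1 (norm_pt_pos x ht))).comp
    (f := fun x => pt x t) (by fun_prop : Continuous fun x : Eu n => pt x t).continuousAt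

theorem integrable_pk {n : ℕ} {t : ℝ} (ht : 0 < t) : Integrable (fun x : Eu n => Hk none (pt x t)) := by
  refine ((integrable_env ht).const_mul (2 ^ (n+1))).mono'
    (continuous_Hk_pt none ht).aestronglyMeasurable (ae_of_all _ fun x => ?_)
  rw [Real.norm_eq_abs, abs_of_pos (pk_pos ht x)]
  exact pk_le ht x

noncomputable def kap (n : ℕ) : ℝ := ∫ x : Eu n, Hk none (pt x 1)

theorem integral_pk {n : ℕ} {t : ℝ} (ht : 0 < t) : ∫ x : Eu n, Hk none (pt x t) = kap n := by
  have : ∀ x : Eu n, Hk none (pt x t) = t⁻¹ ^ n * Hk none (pt (t⁻¹ • x) 1) := by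
    intro x; simpa using Hk_scale none ht x 1
  simp_rw [this]
  exact integral_scale (fun x => Hk none (pt x 1)) ht

theorem kap_pos (n : ℕ) : 0 < kap n := by
  unfold kap
  rw [integral_pos_iff_support_of_nonneg (fun z => (pk_pos one_pos z).le) (integrable_pk one_pos)]
  have : Function.support (fun x : Eu n => Hk none (pt x 1)) = univ := by
    ext z; simp [(pk_pos one_pos z).ne']
  rw [this]; exact Measure.measure_univ_pos.2 (NeZero.ne _)

theorem integral_pk_sub {n : ℕ} {t : ℝ} (ht : 0 < t) (x : Eu n) :
    ∫ y : Eu n, Hk none (pt (x - y) t) = kap n := by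
  rw [integral_sub_left_eq_self (fun z => Hk none (pt z t)) volume x, integral_pk ht]

/-- comparability of weights -/
theorem env_le_env {n : ℕ} {r A : ℝ} (hr : 0 < r) (hA : 1 ≤ A) {z w : Eu n}
    (h : r + ‖w‖ ≤ A * (r + ‖z‖)) : env r z ≤ A ^ (n+1) * env r w := by
  unfold env
  rw [← mul_div_assoc, div_le_div_iff₀ (by positivity) (by positivity)]
  calc r * (r + ‖w‖) ^ (n+1) ≤ r * (A * (r + ‖z‖)) ^ (n+1) := by gcongr
    _ = _ := by rw [mul_pow]; ring

/-- basic kernel difference estimate -/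
theorem abs_Hk_pt_sub_le {n : ℕ} (k : Option (Fin n)) {x y : Eu n} {t s d m : ℝ} (hd : 0 < d)
    (hm : 0 < m) {z : Eu n}
    (h : ‖x - y‖ + |t - s| ≤ d) (h1 : m * (d + ‖z‖) ≤ ‖pt x t‖) (h2 : m * (d + ‖z‖) ≤ ‖pt y s‖) :
    |Hk k (pt x t) - Hk k (pt y s)| ≤ (n + 2) / m ^ (n+1) * env d z := by
  refine (abs_Hk_sub_le k (by positivity) h1 h2).trans ?_
  rw [pt_sub]
  have := (norm_pt_le (x - y) (t - s)).trans h
  unfold env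
  calc (n + 2) * ‖pt (x - y) (t - s)‖ / (m * (d + ‖z‖)) ^ (n + 1)
      ≤ (n + 2) * d / (m * (d + ‖z‖)) ^ (n + 1) := by gcongr
    _ = _ := by rw [mul_pow]; field_simp

set_option linter.unusedVariables false

/-! ## Part C: tails of `BMO` functions, John–Nirenberg in `L²` -/

/-- centred cube -/
def ccube {n : ℕ} (x : Eu n) (r : ℝ) : Set (Eu n) := cube (WithLp.toLp 2 fun i => x i - r) (2 * r)

noncomputable def tailC (n : ℕ) : ℝ := ∑' k : ℕ, (2 * 4 ^ n) * (((k:ℝ) + 1) ^ 2 * (1/2) ^ k)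

theorem summable_tail (n : ℕ) : Summable (fun k : ℕ => (2 * 4 ^ n : ℝ) * (((k:ℝ) + 1) ^ 2 * (1/2) ^ k)) := by
  apply Summable.mul_left
  have h : ∀ m : ℕ, Summable (fun k : ℕ => (k:ℝ) ^ m * (1/2 : ℝ) ^ k) := fun m =>
    summable_pow_mul_geometric_of_norm_lt_one m (by norm_num)
  refine (((h 2).add ((h 1).mul_left 2)).add (h 0)).congr fun k => ?_
  ring

theorem tailC_nonneg (n : ℕ) : 0 ≤ tailC n := tsum_nonneg fun k => by positivity

theorem env_le_dyadic {n : ℕ} {r : ℝ} (hr : 0 < r) (x0 y : Eu n) :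
    ∃ k : ℕ, y ∈ ccube x0 (2 ^ k * r) ∧
      env r (x0 - y) ≤ (2 * 4 ^ n) * (1/2) ^ k / (2 * (2 ^ k * r)) ^ n := by
  have hex : ∃ k : ℕ, ‖x0 - y‖ < 2 ^ k * r := by
    obtain ⟨k, hk⟩ := pow_unbounded_of_one_lt (‖x0 - y‖ / r) (by norm_num : (1:ℝ) < 2)
    exact ⟨k, by rwa [div_lt_iff₀ hr] at hk⟩
  classical
  refine ⟨Nat.find hex, ball_subset_cube x0 ?_, ?_⟩
  · rw [Metric.mem_ball, dist_comm, dist_eq_norm]; exact Nat.find_spec hex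
  · rcases hk : Nat.find hex with _ | m
    · simp only [pow_zero, one_mul, mul_one]
      unfold env
      rw [div_le_div_iff₀ (by positivity) (by positivity)]
      have h4 : (2:ℝ) ^ n ≤ 4 ^ n := by gcongr; norm_num
      calc r * (2 * r) ^ n = 2 ^ n * (r ^ (n+1)) := by rw [mul_pow]; ring
        _ ≤ (2 * 4 ^ n) * (r + ‖x0 - y‖) ^ (n+1) := by
          gcongr
          · nlinarith [show (0:ℝ) < 4 ^ n by positivity]
          · linarith [norm_nonneg (x0 - y)]
    · have hm : 2 ^ m * r ≤ ‖x0 - y‖ := by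
        have := Nat.find_min hex (m := m) (by omega)
        push Not at this; exact this
      unfold env
      rw [div_le_div_iff₀ (by positivity) (by positivity)]
      calc r * (2 * (2 ^ (m+1) * r)) ^ n = (2 * 4 ^ n) * (1/2) ^ (m+1) * (2 ^ m * r) ^ (n+1) := by
            have h1 : (1/2 : ℝ) ^ (m+1) * 2 ^ m * 2 = 1 := by
              rw [mul_assoc, ← pow_succ, ← mul_pow]; norm_num
            have h2 : (2 * (2 ^ (m+1) * r)) = 4 * (2 ^ m * r) := by ring
            rw [h2, mul_pow, pow_succ (2 ^ m * r) n]
            linear_combination (-r * 4 ^ n * (2 ^ m * r) ^ n) * h1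
        _ ≤ _ := by gcongr; linarith

theorem intOn_abs_sub {n : ℕ} {f : Eu n → ℝ} {c : Eu n} {l : ℝ} (hf : IntegrableOn f (cube c l))
    (a : ℝ) : IntegrableOn (fun x => |f x - a|) (cube c l) :=
  (Integrable.sub hf (integrableOn_cube_const a c l)).abs

theorem sq_split {n : ℕ} {f : Eu n → ℝ} (hf : Continuous f) (c : Eu n) {l : ℝ} (hl : 0 < l) (a : ℝ) :
    ∫ x in cube c l, (f x - a) ^ 2 =
      (∫ x in cube c l, (f x - cubeAvg f c l) ^ 2) + (cubeAvg f c l - a) ^ 2 * l ^ n := by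
  have hintg : ∀ (a : ℝ), IntegrableOn (fun x => (f x - a) ^ 2) (cube c l) := fun a =>
    integrableOn_cube (((hf.sub continuous_const).pow 2).locallyIntegrable) c l
  have hi : IntegrableOn f (cube c l) := integrableOn_cube hf.locallyIntegrable c l
  set m := cubeAvg f c l with hm
  have e : ∀ x, (f x - a) ^ 2 = (f x - m) ^ 2 + ((2 * (m - a)) * f x + (a ^ 2 - m ^ 2)) := by
    intro x; ring
  simp_rw [e]
  have hi2 : IntegrableOn (fun x => (2 * (m - a)) * f x + (a ^ 2 - m ^ 2)) (cube c l) :=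
    (Integrable.const_mul hi _).add (integrableOn_cube_const _ _ _)
  rw [integral_add (hintg m) hi2, integral_add (hi.const_mul _) (integrableOn_cube_const _ _ _), setIntegral_cube_const _ _ hl,
    integral_const_mul, cubeAvg_mul f c hl, ← hm]
  ring

theorem tail_bound {n : ℕ} {g : Eu n → ℝ} (hg : ∀ y, 0 ≤ g y) (hgm : LocallyIntegrable g)
    {x0 : Eu n} {r B : ℝ} (hr : 0 < r)
    (h : ∀ k : ℕ, ∫ y in ccube x0 (2 ^ k * r), g y ≤ B * ((k:ℝ) + 1) ^ 2 * (2 * (2 ^ k * r)) ^ n) :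
    Integrable (fun y => env r (x0 - y) * g y) ∧
      ∫ y, env r (x0 - y) * g y ≤ tailC n * B := by
  have hB : 0 ≤ B := by
    have h0 := h 0
    have h1 : 0 ≤ ∫ y in ccube x0 (2 ^ 0 * r), g y := integral_nonneg hg
    have h2 : (0:ℝ) < (2 * (2 ^ 0 * r)) ^ n := by positivity
    simp only [Nat.cast_zero, zero_add, one_pow, mul_one] at h0
    by_contra hB
    push Not at hB
    nlinarith
  let F : ℕ → Eu n → ℝ := fun k y =>
    (2 * 4 ^ n) * (1/2) ^ k / (2 * (2 ^ k * r)) ^ n * (ccube x0 (2 ^ k * r)).indicator g y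
  have hF0 : ∀ k y, 0 ≤ F k y := fun k y =>
    mul_nonneg (by positivity) (indicator_nonneg (fun y _ => hg y) y)
  have hFi : ∀ k, Integrable (F k) := fun k =>
    ((integrable_indicator_iff (measurableSet_cube _ _)).2 (integrableOn_cube hgm _ _)).const_mul _
  have hFI : ∀ k, ∫ y, F k y ≤ B * ((2 * 4 ^ n) * (((k:ℝ) + 1) ^ 2 * (1/2) ^ k)) := by
    intro k
    simp only [F]
    rw [integral_const_mul, integral_indicator (by exact measurableSet_cube _ _)]
    have h2 : (0:ℝ) < (2 * (2 ^ k * r)) ^ n := by positivity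
    calc _ ≤ (2 * 4 ^ n) * (1/2) ^ k / (2 * (2 ^ k * r)) ^ n *
          (B * ((k:ℝ) + 1) ^ 2 * (2 * (2 ^ k * r)) ^ n) := by
          gcongr; exact h k
      _ = _ := by field_simp
  have hlin : ∫⁻ y, ENNReal.ofReal (env r (x0 - y) * g y) ≤ ENNReal.ofReal (tailC n * B) := by
    calc ∫⁻ y, ENNReal.ofReal (env r (x0 - y) * g y)
        ≤ ∫⁻ y, ∑' k, ENNReal.ofReal (F k y) := by
          apply lintegral_mono; intro y
          obtain ⟨k, hk1, hk2⟩ := env_le_dyadic hr x0 y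
          refine le_trans ?_ (ENNReal.le_tsum k)
          apply ENNReal.ofReal_le_ofReal
          simp only [F, indicator_of_mem hk1]
          exact mul_le_mul_of_nonneg_right hk2 (hg y)
      _ = ∑' k, ∫⁻ y, ENNReal.ofReal (F k y) :=
          lintegral_tsum fun k => (hFi k).aestronglyMeasurable.aemeasurable.ennreal_ofReal
      _ = ∑' k, ENNReal.ofReal (∫ y, F k y) := by
          congr 1; ext k
          rw [ofReal_integral_eq_lintegral_ofReal (hFi k) (ae_of_all _ (hF0 k))]
      _ ≤ ∑' k : ℕ, ENNReal.ofReal (B * ((2 * 4 ^ n) * (((k:ℝ) + 1) ^ 2 * (1/2) ^ k))) :=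
          ENNReal.tsum_le_tsum fun k => ENNReal.ofReal_le_ofReal (hFI k)
      _ = ENNReal.ofReal (∑' k : ℕ, B * ((2 * 4 ^ n) * (((k:ℝ) + 1) ^ 2 * (1/2) ^ k))) :=
          (ENNReal.ofReal_tsum_of_nonneg (fun k => by positivity) ((summable_tail n).mul_left B)).symm
      _ = _ := by rw [tsum_mul_left, mul_comm]; rfl
  have hm : AEStronglyMeasurable (fun y => env r (x0 - y) * g y) volume :=
    ((continuous_env hr).comp (continuous_const.sub continuous_id)).aestronglyMeasurable.mul
      hgm.aestronglyMeasurable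
  have h0 : ∀ y, 0 ≤ env r (x0 - y) * g y := fun y => mul_nonneg (env_pos hr _).le (hg y)
  constructor
  · refine ⟨hm, ?_⟩
    rw [hasFiniteIntegral_iff_ofReal (ae_of_all _ h0)]
    exact hlin.trans_lt ENNReal.ofReal_lt_top
  · rw [integral_eq_lintegral_of_nonneg_ae (ae_of_all _ h0) hm]
    exact ENNReal.toReal_le_of_le_ofReal (mul_nonneg (tailC_nonneg n) hB) hlin

theorem ccube_mono {n : ℕ} (x : Eu n) {r r' : ℝ} (h : r ≤ r') : ccube x r ⊆ ccube x r' := by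
  intro y hy i
  have := hy i
  simp only [mem_Ioo] at this ⊢
  constructor <;> linarith [this.1, this.2]

noncomputable def cAvg {n : ℕ} (f : Eu n → ℝ) (x : Eu n) (r : ℝ) : ℝ :=
  cubeAvg f (WithLp.toLp 2 fun i => x i - r) (2 * r)

theorem cAvg_dyadic {n : ℕ} {f : Eu n → ℝ} {b : ℝ} (hf : BMOB f b) (x : Eu n) {r : ℝ} (hr : 0 < r)
    (k : ℕ) : |cAvg f x (2 ^ k * r) - cAvg f x r| ≤ k * (2 ^ n * b) := by
  induction k with
  | zero => simp
  | succ k ih =>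
    have h1 := abs_cubeAvg_sub_cubeAvg_le (f := f) (l := 2 * (2 ^ (k+1) * r)) (l' := 2 * (2 ^ k * r))
      (by positivity) (by positivity)
      (ccube_mono x (r := 2 ^ k * r) (r' := 2 ^ (k+1) * r) (by rw [pow_succ]; nlinarith [show 0 < 2 ^ k * r by positivity]))
      (integrableOn_cube hf.1 _ _)
    have h2 : |cAvg f x (2 ^ (k+1) * r) - cAvg f x (2 ^ k * r)| ≤ 2 ^ n * b := by
      rw [abs_sub_comm]
      have hp : (0:ℝ) < (2 * (2 ^ k * r)) ^ n := by positivity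
      have h3 : (2 * (2 ^ (k+1) * r)) ^ n = 2 ^ n * (2 * (2 ^ k * r)) ^ n := by
        rw [← mul_pow]; ring
      rw [h3] at h1
      have h4 := hf.2 (WithLp.toLp 2 fun i => x i - (2 ^ (k+1) * r)) (2 * (2 ^ (k+1) * r)) (by positivity)
      refine le_of_mul_le_mul_right (h1.trans ?_) hp
      calc _ ≤ b * (2 ^ n * (2 * (2 ^ k * r)) ^ n) := by gcongr
        _ = _ := by ring
    calc _ ≤ |cAvg f x (2 ^ (k+1) * r) - cAvg f x (2 ^ k * r)| + |cAvg f x (2 ^ k * r) - cAvg f x r| :=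
          abs_sub_le _ _ _
      _ ≤ 2 ^ n * b + k * (2 ^ n * b) := add_le_add h2 ih
      _ = _ := by push_cast; ring

theorem BMOB.locInt_sub {n : ℕ} {f : Eu n → ℝ} {b : ℝ} (hf : BMOB f b) (a : ℝ) :
    LocallyIntegrable (fun y => |f y - a|) := by
  have h : LocallyIntegrable (fun y => f y - a) := hf.1.sub (locallyIntegrable_const a)
  exact h.mono (continuous_abs.comp_aestronglyMeasurable h.aestronglyMeasurable) (ae_of_all _ fun x => by simp)

theorem BMOB.tail_one {n : ℕ} {f : Eu n → ℝ} {b : ℝ} (hf : BMOB f b) (x : Eu n) {r : ℝ} (hr : 0 < r) :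
    Integrable (fun y => env r (x - y) * |f y - cAvg f x r|) ∧
      ∫ y, env r (x - y) * |f y - cAvg f x r| ≤ tailC n * ((1 + 2 ^ n) * b) := by
  apply tail_bound (fun y => abs_nonneg _) (hf.locInt_sub _) hr
  intro k
  have hb := hf.nonneg
  have hl : 0 < 2 * (2 ^ k * r) := by positivity
  set c : Eu n := WithLp.toLp 2 fun i => x i - 2 ^ k * r
  have hi : IntegrableOn f (cube c (2 * (2 ^ k * r))) := integrableOn_cube hf.1 _ _
  have hi1 := intOn_abs_sub hi (cubeAvg f c (2 * (2 ^ k * r)))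
  calc ∫ y in ccube x (2 ^ k * r), |f y - cAvg f x r|
      ≤ ∫ y in cube c (2 * (2 ^ k * r)), (|f y - cubeAvg f c (2 * (2 ^ k * r))| + k * (2 ^ n * b)) := by
        apply integral_mono (intOn_abs_sub hi _)
          (hi1.add (integrableOn_cube_const _ _ _))
        intro y
        exact (abs_sub_le _ (cubeAvg f c (2 * (2 ^ k * r))) _).trans
          (add_le_add le_rfl (cAvg_dyadic hf x hr k))
    _ = cubeOsc f c (2 * (2 ^ k * r)) * (2 * (2 ^ k * r)) ^ n + k * (2 ^ n * b) * (2 * (2 ^ k * r)) ^ n := by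
        rw [integral_add hi1 (integrableOn_cube_const _ _ _), cubeOsc_mul _ _ hl, setIntegral_cube_const _ _ hl]
    _ ≤ b * (2 * (2 ^ k * r)) ^ n + k * (2 ^ n * b) * (2 * (2 ^ k * r)) ^ n := by
        gcongr; exact hf.2 _ _ hl
    _ ≤ _ := by
        rw [← add_mul]; gcongr
        have hk : (0:ℝ) ≤ k := by positivity
        nlinarith [mul_nonneg hk hb, mul_nonneg (mul_nonneg hk hb) (by positivity : (0:ℝ) ≤ 2 ^ n),
          mul_nonneg (mul_nonneg hk hk) (mul_nonneg hb (by positivity : (0:ℝ) ≤ 1 + 2 ^ n)), mul_nonneg hb (by positivity : (0:ℝ) ≤ 2 ^ n)]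

/-- one CZ step for the `L²` John–Nirenberg inequality -/
theorem jn_step {n : ℕ} {φ : Eu n → ℝ} {b S : ℝ} (hb : 0 < b) (hφ : BMOB φ b) (hc : Continuous φ)
    (hS : ∀ c l, 0 < l → ∫ x in cube c l, (φ x - cubeAvg φ c l) ^ 2 ≤ S * l ^ n)
    (a : ℝ) (m : ℕ) : ∀ c l, 0 < l →
    (∀ x y : Eu n, dist x y ≤ l / 2 ^ m * √n → |φ x - φ y| ≤ b / 2) →
    |cubeAvg φ c l - a| ≤ (2 + 2 ^ n) * b →
    ∃ s : ℝ, 0 ≤ s ∧ 2 * b * s * l ^ n ≤ ∫ x in cube c l, |φ x - a| ∧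
      ∫ x in cube c l, (φ x - a) ^ 2 ≤ (3 * b) ^ 2 * l ^ n + s * l ^ n * (S + ((2 + 2 ^ n) * b) ^ 2) := by
  have hS0 : 0 ≤ S := by
    have := hS 0 1 one_pos
    have h2 : 0 ≤ ∫ x in cube (0 : Eu n) 1, (φ x - cubeAvg φ 0 1) ^ 2 := integral_nonneg fun x => sq_nonneg _
    simpa using h2.trans this
  have hintg : ∀ (a : ℝ) c l, IntegrableOn (fun x => (φ x - a) ^ 2) (cube c l) := fun a c l =>
    integrableOn_cube (((hc.sub continuous_const).pow 2).locallyIntegrable) c l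
  induction m with
  | zero =>
    intro c l hl hosc ha
    have h0 := cube_nonempty_vol (n := n) hl
    by_cases hcase : |cubeAvg φ c l - a| ≤ 2 * b
    · refine ⟨0, le_rfl, by simpa using integral_nonneg fun x => abs_nonneg _, ?_⟩
      have hav : ∀ x ∈ cube c l, |φ x - cubeAvg φ c l| ≤ b := by
        intro x hx
        have h1 := abs_cubeAvg_sub_le hl (integrableOn_cube hφ.1 c l) (φ x)
        have h2 : ∫ y in cube c l, |φ y - φ x| ≤ b * l ^ n := by
          rw [← setIntegral_cube_const b c hl]
          apply setIntegral_mono_on (intOn_abs_sub (integrableOn_cube hφ.1 c l) _) (integrableOn_cube_const _ _ _) (measurableSet_cube _ _)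
          intro y hy
          have t1 : |φ y - φ c| ≤ b / 2 := hosc y c (by simpa using cube_subset_closedBall c hl.le hy)
          have t2 : |φ x - φ c| ≤ b / 2 := hosc x c (by simpa using cube_subset_closedBall c hl.le hx)
          rw [abs_le] at *
          constructor <;> linarith [t1.1, t1.2, t2.1, t2.2]
        rw [abs_sub_comm]
        exact le_of_mul_le_mul_right (h1.trans h2) h0
      rw [zero_mul, zero_mul, add_zero, ← setIntegral_cube_const _ c hl]
      apply setIntegral_mono_on (hintg a c l) (integrableOn_cube_const _ _ _) (measurableSet_cube _ _)
      intro x hx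
      have t1 := hav x hx
      rw [abs_le] at t1 hcase
      apply sq_le_sq'  <;> linarith [t1.1, t1.2, hcase.1, hcase.2]
    · push Not at hcase
      refine ⟨1, zero_le_one, ?_, ?_⟩
      · refine le_trans ?_ (abs_cubeAvg_sub_le hl (integrableOn_cube hφ.1 c l) a)
        rw [mul_one]; gcongr
      · rw [sq_split hc c hl a]
        have h5 := hS c l hl
        have h6 : (cubeAvg φ c l - a) ^ 2 ≤ ((2 + 2 ^ n) * b) ^ 2 := by
          rw [abs_le] at ha; exact sq_le_sq' ha.1 ha.2
        nlinarith [mul_le_mul_of_nonneg_right h6 h0.le, mul_nonneg (sq_nonneg (3 * b)) h0.le]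
  | succ m ih =>
    intro c l hl hosc ha
    have h0 := cube_nonempty_vol (n := n) hl
    by_cases hcase : |cubeAvg φ c l - a| ≤ 2 * b
    · have hl2 : 0 < l / 2 := by positivity
      have h2n : (l / 2) ^ n = l ^ n / 2 ^ n := by rw [div_pow]
      have hch : ∀ e : Fin n → Bool, ∃ s : ℝ, 0 ≤ s ∧
          2 * b * s * (l/2) ^ n ≤ ∫ x in cube (childC c l e) (l/2), |φ x - a| ∧
          ∫ x in cube (childC c l e) (l/2), (φ x - a) ^ 2 ≤
            (3 * b) ^ 2 * (l/2) ^ n + s * (l/2) ^ n * (S + ((2 + 2 ^ n) * b) ^ 2) := by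
        intro e
        refine ih _ _ hl2 ?_ ?_
        · intro x y hxy
          apply hosc x y
          rw [pow_succ]
          convert hxy using 2
          field_simp
        · have h1 := abs_cubeAvg_sub_cubeAvg_le hl hl2 (childC_subset c hl e) (integrableOn_cube hφ.1 c l)
          have h3 : |cubeAvg φ (childC c l e) (l/2) - cubeAvg φ c l| ≤ 2 ^ n * b := by
            rw [h2n] at h1
            have : |cubeAvg φ (childC c l e) (l/2) - cubeAvg φ c l| * (l ^ n / 2 ^ n) ≤ (2 ^ n * b) * (l ^ n / 2 ^ n) := by
              refine h1.trans ?_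
              have := hφ.2 c l hl
              calc _ ≤ b * l ^ n := by gcongr
                _ = _ := by field_simp
            exact le_of_mul_le_mul_right this (by positivity)
          calc _ ≤ |cubeAvg φ (childC c l e) (l/2) - cubeAvg φ c l| + |cubeAvg φ c l - a| := abs_sub_le _ _ _
            _ ≤ 2 ^ n * b + 2 * b := add_le_add h3 hcase
            _ = _ := by ring
      choose s hs0 hs1 hs2 using hch
      have hcard : (Fintype.card (Fin n → Bool) : ℝ) = 2 ^ n := by simp
      refine ⟨(∑ e, s e) / 2 ^ n, by have := Finset.sum_nonneg fun e (_ : e ∈ Finset.univ) => hs0 e; positivity, ?_, ?_⟩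
      · rw [setIntegral_cube_split c hl (intOn_abs_sub (integrableOn_cube hφ.1 c l) a)]
        refine le_trans (le_of_eq ?_) (Finset.sum_le_sum fun e _ => hs1 e)
        rw [← Finset.sum_mul, ← Finset.mul_sum, h2n]; ring
      · rw [setIntegral_cube_split c hl (hintg a c l)]
        refine (Finset.sum_le_sum fun e _ => hs2 e).trans (le_of_eq ?_)
        rw [Finset.sum_add_distrib, ← Finset.sum_mul, ← Finset.sum_mul,Finset.sum_const, Finset.card_univ, h2n, nsmul_eq_mul, hcard]
        simp only [← Finset.sum_mul]
        have : (2:ℝ) ^ n ≠ 0 := by positivity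
        generalize ∑ e, s e = σ
        field_simp
    · push Not at hcase
      refine ⟨1, zero_le_one, ?_, ?_⟩
      · refine le_trans ?_ (abs_cubeAvg_sub_le hl (integrableOn_cube hφ.1 c l) a)
        rw [mul_one]; gcongr
      · rw [sq_split hc c hl a]
        have h5 := hS c l hl
        have h6 : (cubeAvg φ c l - a) ^ 2 ≤ ((2 + 2 ^ n) * b) ^ 2 := by
          rw [abs_le] at ha; exact sq_le_sq' ha.1 ha.2
        nlinarith [mul_le_mul_of_nonneg_right h6 h0.le, mul_nonneg (sq_nonneg (3 * b)) h0.le]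

theorem jn_sq {n : ℕ} {φ : Eu n → ℝ} {b Mb : ℝ} (hb : 0 < b) (hφ : BMOB φ b)
    (hc : UniformContinuous φ) (hM : ∀ x, |φ x| ≤ Mb) :
    ∀ c l, 0 < l → ∫ x in cube c l, (φ x - cubeAvg φ c l) ^ 2 ≤ (18 + (2 + 2 ^ n) ^ 2) * b ^ 2 * l ^ n := by
  set C : ℝ := (18 + (2 + 2 ^ n) ^ 2) * b ^ 2 with hC
  have step : ∀ d : ℝ, (∀ c l, 0 < l → ∫ x in cube c l, (φ x - cubeAvg φ c l) ^ 2 ≤ (C + d) * l ^ n) →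
      ∀ c l, 0 < l → ∫ x in cube c l, (φ x - cubeAvg φ c l) ^ 2 ≤ (C + d / 2) * l ^ n := by
    intro d hd c l hl
    have h0 := cube_nonempty_vol (n := n) hl
    obtain ⟨δ, hδ, hu⟩ := Metric.uniformContinuous_iff.1 hc (b/2) (by positivity)
    obtain ⟨m, hm⟩ := pow_unbounded_of_one_lt (l * √n / δ) (by norm_num : (1:ℝ) < 2)
    obtain ⟨s, hs0, hs1, hs2⟩ := jn_step hb hφ hc.continuous hd (cubeAvg φ c l) m c l hl
      (by
        intro x y hxy
        have : dist x y < δ := by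
          refine hxy.trans_lt ?_
          rw [div_lt_iff₀ hδ] at hm
          rw [div_mul_eq_mul_div, div_lt_iff₀ (by positivity)]
          linarith
        have := hu this
        rw [Real.dist_eq] at this; exact this.le)
      (by simp; positivity)
    have hs : s ≤ 1/2 := by
      rw [cubeOsc_mul φ c hl] at hs1
      have h1 := hφ.2 c l hl
      have h2 : 2 * b * s * l ^ n ≤ b * l ^ n := hs1.trans (by gcongr)
      have h3 := le_of_mul_le_mul_right h2 h0
      nlinarith
    refine hs2.trans ?_
    have hpos : 0 ≤ C + d + ((2 + 2 ^ n) * b) ^ 2 := by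
      have := hd 0 1 one_pos
      have h2 : 0 ≤ ∫ x in cube (0 : Eu n) 1, (φ x - cubeAvg φ 0 1) ^ 2 := integral_nonneg fun x => sq_nonneg _
      have h3 := h2.trans this
      simp only [one_pow, mul_one] at h3
      positivity
    have e : ∀ u : ℝ, (3 * b) ^ 2 * l ^ n + s * l ^ n * u = ((3 * b) ^ 2 + s * u) * l ^ n := fun u => by ring
    rw [e]
    refine mul_le_mul_of_nonneg_right ?_ h0.le
    nlinarith [mul_le_mul_of_nonneg_right hs hpos]
  have hM0 : 0 ≤ Mb := (abs_nonneg _).trans (hM 0)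
  have base : ∀ c l, 0 < l → ∫ x in cube c l, (φ x - cubeAvg φ c l) ^ 2 ≤ (C + (Mb) ^ 2) * l ^ n := by
    intro c l hl
    have h0 := cube_nonempty_vol (n := n) hl
    have h1 := sq_split hc.continuous c hl 0
    have h2 : ∫ x in cube c l, (φ x - 0) ^ 2 ≤ Mb ^ 2 * l ^ n := by
      rw [← setIntegral_cube_const _ c hl]
      apply integral_mono (integrableOn_cube (f := fun x => (φ x - 0) ^ 2) (by have := hc.continuous; fun_prop : Continuous _).locallyIntegrable c l)
        (integrableOn_cube_const _ _ _)
      intro x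
      have := abs_le.1 (hM x)
      simp only [sub_zero]
      exact sq_le_sq' this.1 this.2
    have h3 : 0 ≤ C := by positivity
    nlinarith [mul_nonneg (sq_nonneg (cubeAvg φ c l - 0)) h0.le, mul_nonneg h3 h0.le]
  have all : ∀ k : ℕ, ∀ c l, 0 < l →
      ∫ x in cube c l, (φ x - cubeAvg φ c l) ^ 2 ≤ (C + Mb ^ 2 / 2 ^ k) * l ^ n := by
    intro k
    induction k with
    | zero => simpa using base
    | succ k ih =>
      have := step _ ih
      convert this using 6
      rw [pow_succ (2:ℝ) k]; rw [div_div]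
  intro c l hl
  have ht : Tendsto (fun k : ℕ => (C + Mb ^ 2 / 2 ^ k) * l ^ n) atTop (nhds ((C + 0) * l ^ n)) := by
    apply Tendsto.mul_const
    apply tendsto_const_nhds.add
    have := (tendsto_pow_atTop_nhds_zero_of_lt_one (r := (1/2 : ℝ)) (by norm_num) (by norm_num)).const_mul (Mb ^ 2)
    simpa [div_eq_mul_inv] using this
  simpa using ge_of_tendsto' ht fun k => all k c l hl

theorem BMOB.tail_two {n : ℕ} {φ : Eu n → ℝ} {b Mb : ℝ} (hb : 0 < b) (hφ : BMOB φ b)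
    (hc : UniformContinuous φ) (hM : ∀ x, |φ x| ≤ Mb) (x : Eu n) {r : ℝ} (hr : 0 < r) :
    Integrable (fun y => env r (x - y) * (φ y - cAvg φ x r) ^ 2) ∧
      ∫ y, env r (x - y) * (φ y - cAvg φ x r) ^ 2 ≤ tailC n * ((18 + (2 + 2 ^ n) ^ 2 + 4 ^ n) * b ^ 2) := by
  apply tail_bound (g := fun y => (φ y - cAvg φ x r) ^ 2) (fun y => sq_nonneg _) (by have := hc.continuous; fun_prop : Continuous _).locallyIntegrable hr
  intro k
  have hl : 0 < 2 * (2 ^ k * r) := by positivity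
  have h0 := cube_nonempty_vol (n := n) hl
  have h1 := sq_split hc.continuous (WithLp.toLp 2 fun i => x i - 2 ^ k * r) hl (cAvg φ x r)
  have h2 := jn_sq hb hφ hc hM (WithLp.toLp 2 fun i => x i - 2 ^ k * r) _ hl
  have h3 := cAvg_dyadic hφ x hr k
  have h4 : (cAvg φ x (2 ^ k * r) - cAvg φ x r) ^ 2 ≤ (k * (2 ^ n * b)) ^ 2 :=
    sq_le_sq' (abs_le.1 h3).1 (abs_le.1 h3).2
  have h5 : ((k:ℝ) * (2 ^ n * b)) ^ 2 = 4 ^ n * b ^ 2 * (k:ℝ) ^ 2 := by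
    rw [mul_pow, mul_pow, ← pow_mul, mul_comm n 2, pow_mul]; norm_num; ring
  rw [h5] at h4
  unfold ccube
  rw [h1]
  have hk : (0:ℝ) ≤ k := by positivity
  calc _ ≤ (18 + (2 + 2 ^ n) ^ 2) * b ^ 2 * (2 * (2 ^ k * r)) ^ n + 4 ^ n * b ^ 2 * (k:ℝ) ^ 2 * (2 * (2 ^ k * r)) ^ n :=
        add_le_add h2 (mul_le_mul_of_nonneg_right h4 h0.le)
    _ = ((18 + (2 + 2 ^ n) ^ 2) * b ^ 2 * 1 + 4 ^ n * b ^ 2 * (k:ℝ) ^ 2) * (2 * (2 ^ k * r)) ^ n := by ring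
    _ ≤ ((18 + (2 + 2 ^ n) ^ 2) * b ^ 2 * (k + 1) ^ 2 + 4 ^ n * b ^ 2 * (k + 1) ^ 2) * (2 * (2 ^ k * r)) ^ n := by
        gcongr
        · nlinarith
        · linarith
    _ = _ := by ring

set_option linter.unusedVariables false

/-! ## Part D: derivatives of the kernels, `L²` bounds -/

noncomputable def ee {n : ℕ} (i : Option (Fin n)) : Vu n := EuclideanSpace.single i 1

theorem ee_apply {n : ℕ} (i k : Option (Fin n)) : ee i k = if k = i then 1 else 0 := by
  simp [ee, PiLp.single_apply]

noncomputable def rn {n : ℕ} (m : ℕ) (ξ : Vu n) : ℝ := (‖ξ‖ ^ m)⁻¹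

theorem rn_nonneg {n : ℕ} (m : ℕ) (ξ : Vu n) : 0 ≤ rn m ξ := by unfold rn; positivity

theorem hasDerivAt_norm_sq_line {n : ℕ} (i : Option (Fin n)) (ξ : Vu n) (τ : ℝ) :
    HasDerivAt (fun τ : ℝ => ‖ξ + τ • ee i‖ ^ 2) (2 * (ξ + τ • ee i) i) τ := by
  have h : HasDerivAt (fun τ : ℝ => ξ + τ • ee i) (ee i) τ := by
    simpa using ((hasDerivAt_id τ).smul_const (ee i)).const_add ξ
  have := h.norm_sq
  refine this.congr_deriv ?_
  rw [real_inner_comm]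
  unfold ee
  rw [EuclideanSpace.inner_single_left]
  simp

theorem hasDerivAt_rn {n : ℕ} (m : ℕ) (i : Option (Fin n)) (ξ : Vu n) (τ : ℝ)
    (h : ξ + τ • ee i ≠ 0) :
    HasDerivAt (fun τ : ℝ => rn m (ξ + τ • ee i))
      (- m * (ξ + τ • ee i) i * rn (m+2) (ξ + τ • ee i)) τ := by
  have hp : 0 < ‖ξ + τ • ee i‖ := norm_pos_iff.2 h
  have h1 : HasDerivAt (fun τ : ℝ => ‖ξ + τ • ee i‖) ((ξ + τ • ee i) i / ‖ξ + τ • ee i‖) τ := by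
    have := (hasDerivAt_norm_sq_line i ξ τ).sqrt (by positivity)
    simp only [Real.sqrt_sq (norm_nonneg _)] at this
    convert this using 1
    field_simp
  have h2 := (h1.fun_pow m).fun_inv (pow_ne_zero _ hp.ne')
  unfold rn
  refine h2.congr_deriv ?_
  set R := ‖ξ + τ • ee i‖
  rcases m with _ | m
  · simp
  · simp only [Nat.add_sub_cancel]
    field_simp
    ring

noncomputable def dH {n : ℕ} (i k : Option (Fin n)) (ξ : Vu n) : ℝ :=
  (if k = i then 1 else 0) * rn (n+1) ξ - (n+1) * (ξ i * ξ k) * rn (n+3) ξ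

noncomputable def ddH {n : ℕ} (i k : Option (Fin n)) (ξ : Vu n) : ℝ :=
  -(n+1) * (2 * (if k = i then 1 else 0) * ξ i + ξ k) * rn (n+3) ξ +
    (n+1) * (n+3) * (ξ i ^ 2 * ξ k) * rn (n+5) ξ

theorem hasDerivAt_coord {n : ℕ} (i k : Option (Fin n)) (ξ : Vu n) (τ : ℝ) :
    HasDerivAt (fun τ : ℝ => (ξ + τ • ee i) k) (if k = i then 1 else 0) τ := by
  have : HasDerivAt (fun τ : ℝ => ξ k + τ * ee i k) (1 * ee i k) τ :=
    ((hasDerivAt_id τ).mul_const _).const_add _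
  rw [one_mul, ee_apply] at this
  simpa [ee_apply] using this

theorem Hk_eq {n : ℕ} (k : Option (Fin n)) (ξ : Vu n) : Hk k ξ = ξ k * rn (n+1) ξ := by
  unfold Hk rn; rw [div_eq_mul_inv]

theorem hasDerivAt_Hk {n : ℕ} (i k : Option (Fin n)) (ξ : Vu n) (τ : ℝ) (h : ξ + τ • ee i ≠ 0) :
    HasDerivAt (fun τ : ℝ => Hk k (ξ + τ • ee i)) (dH i k (ξ + τ • ee i)) τ := by
  simp only [Hk_eq]
  have := (hasDerivAt_coord i k ξ τ).mul (hasDerivAt_rn (n+1) i ξ τ h)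
  refine this.congr_deriv ?_
  unfold dH; push_cast; ring

theorem hasDerivAt_dH {n : ℕ} (i k : Option (Fin n)) (ξ : Vu n) (τ : ℝ) (h : ξ + τ • ee i ≠ 0) :
    HasDerivAt (fun τ : ℝ => dH i k (ξ + τ • ee i)) (ddH i k (ξ + τ • ee i)) τ := by
  unfold dH
  have h1 := (hasDerivAt_rn (n+1) i ξ τ h).const_mul (if k = i then (1:ℝ) else 0)
  have h2 := (((hasDerivAt_coord i i ξ τ).mul (hasDerivAt_coord i k ξ τ)).const_mul ((n:ℝ)+1)).mul
    (hasDerivAt_rn (n+3) i ξ τ h)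
  refine (h1.sub h2).congr_deriv ?_
  unfold ddH; push_cast
  simp only [if_true, Pi.mul_apply]
  ring

theorem dH_comm {n : ℕ} (i k : Option (Fin n)) (ξ : Vu n) : dH i k ξ = dH k i ξ := by
  unfold dH; simp only [eq_comm (a := i)]; ring

theorem sum_sq_coord {n : ℕ} (ξ : Vu n) : ∑ i, ξ i ^ 2 = ‖ξ‖ ^ 2 := by
  rw [EuclideanSpace.norm_sq_eq]; simp

theorem rn_mul_sq {n : ℕ} (m : ℕ) (ξ : Vu n) (h : ξ ≠ 0) : ‖ξ‖ ^ 2 * rn (m + 2) ξ = rn m ξ := by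
  have hp : 0 < ‖ξ‖ := norm_pos_iff.2 h
  unfold rn; rw [pow_add]; field_simp

theorem sum_dH {n : ℕ} (ξ : Vu n) (h : ξ ≠ 0) : ∑ i, dH i i ξ = 0 := by
  unfold dH
  simp only [if_true, one_mul, ← sq]
  rw [Finset.sum_sub_distrib, ← Finset.sum_mul, ← Finset.mul_sum, sum_sq_coord]
  simp only [Finset.sum_const, Finset.card_univ, Fintype.card_option, Fintype.card_fin, nsmul_eq_mul]
  rw [mul_assoc, rn_mul_sq (n+1) ξ h]; push_cast; ring

theorem sum_ddH {n : ℕ} (k : Option (Fin n)) (ξ : Vu n) (h : ξ ≠ 0) : ∑ i, ddH i k ξ = 0 := by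
  unfold ddH
  rw [Finset.sum_add_distrib, ← Finset.sum_mul, ← Finset.sum_mul, ← Finset.mul_sum, ← Finset.mul_sum,
    ← Finset.sum_mul, sum_sq_coord, Finset.sum_add_distrib]
  have e1 : ∑ i : Option (Fin n), 2 * (if k = i then (1:ℝ) else 0) * ξ i = 2 * ξ k := by
    simp
  rw [e1]
  simp only [Finset.sum_const, Finset.card_univ, Fintype.card_option, Fintype.card_fin, nsmul_eq_mul]
  have := rn_mul_sq (n+3) ξ h
  push_cast
  linear_combination ((n:ℝ)+1) * (n+3) * ξ k * this

theorem abs_coord_le {n : ℕ} (ξ : Vu n) (k : Option (Fin n)) : |ξ k| ≤ ‖ξ‖ := by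
  simpa using PiLp.norm_apply_le ξ k

theorem abs_dH_le {n : ℕ} (i k : Option (Fin n)) (ξ : Vu n) (h : ξ ≠ 0) :
    |dH i k ξ| ≤ (n+2) * rn (n+1) ξ := by
  unfold dH
  have h1 := abs_coord_le ξ i
  have h2 := abs_coord_le ξ k
  have h3 := rn_nonneg (n+1) ξ
  have h4 := rn_nonneg (n+3) ξ
  have h5 := rn_mul_sq (n+1) ξ h
  have h6 : |(if k = i then (1:ℝ) else 0)| ≤ 1 := by split_ifs <;> simp
  refine (abs_sub _ _).trans ?_
  rw [abs_mul, abs_mul, abs_mul, abs_mul, abs_of_nonneg h3, abs_of_nonneg h4,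
    abs_of_nonneg (by positivity : (0:ℝ) ≤ (n:ℝ)+1)]
  calc _ ≤ 1 * rn (n+1) ξ + (n+1) * (‖ξ‖ * ‖ξ‖) * rn (n+3) ξ := by gcongr
    _ = _ := by rw [← h5]; ring

theorem abs_ddH_le {n : ℕ} (i k : Option (Fin n)) (ξ : Vu n) (h : ξ ≠ 0) :
    |ddH i k ξ| ≤ (n+1) * (n+6) * (‖ξ‖ * rn (n+3) ξ) := by
  unfold ddH
  have h1 := abs_coord_le ξ i
  have h2 := abs_coord_le ξ k
  have h3 := rn_nonneg (n+5) ξ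
  have h4 := rn_nonneg (n+3) ξ
  have h5 := rn_mul_sq (n+3) ξ h
  have h6 : |(if k = i then (1:ℝ) else 0)| ≤ 1 := by split_ifs <;> simp
  refine (abs_add_le _ _).trans ?_
  have t1 : |2 * (if k = i then (1:ℝ) else 0) * ξ i + ξ k| ≤ 3 * ‖ξ‖ := by
    refine (abs_add_le _ _).trans ?_
    rw [abs_mul, abs_mul, abs_two]
    nlinarith [abs_nonneg (ξ i), mul_le_mul h6 h1 (abs_nonneg _) zero_le_one]
  have t2 : |ξ i ^ 2 * ξ k| ≤ ‖ξ‖ ^ 2 * ‖ξ‖ := by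
    rw [abs_mul, abs_pow]; gcongr
  rw [abs_mul, abs_mul, abs_mul, abs_mul, abs_of_nonneg h3, abs_of_nonneg h4, abs_neg,
    abs_of_nonneg (by positivity : (0:ℝ) ≤ (n:ℝ)+1), abs_of_nonneg (by positivity : (0:ℝ) ≤ ((n:ℝ)+1) * (n+3))]
  calc _ ≤ (n+1) * (3 * ‖ξ‖) * rn (n+3) ξ + (n+1) * (n+3) * (‖ξ‖ ^ 2 * ‖ξ‖) * rn (n+5) ξ := by gcongr
    _ = _ := by rw [← h5]; ring

theorem pt_add_none {n : ℕ} (x : Eu n) (t τ : ℝ) : pt x (t + τ) = pt x t + τ • ee none := by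
  ext o; cases o <;> simp [ee_apply]

theorem pt_add_some {n : ℕ} (x : Eu n) (t τ : ℝ) (j : Fin n) :
    pt (x + τ • EuclideanSpace.single j 1) t = pt x t + τ • ee (some j) := by
  ext o; cases o <;> simp [ee_apply, PiLp.single_apply]

theorem pt_ne_zero {n : ℕ} (x : Eu n) {t : ℝ} (ht : 0 < t) : pt x t ≠ 0 :=
  norm_pos_iff.1 (norm_pt_pos x ht)

theorem continuousAt_rn {n : ℕ} (m : ℕ) {ξ : Vu n} (h : ξ ≠ 0) : ContinuousAt (rn m) ξ := by
  unfold rn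
  have : ‖ξ‖ ^ m ≠ 0 := pow_ne_zero _ (norm_ne_zero_iff.2 h)
  fun_prop (disch := assumption)

theorem continuousAt_dH {n : ℕ} (i k : Option (Fin n)) {ξ : Vu n} (h : ξ ≠ 0) :
    ContinuousAt (dH i k) ξ := by
  unfold dH
  have := continuousAt_rn (n+1) h
  have := continuousAt_rn (n+3) h
  fun_prop

theorem continuousAt_ddH {n : ℕ} (i k : Option (Fin n)) {ξ : Vu n} (h : ξ ≠ 0) :
    ContinuousAt (ddH i k) ξ := by
  unfold ddH
  have := continuousAt_rn (n+5) h
  have := continuousAt_rn (n+3) h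
  fun_prop

theorem continuous_comp_pt {n : ℕ} {k : Vu n → ℝ} (hk : ∀ ξ, ξ ≠ 0 → ContinuousAt k ξ)
    {t : ℝ} (ht : 0 < t) : Continuous (fun x : Eu n => k (pt x t)) := by
  rw [continuous_iff_continuousAt]; intro x
  exact (hk _ (pt_ne_zero x ht)).comp
    (f := fun x => pt x t) (by fun_prop : Continuous fun x : Eu n => pt x t).continuousAt

theorem hasDerivAt_Hk_t {n : ℕ} (k : Option (Fin n)) (x : Eu n) {t : ℝ} (ht : 0 < t) :
    HasDerivAt (fun t => Hk k (pt x t)) (dH none k (pt x t)) t := by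
  have h := hasDerivAt_Hk none k (pt x 0) t (by rw [← pt_add_none, zero_add]; exact pt_ne_zero x ht)
  simp only [← pt_add_none, zero_add] at h
  exact h

theorem hasLineDerivAt_Hk {n : ℕ} (k : Option (Fin n)) (j : Fin n) (x : Eu n) {t : ℝ} (ht : 0 < t) :
    HasLineDerivAt ℝ (fun x => Hk k (pt x t)) (dH (some j) k (pt x t)) x (EuclideanSpace.single j 1) := by
  have h := hasDerivAt_Hk (some j) k (pt x t) 0 (by simpa using pt_ne_zero x ht)
  unfold HasLineDerivAt
  simp only [pt_add_some]
  simpa using h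

set_option linter.unusedVariables false

theorem rn_sq_le {n : ℕ} (hn : 1 ≤ n) (x : Eu n) {t : ℝ} (ht : 0 < t) :
    rn n (pt x t) ^ 2 ≤ (t ^ n)⁻¹ * Hk none (pt x t) := by
  have hN := norm_pt_pos x ht
  have hle : t ≤ ‖pt x t‖ := (le_abs_self t).trans (abs_le_norm_pt x t)
  unfold rn Hk
  rw [pt_none]
  obtain ⟨m, rfl⟩ : ∃ m, n = m + 1 := ⟨n - 1, by omega⟩
  set N := ‖pt x t‖
  have hp : t ^ m ≤ N ^ m := by gcongr
  rw [inv_pow, ← pow_mul, inv_mul_eq_div, div_div, inv_eq_one_div, div_le_div_iff₀ (by positivity) (by positivity)]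
  have : N ^ ((m + 1) * 2) = N ^ (m+2) * N ^ m := by ring
  rw [this, show t ^ (m+1) = t * t ^ m by ring]
  have h2 : 0 ≤ t * N ^ (m+2) := by positivity
  nlinarith [mul_le_mul_of_nonneg_left hp h2]

theorem integrable_rn_sq {n : ℕ} (hn : 1 ≤ n) {t : ℝ} (ht : 0 < t) :
    Integrable (fun x : Eu n => rn n (pt x t) ^ 2) := by
  refine Integrable.mono' ((integrable_pk ht).const_mul ((t ^ n)⁻¹)) ?_ ?_
  · exact ((continuous_comp_pt (fun ξ h => continuousAt_rn n h) ht).pow 2).aestronglyMeasurable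
  · filter_upwards with x
    rw [Real.norm_of_nonneg (by positivity)]
    exact rn_sq_le hn x ht

theorem integral_rn_sq_le {n : ℕ} (hn : 1 ≤ n) {t : ℝ} (ht : 0 < t) :
    ∫ x : Eu n, rn n (pt x t) ^ 2 ≤ (t ^ n)⁻¹ * kap n := by
  rw [← integral_pk ht, ← integral_const_mul]
  exact integral_mono (integrable_rn_sq hn ht) ((integrable_pk ht).const_mul _) (fun x => rn_sq_le hn x ht)

theorem abs_mul_le_sq {a b A A' u v : ℝ} (h1 : |a| ≤ A * u) (h2 : |b| ≤ A' * v) (hA : 0 ≤ A) (hA' : 0 ≤ A') :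
    |a * b| ≤ A * A' * (u ^ 2 + v ^ 2) := by
  rw [abs_mul]
  have h3 : |a| * |b| ≤ (A * u) * (A' * v) := mul_le_mul h1 h2 (abs_nonneg _) ((abs_nonneg _).trans h1)
  have h4 : u * v ≤ u ^ 2 + v ^ 2 := by nlinarith [sq_nonneg (u - v), sq_nonneg u, sq_nonneg v]
  have := mul_le_mul_of_nonneg_left h4 (mul_nonneg hA hA')
  nlinarith

theorem integrable_rn_sq_add {n : ℕ} (hn : 1 ≤ n) {t : ℝ} (ht : 0 < t) (a : Eu n) :
    Integrable (fun x : Eu n => rn n (pt x t) ^ 2 + rn n (pt (x + a) t) ^ 2) :=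
  (integrable_rn_sq hn ht).add ((integrable_rn_sq hn ht).comp_add_right a)

theorem integrable_prod_k {n : ℕ} (hn : 1 ≤ n) {t : ℝ} (ht : 0 < t) (a : Eu n) {k k' : Vu n → ℝ}
    (hk : ∀ ξ, ξ ≠ 0 → ContinuousAt k ξ) (hk' : ∀ ξ, ξ ≠ 0 → ContinuousAt k' ξ) {A A' : ℝ}
    (hA : 0 ≤ A) (hA' : 0 ≤ A')
    (h1 : ∀ x, |k (pt x t)| ≤ A * rn n (pt x t)) (h2 : ∀ x, |k' (pt x t)| ≤ A' * rn n (pt x t)) :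
    Integrable (fun x : Eu n => k (pt x t) * k' (pt (x + a) t)) := by
  refine Integrable.mono' ((integrable_rn_sq_add hn ht a).const_mul (A * A')) ?_ ?_
  · exact ((continuous_comp_pt hk ht).mul ((continuous_comp_pt hk' ht).comp (continuous_id.add continuous_const))).aestronglyMeasurable
  · filter_upwards with x
    exact abs_mul_le_sq (h1 x) (h2 _) hA hA'

theorem abs_Hk_le_rn {n : ℕ} (k : Option (Fin n)) (ξ : Vu n) : |Hk k ξ| ≤ 1 * rn n ξ := by
  rw [one_mul]; exact abs_Hk_le k ξ

theorem rn_succ_le {n : ℕ} (x : Eu n) {t : ℝ} (ht : 0 < t) (m : ℕ) : rn (m+1) (pt x t) ≤ t⁻¹ * rn m (pt x t) := by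
  have hN := norm_pt_pos x ht
  have hle : t ≤ ‖pt x t‖ := (le_abs_self t).trans (abs_le_norm_pt x t)
  unfold rn
  rw [pow_succ, mul_inv, mul_comm]
  gcongr

theorem abs_dH_le_rn {n : ℕ} (i k : Option (Fin n)) (x : Eu n) {t : ℝ} (ht : 0 < t) :
    |dH i k (pt x t)| ≤ ((n+2) * t⁻¹) * rn n (pt x t) := by
  refine (abs_dH_le i k _ (pt_ne_zero x ht)).trans ?_
  rw [mul_assoc]
  have := rn_succ_le x ht n
  gcongr

theorem rn_anti {n : ℕ} (x : Eu n) {t s : ℝ} (ht : 0 < t) (hts : t ≤ s) (m : ℕ) :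
    rn m (pt x s) ≤ rn m (pt x t) := by
  have hN := norm_pt_pos x ht
  have : ‖pt x t‖ ≤ ‖pt x s‖ := by
    have := norm_pt_sq x t
    have := norm_pt_sq x s
    have : ‖pt x t‖ ^ 2 ≤ ‖pt x s‖ ^ 2 := by nlinarith
    exact le_of_sq_le_sq this (norm_nonneg _) 
  unfold rn
  gcongr

/-- integration by parts for the kernels -/
theorem ibp_H {n : ℕ} (hn : 1 ≤ n) {t : ℝ} (ht : 0 < t) (a : Eu n) (k l : Option (Fin n)) (j : Fin n) :
    ∫ x : Eu n, Hk k (pt x t) * dH (some j) l (pt (x + a) t) =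
      - ∫ x : Eu n, dH (some j) k (pt x t) * Hk l (pt (x + a) t) := by
  have hc : (0:ℝ) ≤ (n+2) * t⁻¹ := by positivity
  refine integral_bilinear_hasLineDerivAt_right_eq_neg_left_of_integrable
    (B := ContinuousLinearMap.mul ℝ ℝ) (v := EuclideanSpace.single j 1)
    (f := fun x => Hk k (pt x t)) (g := fun x => Hk l (pt (x + a) t)) ?_ ?_ ?_ ?_ ?_
  · exact integrable_prod_k hn ht a (fun ξ h => continuousAt_dH _ _ h) (fun ξ h => continuousAt_Hk _ h) hc zero_le_one
      (fun x => abs_dH_le_rn _ _ x ht) (fun x => abs_Hk_le_rn _ _)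
  · exact integrable_prod_k hn ht a (fun ξ h => continuousAt_Hk _ h) (fun ξ h => continuousAt_dH _ _ h) zero_le_one hc
      (fun x => abs_Hk_le_rn _ _) (fun x => abs_dH_le_rn _ _ x ht)
  · exact integrable_prod_k hn ht a (fun ξ h => continuousAt_Hk _ h) (fun ξ h => continuousAt_Hk _ h) zero_le_one zero_le_one
      (fun x => abs_Hk_le_rn _ _) (fun x => abs_Hk_le_rn _ _)
  · intro x _; exact hasLineDerivAt_Hk k j x ht
  · intro x _
    have := hasLineDerivAt_Hk l j (x + a) ht
    unfold HasLineDerivAt at this ⊢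
    refine this.congr_of_eventuallyEq (Eventually.of_forall fun τ => ?_)
    simp only
    congr 2; abel

noncomputable def ekk {n : ℕ} (a : Eu n) (k : Option (Fin n)) (t : ℝ) : ℝ :=
  ∫ x : Eu n, Hk k (pt x t) * Hk k (pt (x + a) t)

theorem hasDerivAt_ekk {n : ℕ} (hn : 1 ≤ n) (a : Eu n) (k : Option (Fin n)) {t : ℝ} (ht : 0 < t) :
    HasDerivAt (ekk a k) ((∫ x : Eu n, dH none k (pt x t) * Hk k (pt (x + a) t))
      + ∫ x : Eu n, Hk k (pt x t) * dH none k (pt (x + a) t)) t := by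
  have hc : (0:ℝ) ≤ (n+2) * t⁻¹ := by positivity
  have i1 : Integrable fun x : Eu n => dH none k (pt x t) * Hk k (pt (x + a) t) := integrable_prod_k hn ht a (fun ξ h => continuousAt_dH none k h) (fun ξ h => continuousAt_Hk k h) hc zero_le_one
      (fun x => abs_dH_le_rn _ _ x ht) (fun x => abs_Hk_le_rn _ _)
  have i2 : Integrable fun x : Eu n => Hk k (pt x t) * dH none k (pt (x + a) t) := integrable_prod_k hn ht a (fun ξ h => continuousAt_Hk k h) (fun ξ h => continuousAt_dH none k h) zero_le_one hc
      (fun x => abs_Hk_le_rn _ _) (fun x => abs_dH_le_rn _ _ x ht)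
  rw [← integral_add i1 i2]
  have ht2 : 0 < t / 2 := by positivity
  have hpos : ∀ s ∈ Ioi (t/2), 0 < s := fun s hs => ht2.trans hs
  refine (hasDerivAt_integral_of_dominated_loc_of_deriv_le (s := Ioi (t/2))
    (F := fun s x => Hk k (pt x s) * Hk k (pt (x + a) s))
    (F' := fun s x => dH none k (pt x s) * Hk k (pt (x + a) s) + Hk k (pt x s) * dH none k (pt (x + a) s))
    (bound := fun x => 2 * ((n+2) * (t/2)⁻¹ * 1) * (rn n (pt x (t/2)) ^ 2 + rn n (pt (x + a) (t/2)) ^ 2))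
    (Ioi_mem_nhds (by linarith)) ?_ ?_ ?_ ?_ ?_ ?_).2
  · filter_upwards [Ioi_mem_nhds (show t/2 < t by linarith)] with s hs
    exact ((continuous_Hk_pt k (hpos s hs)).mul ((continuous_Hk_pt k (hpos s hs)).comp (continuous_id.add continuous_const))).aestronglyMeasurable
  · exact integrable_prod_k hn ht a (fun ξ h => continuousAt_Hk _ h) (fun ξ h => continuousAt_Hk _ h) zero_le_one zero_le_one
      (fun x => abs_Hk_le_rn _ _) (fun x => abs_Hk_le_rn _ _)
  · exact (i1.add i2).aestronglyMeasurable
  · filter_upwards with x s hs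
    have hs0 := hpos s hs
    have hs' : t / 2 ≤ s := le_of_lt hs
    have b1 : ∀ y : Eu n, |dH none k (pt y s)| ≤ ((n+2) * (t/2)⁻¹) * rn n (pt y (t/2)) := fun y =>
      (abs_dH_le_rn none k y hs0).trans (by
        have := rn_anti y ht2 hs' n
        have h0 := rn_nonneg n (pt y s)
        gcongr)
    have b2 : ∀ y : Eu n, |Hk k (pt y s)| ≤ 1 * rn n (pt y (t/2)) := fun y =>
      (abs_Hk_le_rn k _).trans (by have := rn_anti y ht2 hs' n; gcongr)
    have hc2 : (0:ℝ) ≤ (n+2) * (t/2)⁻¹ := by positivity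
    refine (norm_add_le _ _).trans ?_
    have e1 := abs_mul_le_sq (b1 x) (b2 (x+a)) hc2 zero_le_one
    have e2 := abs_mul_le_sq (b2 x) (b1 (x+a)) zero_le_one hc2
    rw [Real.norm_eq_abs, Real.norm_eq_abs]
    nlinarith
  · exact (integrable_rn_sq_add hn ht2 a).const_mul _
  · filter_upwards with x s hs
    have hs0 := hpos s hs
    exact (hasDerivAt_Hk_t k x hs0).mul (hasDerivAt_Hk_t k (x+a) hs0)

theorem ekk_eq {n : ℕ} (hn : 1 ≤ n) (a : Eu n) {t : ℝ} (ht : 0 < t) :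
    ∑ j : Fin n, ekk a (some j) t = ekk a none t := by
  have hd : ∀ t ∈ Ioi (0:ℝ), HasDerivAt (fun t => ∑ j : Fin n, ekk a (some j) t - ekk a none t) 0 t := by
    intro t ht
    have ht : 0 < t := ht
    have hc : (0:ℝ) ≤ (n+2) * t⁻¹ := by positivity
    have h := (HasDerivAt.fun_sum (u := Finset.univ) (fun (j : Fin n) _ => hasDerivAt_ekk hn a (some j) ht)).fun_sub (hasDerivAt_ekk hn a none ht)
    refine h.congr_deriv ?_
    have hs : ∀ x : Eu n, dH none none (pt x t) = - ∑ j : Fin n, dH (some j) (some j) (pt x t) := by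
      intro x
      have := sum_dH (pt x t) (pt_ne_zero x ht)
      rw [Fintype.sum_option] at this
      linarith
    have i1 : ∀ i k l : Option (Fin n), Integrable fun x : Eu n => dH i k (pt x t) * Hk l (pt (x + a) t) := fun i k l => integrable_prod_k hn ht a (fun ξ h => continuousAt_dH _ _ h) (fun ξ h => continuousAt_Hk _ h) hc zero_le_one
      (fun x => abs_dH_le_rn _ _ x ht) (fun x => abs_Hk_le_rn _ _)
    have i2 : ∀ i k l : Option (Fin n), Integrable fun x : Eu n => Hk l (pt x t) * dH i k (pt (x + a) t) := fun i k l => integrable_prod_k hn ht a (fun ξ h => continuousAt_Hk _ h) (fun ξ h => continuousAt_dH _ _ h) zero_le_one hc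
      (fun x => abs_Hk_le_rn _ _) (fun x => abs_dH_le_rn _ _ x ht)
    have e1 : ∫ x : Eu n, dH none none (pt x t) * Hk none (pt (x + a) t) =
        - ∑ j : Fin n, ∫ x : Eu n, dH (some j) (some j) (pt x t) * Hk none (pt (x + a) t) := by
      rw [← integral_finsetSum _ (fun j _ => i1 _ _ _), ← integral_neg]
      congr 1; ext x; rw [hs, neg_mul, Finset.sum_mul]
    have e2 : ∫ x : Eu n, Hk none (pt x t) * dH none none (pt (x + a) t) =
        - ∑ j : Fin n, ∫ x : Eu n, Hk none (pt x t) * dH (some j) (some j) (pt (x + a) t) := by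
      rw [← integral_finsetSum _ (fun j _ => i2 _ _ _), ← integral_neg]
      congr 1; ext x; rw [hs, mul_neg, Finset.mul_sum]
    rw [e1, e2, sub_eq_zero, ← neg_add, ← Finset.sum_add_distrib, ← Finset.sum_neg_distrib]
    refine Finset.sum_congr rfl fun j _ => ?_
    simp only [dH_comm none (some j)]
    rw [ibp_H hn ht a (some j) none j, ibp_H hn ht a none (some j) j]
    ring
  have hconst : ∀ s, 0 < s → ∑ j : Fin n, ekk a (some j) t - ekk a none t = ∑ j : Fin n, ekk a (some j) s - ekk a none s := by
    intro s hs
    exact isOpen_Ioi.is_const_of_deriv_eq_zero (s := Ioi (0:ℝ))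
      (f := fun t => ∑ j : Fin n, ekk a (some j) t - ekk a none t) isPreconnected_Ioi
      (fun t ht => (hd t ht).differentiableAt.differentiableWithinAt) (fun t ht => (hd t ht).deriv) ht hs
  have hb : ∀ (k : Option (Fin n)) s, 0 < s → |ekk a k s| ≤ 2 * kap n * (s ^ n)⁻¹ := by
    intro k s hs
    calc |ekk a k s| ≤ ∫ x : Eu n, (rn n (pt x s) ^ 2 + rn n (pt (x + a) s) ^ 2) := by
          unfold ekk; rw [← Real.norm_eq_abs]
          refine norm_integral_le_of_norm_le (integrable_rn_sq_add hn hs a) ?_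
          filter_upwards with x
          have := abs_mul_le_sq (abs_Hk_le_rn k (pt x s)) (abs_Hk_le_rn k (pt (x+a) s)) zero_le_one zero_le_one
          rw [Real.norm_eq_abs]; linarith
      _ = (∫ x : Eu n, rn n (pt x s) ^ 2) + ∫ x : Eu n, rn n (pt x s) ^ 2 := by
          rw [integral_add (integrable_rn_sq hn hs) ((integrable_rn_sq hn hs).comp_add_right a)]
          rw [integral_add_right_eq_self (fun x : Eu n => rn n (pt x s) ^ 2) a]
      _ ≤ _ := by linarith [integral_rn_sq_le hn hs]
  have hlim : Tendsto (fun s : ℝ => ∑ j : Fin n, ekk a (some j) s - ekk a none s) atTop (nhds 0) := by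
    have h1 : Tendsto (fun s : ℝ => 2 * kap n * (s ^ n)⁻¹) atTop (nhds 0) := by
      have := (tendsto_pow_atTop (α := ℝ) (n := n) (by omega)).inv_tendsto_atTop.const_mul (2 * kap n)
      simpa using this
    have h2 : ∀ k, Tendsto (ekk a k) atTop (nhds 0) := fun k => by
      refine squeeze_zero_norm' ?_ h1
      filter_upwards [eventually_gt_atTop 0] with s hs using hb k s hs
    have := (tendsto_finsetSum Finset.univ fun (j : Fin n) _ => h2 (some j)).sub (h2 none)
    simpa using this
  have h0 : Tendsto (fun s : ℝ => ∑ j : Fin n, ekk a (some j) s - ekk a none s) atTop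
      (nhds (∑ j : Fin n, ekk a (some j) t - ekk a none t)) := by
    refine tendsto_const_nhds.congr' ?_
    filter_upwards [eventually_gt_atTop 0] with s hs using hconst s hs
  linarith [tendsto_nhds_unique hlim h0]

set_option linter.unusedVariables false

theorem intg_add {α : Type*} [MeasurableSpace α] {μ : Measure α} {f g : α → ℝ} (hf : Integrable f μ)
    (hg : Integrable g μ) : Integrable (fun x => f x + g x) μ := hf.add hg

theorem intg_sub {α : Type*} [MeasurableSpace α] {μ : Measure α} {f g : α → ℝ} (hf : Integrable f μ)
    (hg : Integrable g μ) : Integrable (fun x => f x - g x) μ := hf.sub hg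

theorem measurable_Hk_pt {n : ℕ} (k : Option (Fin n)) (t : ℝ) : Measurable fun x : Eu n => Hk k (pt x t) :=
  (measurable_Hk k).comp (by fun_prop : Continuous fun x : Eu n => pt x t).measurable

theorem integrable_rn_sq_sub {n : ℕ} (hn : 1 ≤ n) {t : ℝ} (ht : 0 < t) (a : Eu n) :
    Integrable (fun x : Eu n => rn n (pt (x - a) t) ^ 2) :=
  (integrable_rn_sq hn ht).comp_sub_right a

theorem triple_integrable {n : ℕ} (hn : 1 ≤ n) {t : ℝ} (ht : 0 < t) {f : Eu n → ℝ}
    (hf : Measurable f) (hi : Integrable f) (k : Option (Fin n)) :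
    Integrable (Function.uncurry fun (x : Eu n) (p : Eu n × Eu n) =>
      (Hk k (pt (x - p.1) t) * f p.1) * (Hk k (pt (x - p.2) t) * f p.2))
      (volume.prod (volume.prod volume)) := by
  have hG : Integrable (Function.uncurry fun (x : Eu n) (p : Eu n × Eu n) =>
      (rn n (pt (x - p.1) t) ^ 2 + rn n (pt (x - p.2) t) ^ 2) * (|f p.1| * |f p.2|))
      (volume.prod (volume.prod volume)) := by
    have hc := continuous_comp_pt (n := n) (fun ξ h => continuousAt_rn n h) ht
    rw [integrable_prod_iff']
    · constructor
      · filter_upwards with p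
        simp only [Function.uncurry]
        exact (intg_add (integrable_rn_sq_sub hn ht p.1) (integrable_rn_sq_sub hn ht p.2)).mul_const _
      · have : (fun p : Eu n × Eu n => ∫ x : Eu n, ‖(Function.uncurry fun (x : Eu n) (p : Eu n × Eu n) =>
            (rn n (pt (x - p.1) t) ^ 2 + rn n (pt (x - p.2) t) ^ 2) * (|f p.1| * |f p.2|)) (x, p)‖)
            = fun p => (2 * ∫ x : Eu n, rn n (pt x t) ^ 2) * (|f p.1| * |f p.2|) := by
          ext p
          have : ∀ x : Eu n, ‖(Function.uncurry fun (x : Eu n) (p : Eu n × Eu n) =>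
            (rn n (pt (x - p.1) t) ^ 2 + rn n (pt (x - p.2) t) ^ 2) * (|f p.1| * |f p.2|)) (x, p)‖ = 
             (rn n (pt (x - p.1) t) ^ 2 + rn n (pt (x - p.2) t) ^ 2) * (|f p.1| * |f p.2|) := fun x => by
            simp only [Function.uncurry]
            rw [Real.norm_of_nonneg (by positivity)]
          simp only [this]
          rw [integral_mul_const, integral_add (integrable_rn_sq_sub hn ht p.1) (integrable_rn_sq_sub hn ht p.2),
            integral_sub_right_eq_self (fun x : Eu n => rn n (pt x t) ^ 2), integral_sub_right_eq_self (fun x : Eu n => rn n (pt x t) ^ 2)]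
          ring
        rw [this]
        exact (hi.abs.mul_prod hi.abs).const_mul _
    · have h1 : Measurable fun z : Eu n × (Eu n × Eu n) => rn n (pt (z.1 - z.2.1) t) :=
        hc.measurable.comp (by fun_prop : Measurable fun z : Eu n × (Eu n × Eu n) => z.1 - z.2.1)
      have h2 : Measurable fun z : Eu n × (Eu n × Eu n) => rn n (pt (z.1 - z.2.2) t) :=
        hc.measurable.comp (by fun_prop : Measurable fun z : Eu n × (Eu n × Eu n) => z.1 - z.2.2)
      have h3 : Measurable fun z : Eu n × (Eu n × Eu n) => f z.2.1 := hf.comp (by fun_prop)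
      have h4 : Measurable fun z : Eu n × (Eu n × Eu n) => f z.2.2 := hf.comp (by fun_prop)
      exact (((h1.pow_const 2).add (h2.pow_const 2)).mul (h3.abs.mul h4.abs)).aestronglyMeasurable
  refine hG.mono' ?_ ?_
  · have h1 : Measurable fun z : Eu n × (Eu n × Eu n) => Hk k (pt (z.1 - z.2.1) t) :=
        (measurable_Hk_pt k t).comp (by fun_prop : Measurable fun z : Eu n × (Eu n × Eu n) => z.1 - z.2.1)
    have h2 : Measurable fun z : Eu n × (Eu n × Eu n) => Hk k (pt (z.1 - z.2.2) t) :=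
        (measurable_Hk_pt k t).comp (by fun_prop : Measurable fun z : Eu n × (Eu n × Eu n) => z.1 - z.2.2)
    have h3 : Measurable fun z : Eu n × (Eu n × Eu n) => f z.2.1 := hf.comp (by fun_prop)
    have h4 : Measurable fun z : Eu n × (Eu n × Eu n) => f z.2.2 := hf.comp (by fun_prop)
    exact ((h1.mul h3).mul (h2.mul h4)).aestronglyMeasurable
  · filter_upwards with z
    simp only [Function.uncurry]
    have := abs_mul_le_sq (abs_Hk_le_rn k (pt (z.1 - z.2.1) t)) (abs_Hk_le_rn k (pt (z.1 - z.2.2) t)) zero_le_one zero_le_one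
    rw [Real.norm_eq_abs, show Hk k (pt (z.1 - z.2.1) t) * f z.2.1 * (Hk k (pt (z.1 - z.2.2) t) * f z.2.2) =
      (Hk k (pt (z.1 - z.2.1) t) * Hk k (pt (z.1 - z.2.2) t)) * (f z.2.1 * f z.2.2) by ring, abs_mul, abs_mul (f _)]
    have h0 : 0 ≤ |f z.2.1| * |f z.2.2| := by positivity
    nlinarith

theorem conv_sq_integrable {n : ℕ} (hn : 1 ≤ n) {t : ℝ} (ht : 0 < t) {f : Eu n → ℝ}
    (hf : Measurable f) (hi : Integrable f) (k : Option (Fin n)) :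
    Integrable (fun x : Eu n => (∫ y, Hk k (pt (x - y) t) * f y) ^ 2) ∧
    Integrable (fun p : Eu n × Eu n => f p.1 * f p.2 * ekk (p.1 - p.2) k t) (volume.prod volume) ∧
    ∫ x : Eu n, (∫ y, Hk k (pt (x - y) t) * f y) ^ 2 = ∫ p : Eu n × Eu n, f p.1 * f p.2 * ekk (p.1 - p.2) k t ∂(volume.prod volume) := by
  have hT := triple_integrable hn ht hf hi k
  have e1 : ∀ x : Eu n, ∫ p : Eu n × Eu n, (Hk k (pt (x - p.1) t) * f p.1) * (Hk k (pt (x - p.2) t) * f p.2) ∂(volume.prod volume) = (∫ y, Hk k (pt (x - y) t) * f y) ^ 2 := by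
    intro x
    rw [integral_prod_mul (fun y => Hk k (pt (x - y) t) * f y) (fun y => Hk k (pt (x - y) t) * f y)]; ring
  have e2 : ∀ p : Eu n × Eu n, ∫ x : Eu n, (Hk k (pt (x - p.1) t) * f p.1) * (Hk k (pt (x - p.2) t) * f p.2) = f p.1 * f p.2 * ekk (p.1 - p.2) k t := by
    intro p
    unfold ekk
    rw [← integral_const_mul, ← integral_sub_right_eq_self (fun x : Eu n => f p.1 * f p.2 * (Hk k (pt x t) * Hk k (pt (x + (p.1 - p.2)) t))) p.1]
    congr 1; ext x
    rw [show x - p.1 + (p.1 - p.2) = x - p.2 by abel]; ring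
  refine ⟨?_, ?_, ?_⟩
  · have := hT.integral_prod_left
    simpa only [Function.uncurry, e1] using this
  · have := hT.integral_prod_right
    simpa only [Function.uncurry, e2] using this
  · have := integral_integral_swap hT
    simpa only [e1, e2] using this

theorem jensen_pk {n : ℕ} {t : ℝ} (ht : 0 < t) {f : Eu n → ℝ} (x : Eu n)
    (h1 : Integrable (fun y => Hk none (pt (x - y) t) * f y))
    (h2 : Integrable (fun y => Hk none (pt (x - y) t) * f y ^ 2)) :
    (∫ y, Hk none (pt (x - y) t) * f y) ^ 2 ≤ kap n * ∫ y, Hk none (pt (x - y) t) * f y ^ 2 := by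
  have hk := kap_pos n
  have h0 : Integrable (fun y => Hk none (pt (x - y) t)) := (integrable_pk ht).comp_sub_left x
  set m := (∫ y, Hk none (pt (x - y) t) * f y) / kap n with hm
  have hnn : 0 ≤ ∫ y, Hk none (pt (x - y) t) * (f y - m) ^ 2 :=
    integral_nonneg fun y => mul_nonneg (pk_pos ht _).le (sq_nonneg _)
  have hE : ∫ y, Hk none (pt (x - y) t) * (f y - m) ^ 2 = (∫ y, Hk none (pt (x - y) t) * f y ^ 2)
      - 2 * m * (∫ y, Hk none (pt (x - y) t) * f y) + m ^ 2 * kap n := by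
    rw [← integral_pk_sub ht x, ← integral_const_mul, ← integral_const_mul, ← integral_sub h2 (h1.const_mul _),
      ← integral_add (intg_sub h2 (h1.const_mul _)) (h0.const_mul _)]
    congr 1; ext y; ring
  rw [hE] at hnn
  have hI : ∫ y, Hk none (pt (x - y) t) * f y = m * kap n := by rw [hm]; field_simp
  rw [hI] at hnn ⊢
  nlinarith

theorem conv_pk_integrable {n : ℕ} {t : ℝ} (ht : 0 < t) {g : Eu n → ℝ} (hg : Measurable g)
    (hi : Integrable g) :
    Integrable (fun x : Eu n => ∫ y, Hk none (pt (x - y) t) * g y) ∧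
    ∫ x : Eu n, ∫ y, Hk none (pt (x - y) t) * g y = kap n * ∫ y, g y := by
  have hm : Measurable (fun z : Eu n × Eu n => Hk none (pt (z.1 - z.2) t)) :=
    (measurable_Hk_pt none t).comp (by fun_prop : Measurable fun z : Eu n × Eu n => z.1 - z.2)
  have hT : Integrable (Function.uncurry fun (x y : Eu n) => Hk none (pt (x - y) t) * g y) (volume.prod volume) := by
    rw [integrable_prod_iff']
    · constructor
      · filter_upwards with y
        simp only [Function.uncurry]
        exact ((integrable_pk ht).comp_sub_right y).mul_const _
      · have : (fun y : Eu n => ∫ x : Eu n, ‖(Function.uncurry fun (x y : Eu n) => Hk none (pt (x - y) t) * g y) (x, y)‖) = fun y => kap n * |g y| := by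
          ext y
          have : ∀ x : Eu n, ‖(Function.uncurry fun (x y : Eu n) => Hk none (pt (x - y) t) * g y) (x, y)‖ = Hk none (pt (x - y) t) * |g y| := fun x => by
            simp only [Function.uncurry]
            rw [norm_mul, Real.norm_of_nonneg (pk_pos ht _).le, Real.norm_eq_abs]
          simp only [this]
          rw [integral_mul_const, integral_sub_right_eq_self (fun x : Eu n => Hk none (pt x t)), integral_pk ht]
        rw [this]
        exact hi.abs.const_mul _
    · exact (hm.mul (hg.comp measurable_snd)).aestronglyMeasurable
  refine ⟨hT.integral_prod_left, ?_⟩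
  rw [integral_integral_swap hT, ← integral_const_mul]
  congr 1; ext y
  rw [integral_mul_const, integral_sub_right_eq_self (fun x : Eu n => Hk none (pt x t)), integral_pk ht]

theorem pk_le_const {n : ℕ} {t : ℝ} (ht : 0 < t) (x : Eu n) : |Hk none (pt x t)| ≤ (t ^ n)⁻¹ := by
  refine (abs_Hk_le none _).trans ?_
  have hle : t ≤ ‖pt x t‖ := (le_abs_self t).trans (abs_le_norm_pt x t)
  gcongr

theorem integrable_Hk_mul {n : ℕ} (k : Option (Fin n)) {t : ℝ} (ht : 0 < t) {g : Eu n → ℝ} (hi : Integrable g) (x : Eu n) :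
    Integrable (fun y => Hk k (pt (x - y) t) * g y) := by
  refine hi.bdd_mul (c := (t ^ n)⁻¹) ?_ ?_
  · exact ((measurable_Hk_pt k t).comp (by fun_prop : Measurable fun y : Eu n => x - y)).aestronglyMeasurable
  · filter_upwards with y
    refine (abs_Hk_le k _).trans ?_
    have hle : t ≤ ‖pt (x - y) t‖ := (le_abs_self t).trans (abs_le_norm_pt _ t)
    gcongr

theorem l2_bound {n : ℕ} {t : ℝ} (ht : 0 < t) {f : Eu n → ℝ}
    (hf : Measurable f) (hi : Integrable f) (hi2 : Integrable fun y => f y ^ 2) (j : Fin n) :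
    Integrable (fun x : Eu n => (∫ y, Hk (some j) (pt (x - y) t) * f y) ^ 2) ∧
    ∫ x : Eu n, (∫ y, Hk (some j) (pt (x - y) t) * f y) ^ 2 ≤ kap n ^ 2 * ∫ y, f y ^ 2 := by
  have hn : 1 ≤ n := by have := j.2; omega
  refine ⟨(conv_sq_integrable hn ht hf hi (some j)).1, ?_⟩
  calc ∫ x : Eu n, (∫ y, Hk (some j) (pt (x - y) t) * f y) ^ 2
      ≤ ∑ j : Fin n, ∫ x : Eu n, (∫ y, Hk (some j) (pt (x - y) t) * f y) ^ 2 :=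
        Finset.single_le_sum (f := fun j : Fin n => ∫ x : Eu n, (∫ y, Hk (some j) (pt (x - y) t) * f y) ^ 2)
          (fun i _ => integral_nonneg fun x => sq_nonneg _) (Finset.mem_univ j)
    _ = ∫ x : Eu n, (∫ y, Hk none (pt (x - y) t) * f y) ^ 2 := by
        simp only [fun k => (conv_sq_integrable hn ht hf hi k).2.2]
        rw [← integral_finsetSum _ (fun j _ => (conv_sq_integrable hn ht hf hi (some j)).2.1)]
        congr 1; ext p
        rw [← Finset.mul_sum, ekk_eq hn _ ht]
    _ ≤ ∫ x : Eu n, kap n * ∫ y, Hk none (pt (x - y) t) * f y ^ 2 := by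
        refine integral_mono (conv_sq_integrable hn ht hf hi none).1 ((conv_pk_integrable ht (hf.pow_const 2) hi2).1.const_mul _) fun x => ?_
        exact jensen_pk ht x (integrable_Hk_mul none ht hi x) (integrable_Hk_mul none ht hi2 x)
    _ = _ := by
        rw [integral_const_mul, (conv_pk_integrable ht (hf.pow_const 2) hi2).2]; ring

set_option linter.unusedVariables false

/-! ## Part E: the operators `U` -/

theorem env_le_env_one {n : ℕ} {r : ℝ} (hr : 0 < r) (x0 : Eu n) :
    ∃ C, 0 < C ∧ ∀ x : Eu n, env r (x0 - x) ≤ C * env 1 x := by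
  refine ⟨r * ((1 + ‖x0‖ + r) / r ^ 1 + 1) ^ (n+1), by positivity, fun x => ?_⟩
  set A := (1 + ‖x0‖ + r) / r ^ 1 + 1 with hA
  have hx : ‖x‖ ≤ ‖x0‖ + ‖x0 - x‖ := by
    have := norm_sub_le x0 (x0 - x); simpa using this
  have hA1 : A * r = 1 + ‖x0‖ + r + r := by rw [hA]; field_simp
  have hA2 : 1 ≤ A := by rw [hA]; have : 0 ≤ (1 + ‖x0‖ + r) / r ^ 1 := by positivity
                         linarith
  have h : 1 + ‖x‖ ≤ A * (r + ‖x0 - x‖) := by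
    rw [mul_add, hA1]; nlinarith [norm_nonneg (x0 - x)]
  unfold env
  rw [mul_one_div, div_le_div_iff₀ (by positivity) (by positivity), mul_assoc, ← mul_pow]
  gcongr

/-- kernels dominated by `env 1` -/
def EnvB {n : ℕ} (K : Eu n → ℝ) : Prop := Measurable K ∧ ∃ C, ∀ x, |K x| ≤ C * env 1 x

def WI {n : ℕ} (ψ : Eu n → ℝ) : Prop := AEStronglyMeasurable ψ ∧ Integrable (fun x => env 1 x * |ψ x|)

theorem WI.ker {n : ℕ} {ψ K : Eu n → ℝ} (h : WI ψ) (hK : EnvB K) : Integrable (fun x => K x * ψ x) := by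
  obtain ⟨hm, C, hC⟩ := hK
  refine (h.2.const_mul C).mono' (hm.aestronglyMeasurable.mul h.1) (ae_of_all _ fun x => ?_)
  rw [norm_mul, Real.norm_eq_abs, Real.norm_eq_abs, ← mul_assoc]
  gcongr; exact hC x

theorem EnvB.env {n : ℕ} {r : ℝ} (hr : 0 < r) (x0 : Eu n) : EnvB (fun x => env r (x0 - x)) := by
  obtain ⟨C, hC, h⟩ := env_le_env_one hr x0
  exact ⟨((continuous_env hr).comp (continuous_const.sub continuous_id)).measurable, C, fun x => by
    rw [abs_of_pos (env_pos hr _)]; exact h x⟩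

theorem EnvB.add {n : ℕ} {K L : Eu n → ℝ} (hK : EnvB K) (hL : EnvB L) : EnvB (fun x => K x + L x) := by
  obtain ⟨hm, C, hC⟩ := hK
  obtain ⟨hm', C', hC'⟩ := hL
  exact ⟨hm.add hm', C + C', fun x => (abs_add_le _ _).trans (by have := hC x; have := hC' x; nlinarith)⟩

theorem EnvB.const_mul {n : ℕ} {K : Eu n → ℝ} (hK : EnvB K) (c : ℝ) : EnvB (fun x => c * K x) := by
  obtain ⟨hm, C, hC⟩ := hK
  exact ⟨hm.const_mul c, |c| * C, fun x => by rw [abs_mul, mul_assoc]; gcongr; exact hC x⟩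

theorem EnvB.mono {n : ℕ} {K L : Eu n → ℝ} (hK : EnvB K) (hm : Measurable L) (C : ℝ) (h : ∀ x, |L x| ≤ C * |K x|) : EnvB L := by
  obtain ⟨hm', C', hC'⟩ := hK
  exact ⟨hm, |C| * C', fun x => (h x).trans (by
    rw [mul_assoc]
    exact (mul_le_mul_of_nonneg_right (le_abs_self C) (abs_nonneg _)).trans (by gcongr; exact hC' x))⟩

theorem EnvB.pk {n : ℕ} {t : ℝ} (ht : 0 < t) (x0 : Eu n) : EnvB (fun x => Hk none (pt (x0 - x) t)) := by
  refine (EnvB.env ht x0).mono ((measurable_Hk_pt none t).comp (by fun_prop)) (2 ^ (n+1)) fun x => ?_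
  rw [abs_of_pos (pk_pos ht _), abs_of_pos (env_pos ht _)]
  exact pk_le ht _

theorem EnvB.Hk_sub {n : ℕ} (k : Option (Fin n)) (y y' : Eu n) {t s : ℝ} (ht : 0 < t) (hs : 0 < s) :
    EnvB (fun x => Hk k (pt (y - x) t) - Hk k (pt (y' - x) s)) := by
  set d := ‖y - y'‖ + |t - s| + t + s with hd
  have hd0 : 0 < d := by positivity
  have hmt : Measurable fun x : Eu n => Hk k (pt (y - x) t) := (measurable_Hk_pt k t).comp (by fun_prop)
  have hms : Measurable fun x : Eu n => Hk k (pt (y' - x) s) := (measurable_Hk_pt k s).comp (by fun_prop)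
  set m := min t s / (4 * d) with hm
  have hmin : 0 < min t s := lt_min ht hs
  have hm0 : 0 < m := by positivity
  refine (EnvB.env hd0 y).mono (hmt.sub hms) ((n + 2) / m ^ (n+1)) fun x => ?_
  rw [abs_of_pos (env_pos hd0 _)]
  have hmd : m * (4 * d) = min t s := by rw [hm]; field_simp
  have h1 : min t s ≤ t := min_le_left _ _
  have h2 : min t s ≤ s := min_le_right _ _
  have htd : min t s ≤ d := by have := norm_nonneg (y - y'); have := abs_nonneg (t - s); linarith
  have hm4 : m ≤ 1/4 := by
    rw [hm, div_le_div_iff₀ (by positivity) (by positivity)]; linarith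
  have hN1 := half_le_norm_pt (y - x) ht.le
  have hN2 := half_le_norm_pt (y' - x) hs.le
  have hy : ‖y - x‖ ≤ ‖y - y'‖ + ‖y' - x‖ := by
    have := norm_add_le (y - y') (y' - x); simpa using this
  have hyd : ‖y - y'‖ ≤ d := by have := abs_nonneg (t - s); linarith
  have h0 := norm_nonneg (y - x)
  have h0' := norm_nonneg (y' - x)
  refine abs_Hk_pt_sub_le k hd0 hm0 ?_ ?_ ?_
  · rw [show y - x - (y' - x) = y - y' by abel, hd]; linarith
  · nlinarith
  · nlinarith

noncomputable def U {n : ℕ} (k : Option (Fin n)) (ψ : Eu n → ℝ) (y : Eu n) (s : ℝ) : ℝ :=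
  ∫ x, (Hk k (pt (y - x) s) - Hk k (pt (-x) 1)) * ψ x

theorem WI.U_int {n : ℕ} {ψ : Eu n → ℝ} (h : WI ψ) (k : Option (Fin n)) (y : Eu n) {s : ℝ} (hs : 0 < s) :
    Integrable (fun x => (Hk k (pt (y - x) s) - Hk k (pt (-x) 1)) * ψ x) := by
  have := h.ker (EnvB.Hk_sub k y 0 hs one_pos)
  simpa using this

theorem WI.sub_int {n : ℕ} {ψ : Eu n → ℝ} (h : WI ψ) (k : Option (Fin n)) (y y' : Eu n) {t s : ℝ} (ht : 0 < t) (hs : 0 < s) :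
    Integrable (fun x => (Hk k (pt (y - x) t) - Hk k (pt (y' - x) s)) * ψ x) :=
  h.ker (EnvB.Hk_sub k y y' ht hs)

theorem WI.U_sub {n : ℕ} {ψ : Eu n → ℝ} (h : WI ψ) (k : Option (Fin n)) (y y' : Eu n) {t s : ℝ} (ht : 0 < t) (hs : 0 < s) :
    U k ψ y t - U k ψ y' s = ∫ x, (Hk k (pt (y - x) t) - Hk k (pt (y' - x) s)) * ψ x := by
  unfold U
  rw [← integral_sub (h.U_int k y ht) (h.U_int k y' hs)]
  congr 1; ext x; ring

theorem WI.of_bdd {n : ℕ} {ψ : Eu n → ℝ} (hm : AEStronglyMeasurable ψ) {M : ℝ} (h : ∀ x, |ψ x| ≤ M) : WI ψ := by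
  refine ⟨hm, (integrable_env_one.mul_const M).mono' ((continuous_env one_pos).aestronglyMeasurable.mul hm.norm) (ae_of_all _ fun x => ?_)⟩
  have := env_pos one_pos x
  rw [Real.norm_of_nonneg (by positivity)]
  gcongr; exact h x

theorem WI.add {n : ℕ} {ψ χ : Eu n → ℝ} (h : WI ψ) (h' : WI χ) : WI (fun x => ψ x + χ x) := by
  refine ⟨h.1.add h'.1, (h.2.add h'.2).mono' ((continuous_env one_pos).aestronglyMeasurable.mul (h.1.add h'.1).norm) (ae_of_all _ fun x => ?_)⟩
  have := env_pos one_pos x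
  rw [Real.norm_of_nonneg (by positivity)]
  simp only [Pi.add_apply, ← mul_add]
  gcongr; exact abs_add_le _ _

theorem WI.const_mul {n : ℕ} {ψ : Eu n → ℝ} (h : WI ψ) (c : ℝ) : WI (fun x => c * ψ x) := by
  refine ⟨h.1.const_mul c, (h.2.const_mul |c|).congr (ae_of_all _ fun x => ?_)⟩
  simp only [abs_mul]; ring

theorem WI.sub {n : ℕ} {ψ χ : Eu n → ℝ} (h : WI ψ) (h' : WI χ) : WI (fun x => ψ x - χ x) := by
  simpa [sub_eq_add_neg] using h.add (h'.const_mul (-1))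

theorem WI.U_add {n : ℕ} {ψ χ : Eu n → ℝ} (h : WI ψ) (h' : WI χ) (k : Option (Fin n)) (y : Eu n) {s : ℝ} (hs : 0 < s) :
    U k (fun x => ψ x + χ x) y s = U k ψ y s + U k χ y s := by
  unfold U
  rw [← integral_add (h.U_int k y hs) (h'.U_int k y hs)]
  congr 1; ext x; ring

theorem U_const_mul {n : ℕ} (ψ : Eu n → ℝ) (c : ℝ) (k : Option (Fin n)) (y : Eu n) (s : ℝ) :
    U k (fun x => c * ψ x) y s = c * U k ψ y s := by
  unfold U
  rw [← integral_const_mul]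
  congr 1; ext x; ring

theorem WI.U_sub' {n : ℕ} {ψ χ : Eu n → ℝ} (h : WI ψ) (h' : WI χ) (k : Option (Fin n)) (y : Eu n) {s : ℝ} (hs : 0 < s) :
    U k (fun x => ψ x - χ x) y s = U k ψ y s - U k χ y s := by
  unfold U
  rw [← integral_sub (h.U_int k y hs) (h'.U_int k y hs)]
  congr 1; ext x; ring

noncomputable def lipC (n : ℕ) : ℝ := (n + 2) * 4 ^ (n+1) * envC n

theorem lipC_pos (n : ℕ) : 0 < lipC n := by have := envC_pos n; unfold lipC; positivity

theorem Hk_lip {n : ℕ} (k : Option (Fin n)) {x x' : Eu n} {t : ℝ} (ht : 0 < t)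
    (h : ‖x - x'‖ ≤ t) (y : Eu n) :
    |Hk k (pt (x - y) t) - Hk k (pt (x' - y) t)| ≤ (n+2) * 4 ^ (n+1) * (‖x - x'‖ / t) * env t (x - y) := by
  have hN1 := half_le_norm_pt (x - y) ht.le
  have hN2 := half_le_norm_pt (x' - y) ht.le
  have hy : ‖x - y‖ ≤ ‖x - x'‖ + ‖x' - y‖ := by
    have := norm_add_le (x - x') (x' - y); simpa using this
  have h0 := norm_nonneg (x - y)
  have h0' := norm_nonneg (x' - y)
  have hb := abs_Hk_sub_le k (ξ := pt (x - y) t) (ζ := pt (x' - y) t) (m := (t + ‖x - y‖) / 4) (by positivity) (by linarith) (by linarith)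
  refine hb.trans (le_of_eq ?_)
  have : pt (x - y) t - pt (x' - y) t = pt (x - x') 0 := by
    rw [pt_sub]; congr 1 <;> abel
  have hn : ‖pt (x - x') 0‖ = ‖x - x'‖ := by
    have := norm_pt_sq (x - x') 0
    rw [← abs_of_nonneg (norm_nonneg (pt (x - x') 0)), ← abs_of_nonneg (norm_nonneg (x - x'))]
    rw [← sq_eq_sq_iff_abs_eq_abs]; linarith
  rw [this, hn]
  unfold env
  rw [div_pow]
  field_simp

theorem U_lip {n : ℕ} (k : Option (Fin n)) {ψ : Eu n → ℝ} (hm : AEStronglyMeasurable ψ) {M : ℝ}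
    (h : ∀ x, |ψ x| ≤ M) {x x' : Eu n} {t : ℝ} (ht : 0 < t) (hx : ‖x - x'‖ ≤ t) :
    |U k ψ x t - U k ψ x' t| ≤ lipC n * M * (‖x - x'‖ / t) := by
  have hM : 0 ≤ M := (abs_nonneg _).trans (h 0)
  have hW := WI.of_bdd hm h
  rw [hW.U_sub k x x' ht ht, ← Real.norm_eq_abs]
  refine (norm_integral_le_of_norm_le (g := fun y => ((n+2) * 4 ^ (n+1) * (‖x - x'‖ / t) * M) * env t (x - y)) ((integrable_env_sub ht x).const_mul _) (ae_of_all _ fun y => ?_)).trans ?_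
  · rw [norm_mul, Real.norm_eq_abs, Real.norm_eq_abs]
    have h1 := Hk_lip k ht hx y
    have h2 := h y
    have := env_pos ht (x - y)
    calc _ ≤ ((n+2) * 4 ^ (n+1) * (‖x - x'‖ / t) * env t (x - y)) * M := by gcongr
      _ = _ := by ring
  · rw [integral_const_mul, integral_env_sub ht]
    unfold lipC; apply le_of_eq; ring

theorem U_continuous {n : ℕ} (k : Option (Fin n)) {ψ : Eu n → ℝ} (hm : AEStronglyMeasurable ψ) {M : ℝ}
    (h : ∀ x, |ψ x| ≤ M) {t : ℝ} (ht : 0 < t) : Continuous (fun x => U k ψ x t) := by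
  rw [continuous_iff_continuousAt]
  intro x'
  rw [ContinuousAt, tendsto_iff_norm_sub_tendsto_zero]
  have h1 : Tendsto (fun x => lipC n * M * (‖x - x'‖ / t)) (nhds x') (nhds 0) := by
    have : Continuous (fun x => lipC n * M * (‖x - x'‖ / t)) := by fun_prop
    simpa using this.tendsto x'
  refine squeeze_zero' (Eventually.of_forall fun x => norm_nonneg _) ?_ h1
  filter_upwards [Metric.closedBall_mem_nhds x' ht] with x hx
  rw [Metric.mem_closedBall, dist_eq_norm] at hx
  exact U_lip k hm h ht hx

noncomputable def masC (n : ℕ) : ℝ := kap n * 8 ^ n + 4 ^ n * 4 ^ n + (n + 2) * 2 ^ (n+1) * envC n * 2 ^ n + 1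

theorem masC_pos (n : ℕ) : 0 < masC n := by
  have := envC_pos n; have := kap_pos n; unfold masC; positivity

theorem volume_real_ball_le {n : ℕ} (x : Eu n) {r : ℝ} (hr : 0 ≤ r) :
    volume.real (Metric.ball x r) ≤ (2 * r) ^ n := by
  rw [← volume_real_cube (WithLp.toLp 2 fun i => x i - r) (l := 2 * r) (by positivity)]
  exact measureReal_mono (ball_subset_cube x) (volume_cube_lt_top _ _).ne

theorem master {n : ℕ} (j : Fin n) {ψ : Eu n → ℝ} (hm : Measurable ψ) {M : ℝ} (hM : 0 < M)
    (h : ∀ x, |ψ x| ≤ M) (x0 : Eu n) {t s : ℝ} (ht : 0 < t) (hts : t ≤ s) :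
    ∫ x in Metric.ball x0 s, |U (some j) ψ x t - U (some j) ψ x0 s| ≤ masC n * M * s ^ n := by
  have hs : 0 < s := ht.trans_le hts
  have hκ := kap_pos n
  have hE := envC_pos n
  have hW := WI.of_bdd hm.aestronglyMeasurable h
  set B := Metric.ball x0 (4 * s) with hB
  have hBm : MeasurableSet B := measurableSet_ball
  have hBv : volume.real B ≤ (8 * s) ^ n := by
    have := volume_real_ball_le x0 (r := 4 * s) (by positivity)
    rwa [show 2 * (4 * s) = 8 * s by ring] at this
  have hBf : volume B ≠ ⊤ := measure_ball_lt_top.ne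
  set f : Eu n → ℝ := B.indicator ψ with hf
  have hfm : Measurable f := hm.indicator hBm
  have hfM : ∀ x, |f x| ≤ B.indicator (fun _ => M) x := fun x => by
    rw [hf]; by_cases hx : x ∈ B <;> simp [hx, h x]
  have hcI : ∀ c : ℝ, Integrable (B.indicator (fun _ => c)) := fun c =>
    (integrable_indicator_iff hBm).2 (integrableOn_const hBf)
  have hcV : ∀ c : ℝ, ∫ x, B.indicator (fun _ => c) x = volume.real B * c := fun c => by
    rw [integral_indicator hBm, setIntegral_const, smul_eq_mul]
  have hfi : Integrable f := (hcI M).mono' hfm.aestronglyMeasurable (ae_of_all _ hfM)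
  have hf2M : ∀ x, f x ^ 2 ≤ B.indicator (fun _ => M ^ 2) x := fun x => by
    rw [hf]; by_cases hx : x ∈ B
    · simp only [hx, indicator_of_mem]
      have := abs_le.1 (h x); nlinarith
    · simp [hx]
  have hf2 : Integrable (fun x => f x ^ 2) := (hcI (M^2)).mono' (hfm.pow_const 2).aestronglyMeasurable (ae_of_all _ fun x => by
    rw [Real.norm_of_nonneg (sq_nonneg _)]; exact hf2M x)
  have hf2I : ∫ x, f x ^ 2 ≤ (8 * s) ^ n * M ^ 2 := by
    refine (integral_mono hf2 (hcI _) hf2M).trans ?_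
    rw [hcV]; gcongr
  obtain ⟨hL1, hL2⟩ := l2_bound ht hfm hfi hf2 j
  set A : Eu n → ℝ := fun x => ∫ y, Hk (some j) (pt (x - y) t) * f y with hA
  set V := volume.real (Metric.ball x0 s) with hV
  have hVle : V ≤ (2 * s) ^ n := volume_real_ball_le x0 hs.le
  -- pointwise bound
  have hpt : ∀ x ∈ Metric.ball x0 s, |U (some j) ψ x t - U (some j) ψ x0 s| ≤
      (A x ^ 2 / (2 * (kap n * M)) + (kap n * M) / 2) + (8 ^ n * M + (n+2) * 2 ^ (n+1) * envC n * M) := by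
    intro x hx
    rw [Metric.mem_ball, dist_eq_norm] at hx
    have hA' : |A x| ≤ A x ^ 2 / (2 * (kap n * M)) + (kap n * M) / 2 := by
      have hl : 0 < kap n * M := by positivity
      rw [div_add_div _ _ (by positivity) (by positivity), le_div_iff₀ (by positivity)]
      nlinarith [sq_nonneg (|A x| - kap n * M), sq_abs (A x)]
    rw [hW.U_sub (some j) x x0 ht hs]
    have i1 := integrable_Hk_mul (some j) ht hfi x
    have i2 := integrable_Hk_mul (some j) hs hfi x0
    have i3 : Integrable (fun y => (Hk (some j) (pt (x - y) t) - Hk (some j) (pt (x0 - y) s)) * (ψ y - f y)) := by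
      have := intg_sub (hW.sub_int (some j) x x0 ht hs) (intg_sub i1 i2)
      refine this.congr (ae_of_all _ fun y => ?_)
      simp only; ring
    have hsplit : ∫ y, (Hk (some j) (pt (x - y) t) - Hk (some j) (pt (x0 - y) s)) * ψ y =
        A x - (∫ y, Hk (some j) (pt (x0 - y) s) * f y) +
          ∫ y, (Hk (some j) (pt (x - y) t) - Hk (some j) (pt (x0 - y) s)) * (ψ y - f y) := by
      rw [hA, ← integral_sub i1 i2, ← integral_add (intg_sub i1 i2) i3]
      congr 1; ext y; ring
    rw [hsplit]
    have hb2 : |∫ y, Hk (some j) (pt (x0 - y) s) * f y| ≤ 8 ^ n * M := by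
      rw [← Real.norm_eq_abs]
      refine (norm_integral_le_of_norm_le (g := B.indicator (fun _ => (s ^ n)⁻¹ * M)) (hcI _) (ae_of_all _ fun y => ?_)).trans ?_
      · rw [norm_mul, Real.norm_eq_abs, Real.norm_eq_abs]
        by_cases hy : y ∈ B
        · simp only [hf, hy, indicator_of_mem]
          have h1 := abs_Hk_le (some j) (pt (x0 - y) s)
          have hle : s ≤ ‖pt (x0 - y) s‖ := (le_abs_self s).trans (abs_le_norm_pt _ s)
          have h2 : (‖pt (x0 - y) s‖ ^ n)⁻¹ ≤ (s ^ n)⁻¹ := by gcongr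
          have h3 := h y
          have h4 := h1.trans h2
          gcongr
        · simp [hf, hy]
      · rw [hcV]
        calc _ ≤ (8 * s) ^ n * ((s ^ n)⁻¹ * M) := by gcongr
          _ = _ := by rw [mul_pow]; field_simp
    have hb3 : |∫ y, (Hk (some j) (pt (x - y) t) - Hk (some j) (pt (x0 - y) s)) * (ψ y - f y)| ≤ (n+2) * 2 ^ (n+1) * envC n * M := by
      rw [← Real.norm_eq_abs]
      refine (norm_integral_le_of_norm_le (g := fun y => ((n+2) * 2 ^ (n+1) * M) * env (2 * s) (x0 - y)) ((integrable_env_sub (by positivity) x0).const_mul _) (ae_of_all _ fun y => ?_)).trans ?_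
      · rw [norm_mul, Real.norm_eq_abs, Real.norm_eq_abs]
        have hep := env_pos (show 0 < 2 * s by positivity) (x0 - y)
        by_cases hy : y ∈ B
        · simp only [hf, hy, indicator_of_mem, sub_self, abs_zero, mul_zero]; positivity
        · have hy' : 4 * s ≤ ‖x0 - y‖ := by
            rw [hB, Metric.mem_ball, not_lt, dist_comm, dist_eq_norm] at hy; exact hy
          simp only [hf, hy, not_false_eq_true, indicator_of_notMem, sub_zero]
          have hxy : ‖x0 - y‖ ≤ ‖x - x0‖ + ‖x - y‖ := by
            have := norm_sub_le (x - y) (x - x0); rw [show x - y - (x - x0) = x0 - y by abel] at this; linarith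
          have hk := abs_Hk_pt_sub_le (some j) (x := x - y) (y := x0 - y) (t := t) (s := s) (d := 2 * s) (m := 1/2) (by positivity) (by norm_num) (z := x0 - y) (by
            rw [show x - y - (x0 - y) = x - x0 by abel, abs_sub_comm, abs_of_nonneg (by linarith : 0 ≤ s - t)]; linarith)
            (by have := norm_le_norm_pt (x - y) t; linarith) (by have := norm_le_norm_pt (x0 - y) s; linarith)
          have e : ((n:ℝ) + 2) / (1/2) ^ (n+1) = (n+2) * 2 ^ (n+1) := by
            rw [one_div, inv_pow, div_inv_eq_mul]
          rw [e] at hk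
          calc _ ≤ ((n+2) * 2 ^ (n+1) * env (2 * s) (x0 - y)) * M := by gcongr; exact h y
            _ = _ := by ring
      · rw [integral_const_mul, integral_env_sub (by positivity)]; apply le_of_eq; ring
    have t1 := abs_add_le (A x - (∫ y, Hk (some j) (pt (x0 - y) s) * f y)) (∫ y, (Hk (some j) (pt (x - y) t) - Hk (some j) (pt (x0 - y) s)) * (ψ y - f y))
    have t2 := abs_sub (A x) (∫ y, Hk (some j) (pt (x0 - y) s) * f y)
    linarith
  set D := kap n * M with hD
  have hD0 : 0 < D := by positivity
  have hintg : IntegrableOn (fun x => (A x ^ 2 / (2 * D) + D / 2) + (8 ^ n * M + (n+2) * 2 ^ (n+1) * envC n * M)) (Metric.ball x0 s) := by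
    refine intg_add (intg_add (hL1.integrableOn.div_const _) ?_) ?_ <;> exact integrableOn_const measure_ball_lt_top.ne
  have hUc := U_continuous (some j) hm.aestronglyMeasurable h ht
  have hLI : IntegrableOn (fun x => |U (some j) ψ x t - U (some j) ψ x0 s|) (Metric.ball x0 s) :=
    ((by fun_prop : Continuous fun x => |U (some j) ψ x t - U (some j) ψ x0 s|).locallyIntegrable.integrableOn_isCompact
      (isCompact_closedBall x0 s)).mono_set Metric.ball_subset_closedBall
  refine (setIntegral_mono_on hLI hintg measurableSet_ball hpt).trans ?_
  have hA2 : ∫ x in Metric.ball x0 s, A x ^ 2 ≤ kap n ^ 2 * ((8 * s) ^ n * M ^ 2) := by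
    refine (setIntegral_le_integral hL1 (ae_of_all _ fun x => sq_nonneg _)).trans (hL2.trans ?_)
    gcongr
  rw [integral_add (intg_add (hL1.integrableOn.div_const _) (integrableOn_const measure_ball_lt_top.ne)) (integrableOn_const measure_ball_lt_top.ne),
    integral_add (hL1.integrableOn.div_const _) (integrableOn_const measure_ball_lt_top.ne), integral_div,
    setIntegral_const, setIntegral_const, smul_eq_mul, smul_eq_mul, ← hV]
  have e1 : (∫ x in Metric.ball x0 s, A x ^ 2) / (2 * D) ≤ kap n * M * 8 ^ n * s ^ n / 2 := by
    rw [div_le_iff₀ (by positivity)]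
    refine hA2.trans (le_of_eq ?_)
    rw [hD, mul_pow]; ring
  have hV2 : V ≤ 2 ^ n * s ^ n := by rw [← mul_pow]; exact hVle
  have hV8 : V ≤ 8 ^ n * s ^ n := by
    refine hVle.trans ?_; rw [← mul_pow]; gcongr; linarith
  have e2 : V * (D / 2) ≤ (8 ^ n * s ^ n) * (D / 2) := by gcongr
  have e3 : V * (8 ^ n * M + (n+2) * 2 ^ (n+1) * envC n * M) ≤ (2 ^ n * s ^ n) * (8 ^ n * M + (n+2) * 2 ^ (n+1) * envC n * M) := by
    have : (0:ℝ) ≤ 8 ^ n * M + (n+2) * 2 ^ (n+1) * envC n * M := by positivity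
    gcongr
  have e4 : (2:ℝ) ^ n * 8 ^ n = 4 ^ n * 4 ^ n := by rw [← mul_pow, ← mul_pow]; norm_num
  have e5 : (0:ℝ) ≤ M * s ^ n := by positivity
  unfold masC
  rw [hD] at e2
  have : (2:ℝ) ^ n * s ^ n * (8 ^ n * M + (n+2) * 2 ^ (n+1) * envC n * M) = 4 ^ n * 4 ^ n * (M * s ^ n) + (n+2) * 2 ^ (n+1) * envC n * 2 ^ n * (M * s ^ n) := by
    rw [← e4]; ring
  nlinarith

set_option linter.unusedVariables false

theorem fatou {α : Type*} [MeasurableSpace α] {μ : Measure α} {f : ℕ → α → ℝ} {g : α → ℝ}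
    (hf : ∀ i, Integrable (f i) μ) (hlim : ∀ᵐ x ∂μ, Tendsto (fun i => f i x) atTop (nhds (g x)))
    {B : ℝ} (hB : ∀ᶠ i in atTop, ∫ x, |f i x| ∂μ ≤ B) : Integrable g μ ∧ ∫ x, |g x| ∂μ ≤ B := by
  have hgm : AEStronglyMeasurable g μ := aestronglyMeasurable_of_tendsto_ae atTop (fun i => (hf i).1) hlim
  have hB0 : 0 ≤ B := by
    obtain ⟨i, hi⟩ := hB.exists
    exact (integral_nonneg fun x => abs_nonneg _).trans hi
  have h1 : ∫⁻ x, ‖g x‖ₑ ∂μ ≤ ENNReal.ofReal B := by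
    calc ∫⁻ x, ‖g x‖ₑ ∂μ = ∫⁻ x, liminf (fun i => ‖f i x‖ₑ) atTop ∂μ := by
          refine lintegral_congr_ae ?_
          filter_upwards [hlim] with x hx
          exact ((continuous_enorm.tendsto _).comp hx).liminf_eq.symm
      _ ≤ liminf (fun i => ∫⁻ x, ‖f i x‖ₑ ∂μ) atTop := lintegral_liminf_le' fun i => (hf i).1.enorm
      _ ≤ ENNReal.ofReal B := by
          refine liminf_le_of_frequently_le' (Eventually.frequently ?_)
          filter_upwards [hB] with i hi
          rw [← ofReal_integral_norm_eq_lintegral_enorm (hf i)]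
          exact ENNReal.ofReal_le_ofReal hi
  have hgi : Integrable g μ := ⟨hgm, h1.trans_lt ENNReal.ofReal_lt_top⟩
  refine ⟨hgi, ?_⟩
  rw [← ofReal_integral_norm_eq_lintegral_enorm hgi] at h1
  exact (ENNReal.ofReal_le_ofReal_iff hB0).1 h1

/-- the version used: a continuous parameter tending to `0+`. -/
theorem fatou_set {n : ℕ} {S : Set (Eu n)} {f : ℝ → Eu n → ℝ} {g : Eu n → ℝ} {a : ℝ}
    (hS : MeasurableSet S) (hSf : volume S ≠ ⊤)
    (hf : ∀ t, 0 < t → IntegrableOn (f t) S)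
    (hlim : ∀ᵐ x, Tendsto (fun t => f t x) (nhdsWithin 0 (Ioi 0)) (nhds (g x)))
    {B s : ℝ} (hs : 0 < s) (hB : ∀ t, 0 < t → t ≤ s → ∫ x in S, |f t x - a| ≤ B) :
    IntegrableOn g S ∧ ∫ x in S, |g x - a| ≤ B := by
  have hseq : Tendsto (fun i : ℕ => 1 / ((i:ℝ) + 1)) atTop (nhdsWithin 0 (Ioi 0)) := by
    rw [tendsto_nhdsWithin_iff]
    exact ⟨tendsto_one_div_add_atTop_nhds_zero_nat, Eventually.of_forall fun i => by
      simp only [mem_Ioi]; positivity⟩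
  have hc : IntegrableOn (fun _ : Eu n => a) S := integrableOn_const hSf
  have := fatou (μ := volume.restrict S) (f := fun i x => f (1 / ((i:ℝ) + 1)) x - a) (g := fun x => g x - a) (B := B)
    (fun i => intg_sub (hf _ (by positivity)) hc) (ae_restrict_of_ae (by
      filter_upwards [hlim] with x hx
      exact (hx.comp hseq).sub_const a)) (by
      have := (tendsto_one_div_add_atTop_nhds_zero_nat (𝕜 := ℝ)).eventually (gt_mem_nhds hs)
      filter_upwards [this] with i hi
      exact hB _ (by positivity) hi.le)
  refine ⟨?_, this.2⟩
  have h2 := intg_add this.1 hc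
  simp only [sub_add_cancel] at h2
  exact h2

noncomputable def cubC (n : ℕ) : ℝ := masC n * (√n + 1) ^ n

theorem cubC_pos (n : ℕ) : 0 < cubC n := by have := masC_pos n; unfold cubC; positivity

theorem cube_subset_ball {n : ℕ} (c : Eu n) {l : ℝ} (hl : 0 < l) : cube c l ⊆ Metric.ball c (l * (√n + 1)) :=
  (cube_subset_closedBall c hl.le).trans (Metric.closedBall_subset_ball (by nlinarith))

theorem U_integrableOn {n : ℕ} (k : Option (Fin n)) {ψ : Eu n → ℝ} (hm : Measurable ψ) {M : ℝ}
    (h : ∀ x, |ψ x| ≤ M) {t : ℝ} (ht : 0 < t) (x0 : Eu n) (s : ℝ) :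
    IntegrableOn (fun x => U k ψ x t) (Metric.ball x0 s) :=
  ((U_continuous k hm.aestronglyMeasurable h ht).locallyIntegrable.integrableOn_isCompact
      (isCompact_closedBall x0 s)).mono_set Metric.ball_subset_closedBall

theorem U_cube {n : ℕ} (j : Fin n) {ψ : Eu n → ℝ} (hm : Measurable ψ) {M : ℝ} (hM : 0 < M)
    (h : ∀ x, |ψ x| ≤ M) (c : Eu n) {t l : ℝ} (hl : 0 < l) (ht : 0 < t) (hts : t ≤ l * (√n + 1)) :
    ∫ x in cube c l, |U (some j) ψ x t - U (some j) ψ c (l * (√n + 1))| ≤ cubC n * M * l ^ n := by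
  have := master j hm hM h c ht hts
  have hI : IntegrableOn (fun x => |U (some j) ψ x t - U (some j) ψ c (l * (√n + 1))|) (Metric.ball c (l * (√n + 1))) :=
    (intg_sub (U_integrableOn (some j) hm h ht c _) (integrableOn_const measure_ball_lt_top.ne)).abs
  refine (setIntegral_mono_set hI (ae_of_all _ fun x => abs_nonneg _) (cube_subset_ball c hl).eventuallyLE).trans (this.trans (le_of_eq ?_))
  unfold cubC; rw [mul_pow]; ring

/-! ### Lipschitz functions -/

theorem Hk_dyadic {n : ℕ} (k : Option (Fin n)) {t s : ℝ} (hs : 0 < s) (hts : t ≤ s) (h2 : s / 2 ≤ t) (z : Eu n) :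
    |Hk k (pt z t) - Hk k (pt z s)| ≤ (n+2) * 4 ^ (n+1) * env s z := by
  have hN1 := half_le_norm_pt z (by linarith : 0 ≤ t)
  have hN2 := half_le_norm_pt z hs.le
  have h0 := norm_nonneg z
  have := abs_Hk_pt_sub_le k (x := z) (y := z) (t := t) (s := s) (d := s) (m := 1/4) hs (by norm_num) (z := z)
    (by rw [sub_self, norm_zero, abs_sub_comm, abs_of_nonneg (by linarith)]; linarith) (by linarith) (by linarith)
  rwa [one_div, inv_pow, div_inv_eq_mul] at this

theorem integrable_env_sqrt {n : ℕ} : Integrable (fun z : Eu n => env 1 z * √‖z‖) := by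
  have h := integrable_one_add_norm (E := Eu n) (μ := volume) (r := (n : ℝ) + 1/2) (by simp)
  refine h.mono' ((continuous_env one_pos).mul (continuous_norm.sqrt)).aestronglyMeasurable (ae_of_all _ fun z => ?_)
  have h0 := norm_nonneg z
  rw [Real.norm_of_nonneg (mul_nonneg (env_pos one_pos z).le (Real.sqrt_nonneg _))]
  unfold env
  rw [show -((n:ℝ) + 1/2) = (1/2 : ℝ) - ((n + 1 : ℕ):ℝ) by push_cast; ring, Real.rpow_sub (by positivity), Real.rpow_natCast,
    ← Real.sqrt_eq_rpow, div_mul_eq_mul_div, one_mul]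
  gcongr; linarith

noncomputable def sqC (n : ℕ) : ℝ := ∫ z : Eu n, env 1 z * √‖z‖

theorem sqC_nonneg (n : ℕ) : 0 ≤ sqC n := integral_nonneg fun z => mul_nonneg (env_pos one_pos z).le (Real.sqrt_nonneg _)

theorem env_sqrt_scale {n : ℕ} {s : ℝ} (hs : 0 < s) (z : Eu n) :
    env s z * √‖z‖ = √s * (s⁻¹ ^ n * (env 1 (s⁻¹ • z) * √‖s⁻¹ • z‖)) := by
  rw [env_scale hs, norm_smul, Real.norm_of_nonneg (by positivity : 0 ≤ s⁻¹), Real.sqrt_mul (by positivity), Real.sqrt_inv]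
  have : √s ≠ 0 := (Real.sqrt_pos.2 hs).ne'
  field_simp

theorem integral_env_sqrt {n : ℕ} {s : ℝ} (hs : 0 < s) : 
    Integrable (fun z : Eu n => env s z * √‖z‖) ∧ ∫ z : Eu n, env s z * √‖z‖ = √s * sqC n := by
  constructor
  · simp_rw [env_sqrt_scale hs]
    exact ((integrable_env_sqrt.comp_smul (inv_ne_zero hs.ne')).const_mul _).const_mul _
  · simp_rw [env_sqrt_scale hs]
    rw [integral_const_mul, integral_scale (fun z : Eu n => env 1 z * √‖z‖) hs]; rfl

theorem Hk_swap_const {n : ℕ} (j : Fin n) {t s : ℝ} (ht : 0 < t) (hs : 0 < s) (x : Eu n) :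
    ∫ y : Eu n, (Hk (some j) (pt (x - y) t) - Hk (some j) (pt (x - y) s)) = 0 := by
  rw [integral_sub_left_eq_self (fun z => Hk (some j) (pt z t) - Hk (some j) (pt z s)) volume x]
  have hodd : ∀ (z : Eu n) (t : ℝ), Hk (some j) (pt (-z) t) = - Hk (some j) (pt z t) := by
    intro z t
    have e : ‖pt (-z) t‖ = ‖pt z t‖ := by
      rw [← abs_of_nonneg (norm_nonneg (pt (-z) t)), ← abs_of_nonneg (norm_nonneg (pt z t)), ← sq_eq_sq_iff_abs_eq_abs,
        norm_pt_sq, norm_pt_sq, norm_neg]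
    unfold Hk
    rw [e, pt_some, pt_some]; simp [neg_div]
  have := integral_neg_eq_self (fun z : Eu n => Hk (some j) (pt z t) - Hk (some j) (pt z s)) volume
  simp only [hodd] at this
  have e2 : ∫ z : Eu n, (- Hk (some j) (pt z t) - - Hk (some j) (pt z s)) = - ∫ z : Eu n, (Hk (some j) (pt z t) - Hk (some j) (pt z s)) := by
    rw [← integral_neg]; congr 1; ext z; ring
  rw [e2] at this
  linarith

noncomputable def lpC (n : ℕ) : ℝ := (n+2) * 4 ^ (n+1) * sqC n

theorem U_lip_step {n : ℕ} (j : Fin n) {ψ : Eu n → ℝ} {M L : ℝ} (hψ : Continuous ψ)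
    (h : ∀ x, |ψ x| ≤ M) (hL : ∀ x y, |ψ x - ψ y| ≤ L * ‖x - y‖) {t s : ℝ} (hs : 0 < s) (hts : t ≤ s) (h2 : s / 2 ≤ t)
    (x : Eu n) : |U (some j) ψ x t - U (some j) ψ x s| ≤ lpC n * √(2 * M * L) * √s := by
  have ht : 0 < t := by linarith
  have hM : 0 ≤ M := (abs_nonneg _).trans (h 0)
  have hW := WI.of_bdd hψ.aestronglyMeasurable h
  have hWc : WI (fun _ : Eu n => ψ x) := WI.of_bdd (M := |ψ x|) aestronglyMeasurable_const (fun _ => le_rfl)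
  rw [hW.U_sub (some j) x x ht hs]
  have e : ∫ y, (Hk (some j) (pt (x - y) t) - Hk (some j) (pt (x - y) s)) * ψ y =
      ∫ y, (Hk (some j) (pt (x - y) t) - Hk (some j) (pt (x - y) s)) * (ψ y - ψ x) := by
    have : ∫ y, (Hk (some j) (pt (x - y) t) - Hk (some j) (pt (x - y) s)) * ψ x = 0 := by
      rw [integral_mul_const, Hk_swap_const j ht hs, zero_mul]
    rw [← sub_zero (∫ y, (Hk (some j) (pt (x - y) t) - Hk (some j) (pt (x - y) s)) * ψ y), ← this,
      ← integral_sub (hW.sub_int (some j) x x ht hs) (hWc.sub_int (some j) x x ht hs)]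
    congr 1; ext y; ring
  rw [e, ← Real.norm_eq_abs]
  have hI := integral_env_sqrt (n := n) hs
  refine (norm_integral_le_of_norm_le (g := fun y => ((n+2) * 4 ^ (n+1) * √(2 * M * L)) * (env s (x - y) * √‖x - y‖))
    ((hI.1.comp_sub_left x).const_mul _) (ae_of_all _ fun y => ?_)).trans ?_
  · rw [norm_mul, Real.norm_eq_abs, Real.norm_eq_abs]
    have h1 := Hk_dyadic (some j) hs hts h2 (x - y)
    have h3 : |ψ y - ψ x| ≤ √(2 * M * L) * √‖x - y‖ := by
      rw [← Real.sqrt_mul' _ (norm_nonneg _)]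
      apply Real.le_sqrt_of_sq_le
      have a1 : |ψ y - ψ x| ≤ 2 * M := (abs_sub _ _).trans (by linarith [h x, h y])
      have a2 := hL y x
      rw [norm_sub_rev] at a2
      have := mul_le_mul a1 a2 (abs_nonneg _) (by positivity)
      nlinarith
    have := env_pos hs (x - y)
    calc _ ≤ ((n+2) * 4 ^ (n+1) * env s (x - y)) * (√(2 * M * L) * √‖x - y‖) := by gcongr
      _ = _ := by ring
  · rw [integral_const_mul, integral_sub_left_eq_self (fun z => env s z * √‖z‖) volume x, hI.2]
    unfold lpC; apply le_of_eq; ring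

theorem U_lip_all {n : ℕ} (j : Fin n) {ψ : Eu n → ℝ} {M L : ℝ} (hψ : Continuous ψ)
    (h : ∀ x, |ψ x| ≤ M) (hL : ∀ x y, |ψ x - ψ y| ≤ L * ‖x - y‖) {t s : ℝ} (ht : 0 < t) (hts : t ≤ s) 
    (x : Eu n) : |U (some j) ψ x t - U (some j) ψ x s| ≤ 4 * (lpC n * √(2 * M * L)) * √s := by
  have hC : 0 ≤ lpC n * √(2 * M * L) := by have := sqC_nonneg n; unfold lpC; positivity
  set C := lpC n * √(2 * M * L) with hCd
  have key : ∀ k : ℕ, ∀ s, 0 < s → t ≤ s → s / 2 ^ k ≤ t → |U (some j) ψ x t - U (some j) ψ x s| ≤ 4 * C * √s := by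
    intro k
    induction k with
    | zero => 
      intro s hs h1 h2
      have : t = s := by simp at h2; linarith
      rw [this]; simp; positivity
    | succ k ih =>
      intro s hs h1 h2
      have hsq := Real.sqrt_nonneg s
      by_cases h3 : s / 2 ≤ t
      · have := U_lip_step j hψ h hL hs h1 h3 x
        rw [← hCd] at this
        nlinarith [mul_nonneg hC hsq]
      · have a1 := ih (s / 2) (by positivity) (by linarith) (by rw [div_div, ← pow_succ']; exact h2)
        have a2 := U_lip_step j hψ h hL hs (t := s / 2) (by linarith) le_rfl x
        rw [← hCd] at a2
        have a3 := abs_sub_le (U (some j) ψ x t) (U (some j) ψ x (s/2)) (U (some j) ψ x s)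
        have a4 : √(s / 2) ≤ 3/4 * √s := by
          rw [Real.sqrt_le_left (by positivity), mul_pow, Real.sq_sqrt hs.le]; linarith
        have := mul_le_mul_of_nonneg_left a4 hC
        linarith
  obtain ⟨k, hk⟩ := pow_unbounded_of_one_lt (s / t) (show (1:ℝ) < 2 by norm_num)
  refine key k s (ht.trans_le hts) hts ?_
  rw [div_lt_iff₀ ht] at hk
  rw [div_le_iff₀ (by positivity)]; linarith

/-- existence of the limit for bounded Lipschitz functions. -/
theorem U_lip_tendsto {n : ℕ} (j : Fin n) {ψ : Eu n → ℝ} {M L : ℝ} (hψ : Continuous ψ)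
    (h : ∀ x, |ψ x| ≤ M) (hL : ∀ x y, |ψ x - ψ y| ≤ L * ‖x - y‖) :
    ∃ g : Eu n → ℝ, (∀ x, Tendsto (fun t => U (some j) ψ x t) (nhdsWithin 0 (Ioi 0)) (nhds (g x))) := by
  have : ∀ x, ∃ a, Tendsto (fun t => U (some j) ψ x t) (nhdsWithin 0 (Ioi 0)) (nhds a) := by
    intro x
    rw [← cauchy_map_iff_exists_tendsto, Metric.cauchy_iff]
    refine ⟨inferInstance, fun ε hε => ?_⟩
    have hlim : Tendsto (fun s => 4 * (lpC n * √(2 * M * L)) * √s) (nhds 0) (nhds 0) := by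
      have : Continuous (fun s => 4 * (lpC n * √(2 * M * L)) * √s) := by fun_prop
      simpa using this.tendsto 0
    obtain ⟨s, hs1, hs2⟩ := ((hlim.mono_left (nhdsWithin_le_nhds (s := Ioi 0))).eventually (gt_mem_nhds (half_pos hε)) |>.and self_mem_nhdsWithin).exists
    have hs2 : 0 < s := hs2
    refine ⟨Set.image (fun t => U (some j) ψ x t) (Ioc 0 s), image_mem_map (Ioc_mem_nhdsGT hs2), ?_⟩
    rintro _ ⟨t, ht, rfl⟩ _ ⟨t', ht', rfl⟩
    have a1 := U_lip_all j hψ h hL ht.1 ht.2 x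
    have a2 := U_lip_all j hψ h hL ht'.1 ht'.2 x
    rw [Real.dist_eq]
    have a3 := abs_sub_le (U (some j) ψ x t) (U (some j) ψ x s) (U (some j) ψ x t')
    rw [abs_sub_comm (U (some j) ψ x s)] at a3
    linarith
  choose g hg using this
  exact ⟨g, hg⟩

/-- Lipschitz approximation by inf-convolution -/
theorem lip_approx {n : ℕ} {ψ : Eu n → ℝ} (hu : UniformContinuous ψ) {M : ℝ} (h : ∀ x, |ψ x| ≤ M) {ε : ℝ} (hε : 0 < ε) :
    ∃ χ : Eu n → ℝ, ∃ L : ℝ, Continuous χ ∧ (∀ x, |χ x| ≤ M) ∧ (∀ x y, |χ x - χ y| ≤ L * ‖x - y‖) ∧ ∀ x, |ψ x - χ x| ≤ ε := by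
  have hM : 0 ≤ M := (abs_nonneg _).trans (h 0)
  obtain ⟨δ, hδ, hd⟩ := Metric.uniformContinuous_iff.1 hu ε hε
  set L := 2 * M / δ with hLd
  have hL : 0 ≤ L := by positivity
  have hbd : ∀ x, BddBelow (range fun y => ψ y + L * ‖x - y‖) := fun x => ⟨-M, by
    rintro _ ⟨y, rfl⟩
    have := abs_le.1 (h y)
    have : 0 ≤ L * ‖x - y‖ := by positivity
    simp only; linarith⟩
  set χ : Eu n → ℝ := fun x => ⨅ y, (ψ y + L * ‖x - y‖) with hχ
  have hle : ∀ x y, χ x ≤ ψ y + L * ‖x - y‖ := fun x y => ciInf_le (hbd x) y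
  have hup : ∀ x, χ x ≤ ψ x := fun x => by simpa using hle x x
  have hlip1 : ∀ x y, χ x - χ y ≤ L * ‖x - y‖ := by
    intro x y
    rw [sub_le_comm]
    refine le_ciInf fun z => ?_
    have h1 := hle x z
    have h2 : ‖x - z‖ ≤ ‖x - y‖ + ‖y - z‖ := by
      have := norm_add_le (x - y) (y - z); simpa using this
    have := mul_le_mul_of_nonneg_left h2 hL
    linarith
  have hlip : ∀ x y, |χ x - χ y| ≤ L * ‖x - y‖ := fun x y => by
    rw [abs_le]
    have := hlip1 y x; rw [norm_sub_rev] at this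
    exact ⟨by linarith, hlip1 x y⟩
  have hlow : ∀ x, -M ≤ χ x := fun x => le_ciInf fun y => by
    have := abs_le.1 (h y)
    have : 0 ≤ L * ‖x - y‖ := by positivity
    linarith
  refine ⟨χ, L, ?_, ?_, hlip, ?_⟩
  · have : LipschitzWith (Real.toNNReal L) χ := LipschitzWith.of_dist_le_mul fun x y => by
      rw [Real.dist_eq, dist_eq_norm, Real.coe_toNNReal _ hL]; exact hlip x y
    exact this.continuous
  · intro x; rw [abs_le]; exact ⟨hlow x, (hup x).trans (abs_le.1 (h x)).2⟩
  · intro x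
    rw [abs_of_nonneg (by linarith [hup x])]
    rw [sub_le_comm]
    refine le_ciInf fun y => ?_
    have hxy : 0 ≤ L * ‖x - y‖ := by positivity
    by_cases hc : dist y x < δ
    · have := hd hc
      rw [Real.dist_eq] at this
      have := (abs_lt.1 this).1
      linarith
    · rw [not_lt, dist_comm, dist_eq_norm] at hc
      have h1 : 2 * M ≤ L * ‖x - y‖ := by
        calc 2 * M = L * δ := by rw [hLd]; field_simp
          _ ≤ _ := by gcongr
      have := abs_le.1 (h x)
      have := abs_le.1 (h y)
      linarith

set_option linter.unusedVariables false

/-- BMO bound of the limit -/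
theorem U_lim_cube {n : ℕ} (j : Fin n) {ψ g : Eu n → ℝ} (hm : Measurable ψ) {M : ℝ} (hM : 0 < M)
    (h : ∀ x, |ψ x| ≤ M) (hg : ∀ᵐ x, Tendsto (fun t => U (some j) ψ x t) (nhdsWithin 0 (Ioi 0)) (nhds (g x))) :
    LocallyIntegrable g ∧ ∀ c l, 0 < l → ∃ a, ∫ x in cube c l, |g x - a| ≤ cubC n * M * l ^ n := by
  constructor
  · intro x
    refine ⟨Metric.ball x 1, Metric.ball_mem_nhds x one_pos, ?_⟩
    exact (fatou_set measurableSet_ball measure_ball_lt_top.ne (f := fun t x => U (some j) ψ x t) (fun t ht => U_integrableOn (some j) hm h ht x 1)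
      hg (s := 1) (a := U (some j) ψ x 1) one_pos (fun t ht hts => master j hm hM h x ht hts)).1
  · intro c l hl
    refine ⟨U (some j) ψ c (l * (√n + 1)), ?_⟩
    refine (fatou_set (measurableSet_cube c l) (volume_cube_lt_top c l).ne (f := fun t x => U (some j) ψ x t) (fun t ht => ?_) hg (s := l * (√n + 1)) (by positivity) (fun t ht hts => U_cube j hm hM h c hl ht hts)).2
    exact (U_integrableOn (some j) hm h ht c _).mono_set (cube_subset_ball c hl)

theorem U_lim_BMOB {n : ℕ} (j : Fin n) {ψ g : Eu n → ℝ} (hm : Measurable ψ) {M : ℝ} (hM : 0 < M)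
    (h : ∀ x, |ψ x| ≤ M) (hg : ∀ᵐ x, Tendsto (fun t => U (some j) ψ x t) (nhdsWithin 0 (Ioi 0)) (nhds (g x))) :
    BMOB g (2 * (cubC n * M)) := by
  obtain ⟨h1, h2⟩ := U_lim_cube j hm hM h hg
  exact BMOB.of_forall h1 h2

/-- the limit for a bounded uniformly continuous function has vanishing oscillation -/
theorem U_lim_vmo {n : ℕ} (j : Fin n) {ψ g : Eu n → ℝ} (hu : UniformContinuous ψ) {M : ℝ}
    (h : ∀ x, |ψ x| ≤ M) (hg : ∀ᵐ x, Tendsto (fun t => U (some j) ψ x t) (nhdsWithin 0 (Ioi 0)) (nhds (g x)))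
    {ε : ℝ} (hε : 0 < ε) : ∃ δ > 0, ∀ c l, 0 < l → l ≤ δ → ∃ a, ∫ x in cube c l, |g x - a| ≤ ε * l ^ n := by
  have hC := cubC_pos n
  set e := ε / (2 * cubC n) with he
  have he0 : 0 < e := by positivity
  obtain ⟨χ, L, hχc, hχM, hχL, hχe⟩ := lip_approx hu h he0
  have hM : 0 ≤ M := (abs_nonneg _).trans (h 0)
  have hlim : Tendsto (fun s => 4 * (lpC n * √(2 * M * L)) * √s) (nhds 0) (nhds 0) := by
    have : Continuous (fun s => 4 * (lpC n * √(2 * M * L)) * √s) := by fun_prop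
    simpa using this.tendsto 0
  obtain ⟨s, hs1, hs2⟩ := ((hlim.mono_left (nhdsWithin_le_nhds (s := Ioi 0))).eventually (gt_mem_nhds (show 0 < ε/4 by positivity)) |>.and self_mem_nhdsWithin).exists
  have hs2 : 0 < s := hs2
  have hLp := lipC_pos n
  set D := lipC n * (M + 1) with hD
  have hD0 : 0 < D := by positivity
  refine ⟨min (s / (√n + 1)) (s * (ε / 4) / (D * (√n + 1))), by positivity, fun c l hl hlδ => ?_⟩
  set σ := l * (√n + 1) with hσ
  have hσ0 : 0 < σ := by positivity
  have hl1 : σ ≤ s := by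
    have := hlδ.trans (min_le_left _ _)
    rwa [le_div_iff₀ (by positivity)] at this
  have hl2 : D * (σ / s) ≤ ε / 4 := by
    have := hlδ.trans (min_le_right _ _)
    rw [le_div_iff₀ (by positivity)] at this
    rw [← mul_div_assoc, div_le_iff₀ hs2, hσ]
    linarith
  set r : Eu n → ℝ := fun x => ψ x - χ x with hr
  have hrm : Measurable r := hu.continuous.measurable.sub hχc.measurable
  have hWr : WI r := WI.of_bdd hrm.aestronglyMeasurable hχe
  have hWχ : WI χ := WI.of_bdd hχc.aestronglyMeasurable hχM
  have hU : ∀ x t, 0 < t → U (some j) ψ x t = U (some j) r x t + U (some j) χ x t := fun x t ht => by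
    rw [← hWr.U_add hWχ _ _ ht]; congr 1; ext y; rw [hr]; ring
  refine ⟨U (some j) r c σ + U (some j) χ c s, ?_⟩
  have hball := cube_subset_ball c hl
  have hIr : ∀ t, 0 < t → IntegrableOn (fun x => U (some j) r x t) (cube c l) := fun t ht => (U_integrableOn (some j) hrm hχe ht c _).mono_set hball
  have hcI : ∀ a : ℝ, IntegrableOn (fun _ : Eu n => a) (cube c l) := fun a => integrableOn_const (volume_cube_lt_top c l).ne
  refine (fatou_set (measurableSet_cube c l) (volume_cube_lt_top c l).ne (f := fun t x => U (some j) ψ x t) (fun t ht => ?_) hg (s := σ) (by positivity) (fun t ht hts => ?_)).2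
  · exact (U_integrableOn (some j) hu.continuous.measurable h ht c _).mono_set hball
  · calc ∫ x in cube c l, |U (some j) ψ x t - (U (some j) r c σ + U (some j) χ c s)|
        ≤ ∫ x in cube c l, (|U (some j) r x t - U (some j) r c σ| + ε / 2) := by
          refine setIntegral_mono_on ?_ ?_ (measurableSet_cube c l) fun x hx => ?_
          · exact (intg_sub ((U_integrableOn (some j) hu.continuous.measurable h ht c _).mono_set hball) (hcI _)).abs
          · exact intg_add (intg_sub (hIr t ht) (hcI _)).abs (hcI _)
          · rw [hU x t ht]
            have hx' := hball hx
            rw [Metric.mem_ball, dist_eq_norm] at hx'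
            have a1 := U_lip_all j hχc hχM hχL ht (hts.trans hl1) x
            have a2 := U_lip (some j) hχc.aestronglyMeasurable hχM hs2 (hx'.le.trans hl1)
            have a3 : lipC n * M * (‖x - c‖ / s) ≤ ε / 4 := by
              refine le_trans ?_ hl2
              rw [hD]
              gcongr
              · linarith
            have a4 := abs_sub_le (U (some j) χ x t) (U (some j) χ x s) (U (some j) χ c s)
            have a5 := abs_add_le (U (some j) r x t - U (some j) r c σ) (U (some j) χ x t - U (some j) χ c s)
            rw [show U (some j) r x t + U (some j) χ x t - (U (some j) r c σ + U (some j) χ c s) = (U (some j) r x t - U (some j) r c σ) + (U (some j) χ x t - U (some j) χ c s) by ring]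
            linarith
      _ ≤ cubC n * e * l ^ n + ε / 2 * l ^ n := by
          rw [integral_add (intg_sub (hIr t ht) (hcI _)).abs (hcI _), setIntegral_cube_const _ c hl]
          have := U_cube j hrm he0 hχe c hl ht hts
          linarith
      _ = ε * l ^ n := by rw [he]; field_simp; ring

/-! ### a.e. convergence for bounded uniformly continuous functions -/

theorem U_abs_le {n : ℕ} (k : Option (Fin n)) (y : Eu n) {s : ℝ} (hs : 0 < s) :
    ∃ C, 0 ≤ C ∧ ∀ (ψ : Eu n → ℝ) (M : ℝ), (∀ x, |ψ x| ≤ M) → |U k ψ y s| ≤ C * M := by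
  obtain ⟨hm, C, hC⟩ := EnvB.Hk_sub k y 0 hs one_pos
  have hC0 : 0 ≤ C := by
    have := (abs_nonneg _).trans (hC 0)
    exact nonneg_of_mul_nonneg_left this (env_pos one_pos _)
  refine ⟨C * envC n, mul_nonneg hC0 (envC_pos n).le, fun ψ M h => ?_⟩
  unfold U
  rw [← Real.norm_eq_abs]
  refine (norm_integral_le_of_norm_le (g := fun x => (C * M) * env 1 x) (integrable_env_one.const_mul _) (ae_of_all _ fun x => ?_)).trans ?_
  · rw [norm_mul, Real.norm_eq_abs, Real.norm_eq_abs]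
    have h1 := hC x
    simp only [zero_sub] at h1
    have := env_pos one_pos x
    calc _ ≤ (C * env 1 x) * M := by gcongr; exact h x
      _ = _ := by ring
  · rw [integral_const_mul]; unfold envC; apply le_of_eq; ring

theorem ae_of_balls {n : ℕ} {p : Eu n → Prop} (h : ∀ N : ℕ, ∀ᵐ x ∂(volume.restrict (Metric.ball 0 ((N:ℝ) + 1))), p x) : ∀ᵐ x, p x := by
  have := ae_restrict_iUnion_iff (μ := volume) (fun N : ℕ => Metric.ball (0 : Eu n) ((N:ℝ) + 1)) p
  have hU : (⋃ N : ℕ, Metric.ball (0 : Eu n) ((N:ℝ) + 1)) = univ := by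
    rw [eq_univ_iff_forall]; intro x
    obtain ⟨N, hN⟩ := exists_nat_gt ‖x‖
    rw [mem_iUnion]; exact ⟨N, by rw [mem_ball_zero_iff]; linarith⟩
  rw [hU, Measure.restrict_univ] at this
  exact this.2 h

/-- summable `L¹` norms imply a.e. convergence -/
theorem ae_tendsto_of_summable {α : Type*} [MeasurableSpace α] {μ : Measure α} {f : ℕ → α → ℝ}
    (hf : ∀ i, Integrable (f i) μ) {b : ℕ → ℝ} (hb : Summable b) (hfb : ∀ i, ∫ x, |f (i+1) x - f i x| ∂μ ≤ b i) :
    ∀ᵐ x ∂μ, ∃ a, Tendsto (fun i => f i x) atTop (nhds a) := by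
  have hd : ∀ i, Integrable (fun x => f (i+1) x - f i x) μ := fun i => intg_sub (hf _) (hf _)
  have hs : ∑' i, ∫⁻ x, ‖f (i+1) x - f i x‖ₑ ∂μ ≠ ⊤ := by
    refine ne_top_of_le_ne_top hb.tsum_ofReal_ne_top (ENNReal.tsum_le_tsum fun i => ?_)
    rw [← ofReal_integral_norm_eq_lintegral_enorm (hd i)]
    exact ENNReal.ofReal_le_ofReal (hfb i)
  rw [← lintegral_tsum (fun i => (hd i).1.enorm)] at hs
  have := ae_lt_top' (AEMeasurable.tsum fun i => (hd i).1.enorm) hs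
  filter_upwards [this] with x hx
  have hsum : Summable fun i => f (i+1) x - f i x := by
    refine Summable.of_enorm ?_
    exact hx.ne
  refine ⟨(∑' i, (f (i+1) x - f i x)) + f 0 x, ?_⟩
  have h1 := hsum.hasSum.tendsto_sum_nat.add_const (f 0 x)
  refine h1.congr fun i => ?_
  rw [Finset.sum_range_sub (fun i => f i x)]; ring

set_option linter.unusedVariables false

theorem U_lim_ball {n : ℕ} (j : Fin n) {ψ g : Eu n → ℝ} (hm : Measurable ψ) {M : ℝ} (hM : 0 < M)
    (h : ∀ x, |ψ x| ≤ M) (hg : ∀ᵐ x, Tendsto (fun t => U (some j) ψ x t) (nhdsWithin 0 (Ioi 0)) (nhds (g x)))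
    (x0 : Eu n) {s : ℝ} (hs : 0 < s) :
    IntegrableOn g (Metric.ball x0 s) ∧ ∫ x in Metric.ball x0 s, |g x - U (some j) ψ x0 s| ≤ masC n * M * s ^ n :=
  fatou_set measurableSet_ball measure_ball_lt_top.ne (f := fun t x => U (some j) ψ x t) (fun t ht => U_integrableOn (some j) hm h ht x0 s)
      hg (s := s) hs (fun t ht hts => master j hm hM h x0 ht hts)

theorem U_tendsto_unif {n : ℕ} (k : Option (Fin n)) {χ : ℕ → Eu n → ℝ} {ψ : Eu n → ℝ} {e : ℕ → ℝ}
    (hψ : WI ψ) (hχ : ∀ m, WI (χ m)) (he : Tendsto e atTop (nhds 0)) (h : ∀ m x, |ψ x - χ m x| ≤ e m)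
    (y : Eu n) {s : ℝ} (hs : 0 < s) : Tendsto (fun m => U k (χ m) y s) atTop (nhds (U k ψ y s)) := by
  obtain ⟨C, hC, hU⟩ := U_abs_le k y hs
  rw [tendsto_iff_norm_sub_tendsto_zero]
  refine squeeze_zero (fun _ => norm_nonneg _) (fun m => ?_) (by simpa using he.const_mul C)
  have := hU _ _ (h m)
  rw [hψ.U_sub' (hχ m) k y hs] at this
  rw [norm_sub_rev]; exact this

theorem U_ae_lim {n : ℕ} (j : Fin n) {ψ : Eu n → ℝ} (hu : UniformContinuous ψ) {M : ℝ}
    (h : ∀ x, |ψ x| ≤ M) : ∃ g : Eu n → ℝ, ∀ᵐ x, Tendsto (fun t => U (some j) ψ x t) (nhdsWithin 0 (Ioi 0)) (nhds (g x)) := by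
  classical
  set e : ℕ → ℝ := fun m => (1/2)^m with he
  have he0 : ∀ m, 0 < e m := fun m => by positivity
  have hesum : Summable e := summable_geometric_two
  have helim : Tendsto e atTop (nhds 0) := hesum.tendsto_atTop_zero
  choose χ L hχc hχM hχL hχe using fun m => lip_approx hu h (he0 m)
  choose G hG using fun m => U_lip_tendsto j (hχc m) (hχM m) (hχL m)
  have hW : ∀ m, WI (χ m) := fun m => WI.of_bdd (hχc m).aestronglyMeasurable (hχM m)
  have hWψ : WI ψ := WI.of_bdd hu.continuous.aestronglyMeasurable h
  have hem : ∀ k m, m ≤ k → e k ≤ e m := fun k m hkm => pow_le_pow_of_le_one (by norm_num) (by norm_num) hkm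
  have hdiff : ∀ k m, m ≤ k → ∀ x, |χ k x - χ m x| ≤ 2 * e m := fun k m hkm x => by
    have h1 := hχe k x
    have h2 := hχe m x
    have h3 := hem k m hkm
    rw [abs_le] at *; constructor <;> linarith
  have hUd : ∀ k m x t, 0 < t → U (some j) (fun x => χ k x - χ m x) x t = U (some j) (χ k) x t - U (some j) (χ m) x t :=
    fun k m x t ht => (hW k).U_sub' (hW m) _ _ ht
  have hGd : ∀ k m x, Tendsto (fun t => U (some j) (fun x => χ k x - χ m x) x t) (nhdsWithin 0 (Ioi 0)) (nhds (G k x - G m x)) := by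
    intro k m x
    refine ((hG k x).sub (hG m x)).congr' ?_
    filter_upwards [self_mem_nhdsWithin] with t ht
    exact (hUd k m x t ht).symm
  have hball : ∀ k m, m ≤ k → ∀ x0 s, 0 < s → IntegrableOn (fun x => G k x - G m x) (Metric.ball x0 s) ∧
      ∫ x in Metric.ball x0 s, |G k x - G m x - (U (some j) (χ k) x0 s - U (some j) (χ m) x0 s)| ≤ masC n * (2 * e m) * s ^ n := by
    intro k m hkm x0 s hs
    have := U_lim_ball j ((hχc k).measurable.sub (hχc m).measurable) (mul_pos two_pos (he0 m)) (hdiff k m hkm) (ae_of_all _ (hGd k m)) x0 hs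
    have h2 := hUd k m x0 s hs
    refine ⟨this.1, ?_⟩
    rw [← h2]; exact this.2
  have hGint : ∀ m x0 s, 0 < s → IntegrableOn (G m) (Metric.ball x0 s) := fun m x0 s hs =>
    (U_lim_ball j (hχc m).measurable (M := M + 1) (by have := (abs_nonneg _).trans (h 0); linarith) (fun x => (hχM m x).trans (by linarith)) (ae_of_all _ (hG m)) x0 hs).1
  have hcI : ∀ (a : ℝ) (x0 : Eu n) s, IntegrableOn (fun _ : Eu n => a) (Metric.ball x0 s) := fun a x0 s => integrableOn_const measure_ball_lt_top.ne
  -- a.e. limit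
  have hlim : ∀ᵐ x, ∃ a, Tendsto (fun m => G m x) atTop (nhds a) := by
    refine ae_of_balls fun N => ?_
    set s : ℝ := (N:ℝ) + 1 with hs
    have hs0 : 0 < s := by positivity
    obtain ⟨C, hC, hU⟩ := U_abs_le (some j) (0 : Eu n) hs0
    set V := volume.real (Metric.ball (0 : Eu n) s) with hV
    refine ae_tendsto_of_summable (fun m => hGint m 0 s hs0) (b := fun m => (masC n * 2 * s ^ n + C * 2 * V) * e m) (hesum.mul_left _) fun m => ?_
    obtain ⟨h1, h2⟩ := hball (m+1) m (Nat.le_succ m) 0 s hs0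
    set a := U (some j) (χ (m+1)) 0 s - U (some j) (χ m) 0 s with ha
    have h3 : |a| ≤ C * (2 * e m) := by
      have := hU _ _ (hdiff (m+1) m (Nat.le_succ m))
      rwa [hUd (m+1) m 0 s hs0] at this
    calc ∫ x in Metric.ball 0 s, |G (m+1) x - G m x| ≤ ∫ x in Metric.ball 0 s, (|G (m+1) x - G m x - a| + |a|) := by
          refine integral_mono h1.abs (intg_add (intg_sub h1 (hcI _ _ _)).abs (hcI _ _ _)) fun x => ?_
          have := abs_add_le (G (m+1) x - G m x - a) a
          simpa using this
      _ ≤ masC n * (2 * e m) * s ^ n + |a| * V := by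
          rw [integral_add (intg_sub h1 (hcI _ _ _)).abs (hcI _ _ _), setIntegral_const, smul_eq_mul, mul_comm V]
          linarith
      _ ≤ masC n * (2 * e m) * s ^ n + C * (2 * e m) * V := by gcongr
      _ = _ := by ring
  set g : Eu n → ℝ := fun x => if hx : ∃ a, Tendsto (fun m => G m x) atTop (nhds a) then hx.choose else 0 with hg
  have hgl : ∀ᵐ x, Tendsto (fun m => G m x) atTop (nhds (g x)) := by
    filter_upwards [hlim] with x hx
    have : g x = hx.choose := by rw [hg]; exact dif_pos hx
    rw [this]; exact hx.choose_spec
  -- Fatou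
  have hFat : ∀ m x0 s, 0 < s → IntegrableOn (fun x => g x - G m x) (Metric.ball x0 s) ∧
      ∫ x in Metric.ball x0 s, |g x - G m x - (U (some j) ψ x0 s - U (some j) (χ m) x0 s)| ≤ masC n * (2 * e m) * s ^ n := by
    intro m x0 s hs
    have hUl := U_tendsto_unif (some j) hWψ hW helim hχe x0 hs
    have := fatou (μ := volume.restrict (Metric.ball x0 s)) (f := fun k x => G k x - G m x - (U (some j) (χ k) x0 s - U (some j) (χ m) x0 s))
      (g := fun x => g x - G m x - (U (some j) ψ x0 s - U (some j) (χ m) x0 s))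
      (fun k => intg_sub (intg_sub (hGint k x0 s hs) (hGint m x0 s hs)) (hcI _ _ _))
      (by
        filter_upwards [ae_restrict_of_ae hgl] with x hx
        exact (hx.sub_const _).sub (hUl.sub_const _))
      (B := masC n * (2 * e m) * s ^ n)
      (by
        filter_upwards [eventually_ge_atTop m] with k hk
        exact (hball k m hk x0 s hs).2)
    refine ⟨?_, this.2⟩
    have h2 := intg_add this.1 (hcI (U (some j) ψ x0 s - U (some j) (χ m) x0 s) x0 s)
    simpa [IntegrableOn] using h2
  refine ⟨g, ?_⟩
  have hLeb : ∀ m, ∀ᵐ x, Tendsto (fun s => ⨍ y in Metric.closedBall x (s/2), (g y - G m y)) (nhdsWithin 0 (Ioi 0)) (nhds (g x - G m x)) := by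
    intro m
    have hloc : LocallyIntegrable (fun y => g y - G m y) := fun x => ⟨Metric.ball x 1, Metric.ball_mem_nhds x one_pos, (hFat m x 1 one_pos).1⟩
    filter_upwards [IsUnifLocDoublingMeasure.ae_tendsto_average volume hloc 1] with x hx
    refine hx (fun _ => x) (fun s => s / 2) ?_ ?_
    · rw [tendsto_nhdsWithin_iff]
      constructor
      · have : Tendsto (fun s : ℝ => s/2) (nhds 0) (nhds (0/2)) := tendsto_id.div_const 2
        rw [zero_div] at this
        exact this.mono_left nhdsWithin_le_nhds
      · filter_upwards [self_mem_nhdsWithin] with s hs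
        have : (0:ℝ) < s := hs
        exact mem_Ioi.2 (by positivity)
    · filter_upwards [self_mem_nhdsWithin] with s hs
      have : (0:ℝ) < s := hs
      exact Metric.mem_closedBall_self (by positivity)
  set v := volume.real (Metric.closedBall (0 : Eu n) 1) with hv
  have hv0 : 0 < v := by
    rw [hv, measureReal_def]
    exact ENNReal.toReal_pos (Metric.measure_closedBall_pos _ _ one_pos).ne' measure_closedBall_lt_top.ne
  have hcv : ∀ (x : Eu n) s, 0 < s → volume.real (Metric.closedBall x (s/2)) = (s/2)^n * v := fun x s hs => by
    rw [Measure.addHaar_real_closedBall' volume x (by positivity)]; simp [hv]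
  set A := masC n * 2 * 2 ^ n / v with hA
  have hkey : ∀ m x s, 0 < s → |(⨍ y in Metric.closedBall x (s/2), (g y - G m y)) - (U (some j) ψ x s - U (some j) (χ m) x s)| ≤ A * e m := by
    intro m x s hs
    set a := U (some j) ψ x s - U (some j) (χ m) x s with ha
    obtain ⟨h1, h2⟩ := hFat m x s hs
    have hsub : Metric.closedBall x (s/2) ⊆ Metric.ball x s := Metric.closedBall_subset_ball (by linarith)
    have h1' := h1.mono_set hsub
    have hpos : 0 < (s/2)^n * v := by positivity
    rw [setAverage_eq, hcv x s hs, smul_eq_mul]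
    have e1 : ∫ y in Metric.closedBall x (s/2), (g y - G m y - a) = (∫ y in Metric.closedBall x (s/2), (g y - G m y)) - ((s/2)^n * v) * a := by
      rw [integral_sub h1' (integrableOn_const measure_closedBall_lt_top.ne), setIntegral_const, hcv x s hs, smul_eq_mul]
    have e2 : |∫ y in Metric.closedBall x (s/2), (g y - G m y - a)| ≤ masC n * (2 * e m) * s ^ n := by
      refine abs_integral_le_integral_abs.trans (le_trans ?_ h2)
      exact setIntegral_mono_set (intg_sub h1 (hcI _ _ _)).abs (ae_of_all _ fun _ => abs_nonneg _) hsub.eventuallyLE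
    rw [e1] at e2
    have e3 : ((s/2)^n * v)⁻¹ * (∫ y in Metric.closedBall x (s/2), (g y - G m y)) - a = ((s/2)^n * v)⁻¹ * ((∫ y in Metric.closedBall x (s/2), (g y - G m y)) - ((s/2)^n * v) * a) := by
      field_simp
    rw [e3, abs_mul, abs_of_pos (inv_pos.2 hpos)]
    calc _ ≤ ((s/2)^n * v)⁻¹ * (masC n * (2 * e m) * s ^ n) := by gcongr
      _ = A * e m := by rw [hA, div_pow]; field_simp
  filter_upwards [ae_all_iff.2 hLeb] with x hx
  rw [Metric.tendsto_nhds]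
  intro ε hε
  obtain ⟨m, hm⟩ := ((helim.const_mul A).eventually (gt_mem_nhds (show A * 0 < ε/2 by simpa using half_pos hε))).exists
  have h1 := (hx m).sub (hG m x |>.const_mul (-1))
  have h2 := (Metric.tendsto_nhds.1 h1) (ε/2) (half_pos hε)
  filter_upwards [h2, self_mem_nhdsWithin] with s hs hs0
  have hk := hkey m x s hs0
  rw [Real.dist_eq] at *
  rw [abs_lt] at *
  rw [abs_le] at hk
  constructor <;> linarith [hs.1, hs.2, hk.1, hk.2]

set_option linter.unusedVariables false

/-! ### Principal values versus conjugate Poisson integrals -/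

noncomputable def rc (n : ℕ) : ℝ := Real.Gamma (((n : ℝ) + 1) / 2) / Real.pi ^ (((n : ℝ) + 1) / 2)

theorem rc_pos (n : ℕ) : 0 < rc n := by
  unfold rc
  have := Real.Gamma_pos_of_pos (s := ((n : ℝ) + 1) / 2) (by positivity)
  have := Real.rpow_pos_of_pos Real.pi_pos (((n : ℝ) + 1) / 2)
  positivity

theorem rieszK_eq {n : ℕ} (j : Fin n) (z : Eu n) : rieszK n j z = rc n * Hk (some j) (pt z 0) := by
  have : ‖pt z 0‖ = ‖z‖ := by
    have := norm_pt_sq z 0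
    rw [zero_pow two_ne_zero, add_zero] at this
    exact (pow_left_inj₀ (norm_nonneg _) (norm_nonneg _) two_ne_zero).1 this
  unfold rieszK rc Hk
  rw [this, pt_some, mul_div_assoc]

noncomputable def Kk {n : ℕ} (j : Fin n) (ε : ℝ) (z : Eu n) : ℝ :=
  (if ε ≤ ‖z‖ then Hk (some j) (pt z 0) else 0) - Hk (some j) (pt z ε)

theorem measurable_Kk {n : ℕ} (j : Fin n) (ε : ℝ) : Measurable (Kk j ε) := by
  unfold Kk
  exact (Measurable.ite (measurableSet_le measurable_const measurable_norm) (measurable_Hk_pt _ _) measurable_const).sub (measurable_Hk_pt _ _)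

theorem Hk_pt_neg_some {n : ℕ} (j : Fin n) (z : Eu n) (t : ℝ) : Hk (some j) (pt (-z) t) = - Hk (some j) (pt z t) := by
  have : ‖pt (-z) t‖ = ‖pt z t‖ := by
    refine (pow_left_inj₀ (norm_nonneg _) (norm_nonneg _) two_ne_zero).1 ?_
    rw [norm_pt_sq, norm_pt_sq, norm_neg]
  unfold Hk
  rw [this, pt_some, pt_some]; simp [neg_div]

theorem Kk_neg {n : ℕ} (j : Fin n) (ε : ℝ) (z : Eu n) : Kk j ε (-z) = - Kk j ε z := by
  unfold Kk
  rw [norm_neg, Hk_pt_neg_some, Hk_pt_neg_some]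
  split_ifs <;> ring

theorem Kk_scale {n : ℕ} (j : Fin n) {ε : ℝ} (hε : 0 < ε) (z : Eu n) :
    Kk j ε z = ε⁻¹ ^ n * Kk j 1 (ε⁻¹ • z) := by
  unfold Kk
  have h1 := Hk_scale (some j) hε z 0
  have h2 := Hk_scale (some j) hε z 1
  rw [mul_zero] at h1
  rw [mul_one] at h2
  have h3 : 1 ≤ ‖ε⁻¹ • z‖ ↔ ε ≤ ‖z‖ := by
    rw [norm_smul, Real.norm_eq_abs, abs_of_pos (inv_pos.2 hε), inv_mul_eq_div, one_le_div hε]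
  rw [h1, h2]
  simp only [h3]
  split_ifs <;> ring

noncomputable def kkC (n : ℕ) : ℝ := (n + 2) / (1/2) ^ (n+1) + 2 ^ (n+1)

theorem abs_Kk_le {n : ℕ} (j : Fin n) (z : Eu n) : |Kk j 1 z| ≤ kkC n * env 1 z := by
  have he := env_pos one_pos z
  unfold Kk kkC
  rw [add_mul]
  have p1 : 0 ≤ (n + 2) / (1/2 : ℝ) ^ (n+1) * env 1 z := by positivity
  have p2 : 0 ≤ 2 ^ (n+1) * env 1 z := by positivity
  split_ifs with h
  · have := abs_Hk_pt_sub_le (some j) (x := z) (y := z) (t := 0) (s := 1) (d := 1) (m := 1/2) one_pos (by norm_num) (z := z)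
      (by simp) (by have := norm_le_norm_pt z 0; linarith) (by have := half_le_norm_pt z (t := 1) (by norm_num); linarith)
    linarith
  · push Not at h
    rw [zero_sub, abs_neg]
    have h1 := abs_Hk_le (some j) (pt z 1)
    have h2 : 1 ≤ ‖pt z 1‖ := by simpa using abs_le_norm_pt z 1
    have h3 : (‖pt z 1‖ ^ n)⁻¹ ≤ 1 := inv_le_one_of_one_le₀ (one_le_pow₀ h2)
    have h4 : 1 ≤ 2 ^ (n+1) * env 1 z := by
      unfold env
      rw [← mul_div_assoc, one_le_div (by positivity), mul_one]
      gcongr; linarith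
    linarith

theorem integrable_Kk {n : ℕ} (j : Fin n) : Integrable (Kk j 1) :=
  Integrable.mono' (integrable_env_one.const_mul (kkC n)) (measurable_Kk j 1).aestronglyMeasurable (ae_of_all _ fun z => abs_Kk_le j z)

theorem integral_Kk {n : ℕ} (j : Fin n) : ∫ z, Kk j 1 z = 0 := by
  have h1 : ∫ z, Kk j 1 (-z) = ∫ z, Kk j 1 z := integral_neg_eq_self (Kk j 1) volume
  simp only [Kk_neg, integral_neg] at h1
  linarith

theorem integrable_Kk_mul {n : ℕ} (j : Fin n) {ψ : Eu n → ℝ} (hψ : Continuous ψ) {M : ℝ} (h : ∀ x, |ψ x| ≤ M)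
    {ε : ℝ} (hε : 0 < ε) (y : Eu n) : Integrable (fun x => Kk j ε (y - x) * ψ x) := by
  refine Integrable.mul_bdd (c := M) ?_ hψ.aestronglyMeasurable (ae_of_all _ fun x => h x)
  have : Integrable (Kk j ε) := by
    have := ((integrable_Kk j).comp_smul (inv_pos.2 hε).ne').const_mul (ε⁻¹ ^ n)
    refine this.congr (ae_of_all _ fun z => (Kk_scale j hε z).symm)
  exact this.comp_sub_left y

theorem Kk_tendsto {n : ℕ} (j : Fin n) {ψ : Eu n → ℝ} (hψ : Continuous ψ) {M : ℝ} (h : ∀ x, |ψ x| ≤ M) (y : Eu n) :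
    Tendsto (fun ε => ∫ x, Kk j ε (y - x) * ψ x) (nhdsWithin 0 (Ioi 0)) (nhds 0) := by
  have e1 : ∀ ε, 0 < ε → ∫ x, Kk j ε (y - x) * ψ x = ∫ z, Kk j 1 z * ψ (y - ε • z) := by
    intro ε hε
    have h1 := integral_sub_left_eq_self (fun z => Kk j ε z * ψ (y - z)) volume y
    simp only [sub_sub_cancel] at h1
    rw [h1, ← integral_scale (fun z => Kk j 1 z * ψ (y - ε • z)) hε]
    congr 1; ext z
    rw [Kk_scale j hε, smul_smul, mul_inv_cancel₀ hε.ne', one_smul, mul_assoc]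
  have hlim : Tendsto (fun ε : ℝ => ∫ z, Kk j 1 z * ψ (y - ε • z)) (nhdsWithin 0 (Ioi 0)) (nhds (∫ z, Kk j 1 z * ψ y)) := by
    refine tendsto_integral_filter_of_dominated_convergence (fun z => kkC n * env 1 z * M) ?_ ?_ ((integrable_env_one.const_mul _).mul_const _) ?_
    · refine Eventually.of_forall fun ε => ?_
      exact (measurable_Kk j 1).aestronglyMeasurable.mul (by fun_prop : Continuous fun z => ψ (y - ε • z)).aestronglyMeasurable
    · refine Eventually.of_forall fun ε => ae_of_all _ fun z => ?_
      rw [norm_mul, Real.norm_eq_abs, Real.norm_eq_abs]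
      have := abs_Kk_le j z
      have h0 := (abs_nonneg _).trans this
      gcongr
      exact h _
    · refine ae_of_all _ fun z => ?_
      refine Tendsto.const_mul _ ?_
      have : Continuous fun ε : ℝ => ψ (y - ε • z) := by fun_prop
      have := this.tendsto 0
      simp only [zero_smul, sub_zero] at this
      exact this.mono_left nhdsWithin_le_nhds
  rw [integral_mul_const, integral_Kk, zero_mul] at hlim
  refine hlim.congr' ?_
  filter_upwards [self_mem_nhdsWithin] with ε hε
  exact (e1 ε hε).symm

/-- The normalising constant relating both objects. -/
noncomputable def rK {n : ℕ} (j : Fin n) (ψ : Eu n → ℝ) : ℝ := - ∫ x, Kk j 1 (0 - x) * ψ x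

theorem riesz_sub_tendsto {n : ℕ} (j : Fin n) {ψ : Eu n → ℝ} (hψ : Continuous ψ) {M : ℝ} (h : ∀ x, |ψ x| ≤ M) (y : Eu n) :
    Tendsto (fun ε => rieszTruncLinf j ψ y ε - rc n * U (some j) ψ y ε) (nhdsWithin 0 (Ioi 0)) (nhds (rc n * rK j ψ)) := by
  have hW : WI ψ := WI.of_bdd hψ.aestronglyMeasurable h
  -- small error
  set E : ℝ → Eu n → ℝ := fun ε x => if ε ≤ dist y x then 0 else (if 1 ≤ ‖x‖ then Hk (some j) (pt (-x) 0) else 0) with hE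
  have hEm : ∀ ε, Measurable (E ε) := fun ε => by
    refine Measurable.ite (measurableSet_le measurable_const (by fun_prop)) measurable_const ?_
    exact Measurable.ite (measurableSet_le measurable_const measurable_norm) ((measurable_Hk_pt _ _).comp measurable_neg) measurable_const
  have hEb : ∀ ε, ε ≤ 1 → ∀ x, |E ε x| ≤ (Metric.ball y 1).indicator (fun _ => (1:ℝ)) x := by
    intro ε hε x
    rw [hE]; dsimp only
    split_ifs with h1 h2
    · rw [abs_zero]; exact indicator_nonneg (fun _ _ => zero_le_one) _
    · rw [indicator_of_mem (by rw [Metric.mem_ball, dist_comm]; push Not at h1; linarith)]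
      refine (abs_Hk_le _ _).trans (inv_le_one_of_one_le₀ (one_le_pow₀ ?_))
      have := norm_le_norm_pt (-x) 0
      rw [norm_neg] at this; linarith
    · rw [abs_zero]; exact indicator_nonneg (fun _ _ => zero_le_one) _
  have hInd : Integrable ((Metric.ball y 1).indicator (fun _ => (1:ℝ))) :=
    (integrable_indicator_iff measurableSet_ball).2 (integrableOn_const measure_ball_lt_top.ne)
  have hEi : ∀ ε, ε ≤ 1 → Integrable (fun x => E ε x * ψ x) := fun ε hε =>
    Integrable.mul_bdd (c := M) (Integrable.mono' hInd (hEm ε).aestronglyMeasurable (ae_of_all _ fun x => hEb ε hε x)) hψ.aestronglyMeasurable (ae_of_all _ fun x => h x)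
  have hElim : Tendsto (fun ε => ∫ x, E ε x * ψ x) (nhdsWithin 0 (Ioi 0)) (nhds 0) := by
    have hev : ∀ᶠ ε : ℝ in nhdsWithin 0 (Ioi 0), ε ≤ 1 := mem_nhdsWithin_of_mem_nhds (Iic_mem_nhds one_pos)
    have : Tendsto (fun ε => ∫ x, E ε x * ψ x) (nhdsWithin 0 (Ioi 0)) (nhds (∫ x : Eu n, ((if x = y then (if 1 ≤ ‖x‖ then Hk (some j) (pt (-x) 0) else 0) else 0) * ψ x))) := by
      refine tendsto_integral_filter_of_dominated_convergence (fun x => (Metric.ball y 1).indicator (fun _ => (1:ℝ)) x * M) ?_ ?_ (hInd.mul_const _) ?_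
      · filter_upwards [hev] with ε hε
        exact (hEi ε hε).1
      · filter_upwards [hev] with ε hε
        refine ae_of_all _ fun x => ?_
        rw [norm_mul, Real.norm_eq_abs, Real.norm_eq_abs]
        have h0 := (abs_nonneg _).trans (hEb ε hε x)
        gcongr
        · exact hEb ε hε x
        · exact h _
      · refine ae_of_all _ fun x => ?_
        refine Tendsto.mul_const _ ?_
        refine tendsto_const_nhds.congr' ?_
        by_cases hx : x = y
        · filter_upwards [self_mem_nhdsWithin] with ε hε
          rw [hE]; dsimp only
          rw [if_pos hx, if_neg (show ¬ ε ≤ dist y x by rw [hx, dist_self]; exact not_le.2 hε)]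
        · have : ∀ᶠ ε : ℝ in nhdsWithin 0 (Ioi 0), ε ≤ dist y x := mem_nhdsWithin_of_mem_nhds (Iic_mem_nhds (dist_pos.2 (Ne.symm hx)))
          filter_upwards [this] with ε hε
          rw [hE]; dsimp only
          rw [if_neg hx, if_pos hε]
    have hz : ∫ x : Eu n, ((if x = y then (if 1 ≤ ‖x‖ then Hk (some j) (pt (-x) 0) else 0) else 0) * ψ x) = 0 := by
      have hn : 0 < n := j.pos
      have : Nontrivial (Eu n) := by
        have : Nonempty (Fin n) := ⟨j⟩
        infer_instance
      refine integral_eq_zero_of_ae ?_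
      have : ∀ᵐ x : Eu n, x ≠ y := by
        rw [ae_iff]; simp
      filter_upwards [this] with x hx
      simp [hx]
    rwa [hz] at this
  have hsum := (((Kk_tendsto j hψ h y).add hElim).add_const (rK j ψ)).const_mul (rc n)
  rw [zero_add, zero_add] at hsum
  refine hsum.congr' ?_
  have hev : ∀ᶠ ε : ℝ in nhdsWithin 0 (Ioi 0), ε ≤ 1 := mem_nhdsWithin_of_mem_nhds (Iic_mem_nhds one_pos)
  filter_upwards [hev, self_mem_nhdsWithin] with ε hε1 hε
  have hε : 0 < ε := hε
  have hms : MeasurableSet {x : Eu n | ε ≤ dist y x} := measurableSet_le measurable_const (by fun_prop)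
  have i1 := integrable_Kk_mul j hψ h hε y
  have i2 := hEi ε hε1
  have i3 := integrable_Kk_mul j hψ h one_pos (0 : Eu n)
  have i4 := hW.U_int (some j) y hε
  have key : rieszTruncLinf j ψ y ε = rc n * ∫ x, (((Kk j ε (y - x) * ψ x + E ε x * ψ x) - Kk j 1 (0 - x) * ψ x) + (Hk (some j) (pt (y-x) ε) - Hk (some j) (pt (-x) 1)) * ψ x) := by
    unfold rieszTruncLinf
    rw [← integral_indicator hms, ← integral_const_mul]
    congr 1; ext x
    rw [indicator_apply]
    simp only [mem_ofPred_eq, hE]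
    unfold Kk
    rw [rieszK_eq, rieszK_eq, zero_sub, norm_neg, ← dist_eq_norm]
    split_ifs <;> ring
  rw [key, integral_add (intg_sub (intg_add i1 i2) i3) i4, integral_sub (intg_add i1 i2) i3, integral_add i1 i2]
  unfold rK U
  ring

theorem riesz_of_U {n : ℕ} (j : Fin n) {ψ g : Eu n → ℝ} (hψ : Continuous ψ) {M : ℝ} (h : ∀ x, |ψ x| ≤ M)
    (hg : ∀ᵐ x, Tendsto (fun t => U (some j) ψ x t) (nhdsWithin 0 (Ioi 0)) (nhds (g x))) :
    IsRieszTransformLinf j ψ (fun x => rc n * rK j ψ + rc n * g x) := by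
  unfold IsRieszTransformLinf
  filter_upwards [hg] with x hx
  refine ((riesz_sub_tendsto j hψ h x).add (hx.const_mul (rc n))).congr fun ε => ?_
  ring

theorem U_of_riesz {n : ℕ} (j : Fin n) {ψ g : Eu n → ℝ} (hψ : Continuous ψ) {M : ℝ} (h : ∀ x, |ψ x| ≤ M)
    (hg : IsRieszTransformLinf j ψ g) :
    ∀ᵐ x, Tendsto (fun t => U (some j) ψ x t) (nhdsWithin 0 (Ioi 0)) (nhds ((g x - rc n * rK j ψ) / rc n)) := by
  unfold IsRieszTransformLinf at hg
  have := rc_pos n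
  filter_upwards [hg] with x hx
  refine ((hx.sub (riesz_sub_tendsto j hψ h x)).div_const (rc n)).congr fun ε => ?_
  field_simp; ring

/-! ### The easy direction -/

theorem vmo_of_repr {n : ℕ} (φ : Eu n → ℝ) (hφ : IsBMO φ) (φ₀ : Eu n → ℝ) (ψ g : Fin n → Eu n → ℝ)
    (h0 : UniformContinuous φ₀) (hψ : ∀ j, UniformContinuous (ψ j) ∧ ∃ B, ∀ x, |ψ j x| ≤ B)
    (hg : ∀ j, IsRieszTransformLinf j (ψ j) (g j)) (hφg : ∀ᵐ x, φ x = φ₀ x + ∑ j, g j x) : IsVMO φ := by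
  refine ⟨hφ, fun ε hε => ?_⟩
  set e := ε / (2 * (n + 1)) with he
  have he0 : 0 < e := by positivity
  have hrc := rc_pos n
  have hU := fun j => U_of_riesz j (hψ j).1.continuous (hψ j).2.choose_spec (hg j)
  have hbmo := fun j => U_lim_cube j (hψ j).1.continuous.measurable (M := |(hψ j).2.choose| + 1) (by positivity)
    (fun x => ((hψ j).2.choose_spec x).trans (by have := le_abs_self (hψ j).2.choose; linarith)) (hU j)
  choose δ hδ hosc using fun j => U_lim_vmo j (hψ j).1 (hψ j).2.choose_spec (hU j) (ε := e / rc n) (by positivity)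
  obtain ⟨δ0, hδ0, hd0⟩ := Metric.uniformContinuous_iff.1 h0 e he0
  have hgl : ∀ j, LocallyIntegrable (g j) := by
    intro j
    have h1 := ((hbmo j).1.smul (rc n)).add (locallyIntegrable_const (rc n * rK j (ψ j)))
    refine h1.congr (ae_of_all _ fun x => ?_)
    simp only [Pi.add_apply, Pi.smul_apply, smul_eq_mul]
    field_simp; ring
  have hmin : ∃ δ' > 0, ∀ j, δ' ≤ δ j := by
    rcases isEmpty_or_nonempty (Fin n) with hn | hn
    · exact ⟨1, one_pos, fun j => (hn.false j).elim⟩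
    · obtain ⟨j0, hj0⟩ := Finite.exists_min δ
      exact ⟨δ j0, hδ j0, hj0⟩
  obtain ⟨δ', hδ', hδm⟩ := hmin
  refine ⟨min δ' (δ0 / (2 * (√n + 1))), by positivity, fun c l hl hlδ => ?_⟩
  have hl1 : l ≤ δ' := hlδ.trans (min_le_left _ _)
  have hl2 : l * (√n + 1) < δ0 := by
    have := hlδ.trans (min_le_right _ _)
    rw [le_div_iff₀ (by positivity)] at this
    linarith
  choose a ha using fun j => hosc j c l hl (hl1.trans (hδm j))
  set b := φ₀ c + ∑ j, (rc n * a j + rc n * rK j (ψ j)) with hb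
  have hcI : ∀ a : ℝ, IntegrableOn (fun _ : Eu n => a) (cube c l) := fun a => integrableOn_const (volume_cube_lt_top c l).ne
  have hgi : ∀ j, IntegrableOn (fun x => |g j x - (rc n * a j + rc n * rK j (ψ j))|) (cube c l) := fun j => (intg_sub (integrableOn_cube (hgl j) c l) (hcI _)).abs
  have h1 : ∫ x in cube c l, |φ x - b| ≤ ε / 2 * l ^ n := by
    calc ∫ x in cube c l, |φ x - b| ≤ ∫ x in cube c l, (e + ∑ j, |g j x - (rc n * a j + rc n * rK j (ψ j))|) := by
          refine setIntegral_mono_on_ae (intg_sub (integrableOn_cube hφ.1 c l) (hcI _)).abs (intg_add (hcI _) (integrable_finsetSum _ fun j _ => hgi j)) (measurableSet_cube c l) ?_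
          filter_upwards [hφg] with x hx hxc
          have h2 : |φ₀ x - φ₀ c| ≤ e := by
            have := cube_subset_ball c hl hxc
            rw [Metric.mem_ball] at this
            exact (hd0 (this.trans hl2)).le
          have h3 : φ x - b = (φ₀ x - φ₀ c) + ∑ j, (g j x - (rc n * a j + rc n * rK j (ψ j))) := by
            rw [hx, hb, Finset.sum_sub_distrib]; ring
          rw [h3]
          refine (abs_add_le _ _).trans ?_
          gcongr
          exact Finset.abs_sum_le_sum_abs _ _
      _ = e * l ^ n + ∑ j, ∫ x in cube c l, |g j x - (rc n * a j + rc n * rK j (ψ j))| := by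
          rw [integral_add (hcI _) (integrable_finsetSum _ fun j _ => hgi j), setIntegral_cube_const _ c hl, integral_finsetSum _ fun j _ => hgi j]
      _ ≤ e * l ^ n + ∑ j : Fin n, e * l ^ n := by
          gcongr with j
          have : ∫ x in cube c l, |g j x - (rc n * a j + rc n * rK j (ψ j))| = rc n * ∫ x in cube c l, |(g j x - rc n * rK j (ψ j)) / rc n - a j| := by
            rw [← integral_const_mul]
            congr 1; ext x
            rw [show g j x - (rc n * a j + rc n * rK j (ψ j)) = rc n * ((g j x - rc n * rK j (ψ j)) / rc n - a j) by field_simp; ring, abs_mul, abs_of_pos hrc]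
          rw [this]
          calc _ ≤ rc n * (e / rc n * l ^ n) := by gcongr; exact ha j
            _ = _ := by field_simp
      _ = ε / 2 * l ^ n := by
          rw [Finset.sum_const, Finset.card_univ, Fintype.card_fin, nsmul_eq_mul, he]; field_simp; ring
  have h2 := cubeOsc_le_two hl (integrableOn_cube hφ.1 c l) b
  have hln : 0 < l ^ n := by positivity
  refine le_of_mul_le_mul_right ?_ hln
  linarith

set_option linter.unusedVariables false

/-! ## Part F: Poisson extensions as functions on the half space -/

noncomputable def kI {n : ℕ} (k : Vu n → ℝ) (g : Eu n → ℝ) (X : Vu n) : ℝ := ∫ y, k (X - pt y 0) * g y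

def KG {n : ℕ} (k : Vu n → ℝ) : Prop := Measurable k ∧ (∀ ξ, ξ ≠ 0 → ContinuousAt k ξ) ∧
  ∃ A, 0 ≤ A ∧ ∀ ξ : Vu n, 0 < ξ none → |k ξ| ≤ A * (ξ none + 1 + (ξ none)⁻¹) * rn (n+1) ξ

theorem ne_zero_of_none {n : ℕ} {ξ : Vu n} (h : 0 < ξ none) : ξ ≠ 0 := by
  rintro rfl; simp at h

theorem norm_ee {n : ℕ} (i : Option (Fin n)) : ‖(ee i : Vu n)‖ = 1 := by simp [ee]

theorem measurable_rn {n : ℕ} (m : ℕ) : Measurable (rn (n := n) m) := by unfold rn; fun_prop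

theorem KG.Hk {n : ℕ} : KG (Hk (n := n) none) := by
  refine ⟨measurable_Hk _, fun ξ h => continuousAt_Hk none h, 1, zero_le_one, fun ξ h => ?_⟩
  rw [Hk_eq, abs_mul, abs_of_pos h, abs_of_nonneg (rn_nonneg _ _), one_mul]
  have := rn_nonneg (n+1) ξ
  gcongr
  have : 0 < (ξ none)⁻¹ := inv_pos.2 h
  linarith

theorem KG.dH {n : ℕ} (i k : Option (Fin n)) : KG (dH i k) := by
  refine ⟨?_, fun ξ h => continuousAt_dH i k h, n + 2, by positivity, fun ξ h => ?_⟩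
  · unfold _root_.dH
    have := measurable_rn (n := n) (n+1)
    have := measurable_rn (n := n) (n+3)
    fun_prop
  · refine (abs_dH_le i k ξ (ne_zero_of_none h)).trans ?_
    have := rn_nonneg (n+1) ξ
    gcongr
    have : 0 < (ξ none)⁻¹ := inv_pos.2 h
    exact le_mul_of_one_le_right (by positivity) (by linarith)

theorem KG.ddH {n : ℕ} (i k : Option (Fin n)) : KG (ddH i k) := by
  refine ⟨?_, fun ξ h => continuousAt_ddH i k h, (n+1)*(n+6), by positivity, fun ξ h => ?_⟩
  · unfold _root_.ddH
    have := measurable_rn (n := n) (n+5)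
    have := measurable_rn (n := n) (n+3)
    fun_prop
  · refine (abs_ddH_le i k ξ (ne_zero_of_none h)).trans ?_
    have h1 : 0 < ‖ξ‖ := norm_pos_iff.2 (ne_zero_of_none h)
    have h2 : ξ none ≤ ‖ξ‖ := (le_abs_self _).trans (abs_coord_le ξ none)
    have h3 : 0 < (ξ none)⁻¹ := inv_pos.2 h
    have h4 : ‖ξ‖ * rn (n+3) ξ ≤ (ξ none)⁻¹ * rn (n+1) ξ := by
      have e : ‖ξ‖ * rn (n+3) ξ = ‖ξ‖⁻¹ * rn (n+1) ξ := by
        rw [← rn_mul_sq (n+1) ξ (ne_zero_of_none h)]; field_simp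
      rw [e]
      have := rn_nonneg (n+1) ξ
      gcongr
    have := rn_nonneg (n+1) ξ
    have h5 : (ξ none)⁻¹ * rn (n+1) ξ ≤ (ξ none + 1 + (ξ none)⁻¹) * rn (n+1) ξ := by gcongr; linarith
    rw [mul_assoc ((n+1)*(n+6) : ℝ)]
    exact mul_le_mul_of_nonneg_left (h4.trans h5) (by positivity)

theorem loc_lower {n : ℕ} (X : Vu n) (hX : 0 < X none) : ∃ m, 0 < m ∧ ∀ X' : Vu n, ‖X' - X‖ ≤ X none / 2 → ∀ y : Eu n,
    m * (1 + ‖y‖) ≤ ‖X' - pt y 0‖ ∧ X none / 2 ≤ (X' - pt y 0) none ∧ (X' - pt y 0) none ≤ 2 * X none := by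
  set t := X none with ht
  set m := (t/2) / (1 + 2 * (‖X‖ + t)) ⊓ (1/4) ⊓ (t/4) with hm
  have hm0 : 0 < m := by positivity
  refine ⟨m, hm0, fun X' h y => ?_⟩
  have h1 : |(X' - X) none| ≤ t / 2 := (abs_coord_le _ _).trans h
  have h2 : (X' - X) none = X' none - t := by simp [ht]
  have h3 : (X' - pt y 0) none = X' none := by simp
  rw [h2, abs_le] at h1
  have h4 : t / 2 ≤ (X' - pt y 0) none := by rw [h3]; linarith
  refine ⟨?_, h4, by rw [h3]; linarith⟩
  have h5 : t/2 ≤ ‖X' - pt y 0‖ := h4.trans ((le_abs_self _).trans (abs_coord_le _ none))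
  have h6 : ‖y‖ ≤ ‖X' - pt y 0‖ + ‖X‖ + t / 2 := by
    have a1 : ‖y‖ ≤ ‖pt y 0‖ := norm_le_norm_pt y 0
    have a2 : ‖pt y 0‖ ≤ ‖X' - pt y 0‖ + ‖X' - X‖ + ‖X‖ := by
      have : pt y 0 = -(X' - pt y 0) + (X' - X) + X := by abel
      calc ‖pt y 0‖ = ‖-(X' - pt y 0) + (X' - X) + X‖ := by rw [← this]
        _ ≤ _ := by
          refine (norm_add_le _ _).trans ?_
          gcongr
          refine (norm_add_le _ _).trans ?_
          rw [norm_neg]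
    linarith
  have m1 : m ≤ (t/2) / (1 + 2 * (‖X‖ + t)) := (min_le_left _ _).trans (min_le_left _ _)
  have m2 : m ≤ 1/4 := (min_le_left _ _).trans (min_le_right _ _)
  have m3 : m ≤ t/4 := min_le_right _ _
  have hy := norm_nonneg y
  rcases le_total ‖y‖ (2 * (‖X‖ + t)) with hc | hc
  · rw [le_div_iff₀ (by positivity)] at m1
    have : m * (1 + ‖y‖) ≤ m * (1 + 2 * (‖X‖ + t)) := by gcongr
    linarith
  · have : m * (1 + ‖y‖) ≤ t/4 + 1/4 * ‖y‖ := by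
      rw [mul_add, mul_one]; gcongr
    have := norm_nonneg X
    linarith

theorem KG.dom {n : ℕ} {k : Vu n → ℝ} (hk : KG k) (X : Vu n) (hX : 0 < X none) : ∃ C, 0 ≤ C ∧ ∀ X' : Vu n, ‖X' - X‖ ≤ X none / 2 →
    ∀ y : Eu n, |k (X' - pt y 0)| ≤ C * env 1 y := by
  obtain ⟨_, _, A, hA, hb⟩ := hk
  obtain ⟨m, hm, hl⟩ := loc_lower X hX
  refine ⟨A * (2 * X none + 1 + (X none / 2)⁻¹) * (m ^ (n+1))⁻¹, by positivity, fun X' h y => ?_⟩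
  obtain ⟨h1, h2, h3⟩ := hl X' h y
  have hpos : 0 < (X' - pt y 0) none := by linarith
  refine (hb _ hpos).trans ?_
  rw [mul_assoc _ (m ^ (n+1))⁻¹]
  have : rn (n+1) (X' - pt y 0) ≤ (m ^ (n+1))⁻¹ * env 1 y := by
    unfold rn env
    rw [one_div, ← mul_inv, ← mul_pow]
    gcongr
  have := rn_nonneg (n+1) (X' - pt y 0)
  gcongr

theorem KG.meas {n : ℕ} {k : Vu n → ℝ} (hk : KG k) (X : Vu n) : Measurable (fun y : Eu n => k (X - pt y 0)) :=
  hk.1.comp (by fun_prop : Continuous fun y : Eu n => X - pt y 0).measurable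

theorem kI_integrable {n : ℕ} {k : Vu n → ℝ} (hk : KG k) {g : Eu n → ℝ} (hg : Measurable g) {M : ℝ} (hM : ∀ x, |g x| ≤ M)
    (X : Vu n) (hX : 0 < X none) : Integrable (fun y => k (X - pt y 0) * g y) := by
  obtain ⟨C, hC, hd⟩ := hk.dom X hX
  refine Integrable.mul_bdd (c := M) ?_ hg.aestronglyMeasurable (ae_of_all _ fun x => hM x)
  exact (integrable_env_one.const_mul C).mono' (hk.meas X).aestronglyMeasurable (ae_of_all _ fun y => hd X (by simp; positivity) y)

theorem kI_continuousAt {n : ℕ} {k : Vu n → ℝ} (hk : KG k) {g : Eu n → ℝ} (hg : Measurable g) {M : ℝ} (hM : ∀ x, |g x| ≤ M)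
    (X : Vu n) (hX : 0 < X none) : ContinuousAt (kI k g) X := by
  obtain ⟨C, hC, hd⟩ := hk.dom X hX
  unfold kI
  refine continuousAt_of_dominated (bound := fun y => C * env 1 y * M) ?_ ?_ ((integrable_env_one.const_mul C).mul_const M) ?_
  · exact Eventually.of_forall fun X' => ((hk.meas X').mul hg).aestronglyMeasurable
  · filter_upwards [Metric.closedBall_mem_nhds X (half_pos hX)] with X' hX'
    refine ae_of_all _ fun y => ?_
    rw [norm_mul, Real.norm_eq_abs, Real.norm_eq_abs]
    have h1 := hd X' (by rwa [mem_closedBall_iff_norm] at hX') y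
    have h0 := (abs_nonneg _).trans h1
    gcongr
    exact hM y
  · refine ae_of_all _ fun y => ContinuousAt.mul ?_ continuousAt_const
    have : X - pt y 0 ≠ 0 := ne_zero_of_none (by simpa using hX)
    exact (hk.2.1 _ this).comp (f := fun X => X - pt y 0) (by fun_prop)

theorem kI_hasDerivAt {n : ℕ} (i : Option (Fin n)) {k k' : Vu n → ℝ} (hk : KG k) (hk' : KG k')
    (hd : ∀ (ξ : Vu n) (τ : ℝ), ξ + τ • ee i ≠ 0 → HasDerivAt (fun τ : ℝ => k (ξ + τ • ee i)) (k' (ξ + τ • ee i)) τ)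
    {g : Eu n → ℝ} (hg : Measurable g) {M : ℝ} (hM : ∀ x, |g x| ≤ M)
    (X : Vu n) (τ : ℝ) (hX : 0 < (X + τ • ee i) none) :
    HasDerivAt (fun τ : ℝ => kI k g (X + τ • ee i)) (kI k' g (X + τ • ee i)) τ := by
  set Y := X + τ • ee i with hY
  obtain ⟨C, hC, hdom⟩ := hk'.dom Y hX
  unfold kI
  have hs : Metric.ball τ (Y none / 2) ∈ nhds τ := Metric.ball_mem_nhds _ (half_pos hX)
  have hclose : ∀ τ' ∈ Metric.ball τ (Y none / 2), ‖(X + τ' • ee i) - Y‖ ≤ Y none / 2 := by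
    intro τ' h'
    rw [Metric.mem_ball, Real.dist_eq] at h'
    rw [hY, show X + τ' • ee i - (X + τ • ee i) = (τ' - τ) • ee i by rw [sub_smul]; abel, norm_smul, norm_ee, mul_one]
    exact h'.le
  refine (hasDerivAt_integral_of_dominated_loc_of_deriv_le (μ := volume) (𝕜 := ℝ) (F := fun τ y => k (X + τ • ee i - pt y 0) * g y) (F' := fun τ y => k' (X + τ • ee i - pt y 0) * g y)
    (x₀ := τ) (bound := fun y => C * env 1 y * M) hs ?_ ?_ ?_ ?_ ?_ ?_).2
  · exact Eventually.of_forall fun τ' => ((hk.meas _).mul hg).aestronglyMeasurable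
  · exact kI_integrable hk hg hM Y hX
  · exact ((hk'.meas _).mul hg).aestronglyMeasurable
  · refine ae_of_all _ fun y τ' h' => ?_
    rw [norm_mul, Real.norm_eq_abs, Real.norm_eq_abs]
    have h1 := hdom _ (hclose τ' h') y
    have h0 := (abs_nonneg _).trans h1
    gcongr
    exact hM y
  · exact (integrable_env_one.const_mul C).mul_const M
  · refine ae_of_all _ fun y τ' h' => ?_
    have e : ∀ τ : ℝ, X + τ • ee i - pt y 0 = (X - pt y 0) + τ • ee i := fun τ => by abel
    simp only [e]
    refine (hd (X - pt y 0) τ' ?_).mul_const _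
    rw [← e]
    refine ne_zero_of_none ?_
    have h2 := (abs_coord_le _ none).trans (hclose τ' h')
    have h3 : ((X + τ' • ee i) - Y) none = (X + τ' • ee i - pt y 0) none - Y none := by simp
    rw [h3, abs_le] at h2
    linarith

/-- Poisson extension (unnormalised) and its derivatives -/
noncomputable def PX {n : ℕ} (g : Eu n → ℝ) (X : Vu n) : ℝ := kI (Hk none) g X
noncomputable def PX1 {n : ℕ} (i : Option (Fin n)) (g : Eu n → ℝ) (X : Vu n) : ℝ := kI (dH i none) g X
noncomputable def PX2 {n : ℕ} (i : Option (Fin n)) (g : Eu n → ℝ) (X : Vu n) : ℝ := kI (ddH i none) g X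

theorem PX_deriv {n : ℕ} (i : Option (Fin n)) {g : Eu n → ℝ} (hg : Measurable g) {M : ℝ} (hM : ∀ x, |g x| ≤ M)
    (X : Vu n) (τ : ℝ) (hX : 0 < (X + τ • ee i) none) :
    HasDerivAt (fun τ : ℝ => PX g (X + τ • ee i)) (PX1 i g (X + τ • ee i)) τ :=
  kI_hasDerivAt i KG.Hk (KG.dH i none) (fun ξ τ h => hasDerivAt_Hk i none ξ τ h) hg hM X τ hX

theorem PX1_deriv {n : ℕ} (i : Option (Fin n)) {g : Eu n → ℝ} (hg : Measurable g) {M : ℝ} (hM : ∀ x, |g x| ≤ M)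
    (X : Vu n) (τ : ℝ) (hX : 0 < (X + τ • ee i) none) :
    HasDerivAt (fun τ : ℝ => PX1 i g (X + τ • ee i)) (PX2 i g (X + τ • ee i)) τ :=
  kI_hasDerivAt i (KG.dH i none) (KG.ddH i none) (fun ξ τ h => hasDerivAt_dH i none ξ τ h) hg hM X τ hX

theorem sum_PX2 {n : ℕ} {g : Eu n → ℝ} (hg : Measurable g) {M : ℝ} (hM : ∀ x, |g x| ≤ M)
    (X : Vu n) (hX : 0 < X none) : ∑ i, PX2 i g X = 0 := by
  unfold PX2 kI
  rw [← integral_finsetSum _ fun i _ => kI_integrable (KG.ddH i none) hg hM X hX]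
  refine integral_eq_zero_of_ae (ae_of_all _ fun y => ?_)
  simp only [← Finset.sum_mul]
  rw [sum_ddH none _ (ne_zero_of_none (by simpa using hX)), zero_mul]; rfl

theorem PX_pt {n : ℕ} (g : Eu n → ℝ) (x : Eu n) (t : ℝ) : PX g (pt x t) = ∫ y, Hk none (pt (x - y) t) * g y := by
  unfold PX kI
  simp only [pt_sub, sub_zero]

theorem exists_pt {n : ℕ} (X : Vu n) : ∃ x : Eu n, X = pt x (X none) :=
  ⟨WithLp.toLp 2 fun j => X (some j), by ext o; cases o <;> simp⟩

/-- uniform convergence at the boundary -/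
theorem PX_boundary {n : ℕ} {g : Eu n → ℝ} (hg : UniformContinuous g) {M : ℝ} (hM : ∀ x, |g x| ≤ M) {ε : ℝ} (hε : 0 < ε) :
    ∃ δ > 0, ∀ x t, 0 < t → t < δ → |PX g (pt x t) - kap n * g x| ≤ ε := by
  have hM0 : 0 ≤ M := (abs_nonneg _).trans (hM 0)
  -- scaled form
  have e1 : ∀ (x : Eu n) (t : ℝ), 0 < t → PX g (pt x t) - kap n * g x = ∫ z, Hk none (pt z 1) * (g (x - t • z) - g x) := by
    intro x t ht
    have i1 : Integrable fun z : Eu n => Hk none (pt z 1) * g (x - t • z) :=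
      (integrable_pk one_pos).mul_bdd (c := M) (by have := hg.continuous; fun_prop : Continuous fun z => g (x - t • z)).aestronglyMeasurable (ae_of_all _ fun z => hM _)
    have h1 : PX g (pt x t) = ∫ z, Hk none (pt z 1) * g (x - t • z) := by
      rw [PX_pt]
      have h1 := integral_sub_left_eq_self (fun z => Hk none (pt z t) * g (x - z)) volume x
      simp only [sub_sub_cancel] at h1
      rw [h1, ← integral_scale (fun z => Hk none (pt z 1) * g (x - t • z)) ht]
      congr 1; ext z
      have := Hk_scale none ht z 1
      rw [mul_one] at this
      rw [this, smul_smul, mul_inv_cancel₀ ht.ne', one_smul, mul_assoc]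
    simp only [mul_sub]
    rw [integral_sub i1 ((integrable_pk one_pos).mul_const _), integral_mul_const, h1]; rfl
  obtain ⟨δ0, hδ0, hd⟩ := Metric.uniformContinuous_iff.1 hg (ε / (2 * kap n)) (by have := kap_pos n; positivity)
  -- tail
  have htail : Tendsto (fun N : ℕ => ∫ z in {z : Eu n | (N:ℝ) ≤ ‖z‖}, Hk none (pt z 1)) atTop (nhds 0) := by
    have hanti : Antitone fun N : ℕ => {z : Eu n | (N:ℝ) ≤ ‖z‖} := fun a b hab z hz => by
      have : (a:ℝ) ≤ b := by exact_mod_cast hab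
      exact this.trans hz
    have := tendsto_setIntegral_of_antitone (μ := volume) (f := fun z : Eu n => Hk none (pt z 1)) (s := fun N : ℕ => {z : Eu n | (N:ℝ) ≤ ‖z‖})
      (fun N => measurableSet_le measurable_const measurable_norm) hanti ⟨0, (integrable_pk one_pos).integrableOn⟩
    have hemp : (⋂ N : ℕ, {z : Eu n | (N:ℝ) ≤ ‖z‖}) = ∅ := by
      rw [eq_empty_iff_forall_notMem]; intro z hz
      obtain ⟨N, hN⟩ := exists_nat_gt ‖z‖
      exact absurd (mem_iInter.1 hz N) (not_le.2 hN)
    rwa [hemp, setIntegral_empty] at this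
  obtain ⟨N, hN⟩ := (htail.eventually (gt_mem_nhds (show 0 < ε / (4 * (M + 1)) by positivity))).exists
  have hκ := kap_pos n
  refine ⟨δ0 / (N + 1), by positivity, fun x t ht htδ => ?_⟩
  rw [e1 x t ht]
  have i0 := integrable_pk (n := n) one_pos
  have hS : MeasurableSet {z : Eu n | (N:ℝ) ≤ ‖z‖} := measurableSet_le measurable_const measurable_norm
  have hb : Integrable (fun z : Eu n => Hk none (pt z 1) * (ε / (2 * kap n)) + 2 * M * ({z : Eu n | (N:ℝ) ≤ ‖z‖}.indicator (fun z => Hk none (pt z 1)) z)) :=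
    intg_add (i0.mul_const _) ((i0.indicator hS).const_mul _)
  rw [← Real.norm_eq_abs]
  refine (norm_integral_le_of_norm_le hb (ae_of_all _ fun z => ?_)).trans ?_
  · have hp := pk_pos one_pos z
    rw [norm_mul, Real.norm_eq_abs, Real.norm_eq_abs, abs_of_pos hp]
    by_cases hz : (N:ℝ) ≤ ‖z‖
    · rw [indicator_of_mem (s := {z : Eu n | (N:ℝ) ≤ ‖z‖}) hz]
      have : |g (x - t • z) - g x| ≤ 2 * M := by
        have := hM (x - t • z); have := hM x
        rw [abs_le] at *; constructor <;> linarith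
      have h2 : Hk none (pt z 1) * |g (x - t • z) - g x| ≤ Hk none (pt z 1) * (2 * M) := by gcongr
      have h3 : 0 < Hk none (pt z 1) * (ε / (2 * kap n)) := by positivity
      linarith
    · rw [indicator_of_notMem (s := {z : Eu n | (N:ℝ) ≤ ‖z‖}) hz, mul_zero, add_zero]
      push Not at hz
      gcongr
      refine (hd (a := x - t • z) (b := x) ?_).le
      rw [dist_eq_norm, sub_sub_cancel_left, norm_neg, norm_smul, Real.norm_eq_abs, abs_of_pos ht]
      calc t * ‖z‖ ≤ t * (N + 1) := by gcongr; linarith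
        _ < δ0 / (N+1) * (N+1) := by gcongr
        _ = δ0 := by field_simp
  · rw [integral_add (i0.mul_const _) ((i0.indicator hS).const_mul _), integral_mul_const, integral_const_mul, integral_indicator hS]
    have e2 : (∫ z : Eu n, Hk none (pt z 1)) * (ε / (2 * kap n)) = ε / 2 := by
      change kap n * _ = _; field_simp
    rw [e2]
    have : 2 * M * ∫ z in {z : Eu n | (N:ℝ) ≤ ‖z‖}, Hk none (pt z 1) ≤ 2 * (M + 1) * (ε / (4 * (M+1))) := by
      have h0 : 0 ≤ ∫ z in {z : Eu n | (N:ℝ) ≤ ‖z‖}, Hk none (pt z 1) := integral_nonneg fun z => (pk_pos one_pos z).le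
      calc _ ≤ 2 * (M+1) * ∫ z in {z : Eu n | (N:ℝ) ≤ ‖z‖}, Hk none (pt z 1) := by gcongr; linarith
        _ ≤ _ := by gcongr
    have e3 : 2 * (M + 1) * (ε / (4 * (M+1))) = ε / 2 := by field_simp; ring
    linarith

theorem PX_abs_le {n : ℕ} {g : Eu n → ℝ} {M : ℝ} (hM : ∀ x, |g x| ≤ M) (x : Eu n) {t : ℝ} (ht : 0 < t) :
    |PX g (pt x t)| ≤ kap n * M := by
  rw [PX_pt, ← Real.norm_eq_abs]
  refine (norm_integral_le_of_norm_le (g := fun y => Hk none (pt (x-y) t) * M) (((integrable_pk ht).comp_sub_left x).mul_const _) (ae_of_all _ fun y => ?_)).trans ?_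
  · have := pk_pos ht (x - y)
    rw [norm_mul, Real.norm_eq_abs, Real.norm_eq_abs, abs_of_pos this]
    gcongr; exact hM y
  · rw [integral_mul_const, integral_pk_sub ht]

/-- decay at infinity -/
theorem PX_decay {n : ℕ} {g : Eu n → ℝ} {A : ℝ} (hA : 0 ≤ A) (hg : ∀ x, |g x| ≤ A * env 1 x) (x : Eu n) {t R : ℝ} (ht : 0 < t)
    (hR : 0 < R) (hX : R ≤ ‖pt x t‖) : |PX g (pt x t)| ≤ A * (((R/2) ^ n)⁻¹ * envC n + kap n * ((R/2) ^ (n+1))⁻¹) := by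
  rw [PX_pt, ← Real.norm_eq_abs]
  have i1 : Integrable fun y : Eu n => ((R/2) ^ n)⁻¹ * env 1 y := integrable_env_one.const_mul _
  have i2 : Integrable fun y : Eu n => Hk none (pt (x-y) t) * ((R/2) ^ (n+1))⁻¹ := ((integrable_pk ht).comp_sub_left x).mul_const _
  refine (norm_integral_le_of_norm_le (g := fun y => A * (((R/2) ^ n)⁻¹ * env 1 y + Hk none (pt (x-y) t) * ((R/2) ^ (n+1))⁻¹)) ((intg_add i1 i2).const_mul _) (ae_of_all _ fun y => ?_)).trans ?_
  · have hp := pk_pos ht (x - y)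
    have he := env_pos one_pos y
    rw [norm_mul, Real.norm_eq_abs, Real.norm_eq_abs, abs_of_pos hp]
    calc Hk none (pt (x-y) t) * |g y| ≤ Hk none (pt (x-y) t) * (A * env 1 y) := by gcongr; exact hg y
      _ = A * (Hk none (pt (x-y) t) * env 1 y) := by ring
      _ ≤ _ := by
        gcongr
        rcases le_total ‖y‖ (R/2) with hy | hy
        · have h1 : R/2 ≤ ‖pt (x-y) t‖ := by
            have e : pt x t = pt (x-y) t + pt y 0 := by
              have := pt_sub x y t 0
              rw [sub_zero] at this; rw [← this]; abel
            have := norm_add_le (pt (x-y) t) (pt y 0)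
            rw [← e] at this
            have h3 := norm_pt_le y 0
            rw [abs_zero, add_zero] at h3
            linarith
          have h2 : Hk none (pt (x-y) t) ≤ ((R/2) ^ n)⁻¹ := by
            refine (le_abs_self _).trans ((abs_Hk_le _ _).trans ?_)
            gcongr
          have h3 : Hk none (pt (x-y) t) * env 1 y ≤ ((R/2) ^ n)⁻¹ * env 1 y := by gcongr
          have h4 : 0 ≤ Hk none (pt (x-y) t) * ((R/2) ^ (n+1))⁻¹ := by positivity
          linarith
        · have h2 : env 1 y ≤ ((R/2)^(n+1))⁻¹ := by
            unfold env; rw [one_div]; gcongr; linarith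
          have h3 : Hk none (pt (x-y) t) * env 1 y ≤ Hk none (pt (x-y) t) * ((R/2)^(n+1))⁻¹ := by gcongr
          have h4 : 0 ≤ ((R/2) ^ n)⁻¹ * env 1 y := by positivity
          linarith
  · rw [integral_const_mul, integral_add i1 i2, integral_const_mul, integral_mul_const, integral_pk_sub ht]
    rfl

/-- asymptotics as `t → ∞` -/
theorem PX_asymp {n : ℕ} {g : Eu n → ℝ} (hg : Integrable g) :
    Tendsto (fun t : ℝ => t ^ n * PX g (pt 0 t)) atTop (nhds (∫ y, g y)) := by
  have e : ∀ t : ℝ, t ^ n * PX g (pt 0 t) = ∫ y, t ^ n * Hk none (pt (0 - y) t) * g y := fun t => by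
    rw [PX_pt, ← integral_const_mul]; congr 1; ext y; ring
  simp only [e]
  have hk : ∀ t : ℝ, 0 < t → ∀ y : Eu n, t ^ n * Hk none (pt (0-y) t) = (t / ‖pt (0-y) t‖) ^ (n+1) := fun t ht y => by
    unfold Hk; rw [pt_none, div_pow]; ring
  have hle : ∀ t : ℝ, 0 < t → ∀ y : Eu n, t / ‖pt (0-y) t‖ ≤ 1 := fun t ht y =>
    div_le_one_of_le₀ ((le_abs_self t).trans (abs_le_norm_pt _ _)) (norm_nonneg _)
  have : ∫ y, g y = ∫ y, 1 * g y := by simp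
  rw [this]
  refine tendsto_integral_filter_of_dominated_convergence (fun y => |g y|) ?_ ?_ hg.abs ?_
  · exact Eventually.of_forall fun t => (((measurable_Hk_pt none t).comp (measurable_const.sub measurable_id)).const_mul _).aestronglyMeasurable.mul hg.1
  · filter_upwards [eventually_gt_atTop 0] with t ht
    refine ae_of_all _ fun y => ?_
    rw [hk t ht, norm_mul, Real.norm_eq_abs, Real.norm_eq_abs]
    have h0 : 0 ≤ t / ‖pt (0-y) t‖ := by positivity
    rw [abs_of_nonneg (by positivity)]
    exact mul_le_of_le_one_left (abs_nonneg _) (pow_le_one₀ h0 (hle t ht y))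
  · refine ae_of_all _ fun y => Tendsto.mul_const _ ?_
    have hlow : Tendsto (fun t : ℝ => (t / (‖y‖ + t)) ^ (n+1)) atTop (nhds 1) := by
      have h1 : Tendsto (fun t : ℝ => 1 - ‖y‖ / (‖y‖ + t)) atTop (nhds (1 - 0)) :=
        tendsto_const_nhds.sub (tendsto_const_nhds.div_atTop (tendsto_atTop_add_const_left _ _ tendsto_id))
      rw [sub_zero] at h1
      have h2 : Tendsto (fun t : ℝ => t / (‖y‖ + t)) atTop (nhds 1) := by
        refine h1.congr' ?_
        filter_upwards [eventually_gt_atTop 0] with t ht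
        have : 0 < ‖y‖ + t := by positivity
        field_simp; ring
      simpa using h2.pow (n+1)
    refine tendsto_of_tendsto_of_tendsto_of_le_of_le' hlow tendsto_const_nhds ?_ ?_
    · filter_upwards [eventually_gt_atTop 0] with t ht
      rw [hk t ht]
      have := norm_pt_le (0 - y) t
      rw [zero_sub, norm_neg, abs_of_pos ht] at this
      have hp := norm_pt_pos (-y) ht
      rw [zero_sub]
      gcongr
    · filter_upwards [eventually_gt_atTop 0] with t ht
      rw [hk t ht]
      have h0 : 0 ≤ t / ‖pt (0-y) t‖ := by positivity
      exact pow_le_one₀ h0 (hle t ht y)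

set_option linter.unusedVariables false

/-! ## Part G: maximum principle and the Green type inequality -/

theorem deriv2_nonpos_of_max {f f' : ℝ → ℝ} {f2 : ℝ} (h1 : ∀ᶠ τ in nhds 0, HasDerivAt f (f' τ) τ)
    (h2 : HasDerivAt f' f2 0) (hmax : IsLocalMax f 0) : f2 ≤ 0 := by
  by_contra hcon
  push Not at hcon
  have hd : deriv f =ᶠ[nhds 0] f' := h1.mono fun τ h => h.deriv
  have hdd : deriv (deriv f) 0 = f2 := by rw [hd.deriv_eq, h2.deriv]
  have h0 : deriv f 0 = 0 := hmax.deriv_eq_zero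
  have hmin := isLocalMin_of_deriv_deriv_pos (f := f) (x₀ := 0) (by rw [hdd]; exact hcon) h0 h1.self_of_nhds.continuousAt
  have hc : f =ᶠ[nhds 0] fun _ => f 0 := by
    filter_upwards [hmax, hmin] with τ a b using le_antisymm a b
  have hc1 : deriv f =ᶠ[nhds 0] fun _ => 0 := by
    refine hc.deriv.trans ?_
    simp
  rw [hc1.deriv_eq] at hdd
  simp at hdd
  linarith

theorem max_principle {n : ℕ} (v : Vu n → ℝ) (hcont : ∀ X : Vu n, 0 < X none → ContinuousAt v X) (m : ℝ)
    (hb : ∀ η > 0, ∃ t1 > 0, ∃ R : ℝ, ∀ X : Vu n, 0 < X none → (X none < t1 ∨ R < ‖X‖) → v X ≤ m + η)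
    (v1 v2 : Option (Fin n) → Vu n → ℝ)
    (hd1 : ∀ i (X : Vu n) (τ : ℝ), 0 < (X + τ • ee i) none → HasDerivAt (fun τ : ℝ => v (X + τ • ee i)) (v1 i (X + τ • ee i)) τ)
    (hd2 : ∀ i (X : Vu n) (τ : ℝ), 0 < (X + τ • ee i) none → HasDerivAt (fun τ : ℝ => v1 i (X + τ • ee i)) (v2 i (X + τ • ee i)) τ)
    (hΔ : ∀ X : Vu n, 0 < X none → 0 ≤ ∑ i, v2 i X) (X0 : Vu n) (hX0 : 0 < X0 none) : v X0 ≤ m := by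
  by_contra hcon
  push Not at hcon
  set γ := (v X0 - m) / 4 with hγ
  have hγ0 : 0 < γ := by rw [hγ]; linarith
  set u : Vu n → ℝ := fun X => v X + γ * Real.exp (-(X none)) with hu
  obtain ⟨t1, ht1, R, hR⟩ := hb γ hγ0
  set K : Set (Vu n) := {X | t1 ≤ X none} ∩ Metric.closedBall 0 R with hK
  have hKc : IsCompact K := by
    refine (isCompact_closedBall (0 : Vu n) R).inter_left ?_
    exact isClosed_le continuous_const (by fun_prop)
  have hX0K : X0 ∈ K := by
    by_contra hn
    have : X0 none < t1 ∨ R < ‖X0‖ := by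
      by_contra h'
      push Not at h'
      exact hn ⟨h'.1, mem_closedBall_zero_iff.2 h'.2⟩
    have := hR X0 hX0 this
    linarith
  have hcu : ContinuousOn u K := fun X hX => by
    refine ContinuousAt.continuousWithinAt ?_
    have := hcont X (ht1.trans_le hX.1)
    rw [hu]
    refine this.add ?_
    fun_prop
  obtain ⟨X1, hX1K, hX1⟩ := hKc.exists_isMaxOn ⟨X0, hX0K⟩ hcu
  have hX1pos : 0 < X1 none := ht1.trans_le hX1K.1
  have hglob : ∀ X : Vu n, 0 < X none → u X ≤ u X1 := by
    intro X hX
    by_cases hXK : X ∈ K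
    · exact hX1 hXK
    · have : X none < t1 ∨ R < ‖X‖ := by
        by_contra h'
        push Not at h'
        exact hXK ⟨h'.1, mem_closedBall_zero_iff.2 h'.2⟩
      have h1 := hR X hX this
      have h2 : u X0 ≤ u X1 := hX1 hX0K
      have h3 : Real.exp (-(X none)) ≤ 1 := Real.exp_le_one_iff.2 (by linarith)
      have h4 : 0 < Real.exp (-(X0 none)) := Real.exp_pos _
      have h5 : γ * Real.exp (-(X none)) ≤ γ := mul_le_of_le_one_right hγ0.le h3
      have h6 : 0 < γ * Real.exp (-(X0 none)) := by positivity
      have e1 : u X = v X + γ * Real.exp (-(X none)) := rfl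
      have e2 : u X0 = v X0 + γ * Real.exp (-(X0 none)) := rfl
      linarith
  have hle : ∀ i, v2 i X1 + γ * ((if none = i then 1 else 0) * Real.exp (-(X1 none))) ≤ 0 := by
    intro i
    have hev : ∀ᶠ τ : ℝ in nhds 0, 0 < (X1 + τ • ee i) none := by
      have : Continuous fun τ : ℝ => (X1 + τ • ee i) none := by fun_prop
      exact (this.tendsto 0).eventually (lt_mem_nhds (by simpa using hX1pos))
    have hE : ∀ τ : ℝ, HasDerivAt (fun τ : ℝ => Real.exp (-((X1 + τ • ee i) none))) (Real.exp (-((X1 + τ • ee i) none)) * (-(if none = i then 1 else 0))) τ :=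
      fun τ => (hasDerivAt_coord i none X1 τ).neg.exp
    have hz : X1 + (0:ℝ) • ee i = X1 := by simp
    have hd2' := hd2 i X1 0 (by rw [hz]; exact hX1pos)
    have := deriv2_nonpos_of_max (f := fun τ : ℝ => u (X1 + τ • ee i))
      (f' := fun τ => v1 i (X1 + τ • ee i) + γ * (Real.exp (-((X1 + τ • ee i) none)) * (-(if none = i then 1 else 0))))
      (f2 := v2 i (X1 + (0:ℝ) • ee i) + γ * ((Real.exp (-((X1 + (0:ℝ) • ee i) none)) * (-(if none = i then 1 else 0))) * (-(if none = i then 1 else 0))))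
      (by
        filter_upwards [hev] with τ hτ
        exact (hd1 i X1 τ hτ).add ((hE τ).const_mul γ))
      (hd2'.add (((hE 0).mul_const _).const_mul γ))
      (by
        filter_upwards [hev] with τ hτ
        rw [hz]
        exact hglob _ hτ)
    rw [hz] at this
    refine le_trans (le_of_eq ?_) this
    split_ifs <;> ring
  have hsum := Finset.sum_nonpos fun i (_ : i ∈ Finset.univ) => hle i
  rw [Finset.sum_add_distrib, ← Finset.mul_sum, ← Finset.sum_mul] at hsum
  simp only [Finset.sum_ite_eq, Finset.mem_univ, if_true, one_mul] at hsum
  have h1 := hΔ X1 hX1pos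
  have h2 : 0 < γ * Real.exp (-(X1 none)) := by positivity
  linarith

/-- symmetric traceless matrices -/
theorem sym_traceless {ι : Type*} [Fintype ι] [DecidableEq ι] {N : ℝ} (hcard : (Fintype.card ι : ℝ) = N + 1) (hN : 1 ≤ N)
    (M : ι → ι → ℝ) (hs : ∀ i k, M i k = M k i) (ht : ∑ i, M i i = 0) (F : ι → ℝ) :
    (N + 1) * ∑ i, (∑ k, F k * M i k) ^ 2 ≤ N * (∑ i, ∑ k, M i k ^ 2) * ∑ k, F k ^ 2 := by
  set f := ∑ k, F k ^ 2 with hf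
  have hf0 : 0 ≤ f := Finset.sum_nonneg fun k _ => sq_nonneg _
  set R := ∑ i, ∑ k, M i k ^ 2 with hR
  have hR0 : 0 ≤ R := Finset.sum_nonneg fun i _ => Finset.sum_nonneg fun k _ => sq_nonneg _
  set m : ι → ℝ := fun i => ∑ k, F k * M i k with hm
  set W := ∑ i, m i ^ 2 with hW
  rcases hf0.eq_or_lt with h0 | h0
  · have hF : ∀ k, F k = 0 := fun k => by
      have := (Finset.sum_eq_zero_iff_of_nonneg (fun k _ => sq_nonneg (F k))).1 h0.symm k (Finset.mem_univ k)
      exact pow_eq_zero_iff two_ne_zero |>.1 this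
    have : W = 0 := by
      rw [hW]; refine Finset.sum_eq_zero fun i _ => ?_
      simp [hm, hF]
    rw [this, ← h0]; simp
  set L := ∑ i, F i * m i with hL
  set lam := L / f with hlam
  have hLf : L = lam * f := by rw [hlam]; field_simp
  set μ := - lam / N with hμ
  set α := (- lam - μ) / f with hα
  have hN0 : 0 < N := by linarith
  have hμ' : N * μ = - lam := by rw [hμ]; field_simp
  have hα' : α * f = - lam - μ := by rw [hα]; field_simp
  have e1 : ∀ i, ∑ k, (M i k - F i / f * m k - (m i / f + α * F i) * F k - μ * (if i = k then 1 else 0)) ^ 2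
      = ∑ k, M i k ^ 2 - 2 * (F i / f) * (∑ k, M i k * m k) - 2 * (m i / f + α * F i) * m i - 2 * μ * M i i
        + (F i / f) ^ 2 * W + (m i / f + α * F i) ^ 2 * f + μ ^ 2 + 2 * (F i / f) * (m i / f + α * F i) * L
        + 2 * μ * (F i / f) * m i + 2 * μ * (m i / f + α * F i) * F i := by
    intro i
    set x := F i / f
    set y := m i / f + α * F i
    have ex : ∀ k, (M i k - x * m k - y * F k - μ * (if i = k then 1 else 0)) ^ 2 =
        M i k ^ 2 - 2 * x * (M i k * m k) - 2 * y * (F k * M i k) - 2 * μ * (M i k * if i = k then 1 else 0)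
        + x ^ 2 * m k ^ 2 + y ^ 2 * F k ^ 2 + μ ^ 2 * (if i = k then 1 else 0) + 2 * x * y * (F k * m k)
        + 2 * μ * x * (m k * if i = k then 1 else 0) + 2 * μ * y * (F k * if i = k then 1 else 0) := by
      intro k; split_ifs <;> ring
    simp only [ex, Finset.sum_add_distrib, Finset.sum_sub_distrib, ← Finset.mul_sum]
    simp only [mul_ite, mul_one, mul_zero, Finset.sum_ite_eq, Finset.mem_univ, if_true]
    rw [← hf, ← hL, ← hW]
  have e2 : ∑ i, F i * (∑ k, M i k * m k) = W := by
    simp only [Finset.mul_sum]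
    rw [Finset.sum_comm, hW]
    refine Finset.sum_congr rfl fun k _ => ?_
    rw [sq]
    conv_rhs => rw [hm]
    simp only [Finset.sum_mul]
    have : (∑ j, F j * M k j * ∑ l, F l * M k l) = ∑ j, F j * (M j k * m k) := by
      refine Finset.sum_congr rfl fun j _ => ?_
      rw [hs k j]; ring
    rw [this]
  have hnn : 0 ≤ ∑ i, ∑ k, (M i k - F i / f * m k - (m i / f + α * F i) * F k - μ * (if i = k then 1 else 0)) ^ 2 :=
    Finset.sum_nonneg fun i _ => Finset.sum_nonneg fun k _ => sq_nonneg _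
  simp only [e1] at hnn
  have e3 : ∀ i, ∑ k, M i k ^ 2 - 2 * (F i / f) * (∑ k, M i k * m k) - 2 * (m i / f + α * F i) * m i - 2 * μ * M i i
        + (F i / f) ^ 2 * W + (m i / f + α * F i) ^ 2 * f + μ ^ 2 + 2 * (F i / f) * (m i / f + α * F i) * L
        + 2 * μ * (F i / f) * m i + 2 * μ * (m i / f + α * F i) * F i =
      ∑ k, M i k ^ 2 - 2 / f * (F i * ∑ k, M i k * m k) + (-2 / f + 1 / f) * m i ^ 2 + (-2 * α + 2 * α + 2 * L / f ^ 2 + 2 * μ / f + 2 * μ / f) * (F i * m i) - 2 * μ * M i i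
       + (W / f ^ 2 + α ^ 2 * f + 2 * α * L / f + 2 * μ * α) * F i ^ 2 + μ ^ 2 := by
    intro i
    generalize (∑ k, M i k ^ 2) = a1
    generalize (∑ k, M i k * m k) = a2
    field_simp
    ring
  simp only [e3, Finset.sum_add_distrib, Finset.sum_sub_distrib, ← Finset.mul_sum] at hnn
  rw [e2, ← hW, ← hL, ht, ← hf, ← hR, Finset.sum_const, Finset.card_univ, nsmul_eq_mul, hcard] at hnn
  have e4 : R - 2 / f * W + (-2 / f + 1 / f) * W + (-2 * α + 2 * α + 2 * L / f ^ 2 + 2 * μ / f + 2 * μ / f) * L - 2 * μ * 0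
       + (W / f ^ 2 + α ^ 2 * f + 2 * α * L / f + 2 * μ * α) * f + (N + 1) * μ ^ 2
      = R - 2 * (W / f) + 2 * lam ^ 2 + 4 * μ * lam + (α * f) ^ 2 + 2 * (α * f) * lam + 2 * μ * (α * f) + N * μ * μ + μ ^ 2 := by
    rw [hLf]; field_simp; ring
  rw [e4, hα', hμ'] at hnn
  -- R ≥ 2 W/f - lam² - ...
  have hcs : lam ^ 2 ≤ W / f := by
    have := Finset.sum_mul_sq_le_sq_mul_sq Finset.univ F m
    rw [← hL, ← hf, ← hW, hLf] at this
    rw [le_div_iff₀ h0]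
    have h3 : lam ^ 2 * f * f ≤ W * f := by nlinarith
    exact le_of_mul_le_mul_right h3 h0
  have h5 : 0 ≤ N * R - 2 * N * (W / f) + (N - 1) * lam ^ 2 := by
    have : N * (R - 2 * (W / f) + 2 * lam ^ 2 + 4 * μ * lam + (-lam - μ) ^ 2 + 2 * (-lam - μ) * lam + 2 * μ * (-lam - μ) + -lam * μ + μ ^ 2)
        = N * R - 2 * N * (W/f) + N * lam ^ 2 + (N * μ) * lam := by ring
    have h6 := mul_nonneg hN0.le hnn
    rw [this, hμ'] at h6
    linarith
  have h7 : (N + 1) * (W / f) ≤ N * R := by nlinarith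
  have h8 : (N + 1) * (W / f) * f ≤ N * R * f := by gcongr
  have : (N + 1) * (W / f) * f = (N + 1) * W := by field_simp
  linarith

set_option linter.unusedVariables false

/-- Auxiliary function, first and second derivatives, at the level of values. -/
noncomputable def W0 {ι : Type*} [Fintype ι] (o : ι) (ε κ K c : ℝ) (F : ι → ℝ) (Φ Ψ : ℝ) : ℝ :=
  √(ε ^ 2 + ∑ k, F k ^ 2) * (1 + κ * (Ψ + 2 * K) ^ 2) + c * (F o * Φ)

noncomputable def W1 {ι : Type*} [Fintype ι] (o : ι) (ε κ K c : ℝ) (F M : ι → ℝ) (Φ Φ1 Ψ Ψ1 : ℝ) : ℝ :=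
  (∑ k, F k * M k) / √(ε ^ 2 + ∑ k, F k ^ 2) * (1 + κ * (Ψ + 2 * K) ^ 2)
    + √(ε ^ 2 + ∑ k, F k ^ 2) * (2 * κ * (Ψ + 2 * K) * Ψ1) + c * (M o * Φ + F o * Φ1)

noncomputable def W2 {ι : Type*} [Fintype ι] (o : ι) (ε κ K c : ℝ) (F M F2 : ι → ℝ) (Φ Φ1 Φ2 Ψ Ψ1 Ψ2 : ℝ) : ℝ :=
  (((∑ k, M k ^ 2) + ∑ k, F k * F2 k) / √(ε ^ 2 + ∑ k, F k ^ 2)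
      - (∑ k, F k * M k) ^ 2 / √(ε ^ 2 + ∑ k, F k ^ 2) ^ 3) * (1 + κ * (Ψ + 2 * K) ^ 2)
    + 2 * ((∑ k, F k * M k) / √(ε ^ 2 + ∑ k, F k ^ 2)) * (2 * κ * (Ψ + 2 * K) * Ψ1)
    + √(ε ^ 2 + ∑ k, F k ^ 2) * (2 * κ * Ψ1 ^ 2 + 2 * κ * (Ψ + 2 * K) * Ψ2)
    + c * (F2 o * Φ + 2 * (M o * Φ1) + F o * Φ2)

theorem hasDerivAt_sqrtF {ι : Type*} [Fintype ι] {ε : ℝ} (hε : 0 < ε) {F M : ι → ℝ → ℝ} {τ : ℝ}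
    (hF : ∀ k, HasDerivAt (F k) (M k τ) τ) :
    HasDerivAt (fun τ => √(ε ^ 2 + ∑ k, F k τ ^ 2)) ((∑ k, F k τ * M k τ) / √(ε ^ 2 + ∑ k, F k τ ^ 2)) τ := by
  have h1 : HasDerivAt (fun τ => ε ^ 2 + ∑ k, F k τ ^ 2) (∑ k, 2 * (F k τ * M k τ)) τ := by
    refine (HasDerivAt.fun_sum (u := Finset.univ) (A := fun k τ => F k τ ^ 2) (A' := fun k => 2 * (F k τ * M k τ)) fun k _ => ?_).const_add _
    exact ((hF k).fun_pow 2).congr_deriv (by push_cast; ring)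
  have hp : 0 < ε ^ 2 + ∑ k, F k τ ^ 2 := by
    have : 0 ≤ ∑ k, F k τ ^ 2 := Finset.sum_nonneg fun k _ => sq_nonneg _
    positivity
  refine (h1.sqrt hp.ne').congr_deriv ?_
  rw [← Finset.mul_sum]; field_simp

theorem hasDerivAt_W0 {ι : Type*} [Fintype ι] (o : ι) {ε : ℝ} (hε : 0 < ε) (κ K c : ℝ) {F M : ι → ℝ → ℝ}
    {Φ Φ1 Ψ Ψ1 : ℝ → ℝ} {τ : ℝ}
    (hF : ∀ k, HasDerivAt (F k) (M k τ) τ) (hΦ : HasDerivAt Φ (Φ1 τ) τ) (hΨ : HasDerivAt Ψ (Ψ1 τ) τ) :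
    HasDerivAt (fun τ => W0 o ε κ K c (fun k => F k τ) (Φ τ) (Ψ τ))
      (W1 o ε κ K c (fun k => F k τ) (fun k => M k τ) (Φ τ) (Φ1 τ) (Ψ τ) (Ψ1 τ)) τ := by
  have h1 := hasDerivAt_sqrtF hε hF
  have h2 : HasDerivAt (fun τ => 1 + κ * (Ψ τ + 2 * K) ^ 2) (2 * κ * (Ψ τ + 2 * K) * Ψ1 τ) τ :=
    ((((hΨ.add_const (2 * K)).fun_pow 2).const_mul κ).const_add 1).congr_deriv (by push_cast; ring)
  exact ((h1.fun_mul h2).fun_add (((hF o).fun_mul hΦ).const_mul c)).congr_deriv (by simp only [W1])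

theorem hasDerivAt_W1 {ι : Type*} [Fintype ι] (o : ι) {ε : ℝ} (hε : 0 < ε) (κ K c : ℝ) {F M F2 : ι → ℝ → ℝ}
    {Φ Φ1 Φ2 Ψ Ψ1 Ψ2 : ℝ → ℝ} {τ : ℝ}
    (hF : ∀ k, HasDerivAt (F k) (M k τ) τ) (hM : ∀ k, HasDerivAt (M k) (F2 k τ) τ)
    (hΦ : HasDerivAt Φ (Φ1 τ) τ) (hΦ1 : HasDerivAt Φ1 (Φ2 τ) τ) (hΨ : HasDerivAt Ψ (Ψ1 τ) τ) (hΨ1 : HasDerivAt Ψ1 (Ψ2 τ) τ) :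
    HasDerivAt (fun τ => W1 o ε κ K c (fun k => F k τ) (fun k => M k τ) (Φ τ) (Φ1 τ) (Ψ τ) (Ψ1 τ))
      (W2 o ε κ K c (fun k => F k τ) (fun k => M k τ) (fun k => F2 k τ) (Φ τ) (Φ1 τ) (Φ2 τ) (Ψ τ) (Ψ1 τ) (Ψ2 τ)) τ := by
  have h1 := hasDerivAt_sqrtF hε hF
  have h2 : HasDerivAt (fun τ => 1 + κ * (Ψ τ + 2 * K) ^ 2) (2 * κ * (Ψ τ + 2 * K) * Ψ1 τ) τ :=
    ((((hΨ.add_const (2 * K)).fun_pow 2).const_mul κ).const_add 1).congr_deriv (by push_cast; ring)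
  have h3 : HasDerivAt (fun τ => 2 * κ * (Ψ τ + 2 * K) * Ψ1 τ) (2 * κ * Ψ1 τ ^ 2 + 2 * κ * (Ψ τ + 2 * K) * Ψ2 τ) τ :=
    ((((hΨ.add_const (2 * K)).const_mul (2 * κ))).fun_mul hΨ1).congr_deriv (by ring)
  have h4 : HasDerivAt (fun τ => ∑ k, F k τ * M k τ) ((∑ k, M k τ ^ 2) + ∑ k, F k τ * F2 k τ) τ := by
    refine (HasDerivAt.fun_sum (u := Finset.univ) (A := fun k τ => F k τ * M k τ) (A' := fun k => M k τ ^ 2 + F k τ * F2 k τ) fun k _ => ?_).congr_deriv ?_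
    · exact ((hF k).fun_mul (hM k)).congr_deriv (by ring)
    · rw [Finset.sum_add_distrib]
  have hp : 0 < ε ^ 2 + ∑ k, F k τ ^ 2 := by
    have : 0 ≤ ∑ k, F k τ ^ 2 := Finset.sum_nonneg fun k _ => sq_nonneg _
    positivity
  have hr : √(ε ^ 2 + ∑ k, F k τ ^ 2) ≠ 0 := (Real.sqrt_pos.2 hp).ne'
  have h5 := h4.fun_div h1 hr
  have h6 : HasDerivAt (fun τ => c * (M o τ * Φ τ + F o τ * Φ1 τ)) (c * (F2 o τ * Φ τ + 2 * (M o τ * Φ1 τ) + F o τ * Φ2 τ)) τ :=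
    ((((hM o).fun_mul hΦ).fun_add ((hF o).fun_mul hΦ1)).const_mul c).congr_deriv (by ring)
  refine (((h5.fun_mul h2).fun_add (h1.fun_mul h3)).fun_add h6).congr_deriv ?_
  simp only [W2]
  set r := √(ε ^ 2 + ∑ k, F k τ ^ 2)
  field_simp
  ring

set_option maxHeartbeats 1000000 in
theorem lap_nonneg {ι : Type*} [Fintype ι] [DecidableEq ι] (o : ι) {N : ℝ} (hcard : (Fintype.card ι : ℝ) = N + 1) (hN : 1 ≤ N)
    {ε κ K c : ℝ} (hε : 0 < ε) (hK : 0 < K) (hκ : κ = 1 / (16 * K ^ 2 * (N + 1))) (hc : c ^ 2 = 1 / (8 * K * (N + 1) ^ 2))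
    (F : ι → ℝ) (M F2 : ι → ι → ℝ) (Φ Ψ : ℝ) (Φ1 Φ2 Ψ1 Ψ2 : ι → ℝ)
    (hs : ∀ i k, M i k = M k i) (ht : ∑ i, M i i = 0) (hF2 : ∀ k, ∑ i, F2 i k = 0)
    (hΦ2 : ∑ i, Φ2 i = 0) (hΨ2 : ∑ i, Ψ2 i = 2 * ∑ i, Φ1 i ^ 2) (hΨl : -K ≤ Ψ) (hΨu : Ψ ≤ 0) :
    0 ≤ ∑ i, W2 o ε κ K c F (M i) (F2 i) Φ (Φ1 i) (Φ2 i) Ψ (Ψ1 i) (Ψ2 i) := by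
  have htr := sym_traceless hcard hN M hs ht F
  set f := ∑ k, F k ^ 2 with hf
  have hf0 : 0 ≤ f := Finset.sum_nonneg fun k _ => sq_nonneg _
  set R := ∑ i, ∑ k, M i k ^ 2 with hR
  have hR0 : 0 ≤ R := Finset.sum_nonneg fun i _ => Finset.sum_nonneg fun k _ => sq_nonneg _
  set r := √(ε ^ 2 + f) with hr
  have hr0 : 0 < r := Real.sqrt_pos.2 (by positivity)
  have hrf : f ≤ r ^ 2 := by rw [hr, Real.sq_sqrt (by positivity)]; nlinarith
  set m : ι → ℝ := fun i => ∑ k, F k * M i k with hm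
  set A := ∑ i, m i ^ 2 with hA
  have hA0 : 0 ≤ A := Finset.sum_nonneg fun k _ => sq_nonneg _
  have hN1 : 0 < N + 1 := by linarith
  have hκ0 : 0 < κ := by rw [hκ]; positivity
  set h := 1 + κ * (Ψ + 2 * K) ^ 2 with hh
  have hh1 : 1 ≤ h := by rw [hh]; have : 0 ≤ κ * (Ψ + 2 * K) ^ 2 := by positivity
                         linarith
  set h' := 2 * κ * (Ψ + 2 * K) with hh'
  have hl : 2 * κ * K ≤ h' := by rw [hh']; gcongr; linarith
  have hu : h' ≤ 4 * κ * K := by rw [hh']; nlinarith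
  have hkk : 0 < 2 * κ * K := by positivity
  have hh0 : 0 < h' := by linarith
  -- the two completed squares
  have s1 : ∀ i, - (h' ^ 2 / (2 * κ) * (m i ^ 2 / r ^ 3)) ≤ 2 * (m i / r) * (h' * Ψ1 i) + r * (2 * κ * Ψ1 i ^ 2) := by
    intro i
    have e : 2 * (m i / r) * (h' * Ψ1 i) + r * (2 * κ * Ψ1 i ^ 2) + h' ^ 2 / (2 * κ) * (m i ^ 2 / r ^ 3)
        = r * (2 * κ) * (Ψ1 i + h' * m i / (2 * κ * r ^ 2)) ^ 2 := by field_simp; ring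
    have : 0 ≤ r * (2 * κ) * (Ψ1 i + h' * m i / (2 * κ * r ^ 2)) ^ 2 := by positivity
    linarith
  have s2 : ∀ i, - (c ^ 2 / (2 * h') * (M i o ^ 2 / r)) ≤ 2 * c * (M i o * Φ1 i) + 2 * r * h' * Φ1 i ^ 2 := by
    intro i
    have e : 2 * c * (M i o * Φ1 i) + 2 * r * h' * Φ1 i ^ 2 + c ^ 2 / (2 * h') * (M i o ^ 2 / r)
        = 2 * r * h' * (Φ1 i + c * M i o / (2 * r * h')) ^ 2 := by field_simp; ring
    have : 0 ≤ 2 * r * h' * (Φ1 i + c * M i o / (2 * r * h')) ^ 2 := by positivity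
    linarith
  have t1 := Finset.sum_le_sum fun i (_ : i ∈ Finset.univ) => s1 i
  have t2 := Finset.sum_le_sum fun i (_ : i ∈ Finset.univ) => s2 i
  rw [Finset.sum_neg_distrib, ← Finset.mul_sum, ← Finset.sum_div, ← hA] at t1
  rw [Finset.sum_neg_distrib, ← Finset.mul_sum, ← Finset.sum_div] at t2
  have hMo : ∑ i, M i o ^ 2 ≤ R := by
    rw [hR]
    refine Finset.sum_le_sum fun i _ => ?_
    exact Finset.single_le_sum (f := fun k => M i k ^ 2) (fun k _ => sq_nonneg _) (Finset.mem_univ o)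
  have u0 : A / r ^ 3 ≤ N / (N + 1) * (R / r) := by
    have a1 : (N + 1) * A ≤ N * R * r ^ 2 := htr.trans (by gcongr)
    rw [div_le_iff₀ (by positivity)]
    have : N / (N + 1) * (R / r) * r ^ 3 = N * R * r ^ 2 / (N + 1) := by field_simp
    rw [this, le_div_iff₀ hN1]; linarith
  have u1 : h' ^ 2 / (2 * κ) * (A / r ^ 3) ≤ 1 / (2 * (N + 1)) * (R / r) := by
    have a1 : h' ^ 2 / (2 * κ) ≤ 1 / (2 * (N + 1)) := by
      have : h' ^ 2 ≤ (4 * κ * K) ^ 2 := by gcongr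
      calc h' ^ 2 / (2 * κ) ≤ (4 * κ * K) ^ 2 / (2 * κ) := by gcongr
        _ = 8 * K ^ 2 * κ := by field_simp; ring
        _ = 1 / (2 * (N + 1)) := by rw [hκ]; field_simp; norm_num
    have a2 : A / r ^ 3 ≤ R / r := by
      refine u0.trans ?_
      have : N / (N + 1) ≤ 1 := by rw [div_le_one hN1]; linarith
      calc N / (N + 1) * (R / r) ≤ 1 * (R / r) := by gcongr
        _ = _ := one_mul _
    gcongr
  have u2 : c ^ 2 / (2 * h') * ((∑ i, M i o ^ 2) / r) ≤ 1 / (2 * (N + 1)) * (R / r) := by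
    have a1 : c ^ 2 / (2 * h') ≤ 1 / (2 * (N + 1)) := by
      calc c ^ 2 / (2 * h') ≤ c ^ 2 / (2 * (2 * κ * K)) := by gcongr
        _ = 1 / (2 * (N + 1)) := by rw [hc, hκ]; field_simp; norm_num
    gcongr
  have u3 : 1 / (N + 1) * (R / r) ≤ h * (R / r - A / r ^ 3) := by
    have a1 : 1 / (N + 1) * (R / r) ≤ R / r - A / r ^ 3 := by
      have : 1 / (N + 1) * (R / r) = R / r - N / (N + 1) * (R / r) := by field_simp; ring
      linarith
    have a2 : 0 ≤ R / r - A / r ^ 3 := le_trans (by positivity) a1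
    exact a1.trans (le_mul_of_one_le_left a2 hh1)
  have key : ∑ i, W2 o ε κ K c F (M i) (F2 i) Φ (Φ1 i) (Φ2 i) Ψ (Ψ1 i) (Ψ2 i)
      = h * (R / r - A / r ^ 3) + ∑ i, (2 * (m i / r) * (h' * Ψ1 i) + r * (2 * κ * Ψ1 i ^ 2))
        + ∑ i, (2 * c * (M i o * Φ1 i) + 2 * r * h' * Φ1 i ^ 2) := by
    have e : ∀ i, W2 o ε κ K c F (M i) (F2 i) Φ (Φ1 i) (Φ2 i) Ψ (Ψ1 i) (Ψ2 i)
        = h / r * (∑ k, M i k ^ 2) + h / r * (∑ k, F k * F2 i k) - h / r ^ 3 * m i ^ 2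
          + (2 * (m i / r) * (h' * Ψ1 i) + r * (2 * κ * Ψ1 i ^ 2)) + r * h' * Ψ2 i
          + c * Φ * F2 i o + (2 * c * (M i o * Φ1 i) + 2 * r * h' * Φ1 i ^ 2) - 2 * r * h' * Φ1 i ^ 2
          + c * F o * Φ2 i := by
      intro i
      simp only [W2]
      rw [← hr, ← hh, ← hh']
      have : ∑ k, F k * M i k = m i := rfl
      rw [this]
      ring
    simp only [e]
    have e2 : ∑ i, ∑ k, F k * F2 i k = 0 := by
      rw [Finset.sum_comm]
      refine Finset.sum_eq_zero fun k _ => ?_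
      rw [← Finset.mul_sum, hF2, mul_zero]
    simp only [Finset.sum_add_distrib, Finset.sum_sub_distrib, ← Finset.mul_sum]
    rw [e2, hF2, hΦ2, hΨ2]
    ring
  rw [key]
  have : 1 / (N + 1) * (R / r) = 1 / (2 * (N + 1)) * (R / r) + 1 / (2 * (N + 1)) * (R / r) := by field_simp; norm_num
  linarith

set_option linter.unusedVariables false

noncomputable def srcP {n : ℕ} (p : Eu n × ℝ) : Vu n := pt p.1 (-p.2)
noncomputable def FF {n : ℕ} (s : Finset (Eu n × ℝ)) (c : Eu n × ℝ → ℝ) (k : Option (Fin n)) (X : Vu n) : ℝ :=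
  ∑ p ∈ s, c p * Hk k (X - srcP p)
noncomputable def FFM {n : ℕ} (s : Finset (Eu n × ℝ)) (c : Eu n × ℝ → ℝ) (i k : Option (Fin n)) (X : Vu n) : ℝ :=
  ∑ p ∈ s, c p * dH i k (X - srcP p)
noncomputable def FF2 {n : ℕ} (s : Finset (Eu n × ℝ)) (c : Eu n × ℝ → ℝ) (i k : Option (Fin n)) (X : Vu n) : ℝ :=
  ∑ p ∈ s, c p * ddH i k (X - srcP p)

theorem src_none {n : ℕ} (p : Eu n × ℝ) (X : Vu n) : (X - srcP p) none = X none + p.2 := by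
  simp [srcP, pt_none]

theorem src_le {n : ℕ} (p : Eu n × ℝ) {X : Vu n} (hX : 0 ≤ X none) : p.2 ≤ ‖X - srcP p‖ := by
  have h1 : |(X - srcP p) none| ≤ ‖X - srcP p‖ := abs_coord_le _ _
  rw [src_none] at h1
  exact le_trans (by linarith [le_abs_self (X none + p.2)]) h1

theorem src_ne {n : ℕ} {p : Eu n × ℝ} (hp : 0 < p.2) {X : Vu n} (hX : 0 ≤ X none) : X - srcP p ≠ 0 := by
  intro h
  have := src_le p hX
  rw [h, norm_zero] at this; linarith

theorem FF_hasDerivAt {n : ℕ} {s : Finset (Eu n × ℝ)} (c : Eu n × ℝ → ℝ) (hs : ∀ p ∈ s, 0 < p.2) (i k : Option (Fin n))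
    (X : Vu n) (τ : ℝ) (hX : 0 < (X + τ • ee i) none) :
    HasDerivAt (fun τ : ℝ => FF s c k (X + τ • ee i)) (FFM s c i k (X + τ • ee i)) τ := by
  refine HasDerivAt.fun_sum fun p hp => ?_
  refine HasDerivAt.const_mul _ ?_
  have e : ∀ τ : ℝ, X + τ • ee i - srcP p = (X - srcP p) + τ • ee i := fun τ => by abel
  have h := hasDerivAt_Hk i k (X - srcP p) τ (by rw [← e]; exact src_ne (hs p hp) hX.le)
  simp only [e]; exact h

theorem FFM_hasDerivAt {n : ℕ} {s : Finset (Eu n × ℝ)} (c : Eu n × ℝ → ℝ) (hs : ∀ p ∈ s, 0 < p.2) (i k : Option (Fin n))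
    (X : Vu n) (τ : ℝ) (hX : 0 < (X + τ • ee i) none) :
    HasDerivAt (fun τ : ℝ => FFM s c i k (X + τ • ee i)) (FF2 s c i k (X + τ • ee i)) τ := by
  refine HasDerivAt.fun_sum fun p hp => ?_
  refine HasDerivAt.const_mul _ ?_
  have e : ∀ τ : ℝ, X + τ • ee i - srcP p = (X - srcP p) + τ • ee i := fun τ => by abel
  have h := hasDerivAt_dH i k (X - srcP p) τ (by rw [← e]; exact src_ne (hs p hp) hX.le)
  simp only [e]; exact h

theorem FFM_comm {n : ℕ} (s : Finset (Eu n × ℝ)) (c : Eu n × ℝ → ℝ) (i k : Option (Fin n)) (X : Vu n) :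
    FFM s c i k X = FFM s c k i X := by
  simp only [FFM, dH_comm i k]

theorem sum_FFM {n : ℕ} {s : Finset (Eu n × ℝ)} (c : Eu n × ℝ → ℝ) (hs : ∀ p ∈ s, 0 < p.2) {X : Vu n} (hX : 0 ≤ X none) :
    ∑ i, FFM s c i i X = 0 := by
  simp only [FFM]
  rw [Finset.sum_comm]
  refine Finset.sum_eq_zero fun p hp => ?_
  rw [← Finset.mul_sum, sum_dH _ (src_ne (hs p hp) hX), mul_zero]

theorem sum_FF2 {n : ℕ} {s : Finset (Eu n × ℝ)} (c : Eu n × ℝ → ℝ) (hs : ∀ p ∈ s, 0 < p.2) {X : Vu n} (hX : 0 ≤ X none)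
    (k : Option (Fin n)) : ∑ i, FF2 s c i k X = 0 := by
  simp only [FF2]
  rw [Finset.sum_comm]
  refine Finset.sum_eq_zero fun p hp => ?_
  rw [← Finset.mul_sum, sum_ddH _ _ (src_ne (hs p hp) hX), mul_zero]

theorem FF_lip {n : ℕ} {s : Finset (Eu n × ℝ)} (c : Eu n × ℝ → ℝ) (hs : ∀ p ∈ s, 0 < p.2) :
    ∃ B : ℝ, 0 ≤ B ∧ ∀ (k : Option (Fin n)) (X X' : Vu n), 0 ≤ X none → 0 ≤ X' none → |FF s c k X - FF s c k X'| ≤ B * ‖X - X'‖ := by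
  refine ⟨∑ p ∈ s, |c p| * ((n + 2) / p.2 ^ (n + 1)), Finset.sum_nonneg fun p hp => ?_, fun k X X' h h' => ?_⟩
  · have := hs p hp; positivity
  · have e : FF s c k X - FF s c k X' = ∑ p ∈ s, c p * (Hk k (X - srcP p) - Hk k (X' - srcP p)) := by
      simp only [FF, mul_sub, Finset.sum_sub_distrib]
    rw [e, Finset.sum_mul]
    refine (Finset.abs_sum_le_sum_abs _ _).trans (Finset.sum_le_sum fun p hp => ?_)
    rw [abs_mul, mul_assoc]
    refine mul_le_mul_of_nonneg_left ?_ (abs_nonneg _)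
    have := abs_Hk_sub_le k (hs p hp) (src_le p h) (src_le p h')
    rw [sub_sub_sub_cancel_right] at this
    rw [div_mul_eq_mul_div]; exact this

theorem src_lower {n : ℕ} {p : Eu n × ℝ} (hp : 0 < p.2) {X : Vu n} (hX : 0 ≤ X none) :
    1 + ‖X‖ ≤ (1 + (1 + ‖srcP p‖) / p.2) * ‖X - srcP p‖ := by
  have h1 := src_le p hX
  have h2 : ‖X‖ ≤ ‖X - srcP p‖ + ‖srcP p‖ := by
    have := norm_add_le (X - srcP p) (srcP p); simpa using this
  have h3 : (1 + ‖srcP p‖) ≤ (1 + ‖srcP p‖) / p.2 * ‖X - srcP p‖ := by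
    rw [div_mul_eq_mul_div, le_div_iff₀ hp]
    exact mul_le_mul_of_nonneg_left h1 (by positivity)
  linarith

theorem FF_decay {n : ℕ} {s : Finset (Eu n × ℝ)} (c : Eu n × ℝ → ℝ) (hs : ∀ p ∈ s, 0 < p.2) (h0 : ∑ p ∈ s, c p = 0) :
    ∃ A : ℝ, 0 ≤ A ∧ ∀ (k : Option (Fin n)) (X : Vu n), 0 ≤ X none → |FF s c k X| ≤ A * ((1 + ‖X‖) ^ (n + 1))⁻¹ := by
  set q : Eu n × ℝ := (0, 1) with hq
  have hq0 : 0 < q.2 := by simp [hq]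
  set D : Eu n × ℝ → ℝ := fun p => 1 + (1 + ‖srcP p‖) / p.2 with hD
  have hDp : ∀ p, 0 < p.2 → 0 < D p := fun p hp => by simp only [hD]; positivity
  refine ⟨∑ p ∈ s, |c p| * ((n + 2) * ‖srcP q - srcP p‖ * (D p + D q) ^ (n + 1)), Finset.sum_nonneg fun p hp => ?_, fun k X h => ?_⟩
  · have := hDp p (hs p hp); have := hDp q hq0; positivity
  · have e : FF s c k X = ∑ p ∈ s, c p * (Hk k (X - srcP p) - Hk k (X - srcP q)) := by
      simp only [FF, mul_sub, Finset.sum_sub_distrib]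
      rw [← Finset.sum_mul, h0]; ring
    rw [e, Finset.sum_mul]
    refine (Finset.abs_sum_le_sum_abs _ _).trans (Finset.sum_le_sum fun p hp => ?_)
    rw [abs_mul, mul_assoc]
    refine mul_le_mul_of_nonneg_left ?_ (abs_nonneg _)
    have d1 := hDp p (hs p hp)
    have d2 := hDp q hq0
    have hm : ∀ r : Eu n × ℝ, 0 < r.2 → D r ≤ D p + D q → (1 + ‖X‖) / (D p + D q) ≤ ‖X - srcP r‖ := by
      intro r hr hle
      rw [div_le_iff₀ (by positivity)]
      have := src_lower hr h
      calc 1 + ‖X‖ ≤ D r * ‖X - srcP r‖ := this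
        _ ≤ (D p + D q) * ‖X - srcP r‖ := by gcongr
        _ = _ := by ring
    have := abs_Hk_sub_le k (m := (1 + ‖X‖) / (D p + D q)) (by positivity) (hm p (hs p hp) (by linarith)) (hm q hq0 (by linarith))
    rw [sub_sub_sub_cancel_left] at this
    refine this.trans (le_of_eq ?_)
    rw [div_pow]; field_simp

noncomputable def FV {n : ℕ} (s : Finset (Eu n × ℝ)) (c : Eu n × ℝ → ℝ) (X : Vu n) : Vu n := WithLp.toLp 2 fun k => FF s c k X

theorem norm_FV {n : ℕ} (s : Finset (Eu n × ℝ)) (c : Eu n × ℝ → ℝ) (X : Vu n) : ‖FV s c X‖ = √(∑ k, FF s c k X ^ 2) := by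
  rw [EuclideanSpace.norm_eq]; simp [FV]

theorem norm_le_sum_coord {n : ℕ} (v : Vu n) : ‖v‖ ≤ ∑ k, |v k| := by
  rw [EuclideanSpace.norm_eq]
  refine Real.sqrt_le_iff.2 ⟨Finset.sum_nonneg fun k _ => abs_nonneg _, ?_⟩
  simp only [Real.norm_eq_abs]
  exact Finset.sum_sq_le_sq_sum_of_nonneg fun k _ => abs_nonneg _

theorem FV_lip {n : ℕ} {s : Finset (Eu n × ℝ)} (c : Eu n × ℝ → ℝ) (hs : ∀ p ∈ s, 0 < p.2) :
    ∃ B : ℝ, 0 ≤ B ∧ ∀ (X X' : Vu n), 0 ≤ X none → 0 ≤ X' none → ‖FV s c X - FV s c X'‖ ≤ B * ‖X - X'‖ := by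
  obtain ⟨B, hB, h⟩ := FF_lip c hs
  refine ⟨∑ k : Option (Fin n), B, Finset.sum_nonneg fun _ _ => hB, fun X X' hX hX' => ?_⟩
  refine (norm_le_sum_coord _).trans ?_
  rw [Finset.sum_mul]
  exact Finset.sum_le_sum fun k _ => h k X X' hX hX'

theorem FV_decay {n : ℕ} {s : Finset (Eu n × ℝ)} (c : Eu n × ℝ → ℝ) (hs : ∀ p ∈ s, 0 < p.2) (h0 : ∑ p ∈ s, c p = 0) :
    ∃ A : ℝ, 0 ≤ A ∧ ∀ (X : Vu n), 0 ≤ X none → ‖FV s c X‖ ≤ A * ((1 + ‖X‖) ^ (n + 1))⁻¹ := by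
  obtain ⟨B, hB, h⟩ := FF_decay c hs h0
  refine ⟨∑ k : Option (Fin n), B, Finset.sum_nonneg fun _ _ => hB, fun X hX => ?_⟩
  refine (norm_le_sum_coord _).trans ?_
  rw [Finset.sum_mul]
  exact Finset.sum_le_sum fun k _ => h k X hX

theorem FF_le_FV {n : ℕ} (s : Finset (Eu n × ℝ)) (c : Eu n × ℝ → ℝ) (k : Option (Fin n)) (X : Vu n) : |FF s c k X| ≤ ‖FV s c X‖ :=
  abs_coord_le (FV s c X) k

noncomputable def psC (n : ℕ) : ℝ := (kap n)⁻¹ * (2 ^ (n + 1) * (tailC n * (18 + (2 + 2 ^ n) ^ 2 + 4 ^ n))) + 1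

theorem psC_pos (n : ℕ) : 0 < psC n := by
  have := kap_pos n
  have := tailC_nonneg n
  unfold psC; positivity

theorem pk_mul_integrable {n : ℕ} {t : ℝ} (ht : 0 < t) (x : Eu n) {f : Eu n → ℝ} {M : ℝ} (hf : Measurable f) (hM : ∀ x, |f x| ≤ M) :
    Integrable (fun y => Hk none (pt (x - y) t) * f y) := by
  have h1 : Integrable (fun y : Eu n => Hk none (pt (x - y) t)) := (integrable_pk ht).comp_sub_left x
  exact h1.mul_bdd (c := M) hf.aestronglyMeasurable (ae_of_all _ fun y => by rw [Real.norm_eq_abs]; exact hM y)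

/-- The two-sided bound for the variance of the Poisson extension. -/
theorem psi_bound {n : ℕ} {φ : Eu n → ℝ} {b M : ℝ} (hb : 0 < b) (hφ : BMOB φ b) (hc : UniformContinuous φ) (hM : ∀ x, |φ x| ≤ M)
    (X : Vu n) (hX : 0 < X none) :
    -(psC n * b ^ 2) ≤ ((kap n)⁻¹ * PX φ X) ^ 2 - (kap n)⁻¹ * PX (fun x => φ x ^ 2) X ∧
    ((kap n)⁻¹ * PX φ X) ^ 2 - (kap n)⁻¹ * PX (fun x => φ x ^ 2) X ≤ 0 := by
  obtain ⟨x, hx⟩ := exists_pt X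
  set t := X none with ht
  have hk := kap_pos n
  rw [hx, PX_pt, PX_pt]
  have hm : Measurable φ := hc.continuous.measurable
  have i1 := pk_mul_integrable hX x hm hM
  have i2 : Integrable (fun y => Hk none (pt (x - y) t) * φ y ^ 2) := pk_mul_integrable hX x (hm.pow_const 2) (M := M ^ 2)
    (fun y => by rw [abs_pow]; exact pow_le_pow_left₀ (abs_nonneg _) (hM y) 2)
  have i0 : Integrable (fun y : Eu n => Hk none (pt (x - y) t)) := (integrable_pk hX).comp_sub_left x
  set a := cAvg φ x t
  obtain ⟨j1, j2⟩ := BMOB.tail_two hb hφ hc hM x hX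
  have e : ∀ y, Hk none (pt (x - y) t) * (φ y - a) ^ 2 = Hk none (pt (x - y) t) * φ y ^ 2 - 2 * a * (Hk none (pt (x - y) t) * φ y)
      + a ^ 2 * Hk none (pt (x - y) t) := fun y => by ring
  have i3 : Integrable (fun y => Hk none (pt (x - y) t) * φ y ^ 2 - 2 * a * (Hk none (pt (x - y) t) * φ y)) := intg_sub i2 (i1.const_mul _)
  have i4 : Integrable (fun y => Hk none (pt (x - y) t) * (φ y - a) ^ 2) := by
    simp only [e]
    exact intg_add i3 (i0.const_mul _)
  have hI : ∫ y, Hk none (pt (x - y) t) * (φ y - a) ^ 2 ≤ 2 ^ (n + 1) * (tailC n * ((18 + (2 + 2 ^ n) ^ 2 + 4 ^ n) * b ^ 2)) := by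
    calc _ ≤ ∫ y, 2 ^ (n + 1) * (env t (x - y) * (φ y - a) ^ 2) := by
          refine integral_mono i4 (j1.const_mul _) fun y => ?_
          have := pk_le hX (x - y)
          have h2 : 0 ≤ (φ y - a) ^ 2 := sq_nonneg _
          calc Hk none (pt (x - y) t) * (φ y - a) ^ 2 ≤ 2 ^ (n + 1) * env t (x - y) * (φ y - a) ^ 2 := by gcongr
            _ = _ := by ring
      _ = 2 ^ (n + 1) * ∫ y, (env t (x - y) * (φ y - a) ^ 2) := integral_const_mul _ _
      _ ≤ _ := by gcongr
  have e2 : ∫ y, Hk none (pt (x - y) t) * (φ y - a) ^ 2 = (∫ y, Hk none (pt (x - y) t) * φ y ^ 2) - 2 * a * (∫ y, Hk none (pt (x - y) t) * φ y)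
      + a ^ 2 * kap n := by
    simp only [e]
    rw [integral_add i3 (i0.const_mul _), integral_sub i2 (i1.const_mul _), integral_const_mul, integral_const_mul, integral_pk_sub hX]
  have hj := jensen_pk hX x i1 i2
  set P := ∫ y, Hk none (pt (x - y) t) * φ y
  set Q := ∫ y, Hk none (pt (x - y) t) * φ y ^ 2
  constructor
  · rw [e2] at hI
    have h1 := mul_le_mul_of_nonneg_left hI (inv_nonneg.2 hk.le)
    have e3 : (kap n)⁻¹ * (Q - 2 * a * P + a ^ 2 * kap n) = (kap n)⁻¹ * Q - ((kap n)⁻¹ * P) ^ 2 + ((kap n)⁻¹ * P - a) ^ 2 := by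
      field_simp; ring
    rw [e3] at h1
    have e4 : psC n * b ^ 2 = (kap n)⁻¹ * (2 ^ (n + 1) * (tailC n * ((18 + (2 + 2 ^ n) ^ 2 + 4 ^ n) * b ^ 2))) + b ^ 2 := by
      unfold psC; ring
    rw [e4]
    nlinarith [sq_nonneg ((kap n)⁻¹ * P - a), sq_nonneg b]
  · have : ((kap n)⁻¹ * P) ^ 2 ≤ (kap n)⁻¹ * Q := by
      calc ((kap n)⁻¹ * P) ^ 2 = (kap n)⁻¹ ^ 2 * P ^ 2 := by ring
        _ ≤ (kap n)⁻¹ ^ 2 * (kap n * Q) := by gcongr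
        _ = _ := by field_simp
    linarith

set_option linter.unusedVariables false

theorem uc_mul_bdd {n : ℕ} {f g : Eu n → ℝ} {A B : ℝ} (hf : UniformContinuous f) (hg : UniformContinuous g) (hA : ∀ x, |f x| ≤ A) (hB : ∀ x, |g x| ≤ B) :
    UniformContinuous (fun x => f x * g x) := by
  have hA0 : 0 ≤ A := (abs_nonneg _).trans (hA 0)
  have hB0 : 0 ≤ B := (abs_nonneg _).trans (hB 0)
  rw [Metric.uniformContinuous_iff] at *
  intro ε hε
  obtain ⟨d1, hd1, h1⟩ := hf (ε / (2 * (B + 1))) (by positivity)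
  obtain ⟨d2, hd2, h2⟩ := hg (ε / (2 * (A + 1))) (by positivity)
  refine ⟨min d1 d2, lt_min hd1 hd2, fun x y hxy => ?_⟩
  have a1 := h1 (hxy.trans_le (min_le_left _ _))
  have a2 := h2 (hxy.trans_le (min_le_right _ _))
  rw [Real.dist_eq] at *
  have e : f x * g x - f y * g y = (f x - f y) * g x + f y * (g x - g y) := by ring
  rw [e]
  have b1 : |(f x - f y) * g x| ≤ |f x - f y| * (B + 1) := by
    rw [abs_mul]; gcongr; linarith [hB x]
  have b2 : |f y * (g x - g y)| ≤ (A + 1) * |g x - g y| := by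
    rw [abs_mul]; gcongr; linarith [hA y]
  have c1 : |f x - f y| * (B + 1) < ε / 2 := by
    rw [lt_div_iff₀ (by positivity)] at a1; linarith
  have c2 : (A + 1) * |g x - g y| < ε / 2 := by
    rw [lt_div_iff₀ (by positivity)] at a2; linarith
  linarith [abs_add_le ((f x - f y) * g x) (f y * (g x - g y))]

theorem PX_decay' {n : ℕ} (hn : 1 ≤ n) {g : Eu n → ℝ} {A : ℝ} (hA : 0 ≤ A) (hg : ∀ x, |g x| ≤ A * env 1 x) :
    ∃ D : ℝ, 0 ≤ D ∧ ∀ X : Vu n, 0 < X none → 2 ≤ ‖X‖ → |PX g X| ≤ D / ‖X‖ := by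
  have hk := kap_pos n
  have hE := envC_pos n
  refine ⟨A * (envC n + kap n) * 2, by positivity, fun X hX h2 => ?_⟩
  obtain ⟨x, hx⟩ := exists_pt X
  have h := PX_decay hA hg x hX (R := ‖X‖) (by linarith) (by rw [← hx])
  rw [← hx] at h
  refine h.trans ?_
  set r := ‖X‖ / 2 with hr
  have h1 : 1 ≤ r := by rw [hr]; linarith
  have e : A * (envC n + kap n) * 2 / ‖X‖ = A * (r⁻¹ * envC n + kap n * r⁻¹) := by rw [hr]; field_simp
  rw [e]
  have a1 : (r ^ n)⁻¹ ≤ r⁻¹ := by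
    gcongr; calc r = r ^ 1 := (pow_one r).symm
      _ ≤ r ^ n := pow_le_pow_right₀ h1 hn
  have a2 : (r ^ (n + 1))⁻¹ ≤ r⁻¹ := by
    gcongr; calc r = r ^ 1 := (pow_one r).symm
      _ ≤ r ^ (n + 1) := pow_le_pow_right₀ h1 (by omega)
  gcongr

/-- Boundary datum. -/
noncomputable def bw {n : ℕ} (s : Finset (Eu n × ℝ)) (cf : Eu n × ℝ → ℝ) (h0 c : ℝ) (φ : Eu n → ℝ) (x : Eu n) : ℝ :=
  h0 * ‖FV s cf (pt x 0)‖ + c * (FF s cf none (pt x 0) * φ x)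

theorem FV_uc {n : ℕ} {s : Finset (Eu n × ℝ)} (cf : Eu n × ℝ → ℝ) (hs : ∀ p ∈ s, 0 < p.2) :
    UniformContinuous (fun x : Eu n => FV s cf (pt x 0)) := by
  obtain ⟨B, hB, h⟩ := FV_lip cf hs
  refine LipschitzWith.uniformContinuous (K := B.toNNReal) (LipschitzWith.of_dist_le_mul fun x y => ?_)
  rw [dist_eq_norm, dist_eq_norm, Real.coe_toNNReal _ hB]
  have := h (pt x 0) (pt y 0) (by rw [pt_none]) (by rw [pt_none])
  rw [pt_sub, sub_zero] at this
  refine this.trans ?_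
  have := norm_pt_le (x - y) 0
  simp at this
  gcongr

theorem FF_uc {n : ℕ} {s : Finset (Eu n × ℝ)} (cf : Eu n × ℝ → ℝ) (hs : ∀ p ∈ s, 0 < p.2) (k : Option (Fin n)) :
    UniformContinuous (fun x : Eu n => FF s cf k (pt x 0)) := by
  have h := FV_uc cf hs
  rw [Metric.uniformContinuous_iff] at *
  intro ε hε
  obtain ⟨d, hd, h⟩ := h ε hε
  refine ⟨d, hd, fun x y hxy => lt_of_le_of_lt ?_ (h hxy)⟩
  rw [Real.dist_eq, dist_eq_norm]
  exact abs_coord_le (FV s cf (pt x 0) - FV s cf (pt y 0)) k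

theorem FV_bdry_decay {n : ℕ} {s : Finset (Eu n × ℝ)} (cf : Eu n × ℝ → ℝ) (hs : ∀ p ∈ s, 0 < p.2) (h0 : ∑ p ∈ s, cf p = 0) :
    ∃ A : ℝ, 0 ≤ A ∧ ∀ x : Eu n, ‖FV s cf (pt x 0)‖ ≤ A * env 1 x := by
  obtain ⟨A, hA, h⟩ := FV_decay cf hs h0
  refine ⟨A, hA, fun x => (h _ (by rw [pt_none])).trans ?_⟩
  unfold env
  rw [one_div]
  have := norm_le_norm_pt x 0
  gcongr

theorem bw_le {n : ℕ} {s : Finset (Eu n × ℝ)} (cf : Eu n × ℝ → ℝ) {h0 c M A : ℝ} (hh : 0 ≤ h0) {φ : Eu n → ℝ} (hM : ∀ x, |φ x| ≤ M)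
    (hA : ∀ x : Eu n, ‖FV s cf (pt x 0)‖ ≤ A * env 1 x) (x : Eu n) :
    |bw s cf h0 c φ x| ≤ (h0 + |c| * M) * A * env 1 x := by
  have hM0 : 0 ≤ M := (abs_nonneg _).trans (hM 0)
  unfold bw
  refine (abs_add_le _ _).trans ?_
  rw [abs_mul, abs_mul, abs_mul, abs_of_nonneg hh, abs_norm]
  have h1 := hA x
  have h2 := (FF_le_FV s cf none (pt x 0)).trans h1
  have h4 : 0 ≤ A * env 1 x := (norm_nonneg _).trans h1
  have h3 : |c| * (|FF s cf none (pt x 0)| * |φ x|) ≤ |c| * (A * env 1 x * M) := by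
    gcongr
    exact hM x
  nlinarith [mul_le_mul_of_nonneg_left h1 hh]

theorem bw_uc {n : ℕ} {s : Finset (Eu n × ℝ)} (cf : Eu n × ℝ → ℝ) (hs : ∀ p ∈ s, 0 < p.2) (hc0 : ∑ p ∈ s, cf p = 0) (h0 c : ℝ) {M : ℝ}
    {φ : Eu n → ℝ} (hφ : UniformContinuous φ) (hM : ∀ x, |φ x| ≤ M) : UniformContinuous (bw s cf h0 c φ) := by
  obtain ⟨A, hA, h⟩ := FV_bdry_decay cf hs hc0
  have henv : ∀ x : Eu n, env 1 x ≤ 1 := fun x => by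
    unfold env; rw [div_le_one (by positivity)]
    exact one_le_pow₀ (by linarith [norm_nonneg x])
  have hb : ∀ x : Eu n, |FF s cf none (pt x 0)| ≤ A := fun x =>
    (FF_le_FV s cf none (pt x 0)).trans ((h x).trans (by nlinarith [henv x]))
  have u1 : UniformContinuous (fun x : Eu n => FF s cf none (pt x 0) * φ x) := uc_mul_bdd (FF_uc cf hs none) hφ hb hM
  have u2 : UniformContinuous (fun x : Eu n => ‖FV s cf (pt x 0)‖) := uniformContinuous_norm.comp (FV_uc cf hs)
  exact (u2.const_smul h0).add (u1.const_smul c)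

theorem pt_sub_vert {n : ℕ} (x : Eu n) (t : ℝ) : ‖pt x t - pt x 0‖ ≤ |t| := by
  rw [pt_sub, sub_self, sub_zero]
  refine (norm_pt_le _ _).trans ?_
  simp

theorem FV_continuousAt {n : ℕ} {s : Finset (Eu n × ℝ)} (cf : Eu n × ℝ → ℝ) (hs : ∀ p ∈ s, 0 < p.2) (X : Vu n) (hX : 0 < X none) :
    ContinuousAt (FV s cf) X := by
  obtain ⟨B, hB, h⟩ := FV_lip cf hs
  rw [ContinuousAt, tendsto_iff_norm_sub_tendsto_zero]
  have h1 : Tendsto (fun Y : Vu n => B * ‖Y - X‖) (nhds X) (nhds 0) := by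
    have : Tendsto (fun Y : Vu n => B * ‖Y - X‖) (nhds X) (nhds (B * ‖X - X‖)) := Continuous.tendsto (by fun_prop) X
    simpa using this
  have hev : ∀ᶠ Y : Vu n in nhds X, 0 < Y none :=
    (Continuous.tendsto (f := fun Y : Vu n => Y none) (by fun_prop) X).eventually (lt_mem_nhds hX)
  refine tendsto_of_tendsto_of_tendsto_of_le_of_le' tendsto_const_nhds h1 (Eventually.of_forall fun _ => norm_nonneg _) ?_
  filter_upwards [hev] with Y hY using h Y X hY.le hX.le

theorem sqrt_eps_le {a ε : ℝ} (hε : 0 ≤ ε) (ha : 0 ≤ a) : √(ε ^ 2 + a) ≤ √a + ε := by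
  rw [Real.sqrt_le_iff]
  refine ⟨by positivity, ?_⟩
  nlinarith [Real.sq_sqrt ha, Real.sqrt_nonneg a]

set_option linter.unusedVariables false

noncomputable def PhiX {n : ℕ} (φ : Eu n → ℝ) (X : Vu n) : ℝ := (kap n)⁻¹ * PX φ X
noncomputable def PhiX1 {n : ℕ} (φ : Eu n → ℝ) (i : Option (Fin n)) (X : Vu n) : ℝ := (kap n)⁻¹ * PX1 i φ X
noncomputable def PhiX2 {n : ℕ} (φ : Eu n → ℝ) (i : Option (Fin n)) (X : Vu n) : ℝ := (kap n)⁻¹ * PX2 i φ X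
noncomputable def PsiX {n : ℕ} (φ : Eu n → ℝ) (X : Vu n) : ℝ := PhiX φ X ^ 2 - PhiX (fun x => φ x ^ 2) X
noncomputable def PsiX1 {n : ℕ} (φ : Eu n → ℝ) (i : Option (Fin n)) (X : Vu n) : ℝ :=
  2 * PhiX φ X * PhiX1 φ i X - PhiX1 (fun x => φ x ^ 2) i X
noncomputable def PsiX2 {n : ℕ} (φ : Eu n → ℝ) (i : Option (Fin n)) (X : Vu n) : ℝ :=
  2 * PhiX1 φ i X ^ 2 + 2 * PhiX φ X * PhiX2 φ i X - PhiX2 (fun x => φ x ^ 2) i X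

theorem green_bdry {n : ℕ} {s : Finset (Eu n × ℝ)} (cf : Eu n × ℝ → ℝ) (hs : ∀ p ∈ s, 0 < p.2)
    (hc0 : ∑ p ∈ s, cf p = 0) {φ : Eu n → ℝ} {M : ℝ} (hc : UniformContinuous φ) (hM : ∀ x, |φ x| ≤ M)
    {h0 c : ℝ} (hh : 0 ≤ h0) {η : ℝ} (hη : 0 < η) :
    ∃ t1 > 0, ∀ X : Vu n, 0 < X none → X none < t1 →
      ‖FV s cf X‖ * h0 + c * (FF s cf none X * PhiX φ X) - PhiX (bw s cf h0 c φ) X ≤ η := by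
  have hk := kap_pos n
  have hM0 : 0 ≤ M := (abs_nonneg _).trans (hM 0)
  obtain ⟨B, hB, hBl⟩ := FV_lip cf hs
  obtain ⟨A, hA, hAd⟩ := FV_bdry_decay cf hs hc0
  have henv : ∀ x : Eu n, env 1 x ≤ 1 := fun x => by
    unfold env; rw [div_le_one (by positivity)]
    exact one_le_pow₀ (by linarith [norm_nonneg x])
  have hAd' : ∀ x : Eu n, ‖FV s cf (pt x 0)‖ ≤ A := fun x => (hAd x).trans (by nlinarith [henv x])
  have hw := bw_uc cf hs hc0 h0 c hc hM
  have hwb : ∀ x, |bw s cf h0 c φ x| ≤ (h0 + |c| * M) * A := fun x =>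
    (bw_le cf hh hM hAd x).trans (mul_le_of_le_one_right (by positivity) (henv x))
  obtain ⟨d1, hd1, b1⟩ := PX_boundary hc hM (ε := kap n * (η / (3 * (|c| * A + 1)))) (by positivity)
  obtain ⟨d2, hd2, b2⟩ := PX_boundary hw hwb (ε := kap n * (η / 3)) (by positivity)
  set d3 := η / (3 * (B * h0 + |c| * (B * M) + 1)) with hd3
  have hd3p : 0 < d3 := by positivity
  refine ⟨min d1 (min d2 d3), lt_min hd1 (lt_min hd2 hd3p), fun X hX hXt => ?_⟩
  obtain ⟨x, hx⟩ := exists_pt X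
  set t := X none with ht
  have t1 : t < d1 := hXt.trans_le (min_le_left _ _)
  have t2 : t < d2 := hXt.trans_le ((min_le_right _ _).trans (min_le_left _ _))
  have t3 : t < d3 := hXt.trans_le ((min_le_right _ _).trans (min_le_right _ _))
  have c1 := b1 x t hX t1
  have c2 := b2 x t hX t2
  rw [hx]
  have e1 : ∀ g : Eu n → ℝ, |PhiX g (pt x t) - g x| = (kap n)⁻¹ * |PX g (pt x t) - kap n * g x| := fun g => by
    rw [← abs_of_pos (inv_pos.2 hk), ← abs_mul]
    unfold PhiX; congr 1; field_simp
  have f1 : |PhiX φ (pt x t) - φ x| ≤ η / (3 * (|c| * A + 1)) := by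
    rw [e1, inv_mul_le_iff₀ hk]; exact c1
  have f2 : |PhiX (bw s cf h0 c φ) (pt x t) - bw s cf h0 c φ x| ≤ η / 3 := by
    rw [e1, inv_mul_le_iff₀ hk]; exact c2
  have l1 := hBl (pt x t) (pt x 0) (by rw [pt_none]; exact hX.le) (by rw [pt_none])
  have l2 : ‖FV s cf (pt x t) - FV s cf (pt x 0)‖ ≤ B * t := l1.trans (by
    have := pt_sub_vert x t; rw [abs_of_pos hX] at this; gcongr)
  have l3 : ‖FV s cf (pt x t)‖ ≤ ‖FV s cf (pt x 0)‖ + B * t := by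
    have := norm_sub_norm_le (FV s cf (pt x t)) (FV s cf (pt x 0)); linarith
  have l4 : |FF s cf none (pt x t) - FF s cf none (pt x 0)| ≤ B * t :=
    (abs_coord_le (FV s cf (pt x t) - FV s cf (pt x 0)) none).trans l2
  have hΦ : |PhiX φ (pt x t)| ≤ M := by
    unfold PhiX; rw [abs_mul, abs_of_pos (inv_pos.2 hk), inv_mul_le_iff₀ hk]; exact PX_abs_le hM x hX
  have l5 : |FF s cf none (pt x t) * PhiX φ (pt x t) - FF s cf none (pt x 0) * φ x| ≤ B * t * M + A * (η / (3 * (|c| * A + 1))) := by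
    have e : FF s cf none (pt x t) * PhiX φ (pt x t) - FF s cf none (pt x 0) * φ x =
      (FF s cf none (pt x t) - FF s cf none (pt x 0)) * PhiX φ (pt x t) + FF s cf none (pt x 0) * (PhiX φ (pt x t) - φ x) := by ring
    rw [e]
    refine (abs_add_le _ _).trans ?_
    rw [abs_mul, abs_mul]
    have := (FF_le_FV s cf none (pt x 0)).trans (hAd' x)
    gcongr
  have l6 : c * (FF s cf none (pt x t) * PhiX φ (pt x t)) - c * (FF s cf none (pt x 0) * φ x) ≤ |c| * (B * t * M + A * (η / (3 * (|c| * A + 1)))) := by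
    rw [← mul_sub]
    refine (le_abs_self _).trans ?_
    rw [abs_mul]; gcongr
  have l7 : |c| * (A * (η / (3 * (|c| * A + 1)))) ≤ η / 3 := by
    have : |c| * (A * (η / (3 * (|c| * A + 1)))) = (|c| * A) / (|c| * A + 1) * (η / 3) := by field_simp
    rw [this]
    have h1 : (|c| * A) / (|c| * A + 1) ≤ 1 := by rw [div_le_one (by positivity)]; linarith
    calc _ ≤ 1 * (η / 3) := by gcongr
      _ = _ := one_mul _
  have l8 : (B * h0 + |c| * (B * M)) * t ≤ η / 3 := by
    have h1 : t * (3 * (B * h0 + |c| * (B * M) + 1)) ≤ η := by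
      rw [hd3, lt_div_iff₀ (by positivity)] at t3; exact t3.le
    nlinarith
  have l9 := mul_le_mul_of_nonneg_right l3 hh
  have l10 := (abs_le.1 f2).1
  unfold bw at l10
  have : PhiX (fun x => h0 * ‖FV s cf (pt x 0)‖ + c * (FF s cf none (pt x 0) * φ x)) (pt x t) = PhiX (bw s cf h0 c φ) (pt x t) := rfl
  have l10' : -(η / 3) ≤ PhiX (bw s cf h0 c φ) (pt x t) - (h0 * ‖FV s cf (pt x 0)‖ + c * (FF s cf none (pt x 0) * φ x)) := l10
  nlinarith

theorem green_inf {n : ℕ} (hn : 1 ≤ n) {s : Finset (Eu n × ℝ)} (cf : Eu n × ℝ → ℝ) (hs : ∀ p ∈ s, 0 < p.2)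
    (hc0 : ∑ p ∈ s, cf p = 0) {φ : Eu n → ℝ} {M : ℝ} (hM : ∀ x, |φ x| ≤ M)
    {h0 c : ℝ} (hh : 0 ≤ h0) {η : ℝ} (hη : 0 < η) :
    ∃ R : ℝ, ∀ X : Vu n, 0 < X none → R < ‖X‖ →
      ‖FV s cf X‖ * h0 + c * (FF s cf none X * PhiX φ X) - PhiX (bw s cf h0 c φ) X ≤ η := by
  have hk := kap_pos n
  have hM0 : 0 ≤ M := (abs_nonneg _).trans (hM 0)
  obtain ⟨A, hA, hAd⟩ := FV_bdry_decay cf hs hc0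
  obtain ⟨A', hA', hAd'⟩ := FV_decay cf hs hc0
  obtain ⟨D, hD, hDd⟩ := PX_decay' hn (g := bw s cf h0 c φ) (A := (h0 + |c| * M) * A) (by positivity) (fun x => bw_le cf hh hM hAd x)
  set E := A' * h0 + |c| * (A' * M) + (kap n)⁻¹ * D with hE
  have hE0 : 0 ≤ E := by positivity
  refine ⟨max 2 (E / η), fun X hX hR => ?_⟩
  have r1 : 2 < ‖X‖ := (le_max_left _ _).trans_lt hR
  have r2 : E / η < ‖X‖ := (le_max_right _ _).trans_lt hR
  have h0' : 0 < ‖X‖ := by linarith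
  have g1 : ‖FV s cf X‖ ≤ A' / ‖X‖ := by
    refine (hAd' X hX.le).trans ?_
    rw [div_eq_mul_inv]
    gcongr
    calc ‖X‖ ≤ (1 + ‖X‖) ^ 1 := by rw [pow_one]; linarith
      _ ≤ (1 + ‖X‖) ^ (n + 1) := pow_le_pow_right₀ (by linarith) (by omega)
  have g2 := (FF_le_FV s cf none X).trans g1
  obtain ⟨x, hx⟩ := exists_pt X
  have hΦ : |PhiX φ X| ≤ M := by
    unfold PhiX; rw [abs_mul, abs_of_pos (inv_pos.2 hk), inv_mul_le_iff₀ hk, hx]; exact PX_abs_le hM x hX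
  have g3 : |PhiX (bw s cf h0 c φ) X| ≤ (kap n)⁻¹ * (D / ‖X‖) := by
    unfold PhiX; rw [abs_mul, abs_of_pos (inv_pos.2 hk)]
    have := hDd X hX r1.le
    gcongr
  have g4 : c * (FF s cf none X * PhiX φ X) ≤ |c| * (A' / ‖X‖ * M) := by
    refine (le_abs_self _).trans ?_
    rw [abs_mul, abs_mul]; gcongr
  have g5 : ‖FV s cf X‖ * h0 ≤ A' / ‖X‖ * h0 := by gcongr
  have g6 : E / ‖X‖ ≤ η := by
    rw [div_lt_iff₀ hη] at r2
    rw [div_le_iff₀ h0']; linarith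
  have g7 : E / ‖X‖ = A' / ‖X‖ * h0 + |c| * (A' / ‖X‖ * M) + (kap n)⁻¹ * (D / ‖X‖) := by rw [hE]; field_simp
  have := neg_abs_le (PhiX (bw s cf h0 c φ) X)
  linarith

theorem PhiX_cont {n : ℕ} {g : Eu n → ℝ} (hg : Measurable g) {M : ℝ} (hM : ∀ x, |g x| ≤ M) (X : Vu n) (hX : 0 < X none) :
    ContinuousAt (PhiX g) X := (kI_continuousAt KG.Hk hg hM X hX).const_mul _

theorem green_v {n : ℕ} (hn : 1 ≤ n) {s : Finset (Eu n × ℝ)} (cf : Eu n × ℝ → ℝ) (hs : ∀ p ∈ s, 0 < p.2)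
    (hc0 : ∑ p ∈ s, cf p = 0) {φ : Eu n → ℝ} {M : ℝ} (hc : UniformContinuous φ) (hM : ∀ x, |φ x| ≤ M)
    {ε κ K c : ℝ} (hε : 0 < ε) (hK : 0 < K) (hκ : κ = 1 / (16 * K ^ 2 * ((n : ℝ) + 1))) (hcc : c ^ 2 = 1 / (8 * K * ((n : ℝ) + 1) ^ 2))
    (hΨ : ∀ X : Vu n, 0 < X none → -K ≤ PsiX φ X ∧ PsiX φ X ≤ 0) (X0 : Vu n) (hX0 : 0 < X0 none) :
    W0 none ε κ K c (fun k => FF s cf k X0) (PhiX φ X0) (PsiX φ X0) - PhiX (bw s cf (1 + 4 * κ * K ^ 2) c φ) X0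
      ≤ ε * (1 + 4 * κ * K ^ 2) := by
  have hk := kap_pos n
  have hM0 : 0 ≤ M := (abs_nonneg _).trans (hM 0)
  have hn1 : (1 : ℝ) ≤ n := by exact_mod_cast hn
  have hκ0 : 0 < κ := by rw [hκ]; positivity
  set h0 := 1 + 4 * κ * K ^ 2 with hh0
  have hh : 0 ≤ h0 := by rw [hh0]; positivity
  have hm : Measurable φ := hc.continuous.measurable
  have hm2 : Measurable (fun x => φ x ^ 2) := hm.pow_const 2
  have hM2 : ∀ x, |φ x ^ 2| ≤ M ^ 2 := fun y => by rw [abs_pow]; exact pow_le_pow_left₀ (abs_nonneg _) (hM y) 2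
  obtain ⟨A, hA, hAd⟩ := FV_bdry_decay cf hs hc0
  have henv : ∀ x : Eu n, env 1 x ≤ 1 := fun x => by
    unfold env; rw [div_le_one (by positivity)]
    exact one_le_pow₀ (by linarith [norm_nonneg x])
  have hw := bw_uc cf hs hc0 h0 c hc hM
  have hwm : Measurable (bw s cf h0 c φ) := hw.continuous.measurable
  have hwb : ∀ x, |bw s cf h0 c φ x| ≤ (h0 + |c| * M) * A := fun x =>
    (bw_le cf hh hM hAd x).trans (mul_le_of_le_one_right (by positivity) (henv x))
  have dP : ∀ {g : Eu n → ℝ}, Measurable g → ∀ {M : ℝ}, (∀ x, |g x| ≤ M) → ∀ i (X : Vu n) (τ : ℝ), 0 < (X + τ • ee i) none →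
      HasDerivAt (fun τ : ℝ => PhiX g (X + τ • ee i)) (PhiX1 g i (X + τ • ee i)) τ :=
    fun hg M hM i X τ h => (PX_deriv i hg hM X τ h).const_mul _
  have dP1 : ∀ {g : Eu n → ℝ}, Measurable g → ∀ {M : ℝ}, (∀ x, |g x| ≤ M) → ∀ i (X : Vu n) (τ : ℝ), 0 < (X + τ • ee i) none →
      HasDerivAt (fun τ : ℝ => PhiX1 g i (X + τ • ee i)) (PhiX2 g i (X + τ • ee i)) τ :=
    fun hg M hM i X τ h => (PX1_deriv i hg hM X τ h).const_mul _
  have sP : ∀ {g : Eu n → ℝ}, Measurable g → ∀ {M : ℝ}, (∀ x, |g x| ≤ M) → ∀ (X : Vu n), 0 < X none → ∑ i, PhiX2 g i X = 0 :=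
    fun hg M hM X h => by simp only [PhiX2]; rw [← Finset.mul_sum, sum_PX2 hg hM X h, mul_zero]
  have dS : ∀ i (X : Vu n) (τ : ℝ), 0 < (X + τ • ee i) none →
      HasDerivAt (fun τ : ℝ => PsiX φ (X + τ • ee i)) (PsiX1 φ i (X + τ • ee i)) τ := fun i X τ h =>
    (((dP hm hM i X τ h).fun_pow 2).fun_sub (dP hm2 hM2 i X τ h)).congr_deriv (by simp only [PsiX1]; push_cast; ring)
  have dS1 : ∀ i (X : Vu n) (τ : ℝ), 0 < (X + τ • ee i) none →
      HasDerivAt (fun τ : ℝ => PsiX1 φ i (X + τ • ee i)) (PsiX2 φ i (X + τ • ee i)) τ := fun i X τ h =>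
    ((((dP hm hM i X τ h).const_mul 2).fun_mul (dP1 hm hM i X τ h)).fun_sub (dP1 hm2 hM2 i X τ h)).congr_deriv (by simp only [PsiX2]; ring)
  refine max_principle
    (fun X => W0 none ε κ K c (fun k => FF s cf k X) (PhiX φ X) (PsiX φ X) - PhiX (bw s cf h0 c φ) X) ?_ (ε * h0) ?_
    (fun i X => W1 none ε κ K c (fun k => FF s cf k X) (fun k => FFM s cf i k X) (PhiX φ X) (PhiX1 φ i X) (PsiX φ X) (PsiX1 φ i X)
      - PhiX1 (bw s cf h0 c φ) i X)
    (fun i X => W2 none ε κ K c (fun k => FF s cf k X) (fun k => FFM s cf i k X) (fun k => FF2 s cf i k X) (PhiX φ X) (PhiX1 φ i X)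
      (PhiX2 φ i X) (PsiX φ X) (PsiX1 φ i X) (PsiX2 φ i X) - PhiX2 (bw s cf h0 c φ) i X) ?_ ?_ ?_ X0 hX0
  · intro X hX
    have c1 := PhiX_cont hm hM X hX
    have c2 := PhiX_cont hm2 hM2 X hX
    have c3 := PhiX_cont hwm hwb X hX
    have c4 : ∀ k, ContinuousAt (fun X => FF s cf k X) X := fun k => by
      have := FV_continuousAt cf hs X hX
      exact (Continuous.continuousAt (f := fun v : Vu n => v k) (by fun_prop)).comp this
    have c5 : ContinuousAt (PsiX φ) X := (c1.pow 2).sub c2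
    have c6 : ContinuousAt (fun X => ∑ k, FF s cf k X ^ 2) X := tendsto_finsetSum _ fun k _ => (c4 k).pow 2
    unfold W0
    refine ContinuousAt.sub ?_ c3
    refine ContinuousAt.add (ContinuousAt.mul ?_ ?_) ?_
    · exact (continuousAt_const.add c6).sqrt
    · exact continuousAt_const.add (continuousAt_const.mul ((c5.add continuousAt_const).pow 2))
    · exact continuousAt_const.mul ((c4 none).mul c1)
  · intro η hη
    obtain ⟨t1, ht1, b1⟩ := green_bdry cf hs hc0 hc hM (c := c) hh hη
    obtain ⟨R, b2⟩ := green_inf hn cf hs hc0 hM (c := c) hh hη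
    refine ⟨t1, ht1, R, fun X hX h => ?_⟩
    have hb : ‖FV s cf X‖ * h0 + c * (FF s cf none X * PhiX φ X) - PhiX (bw s cf h0 c φ) X ≤ η := by
      rcases h with h | h
      · exact b1 X hX h
      · exact b2 X hX h
    obtain ⟨p1, p2⟩ := hΨ X hX
    have g1 : √(ε ^ 2 + ∑ k, FF s cf k X ^ 2) ≤ ‖FV s cf X‖ + ε := by
      rw [norm_FV]; exact sqrt_eps_le hε.le (Finset.sum_nonneg fun _ _ => sq_nonneg _)
    have g2 : 1 + κ * (PsiX φ X + 2 * K) ^ 2 ≤ h0 := by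
      have : (PsiX φ X + 2 * K) ^ 2 ≤ (2 * K) ^ 2 := by
        apply pow_le_pow_left₀ <;> linarith
      rw [hh0]; nlinarith
    have g3 : √(ε ^ 2 + ∑ k, FF s cf k X ^ 2) * (1 + κ * (PsiX φ X + 2 * K) ^ 2) ≤ (‖FV s cf X‖ + ε) * h0 := by
      gcongr
    simp only [W0]
    linarith
  · intro i X τ h
    exact (hasDerivAt_W0 (M := fun k τ => FFM s cf i k (X + τ • ee i)) (Φ1 := fun τ => PhiX1 φ i (X + τ • ee i)) (Ψ1 := fun τ => PsiX1 φ i (X + τ • ee i))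
      none hε κ K c (fun k => FF_hasDerivAt cf hs i k X τ h) (dP hm hM i X τ h) (dS i X τ h)).fun_sub (dP hwm hwb i X τ h)
  · intro i X τ h
    exact (hasDerivAt_W1 (F := fun k τ => FF s cf k (X + τ • ee i)) (M := fun k τ => FFM s cf i k (X + τ • ee i)) (F2 := fun k τ => FF2 s cf i k (X + τ • ee i))
      (Φ := fun τ => PhiX φ (X + τ • ee i)) (Φ1 := fun τ => PhiX1 φ i (X + τ • ee i)) (Φ2 := fun τ => PhiX2 φ i (X + τ • ee i))
      (Ψ := fun τ => PsiX φ (X + τ • ee i)) (Ψ1 := fun τ => PsiX1 φ i (X + τ • ee i)) (Ψ2 := fun τ => PsiX2 φ i (X + τ • ee i))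
      none hε κ K c (fun k => FF_hasDerivAt cf hs i k X τ h) (fun k => FFM_hasDerivAt cf hs i k X τ h)
      (dP hm hM i X τ h) (dP1 hm hM i X τ h) (dS i X τ h) (dS1 i X τ h)).fun_sub (dP1 hwm hwb i X τ h)
  · intro X hX
    rw [Finset.sum_sub_distrib, sP hwm hwb X hX, sub_zero]
    refine lap_nonneg none (N := n) (by simp) hn1 hε hK hκ hcc _ (fun i k => FFM s cf i k X) (fun i k => FF2 s cf i k X) _ _ (fun i => PhiX1 φ i X)
      (fun i => PhiX2 φ i X) (fun i => PsiX1 φ i X) (fun i => PsiX2 φ i X) (fun i k => FFM_comm s cf i k X) (sum_FFM cf hs hX.le) (sum_FF2 cf hs hX.le)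
      (sP hm hM X hX) ?_ (hΨ X hX).1 (hΨ X hX).2
    simp only [PsiX2, Finset.sum_sub_distrib, Finset.sum_add_distrib, ← Finset.mul_sum]
    rw [sP hm hM X hX, sP hm2 hM2 X hX]; ring

set_option linter.unusedVariables false

theorem FV_bdry_integrable {n : ℕ} {s : Finset (Eu n × ℝ)} (cf : Eu n × ℝ → ℝ) (hs : ∀ p ∈ s, 0 < p.2) (hc0 : ∑ p ∈ s, cf p = 0) :
    Integrable (fun x : Eu n => ‖FV s cf (pt x 0)‖) := by
  obtain ⟨A, hA, hAd⟩ := FV_bdry_decay cf hs hc0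
  refine (integrable_env_one.const_mul A).mono' ?_ (ae_of_all _ fun x => ?_)
  · exact (uniformContinuous_norm.comp (FV_uc cf hs)).continuous.aestronglyMeasurable
  · rw [norm_norm]; exact hAd x

theorem FF_bdry_integrable {n : ℕ} {s : Finset (Eu n × ℝ)} (cf : Eu n × ℝ → ℝ) (hs : ∀ p ∈ s, 0 < p.2) (hc0 : ∑ p ∈ s, cf p = 0)
    (k : Option (Fin n)) : Integrable (fun x : Eu n => FF s cf k (pt x 0)) := by
  refine (FV_bdry_integrable cf hs hc0).mono' (FF_uc cf hs k).continuous.aestronglyMeasurable (ae_of_all _ fun x => ?_)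
  exact FF_le_FV s cf k _

theorem green_nonneg {n : ℕ} (hn : 1 ≤ n) {s : Finset (Eu n × ℝ)} (cf : Eu n × ℝ → ℝ) (hs : ∀ p ∈ s, 0 < p.2)
    (hc0 : ∑ p ∈ s, cf p = 0) {φ : Eu n → ℝ} {M : ℝ} (hc : UniformContinuous φ) (hM : ∀ x, |φ x| ≤ M)
    {κ K c : ℝ} (hK : 0 < K) (hκ : κ = 1 / (16 * K ^ 2 * ((n : ℝ) + 1))) (hcc : c ^ 2 = 1 / (8 * K * ((n : ℝ) + 1) ^ 2))
    (hΨ : ∀ X : Vu n, 0 < X none → -K ≤ PsiX φ X ∧ PsiX φ X ≤ 0) :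
    0 ≤ ∫ x, bw s cf (1 + 4 * κ * K ^ 2) c φ x := by
  have hk := kap_pos n
  have hM0 : 0 ≤ M := (abs_nonneg _).trans (hM 0)
  have hκ0 : 0 < κ := by rw [hκ]; positivity
  set h0 := 1 + 4 * κ * K ^ 2 with hh0
  have hh : 0 < h0 := by rw [hh0]; positivity
  obtain ⟨A, hA, hAd⟩ := FV_bdry_decay cf hs hc0
  obtain ⟨A', hA', hAd'⟩ := FV_decay cf hs hc0
  have hintg : Integrable (bw s cf h0 c φ) := by
    refine (integrable_env_one.const_mul ((h0 + |c| * M) * A)).mono' (bw_uc cf hs hc0 h0 c hc hM).continuous.aestronglyMeasurable (ae_of_all _ fun x => ?_)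
    exact bw_le cf hh.le hM hAd x
  have hlow : ∀ t : ℝ, 0 < t → -(kap n * (|c| * (A' * M))) * t⁻¹ ≤ t ^ n * PX (bw s cf h0 c φ) (pt 0 t) := by
    intro t ht
    have hXt : 0 < (pt (0 : Eu n) t) none := by rw [pt_none]; exact ht
    have h1 : -(|c| * (A' * ((1 + ‖pt (0 : Eu n) t‖) ^ (n + 1))⁻¹ * M)) ≤ PhiX (bw s cf h0 c φ) (pt 0 t) := by
      refine le_of_forall_pos_le_add fun η hη => ?_
      have h2 := green_v hn cf hs hc0 hc hM (ε := η / h0) (by positivity) hK hκ hcc hΨ (pt 0 t) hXt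
      rw [← hh0, div_mul_cancel₀ _ hh.ne'] at h2
      simp only [W0] at h2
      have h3 : 0 ≤ √((η / h0) ^ 2 + ∑ k, FF s cf k (pt 0 t) ^ 2) * (1 + κ * (PsiX φ (pt 0 t) + 2 * K) ^ 2) := by positivity
      have hΦ : |PhiX φ (pt 0 t)| ≤ M := by
        unfold PhiX; rw [abs_mul, abs_of_pos (inv_pos.2 hk), inv_mul_le_iff₀ hk]; exact PX_abs_le hM 0 ht
      have h4 : |c * (FF s cf none (pt 0 t) * PhiX φ (pt 0 t))| ≤ |c| * (A' * ((1 + ‖pt (0 : Eu n) t‖) ^ (n + 1))⁻¹ * M) := by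
        rw [abs_mul, abs_mul]
        have := (FF_le_FV s cf none (pt 0 t)).trans (hAd' _ hXt.le)
        gcongr
      have := (abs_le.1 h4).1
      linarith
    have h5 : ((1 + ‖pt (0 : Eu n) t‖) ^ (n + 1))⁻¹ ≤ (t ^ (n + 1))⁻¹ := by
      have := abs_le_norm_pt (0 : Eu n) t
      rw [abs_of_pos ht] at this
      gcongr; linarith
    have h6 : -(|c| * (A' * (t ^ (n + 1))⁻¹ * M)) ≤ PhiX (bw s cf h0 c φ) (pt 0 t) := le_trans (by
      have : |c| * (A' * ((1 + ‖pt (0 : Eu n) t‖) ^ (n + 1))⁻¹ * M) ≤ |c| * (A' * (t ^ (n + 1))⁻¹ * M) := by gcongr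
      linarith) h1
    have h7 := mul_le_mul_of_nonneg_left h6 (by positivity : 0 ≤ kap n * t ^ n)
    unfold PhiX at h7
    have e1 : kap n * t ^ n * -(|c| * (A' * (t ^ (n + 1))⁻¹ * M)) = -(kap n * (|c| * (A' * M))) * t⁻¹ := by field_simp; ring
    have e2 : kap n * t ^ n * ((kap n)⁻¹ * PX (bw s cf h0 c φ) (pt 0 t)) = t ^ n * PX (bw s cf h0 c φ) (pt 0 t) := by field_simp
    rw [e1, e2] at h7; exact h7
  have l1 := PX_asymp hintg
  have l2 : Tendsto (fun t : ℝ => -(kap n * (|c| * (A' * M))) * t⁻¹) atTop (nhds 0) := by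
    have := tendsto_inv_atTop_zero (𝕜 := ℝ) |>.const_mul (-(kap n * (|c| * (A' * M))))
    simpa using this
  exact le_of_tendsto_of_tendsto l2 l1 ((eventually_gt_atTop 0).mono fun t ht => hlow t ht)

noncomputable def gC (n : ℕ) : ℝ := 2 * (((n : ℝ) + 1) * √(8 * psC n))

theorem gC_pos (n : ℕ) : 0 < gC n := by
  have := psC_pos n
  unfold gC; positivity

/-- Uchiyama / Fefferman type estimate for finite combinations of kernels. -/
theorem green {n : ℕ} (hn : 1 ≤ n) {s : Finset (Eu n × ℝ)} (cf : Eu n × ℝ → ℝ) (hs : ∀ p ∈ s, 0 < p.2)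
    (hc0 : ∑ p ∈ s, cf p = 0) {φ : Eu n → ℝ} {M b : ℝ} (hb : 0 < b) (hφ : BMOB φ b) (hc : UniformContinuous φ) (hM : ∀ x, |φ x| ≤ M) :
    ∫ x, FF s cf none (pt x 0) * φ x ≤ gC n * b * ∫ x, ‖FV s cf (pt x 0)‖ := by
  have hp := psC_pos n
  set K := psC n * b ^ 2 with hK
  have hK0 : 0 < K := by positivity
  set q := ((n : ℝ) + 1) * √(8 * psC n) * b with hq
  have hq0 : 0 < q := by positivity
  have hn1 : (1 : ℝ) ≤ n := by exact_mod_cast hn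
  have h := green_nonneg hn cf hs hc0 hc hM (c := -q⁻¹) hK0 rfl (by
    have : q ^ 2 = 8 * K * ((n : ℝ) + 1) ^ 2 := by
      rw [hq, mul_pow, mul_pow, Real.sq_sqrt (by positivity), hK]; ring
    rw [neg_sq, inv_pow, this, one_div]) (fun X hX => psi_bound hb hφ hc hM X hX)
  set h0 := 1 + 4 * (1 / (16 * K ^ 2 * ((n : ℝ) + 1))) * K ^ 2 with hh0
  have hh : h0 ≤ 2 := by
    have : 4 * (1 / (16 * K ^ 2 * ((n : ℝ) + 1))) * K ^ 2 = 1 / (4 * ((n : ℝ) + 1)) := by field_simp; norm_num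
    rw [hh0, this]
    have : 1 / (4 * ((n : ℝ) + 1)) ≤ 1 := by rw [div_le_one (by positivity)]; linarith
    linarith
  have i1 := FV_bdry_integrable cf hs hc0
  have i2 : Integrable (fun x : Eu n => FF s cf none (pt x 0) * φ x) :=
    (FF_bdry_integrable cf hs hc0 none).mul_bdd (c := M) hc.continuous.aestronglyMeasurable (ae_of_all _ fun y => by rw [Real.norm_eq_abs]; exact hM y)
  simp only [bw] at h
  rw [integral_add (i1.const_mul _) (i2.const_mul _), integral_const_mul, integral_const_mul] at h
  set I := ∫ x : Eu n, ‖FV s cf (pt x 0)‖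
  have hI : 0 ≤ I := integral_nonneg fun _ => norm_nonneg _
  have h2 : q⁻¹ * (∫ x, FF s cf none (pt x 0) * φ x) ≤ 2 * I := by nlinarith
  rw [inv_mul_le_iff₀ hq0] at h2
  refine h2.trans (le_of_eq ?_)
  rw [hq]; unfold gC; ring

set_option linter.unusedVariables false

noncomputable def rw1 {n : ℕ} (x : Eu n) : ℝ := √(env 1 x)

theorem rw1_pos {n : ℕ} (x : Eu n) : 0 < rw1 x := Real.sqrt_pos.2 (env_pos one_pos x)
theorem rw1_sq {n : ℕ} (x : Eu n) : rw1 x ^ 2 = env 1 x := Real.sq_sqrt (env_pos one_pos x).le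
theorem rw1_cont {n : ℕ} : Continuous (rw1 : Eu n → ℝ) := (continuous_env one_pos).sqrt
theorem rw1_memLp {n : ℕ} : MemLp (rw1 : Eu n → ℝ) 2 := by
  rw [memLp_two_iff_integrable_sq rw1_cont.aestronglyMeasurable]
  simp only [rw1_sq]; exact integrable_env_one

theorem rw1_mul_int {n : ℕ} {G : Eu n → Vu n} (hG : MemLp G 2) : Integrable (fun x => rw1 x * ‖G x‖) :=
  rw1_memLp.integrable_mul hG.norm

set_option maxHeartbeats 2000000 in
theorem l1_dual {n : ℕ} {P : Type*} (f : P → Eu n → Vu n) (hf : ∀ p, Measurable (f p))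
    (hA : ∀ p, ∃ A : ℝ, ∀ x, ‖f p x‖ ≤ A * env 1 x) (L : P → ℝ) {C : ℝ} (hC : 0 ≤ C)
    (hL : ∀ c : P →₀ ℝ, (c.sum fun p a => a * L p) ≤ C * ∫ x, ‖c.sum fun p a => a • f p x‖) :
    ∃ β : Eu n → Vu n, Measurable β ∧ (∀ x, ‖β x‖ ≤ C) ∧ ∀ p, L p = ∫ x, inner ℝ (β x) (f p x) := by
  classical
  have hg : ∀ p, MemLp (fun x => (rw1 x)⁻¹ • f p x) 2 (volume : Measure (Eu n)) := by
    intro p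
    obtain ⟨A, hA⟩ := hA p
    refine MemLp.of_le_mul (c := A) rw1_memLp ?_ (ae_of_all _ fun x => ?_)
    · exact (rw1_cont.measurable.inv.smul (hf p)).aestronglyMeasurable
    · have h0 := rw1_pos x
      rw [norm_smul, norm_inv, Real.norm_of_nonneg h0.le, inv_mul_le_iff₀ h0]
      refine (hA x).trans (le_of_eq ?_)
      rw [← rw1_sq]; ring
  set gen : P → Lp (Vu n) 2 (volume : Measure (Eu n)) := fun p => (hg p).toLp _ with hgen
  set T := Finsupp.linearCombination ℝ gen with hT
  set l0 := Finsupp.linearCombination ℝ L with hl0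
  set N : Lp (Vu n) 2 (volume : Measure (Eu n)) → ℝ := fun G => C * ∫ x, rw1 x * ‖G x‖ with hN
  have hTc : ∀ c : P →₀ ℝ, ∀ᵐ x : Eu n, (T c : Lp (Vu n) 2 (volume : Measure (Eu n))) x = (rw1 x)⁻¹ • c.sum fun p a => a • f p x := by
    intro c
    have e : T c = ∑ p ∈ c.support, c p • gen p := by rw [hT, Finsupp.linearCombination_apply]; rfl
    rw [e]
    have h1 := Lp.coeFn_finsetSum c.support (fun p => c p • gen p)
    have h2 : ∀ᵐ x : Eu n, ∀ p ∈ c.support, (c p • gen p : Lp (Vu n) 2 (volume : Measure (Eu n))) x = c p • ((rw1 x)⁻¹ • f p x) := by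
      rw [Finset.eventually_all]
      intro p hp
      filter_upwards [Lp.coeFn_smul (c p) (gen p), (hg p).coeFn_toLp] with x a1 a2
      rw [a1, Pi.smul_apply, a2]
    filter_upwards [h1, h2] with x a1 a2
    rw [a1, Finset.sum_apply, Finset.sum_congr rfl a2, Finsupp.sum, Finset.smul_sum]
    refine Finset.sum_congr rfl fun p _ => ?_
    rw [smul_comm]
  have hle : ∀ c, l0 c ≤ N (T c) := by
    intro c
    have e : l0 c = c.sum fun p a => a * L p := by rw [hl0, Finsupp.linearCombination_apply]; rfl
    rw [e]
    refine (hL c).trans (le_of_eq ?_)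
    rw [hN]
    congr 1
    refine integral_congr_ae ?_
    filter_upwards [hTc c] with x hx
    have h0 := rw1_pos x
    rw [hx, norm_smul, norm_inv, Real.norm_of_nonneg h0.le, mul_inv_cancel_left₀ h0.ne']
  have hker : LinearMap.ker T ≤ LinearMap.ker l0 := by
    intro c hc
    rw [LinearMap.mem_ker] at hc ⊢
    have hz : N 0 = 0 := by
      rw [hN]
      have : ∫ x : Eu n, rw1 x * ‖(0 : Lp (Vu n) 2 (volume : Measure (Eu n))) x‖ = 0 := by
        rw [integral_eq_zero_of_ae]
        filter_upwards [Lp.coeFn_zero (Vu n) 2 (volume : Measure (Eu n))] with x hx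
        rw [hx]; simp
      simp only [this, mul_zero]
    have a1 := hle c
    have a2 := hle (-c)
    rw [map_neg, map_neg, hc, neg_zero, hz] at a2
    rw [hc, hz] at a1
    linarith
  set pm : Lp (Vu n) 2 (volume : Measure (Eu n)) →ₗ.[ℝ] ℝ :=
    ⟨LinearMap.range T, ((LinearMap.ker T).liftQ l0 hker).comp T.quotKerEquivRange.symm.toLinearMap⟩ with hpm
  have hpmT : ∀ c (h : T c ∈ LinearMap.range T), pm ⟨T c, h⟩ = l0 c := by
    intro c h
    have : pm ⟨T c, h⟩ = (LinearMap.ker T).liftQ l0 hker (T.quotKerEquivRange.symm ⟨T c, h⟩) := rfl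
    rw [this, LinearMap.quotKerEquivRange_symm_apply_image]
    simp
  obtain ⟨g, hg1, hg2⟩ := exists_extension_of_le_sublinear pm N (by
      intro c hc G
      simp only [hN]
      have : ∫ x, rw1 x * ‖(c • G : Lp (Vu n) 2 (volume : Measure (Eu n))) x‖ = ∫ x, c * (rw1 x * ‖G x‖) := by
        refine integral_congr_ae ?_
        filter_upwards [Lp.coeFn_smul c G] with x hx
        rw [hx, Pi.smul_apply, norm_smul, Real.norm_of_nonneg hc.le]; ring
      rw [this, integral_const_mul]; ring) (by
      intro G G'
      simp only [hN]
      rw [← mul_add]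
      refine mul_le_mul_of_nonneg_left ?_ hC
      rw [← integral_add (rw1_mul_int (Lp.memLp G)) (rw1_mul_int (Lp.memLp G'))]
      refine integral_mono_ae (rw1_mul_int (Lp.memLp _)) (intg_add (rw1_mul_int (Lp.memLp G)) (rw1_mul_int (Lp.memLp G'))) ?_
      filter_upwards [Lp.coeFn_add G G'] with x hx
      rw [hx, Pi.add_apply, ← mul_add]
      exact mul_le_mul_of_nonneg_left (norm_add_le _ _) (rw1_pos x).le) (by
      rintro ⟨G, hG⟩
      obtain ⟨c, rfl⟩ := hG
      exact (hpmT c ⟨c, rfl⟩).le.trans (hle c))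
  -- continuity
  set Rw : Lp ℝ 2 (volume : Measure (Eu n)) := rw1_memLp.toLp _ with hRw
  have hNb : ∀ G, N G ≤ C * ‖Rw‖ * ‖G‖ := by
    intro G
    simp only [hN]
    rw [mul_assoc]
    refine mul_le_mul_of_nonneg_left ?_ hC
    set G' : Lp ℝ 2 (volume : Measure (Eu n)) := (Lp.memLp G).norm.toLp _ with hG'
    have e1 : ‖G'‖ = ‖G‖ := by
      rw [hG', Lp.norm_toLp, Lp.norm_def, eLpNorm_norm]
    have e2 : ∫ x, rw1 x * ‖G x‖ = inner ℝ Rw G' := by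
      rw [L2.inner_def]
      refine integral_congr_ae ?_
      filter_upwards [(rw1_memLp (n := n)).coeFn_toLp, (Lp.memLp G).norm.coeFn_toLp] with x a1 a2
      rw [a1, a2]; simp [mul_comm]
    rw [e2, ← e1]
    exact real_inner_le_norm _ _
  set gc : StrongDual ℝ (Lp (Vu n) 2 (volume : Measure (Eu n))) := LinearMap.mkContinuous g (C * ‖Rw‖) (fun G => by
    rw [Real.norm_eq_abs, abs_le']
    refine ⟨(hg2 G).trans (hNb G), ?_⟩
    rw [← map_neg]
    refine (hg2 _).trans ((hNb _).trans ?_)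
    rw [norm_neg]) with hgc
  set B := (InnerProductSpace.toDual ℝ _).symm gc with hB
  have hBi : ∀ G, inner ℝ B G = g G := fun G => by rw [hB, InnerProductSpace.toDual_symm_apply]; rfl
  -- measurable representative
  obtain ⟨B', hB'm, hBB'⟩ : ∃ B' : Eu n → Vu n, Measurable B' ∧ (B : Eu n → Vu n) =ᵐ[volume] B' :=
    ⟨_, (Lp.aestronglyMeasurable B).stronglyMeasurable_mk.measurable, (Lp.aestronglyMeasurable B).ae_eq_mk⟩
  set S := {x : Eu n | C * rw1 x < ‖B' x‖} with hS
  have hSm : MeasurableSet S := measurableSet_lt (measurable_const.mul rw1_cont.measurable) hB'm.norm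
  have hB'L : MemLp B' 2 := (memLp_congr_ae hBB').1 (Lp.memLp B)
  have hSz : ∀ᵐ x : Eu n, x ∉ S := by
    have hGL : MemLp (S.indicator B') 2 := hB'L.indicator hSm
    have h1 := hg2 (hGL.toLp _)
    rw [← hBi, L2.inner_def] at h1
    have e1 : ∫ x, inner ℝ (B x) ((hGL.toLp _ : Lp (Vu n) 2 (volume : Measure (Eu n))) x) = ∫ x, S.indicator (fun x => ‖B' x‖ ^ 2) x := by
      refine integral_congr_ae ?_
      filter_upwards [hBB', hGL.coeFn_toLp] with x a1 a2
      rw [a1, a2]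
      by_cases hx : x ∈ S
      · rw [indicator_of_mem hx, indicator_of_mem hx, real_inner_self_eq_norm_sq]
      · rw [indicator_of_notMem hx, indicator_of_notMem hx, inner_zero_right]
    have e2 : N (hGL.toLp _) = ∫ x, S.indicator (fun x => C * (rw1 x * ‖B' x‖)) x := by
      simp only [hN]
      rw [← integral_const_mul]
      refine integral_congr_ae ?_
      filter_upwards [hGL.coeFn_toLp] with x a2
      rw [a2]
      by_cases hx : x ∈ S
      · rw [indicator_of_mem hx, indicator_of_mem hx]
      · rw [indicator_of_notMem hx, indicator_of_notMem hx]; simp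
    rw [e1, e2] at h1
    have i1 : Integrable (S.indicator (fun x => ‖B' x‖ ^ 2)) :=
      ((memLp_two_iff_integrable_sq hB'L.norm.1).1 hB'L.norm).indicator hSm
    have i2 : Integrable (S.indicator (fun x => C * (rw1 x * ‖B' x‖))) := ((rw1_mul_int hB'L).const_mul C).indicator hSm
    have hle' : ∀ x, S.indicator (fun x => C * (rw1 x * ‖B' x‖)) x ≤ S.indicator (fun x => ‖B' x‖ ^ 2) x := by
      intro x
      by_cases hx : x ∈ S
      · rw [indicator_of_mem hx, indicator_of_mem hx]
        have : C * rw1 x < ‖B' x‖ := hx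
        nlinarith [norm_nonneg (B' x)]
      · rw [indicator_of_notMem hx, indicator_of_notMem hx]
    have h3 : ∫ x, (S.indicator (fun x => ‖B' x‖ ^ 2) x - S.indicator (fun x => C * (rw1 x * ‖B' x‖)) x) = 0 := by
      rw [integral_sub i1 i2]
      have := integral_mono i2 i1 hle'
      linarith
    have h4 := (integral_eq_zero_iff_of_nonneg (fun x => sub_nonneg.2 (hle' x)) (intg_sub i1 i2)).1 h3
    filter_upwards [h4] with x hx hxS
    simp only [indicator_of_mem hxS, Pi.zero_apply] at hx
    have h5 : C * rw1 x < ‖B' x‖ := hxS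
    have h6 : 0 ≤ C * rw1 x := mul_nonneg hC (rw1_pos x).le
    nlinarith
  refine ⟨Sᶜ.indicator (fun x => (rw1 x)⁻¹ • B' x), (rw1_cont.measurable.inv.smul hB'm).indicator hSm.compl, ?_, ?_⟩
  · intro x
    by_cases hx : x ∈ S
    · rw [indicator_of_notMem (by simpa using hx)]; simpa using hC
    · rw [indicator_of_mem (by simpa using hx)]
      have h0 := rw1_pos x
      rw [norm_smul, norm_inv, Real.norm_of_nonneg h0.le, inv_mul_le_iff₀ h0]
      have : ¬ (C * rw1 x < ‖B' x‖) := hx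
      linarith
  · intro p
    have hTp : T (Finsupp.single p 1) = gen p := by rw [hT, Finsupp.linearCombination_single, one_smul]
    have h1 : g (gen p) = L p := by
      have := hg1 ⟨T (Finsupp.single p 1), LinearMap.mem_range_self _ _⟩
      rw [hpmT] at this
      simp only [hTp] at this
      rw [this, hl0, Finsupp.linearCombination_single, one_smul]
    rw [← h1, ← hBi, L2.inner_def]
    refine integral_congr_ae ?_
    filter_upwards [hBB', (hg p).coeFn_toLp, hSz] with x a1 a2 a3
    rw [indicator_of_mem (by simpa using a3), a1, a2, inner_smul_right, inner_smul_left]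
    simp

set_option linter.unusedVariables false

theorem BMOB.wi {n : ℕ} {f : Eu n → ℝ} {b : ℝ} (hf : BMOB f b) : WI f := by
  refine ⟨hf.1.aestronglyMeasurable, ?_⟩
  obtain ⟨h1, -⟩ := hf.tail_one 0 one_pos
  simp only [zero_sub, env_neg] at h1
  set a := cAvg f 0 1
  refine (intg_add h1 (integrable_env_one.const_mul |a|)).mono' ?_ (ae_of_all _ fun x => ?_)
  · exact (continuous_env one_pos).aestronglyMeasurable.mul (continuous_abs.comp_aestronglyMeasurable hf.1.aestronglyMeasurable)
  · have h0 := env_pos one_pos x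
    rw [Real.norm_of_nonneg (by positivity)]
    have : |f x| ≤ |f x - a| + |a| := by have := abs_add_le (f x - a) a; simpa using this
    nlinarith

theorem green' {n : ℕ} (hn : 1 ≤ n) {s : Finset (Eu n × ℝ)} (cf : Eu n × ℝ → ℝ) (hs : ∀ p ∈ s, 0 < p.2)
    (hc0 : ∑ p ∈ s, cf p = 0) {v : Eu n → ℝ} {b : ℝ} (hb : 0 < b) (hv : BMOB v b) (hc : UniformContinuous v) :
    ∫ x, FF s cf none (pt x 0) * v x ≤ gC n * (2 * b) * ∫ x, ‖FV s cf (pt x 0)‖ := by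
  obtain ⟨A, hA, hAd⟩ := FV_bdry_decay cf hs hc0
  have hlim : Tendsto (fun N : ℕ => ∫ x, FF s cf none (pt x 0) * trunc N (v x)) atTop (nhds (∫ x, FF s cf none (pt x 0) * v x)) := by
    refine tendsto_integral_of_dominated_convergence (fun x => A * (env 1 x * |v x|)) ?_ (hv.wi.2.const_mul A) ?_ ?_
    · intro N
      exact ((FF_uc cf hs none).continuous.mul ((trunc_cont _).comp hc.continuous)).aestronglyMeasurable
    · intro N
      refine ae_of_all _ fun x => ?_
      rw [norm_mul, Real.norm_eq_abs, Real.norm_eq_abs, ← mul_assoc]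
      have h1 := (FF_le_FV s cf none (pt x 0)).trans (hAd x)
      exact mul_le_mul h1 (trunc_abs_le (Nat.cast_nonneg N) _) (abs_nonneg _) ((abs_nonneg _).trans h1)
    · refine ae_of_all _ fun x => ?_
      refine tendsto_const_nhds.congr' ?_
      obtain ⟨N0, hN0⟩ := exists_nat_ge |v x|
      filter_upwards [eventually_ge_atTop N0] with N hN
      rw [trunc_eq]
      exact hN0.trans (by exact_mod_cast hN)
  refine le_of_tendsto' hlim fun N => ?_
  have huc : UniformContinuous (fun x => trunc N (v x)) := by
    have : UniformContinuous (trunc N) := (LipschitzWith.of_dist_le_mul (K := 1) fun x y => by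
      rw [Real.dist_eq, Real.dist_eq]; simpa using trunc_lip N x y).uniformContinuous
    exact this.comp hc
  exact green hn cf hs hc0 (by positivity) (hv.trunc (Nat.cast_nonneg N)) huc (fun x => trunc_le (Nat.cast_nonneg N) _)

noncomputable def HV {n : ℕ} (ξ : Vu n) : Vu n := WithLp.toLp 2 fun k => Hk k ξ

noncomputable def qP (n : ℕ) : Eu n × ℝ := (0, 1)

theorem finsupp_FF {n : ℕ} (c : {p : Eu n × ℝ // 0 < p.2} →₀ ℝ) :
    ∃ (s : Finset (Eu n × ℝ)) (cf : Eu n × ℝ → ℝ), (∀ p ∈ s, 0 < p.2) ∧ ∑ p ∈ s, cf p = 0 ∧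
      ∀ k X, FF s cf k X = c.sum fun p a => a * (Hk k (X - srcP p.1) - Hk k (X - srcP (qP n))) := by
  classical
  set cc : (Eu n × ℝ) →₀ ℝ := c.mapDomain Subtype.val - Finsupp.single (qP n) (c.sum fun _ a => a) with hcc
  have key : ∀ h : Eu n × ℝ → ℝ, (cc.sum fun p a => a * h p) = c.sum fun p a => a * (h p.1 - h (qP n)) := by
    intro h
    rw [hcc, Finsupp.sum_sub_index (by intros; ring), Finsupp.sum_mapDomain_index (by intros; ring) (by intros; ring),
      Finsupp.sum_single_index (by ring)]
    simp only [Finsupp.sum, mul_sub, Finset.sum_sub_distrib, ← Finset.sum_mul]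
  refine ⟨cc.support, cc, ?_, ?_, ?_⟩
  · intro p hp
    have h1 := Finsupp.support_sub hp
    rcases Finset.mem_union.1 h1 with h2 | h2
    · have h3 := Finsupp.mapDomain_support h2
      obtain ⟨q, -, rfl⟩ := Finset.mem_image.1 h3
      exact q.2
    · have h3 := Finsupp.support_single_subset h2
      rw [Finset.mem_singleton] at h3
      rw [h3]; simp [qP]
  · have := key (fun _ => 1)
    simp only [mul_one, sub_self, mul_zero] at this
    rw [Finsupp.sum, Finsupp.sum_fun_zero] at this
    exact this
  · intro k X
    exact key fun p => Hk k (X - srcP p)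

theorem finsupp_FV {n : ℕ} (c : {p : Eu n × ℝ // 0 < p.2} →₀ ℝ) :
    ∃ (s : Finset (Eu n × ℝ)) (cf : Eu n × ℝ → ℝ), (∀ p ∈ s, 0 < p.2) ∧ ∑ p ∈ s, cf p = 0 ∧
      (∀ k X, FF s cf k X = c.sum fun p a => a * (Hk k (X - srcP p.1) - Hk k (X - srcP (qP n)))) ∧
      ∀ X, FV s cf X = c.sum fun p a => a • (HV (X - srcP p.1) - HV (X - srcP (qP n))) := by
  obtain ⟨s, cf, h1, h2, h3⟩ := finsupp_FF c
  refine ⟨s, cf, h1, h2, h3, fun X => ?_⟩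
  ext k
  simp only [Finsupp.sum, WithLp.ofLp_sum, Finset.sum_apply]
  exact h3 k X

theorem Hk_none_refl {n : ℕ} (x : Eu n) (s : ℝ) : Hk none (pt (-x) s) = Hk none (pt x s) := by
  have : ‖pt (-x) s‖ = ‖pt x s‖ := by
    rw [← sq_eq_sq₀ (norm_nonneg _) (norm_nonneg _), norm_pt_sq, norm_pt_sq, norm_neg]
  unfold Hk; rw [pt_none, pt_none, this]

theorem Hk_some_refl {n : ℕ} (j : Fin n) (x : Eu n) (s : ℝ) : Hk (some j) (pt (-x) s) = - Hk (some j) (pt x s) := by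
  have : ‖pt (-x) s‖ = ‖pt x s‖ := by
    rw [← sq_eq_sq₀ (norm_nonneg _) (norm_nonneg _), norm_pt_sq, norm_pt_sq, norm_neg]
  unfold Hk; rw [pt_some, pt_some, this]; simp [neg_div]

theorem pt_sub_src {n : ℕ} (x y : Eu n) (s : ℝ) : pt x 0 - srcP (y, s) = pt (-(y - x)) s := by
  unfold srcP; rw [pt_sub, neg_sub]; simp

theorem HVdiff_none {n : ℕ} (x y : Eu n) (s : ℝ) :
    Hk none (pt x 0 - srcP (y, s)) - Hk none (pt x 0 - srcP (qP n)) = Hk none (pt (y - x) s) - Hk none (pt (-x) 1) := by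
  unfold qP
  rw [pt_sub_src, pt_sub_src, Hk_none_refl, Hk_none_refl, zero_sub]

theorem HVdiff_some {n : ℕ} (j : Fin n) (x y : Eu n) (s : ℝ) :
    Hk (some j) (pt x 0 - srcP (y, s)) - Hk (some j) (pt x 0 - srcP (qP n)) = - (Hk (some j) (pt (y - x) s) - Hk (some j) (pt (-x) 1)) := by
  unfold qP
  rw [pt_sub_src, pt_sub_src, Hk_some_refl, Hk_some_refl, zero_sub]; ring

/-- Fefferman–Stein decomposition of the extension of a uniformly continuous BMO function. -/
theorem dual_rep {n : ℕ} (hn : 1 ≤ n) {v : Eu n → ℝ} {b : ℝ} (hb : 0 < b) (hv : BMOB v b) (hc : UniformContinuous v) :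
    ∃ β : Option (Fin n) → Eu n → ℝ, (∀ k, Measurable (β k)) ∧ (∀ k x, |β k x| ≤ gC n * (2 * b)) ∧
      ∀ y s, 0 < s → U none v y s = U none (β none) y s + ∑ j, U (some j) (β (some j)) y s := by
  have hg := gC_pos n
  have hHm : ∀ Y : Vu n, Measurable (fun x : Eu n => HV (pt x 0 - Y)) := by
    intro Y
    have h1 : ∀ k, Measurable (fun x : Eu n => Hk k (pt x 0 - Y)) := fun k =>
      (measurable_Hk k).comp (by
        have : Continuous (fun x : Eu n => pt x 0 - Y) := by
          have := continuous_pt (n := n)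
          fun_prop
        exact this.measurable)
    exact (WithLp.measurable_toLp 2 _).comp (measurable_pi_lambda _ h1)
  obtain ⟨β, hβm, hβ, hrep⟩ := l1_dual (P := {p : Eu n × ℝ // 0 < p.2}) (fun p x => HV (pt x 0 - srcP p.1) - HV (pt x 0 - srcP (qP n)))
    (fun p => (hHm _).sub (hHm _)) (fun p => by
      obtain ⟨s, cf, h1, h2, h3, h4⟩ := finsupp_FV (Finsupp.single p 1)
      obtain ⟨A, hA, hAd⟩ := FV_bdry_decay cf h1 h2
      refine ⟨A, fun x => ?_⟩
      have := hAd x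
      rw [h4, Finsupp.sum_single_index (by simp), one_smul] at this
      exact this) (fun p => U none v p.1.1 p.1.2) (C := gC n * (2 * b)) (by positivity) (fun c => by
      obtain ⟨s, cf, h1, h2, h3, h4⟩ := finsupp_FV c
      have := green' hn cf h1 h2 hb hv hc
      simp only [h4, h3] at this
      refine le_trans (le_of_eq ?_) this
      simp only [Finsupp.sum, Finset.sum_mul]
      rw [integral_finsetSum]
      · refine Finset.sum_congr rfl fun p _ => ?_
        unfold U
        rw [← integral_const_mul]
        refine integral_congr_ae (ae_of_all _ fun x => ?_)
        have := HVdiff_none x p.1.1 p.1.2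
        simp only [Prod.mk.eta] at this
        simp only [this]; ring
      · intro p _
        have h5 := (hv.wi.U_int none p.1.1 p.2).const_mul (c p)
        refine h5.congr (ae_of_all _ fun x => ?_)
        have := HVdiff_none x p.1.1 p.1.2
        simp only [Prod.mk.eta] at this
        simp only [this]; ring)
  have hcm : ∀ k, Measurable (fun x => β x k) := fun k => by
    have : Measurable (fun v : Vu n => v k) := (Continuous.measurable (by fun_prop))
    exact this.comp hβm
  have hcb : ∀ k x, |β x k| ≤ gC n * (2 * b) := fun k x => (abs_coord_le (β x) k).trans (hβ x)
  refine ⟨fun k => match k with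
    | none => fun x => β x none
    | some j => fun x => - β x (some j), ?_, ?_, ?_⟩
  · rintro (_ | j)
    · exact hcm none
    · exact (hcm (some j)).neg
  · rintro (_ | j) x
    · exact hcb none x
    · simp only [abs_neg]; exact hcb (some j) x
  · intro y s hs
    have := hrep ⟨(y, s), hs⟩
    simp only at this ⊢
    rw [this]
    unfold U
    have i0 := (WI.of_bdd (hcm none).aestronglyMeasurable (hcb none)).U_int none y hs
    have ij : ∀ j : Fin n, Integrable (fun x => (Hk (some j) (pt (y - x) s) - Hk (some j) (pt (-x) 1)) * -β x (some j)) := fun j =>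
      (WI.of_bdd (hcm (some j)).neg.aestronglyMeasurable (fun x => by simp only [Pi.neg_apply, abs_neg]; exact hcb (some j) x)).U_int (some j) y hs
    rw [← integral_finsetSum _ fun j _ => ij j, ← integral_add i0 (integrable_finsetSum _ fun j _ => ij j)]
    refine integral_congr_ae (ae_of_all _ fun x => ?_)
    simp only [PiLp.inner_apply, Fintype.sum_option]
    have e0 := HVdiff_none x y s
    have ej := fun j => HVdiff_some j x y s
    simp only [PiLp.sub_apply, HV, e0, ej]
    simp
    rw [← Finset.sum_neg_distrib]
    exact Finset.sum_congr rfl fun j _ => by ring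

set_option linter.unusedVariables false

/-! ## Part J: mollification and the iteration -/

structure Mol {n : ℕ} (η : Eu n → ℝ) (δ A L : ℝ) : Prop where
  cont : Continuous η
  nonneg : ∀ z, 0 ≤ η z
  intg : Integrable η
  one : ∫ z, η z = 1
  supp : ∀ z, δ ≤ ‖z‖ → η z = 0
  le : ∀ z, η z ≤ A / δ ^ n
  lip : ∀ z w, |η z - η w| ≤ L * ‖z - w‖

theorem exists_mol (n : ℕ) : ∃ A > 0, ∀ δ > 0, ∃ (η : Eu n → ℝ) (L : ℝ), 0 ≤ L ∧ Mol η δ A L := by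
  set f : Eu n → ℝ := fun z => max 0 (1 - ‖z‖) with hf
  have hfc : Continuous f := by fun_prop
  have hf0 : ∀ z, 0 ≤ f z := fun z => le_max_left _ _
  have hf1 : ∀ z, f z ≤ 1 := fun z => max_le zero_le_one (by linarith [norm_nonneg z])
  have hfs : ∀ z, 1 ≤ ‖z‖ → f z = 0 := fun z hz => max_eq_left (by linarith)
  have hflip : ∀ z w, |f z - f w| ≤ ‖z - w‖ := fun z w => by
    have h1 := abs_max_sub_max_le_abs (1 - ‖z‖) (1 - ‖w‖) 0
    rw [max_comm _ 0, max_comm _ 0] at h1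
    refine h1.trans ?_
    have := abs_norm_sub_norm_le w z
    rw [norm_sub_rev w z] at this
    rw [show 1 - ‖z‖ - (1 - ‖w‖) = ‖w‖ - ‖z‖ by ring]; exact this
  have hcs : HasCompactSupport f := by
    refine HasCompactSupport.intro (isCompact_closedBall (0 : Eu n) 1) fun z hz => hfs z ?_
    simp at hz; exact hz.le
  have hfi : Integrable f := hfc.integrable_of_hasCompactSupport hcs
  have hm : 0 < ∫ z, f z :=
    hfc.integral_pos_of_hasCompactSupport_nonneg_nonzero hcs hf0 (x := 0) (by simp [hf])
  set m := ∫ z, f z with hmd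
  clear_value f
  refine ⟨m⁻¹, by positivity, fun δ hδ => ⟨fun z => m⁻¹ * (δ⁻¹ ^ n * f (δ⁻¹ • z)), m⁻¹ * (δ⁻¹ ^ n * δ⁻¹), by positivity, ?_⟩⟩
  refine ⟨continuous_const.mul (continuous_const.mul (hfc.comp (continuous_const_smul _))), fun z => ?_, ?_, ?_, fun z hz => ?_, fun z => ?_, fun z w => ?_⟩
  · have := hf0 (δ⁻¹ • z); positivity
  · exact ((hfi.comp_smul (by positivity : δ⁻¹ ≠ 0)).const_mul _).const_mul _
  · rw [integral_const_mul, integral_scale f hδ]; exact inv_mul_cancel₀ hm.ne'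
  · rw [hfs]; · simp
    rw [norm_smul, norm_inv, Real.norm_of_nonneg hδ.le, inv_mul_eq_div, le_div_iff₀ hδ]; linarith
  · rw [div_eq_mul_inv, ← inv_pow]
    have := hf1 (δ⁻¹ • z)
    calc m⁻¹ * (δ⁻¹ ^ n * f (δ⁻¹ • z)) ≤ m⁻¹ * (δ⁻¹ ^ n * 1) := by gcongr
      _ = _ := by ring
  · have := hflip (δ⁻¹ • z) (δ⁻¹ • w)
    rw [← smul_sub, norm_smul, norm_inv, Real.norm_of_nonneg hδ.le] at this
    calc |m⁻¹ * (δ⁻¹ ^ n * f (δ⁻¹ • z)) - m⁻¹ * (δ⁻¹ ^ n * f (δ⁻¹ • w))|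
        = m⁻¹ * (δ⁻¹ ^ n * |f (δ⁻¹ • z) - f (δ⁻¹ • w)|) := by
          rw [← mul_sub, ← mul_sub, abs_mul, abs_mul, abs_of_pos (by positivity : 0 < m⁻¹), abs_of_pos (by positivity : 0 < δ⁻¹ ^ n)]
      _ ≤ m⁻¹ * (δ⁻¹ ^ n * (δ⁻¹ * ‖z - w‖)) := by gcongr
      _ = _ := by ring

noncomputable def mol {n : ℕ} (η u : Eu n → ℝ) (x : Eu n) : ℝ := ∫ y, η (x - y) * u y

theorem Mol.supp' {n : ℕ} {η : Eu n → ℝ} {δ A L : ℝ} (h : Mol η δ A L) {Q : Set (Eu n)} {x : Eu n} (hQ : Metric.ball x δ ⊆ Q) (g : Eu n → ℝ) :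
    Function.support (fun y => η (x - y) * g y) ⊆ Q := by
  intro y hy
  by_contra hcon
  refine hy ?_
  simp only
  rw [h.supp, zero_mul]
  by_contra h2
  push Not at h2
  exact hcon (hQ (by rw [Metric.mem_ball, dist_comm, dist_eq_norm]; exact h2))

theorem Mol.mul_int {n : ℕ} {η : Eu n → ℝ} {δ A L : ℝ} (h : Mol η δ A L) {g : Eu n → ℝ} (hg : LocallyIntegrable g) (x : Eu n) :
    Integrable (fun y => η (x - y) * g y) := by
  rw [← integrableOn_iff_integrable_of_support_subset (h.supp' (ball_subset_cube x) g)]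
  have h1 := integrableOn_cube hg (WithLp.toLp 2 fun i => x i - δ) (2 * δ)
  refine Integrable.bdd_mul (c := A / δ ^ n) h1 (h.cont.comp (by fun_prop)).aestronglyMeasurable (ae_of_all _ fun y => ?_)
  rw [Real.norm_of_nonneg (h.nonneg _)]; exact h.le _

theorem Mol.int_sub {n : ℕ} {η : Eu n → ℝ} {δ A L : ℝ} (h : Mol η δ A L) (x : Eu n) :
    Integrable (fun y => η (x - y)) ∧ ∫ y, η (x - y) = 1 :=
  ⟨h.intg.comp_sub_left x, by rw [integral_sub_left_eq_self (fun z => η z) _ x, h.one]⟩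

theorem locInt_sub_const {n : ℕ} {u : Eu n → ℝ} (hu : LocallyIntegrable u) (a : ℝ) : LocallyIntegrable (fun y => u y - a) :=
  hu.sub (locallyIntegrable_const a)

theorem Mol.sub_const {n : ℕ} {η : Eu n → ℝ} {δ A L : ℝ} (h : Mol η δ A L) {u : Eu n → ℝ} (hu : LocallyIntegrable u) (x : Eu n) (a : ℝ) :
    mol η u x - a = ∫ y, η (x - y) * (u y - a) := by
  have : a = ∫ y, η (x - y) * a := by rw [integral_mul_const, (h.int_sub x).2, one_mul]
  conv_lhs => rw [this]
  unfold mol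
  rw [← integral_sub (h.mul_int hu x) ((h.int_sub x).1.mul_const a)]
  congr 1; ext y; ring

theorem Mol.loc {n : ℕ} {η : Eu n → ℝ} {δ A L : ℝ} (h : Mol η δ A L) {u : Eu n → ℝ} (hu : LocallyIntegrable u) (x : Eu n) (a : ℝ)
    {c : Eu n} {l : ℝ} (hQ : Metric.ball x δ ⊆ cube c l) :
    |mol η u x - a| ≤ A / δ ^ n * ∫ y in cube c l, |u y - a| := by
  have hi := integrableOn_cube (locInt_sub_const hu a) c l
  rw [h.sub_const hu, ← setIntegral_eq_integral_of_forall_compl_eq_zero (s := cube c l), ← integral_const_mul, ← Real.norm_eq_abs]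
  · refine norm_integral_le_of_norm_le (hi.abs.const_mul _) (ae_of_all _ fun y => ?_)
    rw [norm_mul, Real.norm_of_nonneg (h.nonneg _), Real.norm_eq_abs]
    gcongr; exact h.le _
  · intro y hy
    by_contra hc
    exact hy (h.supp' hQ (fun y => u y - a) hc)

theorem Mol.loc_lip {n : ℕ} {η : Eu n → ℝ} {δ A L : ℝ} (h : Mol η δ A L) {u : Eu n → ℝ} (hu : LocallyIntegrable u) (x x' : Eu n) (a : ℝ)
    {c : Eu n} {l : ℝ} (hQ : Metric.ball x δ ⊆ cube c l) (hQ' : Metric.ball x' δ ⊆ cube c l) :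
    |mol η u x - mol η u x'| ≤ L * ‖x - x'‖ * ∫ y in cube c l, |u y - a| := by
  have hl := locInt_sub_const hu a
  have hi := integrableOn_cube hl c l
  have e : mol η u x - mol η u x' = ∫ y, (η (x - y) * (u y - a) - η (x' - y) * (u y - a)) := by
    rw [integral_sub (h.mul_int hl x) (h.mul_int hl x'), ← h.sub_const hu, ← h.sub_const hu]; ring
  rw [e, ← setIntegral_eq_integral_of_forall_compl_eq_zero (s := cube c l), ← integral_const_mul, ← Real.norm_eq_abs]
  · refine norm_integral_le_of_norm_le (hi.abs.const_mul _) (ae_of_all _ fun y => ?_)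
    rw [← sub_mul, norm_mul, Real.norm_eq_abs, Real.norm_eq_abs]
    gcongr
    have := h.lip (x - y) (x' - y)
    simpa using this
  · intro y hy
    have h1 : η (x - y) * (u y - a) = 0 := by
      by_contra hc; exact hy (h.supp' hQ (fun y => u y - a) hc)
    have h2 : η (x' - y) * (u y - a) = 0 := by
      by_contra hc; exact hy (h.supp' hQ' (fun y => u y - a) hc)
    rw [h1, h2, sub_zero]

noncomputable def dJ (n : ℕ) : ℝ := 2 * (√n + 2)
theorem dJ_ge (n : ℕ) : 4 ≤ dJ n := by unfold dJ; have := Real.sqrt_nonneg (n:ℝ); linarith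
noncomputable def cJ (n : ℕ) (A : ℝ) : ℝ := 2 * (1 + (2 * dJ n) ^ n + A * dJ n ^ n)

/-- small-scale oscillation bound -/
def SO {n : ℕ} (u : Eu n → ℝ) (r ω : ℝ) : Prop := ∀ c l, 0 < l → l ≤ r → cubeOsc u c l ≤ ω

theorem Mol.uc {n : ℕ} {η : Eu n → ℝ} {δ A L : ℝ} (h : Mol η δ A L) (hδ : 0 < δ) (hL : 0 ≤ L) {u : Eu n → ℝ} (hu : LocallyIntegrable u) {ω : ℝ}
    (hω : SO u (dJ n * δ) ω) : UniformContinuous (mol η u) := by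
  have hD := dJ_ge n
  have key : ∀ x x', ‖x - x'‖ ≤ δ → |mol η u x - mol η u x'| ≤ L * ‖x - x'‖ * (ω * (2 * (2 * δ)) ^ n) := by
    intro x x' hx
    have hl : 0 < 2 * (2 * δ) := by positivity
    refine (h.loc_lip hu x x' (cubeAvg u (WithLp.toLp 2 fun i => x i - 2 * δ) (2 * (2 * δ))) (c := WithLp.toLp 2 fun i => x i - 2 * δ) (l := 2 * (2 * δ)) ?_ ?_).trans ?_
    · exact (Metric.ball_subset_ball (by linarith)).trans (ball_subset_cube x)
    · refine (Metric.ball_subset_ball' ?_).trans (ball_subset_cube x)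
      rw [dist_comm, dist_eq_norm]; linarith
    · rw [cubeOsc_mul u _ hl]
      have := hω (WithLp.toLp 2 fun i => x i - 2 * δ) (2 * (2 * δ)) hl (by nlinarith)
      gcongr
  have hω0 : 0 ≤ ω := (cubeOsc_nonneg u 0 hδ).trans (hω 0 δ hδ (by nlinarith))
  set B := L * (ω * (2 * (2 * δ)) ^ n) with hB
  have hB0 : 0 ≤ B := by positivity
  rw [Metric.uniformContinuous_iff]
  intro ε hε
  refine ⟨min δ (ε / (B + 1)), by positivity, fun {a b} hab => ?_⟩
  rw [dist_eq_norm] at hab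
  have h1 := (lt_min_iff.1 hab).1
  have h2 := (lt_min_iff.1 hab).2
  rw [lt_div_iff₀ (by positivity)] at h2
  rw [Real.dist_eq]
  have := key a b h1.le
  have : L * ‖a - b‖ * (ω * (2 * (2 * δ)) ^ n) = B * ‖a - b‖ := by rw [hB]; ring
  nlinarith [norm_nonneg (a - b)]

theorem Mol.bmob {n : ℕ} {η : Eu n → ℝ} {δ A L : ℝ} (h : Mol η δ A L) (hδ : 0 < δ) (hA : 0 < A) (hL : 0 ≤ L) {u : Eu n → ℝ} (hu : LocallyIntegrable u) {ω : ℝ}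
    (hω : SO u (dJ n * δ) ω) : BMOB (fun x => u x - mol η u x) (cJ n A * ω) := by
  have hD := dJ_ge n
  have hD0 : 0 < dJ n := by linarith
  have hω0 : 0 ≤ ω := (cubeOsc_nonneg u 0 hδ).trans (hω 0 δ hδ (by nlinarith))
  have hml : LocallyIntegrable (mol η u) := (h.uc hδ hL hu hω).continuous.locallyIntegrable
  have hdl : LocallyIntegrable (fun x => u x - mol η u x) := hu.sub hml
  set ρ := δ * (√n + 2) with hρ
  have hρ0 : 0 < 2 * ρ := by positivity
  have hρD : 2 * ρ = dJ n * δ := by rw [hρ]; unfold dJ; ring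
  -- the enlarged cube
  set cc : Eu n → Eu n := fun c => WithLp.toLp 2 fun i => c i - ρ with hcc
  have hball : ∀ c : Eu n, ∀ l, 0 < l → l ≤ δ → ∀ x ∈ cube c l, Metric.ball x δ ⊆ cube (cc c) (2 * ρ) := by
    intro c l hl hlδ x hx
    refine (Metric.ball_subset_ball' ?_).trans (ball_subset_cube c)
    have := cube_subset_ball c hl hx
    rw [Metric.mem_ball] at this
    have h3 : l * (√n + 1) ≤ δ * (√n + 1) := by gcongr
    rw [hρ]; nlinarith
  have hosc : ∀ c : Eu n, ∫ y in cube (cc c) (2 * ρ), |u y - cubeAvg u (cc c) (2 * ρ)| ≤ ω * (dJ n ^ n * δ ^ n) := by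
    intro c
    rw [cubeOsc_mul u _ hρ0, ← mul_pow, ← hρD]
    have := hω (cc c) _ hρ0 hρD.le
    gcongr
  set E := A * dJ n ^ n * ω with hE
  have hmE : ∀ c : Eu n, ∀ l, 0 < l → l ≤ δ → ∀ x ∈ cube c l, |mol η u x - cubeAvg u (cc c) (2 * ρ)| ≤ E := by
    intro c l hl hlδ x hx
    refine (h.loc hu x _ (hball c l hl hlδ x hx)).trans ?_
    calc _ ≤ A / δ ^ n * (ω * (dJ n ^ n * δ ^ n)) := by have := hosc c; gcongr
      _ = E := by rw [hE]; field_simp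
  have e : cJ n A * ω = 2 * ((1 + (2 * dJ n) ^ n + A * dJ n ^ n) * ω) := by unfold cJ; ring
  rw [e]
  have hpos : 0 ≤ (2 * dJ n) ^ n * ω := by positivity
  have hE0 : 0 ≤ E := by positivity
  refine BMOB.of_forall hdl fun c l hl => ?_
  have hln : 0 < l ^ n := by positivity
  rcases le_or_gt l δ with hlδ | hlδ
  · refine ⟨cubeAvg u c l - cubeAvg u (cc c) (2 * ρ), ?_⟩
    have i1 : IntegrableOn (fun x => |u x - cubeAvg u c l|) (cube c l) := (integrableOn_cube (locInt_sub_const hu _) c l).abs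
    calc ∫ x in cube c l, |u x - mol η u x - (cubeAvg u c l - cubeAvg u (cc c) (2 * ρ))|
        ≤ ∫ x in cube c l, (|u x - cubeAvg u c l| + E) := by
          refine setIntegral_mono_on (integrableOn_cube (locInt_sub_const hdl _) c l).abs (i1.add (integrableOn_cube_const _ c l)) (measurableSet_cube c l) fun x hx => ?_
          have h1 := hmE c l hl hlδ x hx
          have h2 := abs_sub (u x - cubeAvg u c l) (mol η u x - cubeAvg u (cc c) (2 * ρ))
          have h3 : u x - mol η u x - (cubeAvg u c l - cubeAvg u (cc c) (2 * ρ)) = (u x - cubeAvg u c l) - (mol η u x - cubeAvg u (cc c) (2 * ρ)) := by ring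
          rw [h3]; linarith
      _ = cubeOsc u c l * l ^ n + E * l ^ n := by
          rw [integral_add i1 (integrableOn_cube_const _ c l), setIntegral_cube_const _ c hl, cubeOsc_mul u c hl]
      _ ≤ (1 + (2 * dJ n) ^ n + A * dJ n ^ n) * ω * l ^ n := by
          have := hω c l hl (by nlinarith)
          have : cubeOsc u c l * l ^ n ≤ ω * l ^ n := by gcongr
          nlinarith
  · refine ⟨0, ?_⟩
    have hg : LocallyIntegrable (fun x => |u x - mol η u x|) := fun x => (hdl x).norm
    have := setIntegral_cube_le_of_small (A := (1 + (2 * dJ n) ^ n + A * dJ n ^ n) * ω) hg hδ ?_ c l (by linarith)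
    · simpa using this
    intro c l hl h1 h2
    have hln : 0 < l ^ n := by positivity
    have i1 : IntegrableOn (fun x => |u x - cubeAvg u (cc c) (2 * ρ)|) (cube (cc c) (2 * ρ)) := (integrableOn_cube (locInt_sub_const hu _) _ _).abs
    have hsub : cube c l ⊆ cube (cc c) (2 * ρ) := fun x hx => hball c l hl h1 x hx (Metric.mem_ball_self hδ)
    have i2 := i1.mono_set hsub
    calc ∫ x in cube c l, |u x - mol η u x|
        ≤ ∫ x in cube c l, (|u x - cubeAvg u (cc c) (2 * ρ)| + E) := by
          refine setIntegral_mono_on (integrableOn_cube hdl c l).abs (i2.add (integrableOn_cube_const _ c l)) (measurableSet_cube c l) fun x hx => ?_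
          have h1 := hmE c l hl h1 x hx
          have h2 := abs_sub (u x - cubeAvg u (cc c) (2 * ρ)) (mol η u x - cubeAvg u (cc c) (2 * ρ))
          have h3 : u x - mol η u x = (u x - cubeAvg u (cc c) (2 * ρ)) - (mol η u x - cubeAvg u (cc c) (2 * ρ)) := by ring
          rw [h3]; linarith
      _ = (∫ x in cube c l, |u x - cubeAvg u (cc c) (2 * ρ)|) + E * l ^ n := by
          rw [integral_add i2 (integrableOn_cube_const _ c l), setIntegral_cube_const _ c hl]
      _ ≤ ω * (dJ n ^ n * δ ^ n) + E * l ^ n := by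
          gcongr
          refine le_trans ?_ (hosc c)
          exact setIntegral_mono_set i1 (ae_of_all _ fun x => abs_nonneg _) hsub.eventuallyLE
      _ ≤ ω * (dJ n ^ n * (2 * l) ^ n) + E * l ^ n := by gcongr; linarith
      _ ≤ _ := by
          have : ω * (dJ n ^ n * (2 * l) ^ n) = (2 * dJ n) ^ n * ω * l ^ n := by rw [mul_pow, mul_pow]; ring
          rw [this, hE]; nlinarith

set_option linter.unusedVariables false

theorem bdd_locInt {n : ℕ} {ψ : Eu n → ℝ} (hm : Measurable ψ) {M : ℝ} (h : ∀ x, |ψ x| ≤ M) : LocallyIntegrable ψ :=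
  (locallyIntegrable_const M).mono hm.aestronglyMeasurable (ae_of_all _ fun x => by
    rw [Real.norm_eq_abs, Real.norm_eq_abs]; exact (h x).trans (le_abs_self _))

theorem Mol.bdd {n : ℕ} {η : Eu n → ℝ} {δ A L : ℝ} (h : Mol η δ A L) {ψ : Eu n → ℝ} {M : ℝ} (hM : ∀ x, |ψ x| ≤ M) (x : Eu n) :
    |mol η ψ x| ≤ M := by
  have h1 := h.int_sub x
  have : ∫ y, M * η (x - y) = M := by rw [integral_const_mul, h1.2, mul_one]
  rw [← this, ← Real.norm_eq_abs]
  refine norm_integral_le_of_norm_le (h1.1.const_mul M) (ae_of_all _ fun y => ?_)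
  rw [norm_mul, Real.norm_of_nonneg (h.nonneg _), Real.norm_eq_abs, mul_comm]
  have := h.nonneg (x - y)
  gcongr; exact hM y

theorem Mol.bdd_lip {n : ℕ} {η : Eu n → ℝ} {δ A L : ℝ} (h : Mol η δ A L) (hδ : 0 < δ) (hL : 0 ≤ L) {ψ : Eu n → ℝ} (hm : Measurable ψ) {M : ℝ} (hM : ∀ x, |ψ x| ≤ M) (x x' : Eu n) :
    |mol η ψ x - mol η ψ x'| ≤ (2 * (L * M * (2 * δ) ^ n)) * ‖x - x'‖ := by
  have hl := bdd_locInt hm hM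
  have hM0 : 0 ≤ M := (abs_nonneg _).trans (hM 0)
  have ib : ∀ z : Eu n, Integrable ((Metric.ball z δ).indicator fun _ => L * ‖x - x'‖ * M) := fun z =>
    (integrable_indicator_iff Metric.isOpen_ball.measurableSet).2 (integrableOn_const (measure_ball_lt_top).ne)
  have vb : ∀ z : Eu n, ∫ y, (Metric.ball z δ).indicator (fun _ => L * ‖x - x'‖ * M) y ≤ L * ‖x - x'‖ * M * (2 * δ) ^ n := fun z => by
    rw [integral_indicator Metric.isOpen_ball.measurableSet, setIntegral_const, smul_eq_mul, mul_comm]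
    have := volume_real_ball_le z hδ.le
    gcongr
  unfold mol
  rw [← integral_sub (h.mul_int hl x) (h.mul_int hl x'), ← Real.norm_eq_abs]
  refine (norm_integral_le_of_norm_le ((ib x).add (ib x')) (ae_of_all _ fun y => ?_)).trans ?_
  · rw [← sub_mul, norm_mul, Real.norm_eq_abs, Real.norm_eq_abs]
    have h0 : 0 ≤ L * ‖x - x'‖ * M := by positivity
    have hi : ∀ z : Eu n, 0 ≤ (Metric.ball z δ).indicator (fun _ => L * ‖x - x'‖ * M) y := fun z => indicator_nonneg (fun _ _ => h0) _
    have hlip : |η (x - y) - η (x' - y)| * |ψ y| ≤ L * ‖x - x'‖ * M := by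
      have := h.lip (x - y) (x' - y)
      simp only [sub_sub_sub_cancel_right] at this
      exact mul_le_mul this (hM y) (abs_nonneg _) (by positivity)
    have hz : ∀ z : Eu n, y ∉ Metric.ball z δ → η (z - y) = 0 := fun z hz => h.supp _ (by
      rw [Metric.mem_ball, not_lt, dist_comm, dist_eq_norm] at hz; exact hz)
    simp only [Pi.add_apply]
    by_cases h1 : y ∈ Metric.ball x δ
    · have := hi x'
      rw [indicator_of_mem h1]; linarith
    · by_cases h2 : y ∈ Metric.ball x' δ
      · have := hi x
        rw [indicator_of_mem h2]; linarith
      · rw [hz x h1, hz x' h2]; simp only [sub_zero, abs_zero, zero_mul]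
        exact add_nonneg (hi x) (hi x')
  · simp only [Pi.add_apply]
    rw [integral_add (ib x) (ib x')]
    have := vb x; have := vb x'
    nlinarith

theorem Mol.U_mol {n : ℕ} {η : Eu n → ℝ} {δ A L : ℝ} (h : Mol η δ A L) (hδ : 0 < δ) {ψ : Eu n → ℝ} (hm : Measurable ψ) (hψ : WI ψ) (k : Option (Fin n)) (y : Eu n) {s : ℝ} (hs : 0 < s) :
    Integrable (fun z => η z * (U k ψ (y - z) s - U k ψ (-z) 1)) ∧
    U k (mol η ψ) y s = ∫ z, η z * (U k ψ (y - z) s - U k ψ (-z) 1) := by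
  obtain ⟨hGm, C, hC⟩ := EnvB.Hk_sub k y 0 hs one_pos
  simp only [zero_sub] at hGm hC
  set G : Eu n → ℝ := fun x => Hk k (pt (y - x) s) - Hk k (pt (-x) 1) with hG
  have hC0 : 0 ≤ C := by
    have := (abs_nonneg _).trans (hC 0)
    exact nonneg_of_mul_nonneg_left this (env_pos one_pos _)
  have hintg : Integrable (Function.uncurry fun x z => η z * (G x * ψ (x - z))) (volume.prod volume) := by
    have h1 := Integrable.convolution_integrand (ContinuousLinearMap.mul ℝ ℝ) (μ := (volume : Measure (Eu n))) (ν := volume) h.intg hψ.2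
    simp only [ContinuousLinearMap.mul_apply'] at h1
    refine (h1.const_mul (C * (1 + δ) ^ (n+1))).mono' ?_ (ae_of_all _ ?_)
    · have := h.cont.measurable
      exact ((this.comp measurable_snd).mul ((hGm.comp measurable_fst).mul (hm.comp (measurable_fst.sub measurable_snd)))).aestronglyMeasurable
    · rintro ⟨x, z⟩
      simp only [Function.uncurry_apply_pair]
      rw [norm_mul, norm_mul, Real.norm_of_nonneg (h.nonneg _), Real.norm_eq_abs, Real.norm_eq_abs]
      rcases le_or_gt δ ‖z‖ with hz | hz
      · rw [h.supp z hz]; simp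
      · have h2 : env 1 x ≤ (1 + δ) ^ (n+1) * env 1 (x - z) := by
          refine env_le_env one_pos (by linarith) ?_
          have := norm_sub_le x z
          nlinarith [norm_nonneg x]
        have h3 := h.nonneg z
        have h4 : |G x| ≤ C * ((1 + δ) ^ (n+1) * env 1 (x - z)) := (hC x).trans (by gcongr)
        calc η z * (|G x| * |ψ (x - z)|) ≤ η z * (C * ((1 + δ) ^ (n+1) * env 1 (x - z)) * |ψ (x - z)|) := by gcongr
          _ = _ := by ring
  have hinner : ∀ z, ∫ x, η z * (G x * ψ (x - z)) = η z * (U k ψ (y - z) s - U k ψ (-z) 1) := by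
    intro z
    rw [integral_const_mul, hψ.U_sub k (y - z) (-z) hs one_pos]
    congr 1
    rw [← integral_sub_right_eq_self (fun x => (Hk k (pt (y - z - x) s) - Hk k (pt (-z - x) 1)) * ψ x) z]
    congr 1; ext x
    rw [hG]; simp only
    rw [show y - z - (x - z) = y - x by abel, show -z - (x - z) = -x by abel]
  constructor
  · exact hintg.integral_prod_right.congr (ae_of_all _ hinner)
  · rw [← integral_congr_ae (ae_of_all _ hinner), ← integral_integral_swap hintg]
    unfold U
    congr 1; ext x
    have : mol η ψ x = ∫ z, η z * ψ (x - z) := by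
      unfold mol
      rw [← integral_sub_left_eq_self (fun z => η z * ψ (x - z)) _ x]
      congr 1; ext z; rw [sub_sub_cancel]
    rw [this, ← integral_const_mul]
    congr 1; ext z; ring

/-- boundary values of the Poisson extension -/
theorem U_none_tendsto {n : ℕ} {w : Eu n → ℝ} (hw : UniformContinuous w) (hi : WI w) (y : Eu n) :
    Tendsto (fun s => U none w y s) (nhdsWithin 0 (Ioi 0)) (nhds (kap n * w y - ∫ x, Hk none (pt (-x) 1) * w x)) := by
  set N := |w y| + 1 with hN
  have hN0 : 0 ≤ N := by positivity
  set w1 : Eu n → ℝ := fun x => trunc N (w x) with hw1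
  set w2 : Eu n → ℝ := fun x => w x - w1 x with hw2
  have hu1 : UniformContinuous w1 := by
    rw [Metric.uniformContinuous_iff] at hw ⊢
    intro ε hε
    obtain ⟨d, hd, h⟩ := hw ε hε
    refine ⟨d, hd, fun {a b} hab => ?_⟩
    have h1 := h hab
    rw [Real.dist_eq] at h1 ⊢
    exact (trunc_lip N (w a) (w b)).trans_lt h1
  have hb1 : ∀ x, |w1 x| ≤ N := fun x => trunc_le hN0 _
  have hi1 : WI w1 := WI.of_bdd hu1.continuous.aestronglyMeasurable hb1
  have hi2 : WI w2 := hi.sub hi1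
  obtain ⟨r, hr, hr2⟩ : ∃ r > 0, ∀ x, ‖y - x‖ < r → w2 x = 0 := by
    obtain ⟨d, hd, h⟩ := Metric.uniformContinuous_iff.1 hw 1 one_pos
    refine ⟨d, hd, fun x hx => ?_⟩
    have := @h x y (by rw [dist_comm, dist_eq_norm]; exact hx)
    rw [Real.dist_eq] at this
    rw [hw2, hw1]; simp only
    rw [trunc_eq, sub_self]
    have := abs_sub_abs_le_abs_sub (w x) (w y)
    linarith
  have hd : ∀ s, 0 < s → U none w y s = PX w1 (pt y s) + (∫ x, Hk none (pt (y - x) s) * w2 x) - ∫ x, Hk none (pt (-x) 1) * w x := by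
    intro s hs
    have i0 := hi.ker (EnvB.pk one_pos 0)
    simp only [zero_sub] at i0
    have i1 := hi1.ker (EnvB.pk hs y)
    have i2 := hi2.ker (EnvB.pk hs y)
    rw [PX_pt, ← integral_add i1 i2, ← integral_sub (intg_add i1 i2) i0]
    unfold U
    congr 1; ext x
    rw [hw2]; ring
  have t1 : Tendsto (fun s => PX w1 (pt y s)) (nhdsWithin 0 (Ioi 0)) (nhds (kap n * w y)) := by
    have hwy : w1 y = w y := trunc_eq (by rw [hN]; linarith)
    rw [Metric.tendsto_nhdsWithin_nhds]
    intro ε hε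
    obtain ⟨d, hd, h⟩ := PX_boundary hu1 hb1 (half_pos hε)
    refine ⟨d, hd, fun {s} hs hsd => ?_⟩
    rw [Real.dist_eq, sub_zero, abs_of_pos hs] at hsd
    have := h y s hs hsd
    rw [hwy] at this
    rw [Real.dist_eq]; linarith
  have t2 : Tendsto (fun s => ∫ x, Hk none (pt (y - x) s) * w2 x) (nhdsWithin 0 (Ioi 0)) (nhds 0) := by
    have iE : Integrable (fun x => env r (y - x) * |w2 x|) := by
      have := (hi2.ker (EnvB.env hr y)).abs
      refine this.congr (ae_of_all _ fun x => ?_)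
      simp only [abs_mul, abs_of_pos (env_pos hr _)]
    rw [tendsto_zero_iff_norm_tendsto_zero]
    have hlim : Tendsto (fun s : ℝ => s * (2 ^ (n+1) / r * ∫ x, env r (y - x) * |w2 x|)) (nhdsWithin 0 (Ioi 0)) (nhds 0) := by
      have : Tendsto (fun s : ℝ => s * (2 ^ (n+1) / r * ∫ x, env r (y - x) * |w2 x|)) (nhds 0) (nhds (0 * (2 ^ (n+1) / r * ∫ x, env r (y - x) * |w2 x|))) := Continuous.tendsto (by fun_prop) 0
      rw [zero_mul] at this
      exact this.mono_left nhdsWithin_le_nhds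
    refine squeeze_zero' (Eventually.of_forall fun _ => norm_nonneg _) ?_ hlim
    filter_upwards [self_mem_nhdsWithin] with s hs
    have hs : 0 < s := hs
    rw [← mul_assoc, ← integral_const_mul]
    refine norm_integral_le_of_norm_le (iE.const_mul _) (ae_of_all _ fun x => ?_)
    rw [norm_mul, Real.norm_eq_abs, Real.norm_eq_abs, ← mul_assoc]
    rcases lt_or_ge ‖y - x‖ r with hx | hx
    · rw [hr2 x hx]; simp
    · gcongr
      rw [abs_of_pos (pk_pos hs _)]
      unfold Hk env
      rw [pt_none]
      have h1 := norm_le_norm_pt (y - x) s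
      have h2 : 0 < ‖y - x‖ := lt_of_lt_of_le hr hx
      calc s / ‖pt (y - x) s‖ ^ (n+1) ≤ s / ‖y - x‖ ^ (n+1) := by gcongr
        _ = s * (2 ^ (n+1) / r) * (r / (2 * ‖y - x‖) ^ (n+1)) := by rw [mul_pow]; field_simp
        _ ≤ _ := by gcongr; linarith
  have := (t1.add t2).sub_const (∫ x, Hk none (pt (-x) 1) * w x)
  rw [add_zero] at this
  refine this.congr' ?_
  filter_upwards [self_mem_nhdsWithin] with s hs
  exact (hd s hs).symm

set_option linter.unusedVariables false

theorem BMOB.const {n : ℕ} (a : ℝ) : BMOB (fun _ : Eu n => a) 0 := by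
  have := BMOB.of_forall (n := n) (f := fun _ => a) (b := 0) (locallyIntegrable_const a) fun c l hl => ⟨a, by simp⟩
  simpa using this

theorem BMOB.of_bdd {n : ℕ} {f : Eu n → ℝ} (hm : Measurable f) {M : ℝ} (h : ∀ x, |f x| ≤ M) : BMOB f (2 * M) := by
  refine BMOB.of_forall (bdd_locInt hm h) fun c l hl => ⟨0, ?_⟩
  rw [← setIntegral_cube_const M c hl]
  refine setIntegral_mono_on (integrableOn_cube (locInt_sub_const (bdd_locInt hm h) 0) c l).abs (integrableOn_cube_const M c l) (measurableSet_cube c l) fun x _ => ?_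
  rw [sub_zero]; exact h x

def VO {n : ℕ} (u : Eu n → ℝ) : Prop := ∀ ε > 0, ∃ r > 0, SO u r ε

theorem SO.sub {n : ℕ} {u v : Eu n → ℝ} (hu : LocallyIntegrable u) (hv : LocallyIntegrable v) {r a b : ℝ} (h : SO u r a) (h' : SO v r b) :
    SO (fun x => u x - v x) r (a + b) := by
  intro c l hl hlr
  have h1 := cubeOsc_add_le (g := fun x => - v x) hl (integrableOn_cube hu c l) (integrableOn_cube hv c l).neg
  have h2 := cubeOsc_neg v c l
  have h3 := h c l hl hlr
  have h4 := h' c l hl hlr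
  have e : cubeOsc (fun x => u x - v x) c l ≤ cubeOsc u c l + cubeOsc (fun x => - v x) c l := by
    simpa [sub_eq_add_neg] using h1
  rw [h2] at e
  linarith

theorem VO.of_uc {n : ℕ} {u : Eu n → ℝ} (hu : UniformContinuous u) : VO u := by
  intro ε hε
  obtain ⟨d, hd, h⟩ := Metric.uniformContinuous_iff.1 hu (ε / 2) (half_pos hε)
  have hs : 0 < √n + 1 := by have := Real.sqrt_nonneg (n:ℝ); linarith
  refine ⟨d / (√n + 1), by positivity, fun c l hl hlr => ?_⟩
  have hl2 : l * (√n + 1) ≤ d := by rwa [le_div_iff₀ hs] at hlr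
  have hli := hu.continuous.locallyIntegrable (μ := (volume : Measure (Eu n)))
  have h1 := cubeOsc_le_two hl (integrableOn_cube hli c l) (u c)
  have h2 : ∫ x in cube c l, |u x - u c| ≤ ε / 2 * l ^ n := by
    rw [← setIntegral_cube_const _ c hl]
    refine setIntegral_mono_on (integrableOn_cube (locInt_sub_const hli _) c l).abs (integrableOn_cube_const _ c l) (measurableSet_cube c l) fun x hx => ?_
    have := cube_subset_ball c hl hx
    rw [Metric.mem_ball] at this
    have := @h x c (by linarith)
    rw [Real.dist_eq] at this; exact this.le
  have h0 := cube_nonempty_vol (n := n) hl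
  refine le_of_mul_le_mul_right ?_ h0
  linarith

theorem VO.sub {n : ℕ} {u v : Eu n → ℝ} (hu : LocallyIntegrable u) (hv : LocallyIntegrable v) (h : VO u) (h' : VO v) :
    VO (fun x => u x - v x) := by
  intro ε hε
  obtain ⟨r, hr, h1⟩ := h (ε / 2) (half_pos hε)
  obtain ⟨r', hr', h2⟩ := h' (ε / 2) (half_pos hε)
  refine ⟨min r r', by positivity, ?_⟩
  have h3 : SO u (min r r') (ε / 2) := fun c l hl hlr => h1 c l hl (hlr.trans (min_le_left _ _))
  have h4 : SO v (min r r') (ε / 2) := fun c l hl hlr => h2 c l hl (hlr.trans (min_le_right _ _))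
  have := h3.sub hu hv h4
  rwa [add_halves] at this

theorem lip_uc {n : ℕ} {f : Eu n → ℝ} {K : ℝ} (h : ∀ x y, |f x - f y| ≤ K * ‖x - y‖) : UniformContinuous f := by
  have hK : LipschitzWith (Real.toNNReal K) f := LipschitzWith.of_dist_le_mul fun x y => by
    rw [Real.dist_eq, dist_eq_norm]
    refine (h x y).trans ?_
    gcongr; exact Real.le_coe_toNNReal K
  exact hK.uniformContinuous

theorem step {n : ℕ} (hn : 1 ≤ n) : ∃ C > 0, ∀ (u : Eu n → ℝ) (b ε : ℝ), 0 < b → 0 < ε → BMOB u b → VO u →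
    ∃ (ψ : Option (Fin n) → Eu n → ℝ) (g : Fin n → Eu n → ℝ), (∀ k, UniformContinuous (ψ k)) ∧ (∀ k x, |ψ k x| ≤ C * b) ∧
      (∀ j x, Tendsto (fun t => U (some j) (ψ (some j)) x t) (nhdsWithin 0 (Ioi 0)) (nhds (g j x))) ∧
      BMOB (fun x => u x - (ψ none x + ∑ j, g j x)) ε ∧ UniformContinuous (fun x => ψ none x + ∑ j, g j x) := by
  obtain ⟨A, hA, hmol⟩ := exists_mol n
  have hκ := kap_pos n
  have hg0 := gC_pos n
  have hD := dJ_ge n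
  have hD0 : 0 < dJ n := by linarith
  have hc : 0 < cJ n A := by unfold cJ; positivity
  set c := cJ n A with hcd
  set κ := kap n with hκd
  refine ⟨(1 + κ⁻¹) * (gC n * (2 * ((1 + c)))), by positivity, fun u b ε hb hε hu hvo => ?_⟩
  set ω := ε / (c * (2 + c)) with hω
  have hω0 : 0 < ω := by positivity
  obtain ⟨r, hr, hr'⟩ := hvo ω hω0
  set δ := r / dJ n with hδd
  have hδ : 0 < δ := by positivity
  have hrδ : dJ n * δ = r := by rw [hδd]; field_simp
  rw [← hrδ] at hr'
  obtain ⟨η, L, hL, hη⟩ := hmol δ hδ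
  have hub : SO u (dJ n * δ) b := fun c l hl _ => hu.2 c l hl
  set v := mol η u with hv
  have hvu : UniformContinuous v := hη.uc hδ hL hu.1 hub
  have hvl : LocallyIntegrable v := hvu.continuous.locallyIntegrable
  have hd1 : BMOB (fun x => u x - v x) (c * ω) := hη.bmob hδ hA hL hu.1 hr'
  have hd2 : BMOB (fun x => u x - v x) (c * b) := hη.bmob hδ hA hL hu.1 hub
  have e1 : (fun x => u x - (u x - v x)) = v := by ext x; ring
  have hvb : BMOB v ((1 + c) * b) := by
    have := hu.sub hd2
    rw [e1] at this
    exact this.mono (by ring_nf; rfl)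
  have hvs : SO v (dJ n * δ) ((1 + c) * ω) := by
    have := hr'.sub hu.1 hd1.1 (fun c l hl _ => hd1.2 c l hl)
    rw [e1] at this
    convert this using 1; ring
  set w := mol η v with hw
  have hwu : UniformContinuous w := hη.uc hδ hL hvl hvs
  have hd3 : BMOB (fun x => v x - w x) (c * ((1 + c) * ω)) := hη.bmob hδ hA hL hvl hvs
  have hwb : WI w := by
    have := hvb.sub hd3
    have e2 : (fun x => v x - (v x - w x)) = w := by ext x; ring
    rw [e2] at this
    exact this.wi
  obtain ⟨β, hβm, hβb, hrep⟩ := dual_rep hn (by positivity : 0 < (1 + c) * b) hvb hvu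
  have hβw : ∀ k, WI (β k) := fun k => WI.of_bdd (hβm k).aestronglyMeasurable (hβb k)
  set χ : Option (Fin n) → Eu n → ℝ := fun k => mol η (β k) with hχ
  have hχb : ∀ k x, |χ k x| ≤ gC n * (2 * ((1 + c) * b)) := fun k x => hη.bdd (hβb k) x
  have hχl := fun k => hη.bdd_lip hδ hL (hβm k) (hβb k)
  have hχu : ∀ k, UniformContinuous (χ k) := fun k => lip_uc (hχl k)
  have hχw : ∀ k, WI (χ k) := fun k => WI.of_bdd (hχu k).continuous.aestronglyMeasurable (hχb k)
  have hid : ∀ y s, 0 < s → U none w y s = U none (χ none) y s + ∑ j, U (some j) (χ (some j)) y s := by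
    intro y s hs
    rw [(hη.U_mol hδ hvu.continuous.measurable hvb.wi none y hs).2]
    have hk := fun k => hη.U_mol hδ (hβm k) (hβw k) k y hs
    simp only [hχ, fun k => (hk k).2]
    rw [← integral_finsetSum _ fun j _ => (hk (some j)).1, ← integral_add (hk none).1 (integrable_finsetSum _ fun j _ => (hk (some j)).1)]
    congr 1; ext z
    rw [hrep (y - z) s hs, hrep (-z) 1 one_pos, ← Finset.mul_sum, Finset.sum_sub_distrib]
    ring
  choose G hG using fun j => U_lip_tendsto j (hχu (some j)).continuous (hχb (some j)) (hχl (some j))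
  set a1 := ∫ x, Hk none (pt (-x) 1) * w x
  set a2 := ∫ x, Hk none (pt (-x) 1) * χ none x
  have hlim : ∀ y, κ * w y - a1 = κ * χ none y - a2 + ∑ j, G j y := by
    intro y
    have l1 := U_none_tendsto hwu hwb y
    have l2 := (U_none_tendsto (hχu none) (hχw none) y).add (tendsto_finsetSum Finset.univ fun j _ => hG j y)
    refine tendsto_nhds_unique l1 (l2.congr' ?_)
    filter_upwards [self_mem_nhdsWithin] with s hs
    exact (hid y s hs).symm
  set ψ : Option (Fin n) → Eu n → ℝ := fun k => match k with
    | none => χ none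
    | some j => fun x => κ⁻¹ * χ (some j) x with hψ
  have hsum : ∀ x, ψ none x + ∑ j, κ⁻¹ * G j x = w x - κ⁻¹ * (a1 - a2) := by
    intro x
    have := hlim x
    have e : ∑ j, G j x = κ * w x - a1 - κ * χ none x + a2 := by linarith
    rw [← Finset.mul_sum, e, hψ]
    simp only
    field_simp; ring
  refine ⟨ψ, fun j x => κ⁻¹ * G j x, ?_, ?_, ?_, ?_, ?_⟩
  · rintro (_ | j)
    · exact hχu none
    · exact (hχu (some j)).const_smul κ⁻¹
  · rintro (_ | j) x
    · refine (hχb none x).trans ?_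
      have h1 : 0 ≤ κ⁻¹ * (gC n * (2 * (1 + c)) * b) := by positivity
      nlinarith
    · simp only [hψ, abs_mul]
      have h1 : 0 ≤ gC n * (2 * (1 + c)) * b := by positivity
      have h2 := hχb (some j) x
      rw [abs_of_pos (by positivity : 0 < κ⁻¹)]
      calc κ⁻¹ * |χ (some j) x| ≤ κ⁻¹ * (gC n * (2 * ((1 + c) * b))) := by gcongr
        _ ≤ _ := by nlinarith
  · intro j x
    refine ((hG j x).const_mul κ⁻¹).congr fun t => ?_
    rw [← U_const_mul]
  · have h1 := (hd1.add hd3).add (BMOB.const (n := n) (κ⁻¹ * (a1 - a2)))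
    have e3 : (fun x => u x - (ψ none x + ∑ j, κ⁻¹ * G j x)) = fun x => u x - v x + (v x - w x) + κ⁻¹ * (a1 - a2) := by
      ext x; rw [hsum x]; ring
    rw [e3]
    refine BMOB.mono h1 (le_of_eq ?_)
    rw [hω]; field_simp; ring
  · simp only [hsum]
    exact hwu.sub uniformContinuous_const

set_option linter.unusedVariables false

theorem iter {n : ℕ} (hn : 1 ≤ n) {u : Eu n → ℝ} {b : ℝ} (hb : 0 < b) (hu : BMOB u b) (hv : VO u) :
    ∃ (K : ℝ) (ψ : ℕ → Option (Fin n) → Eu n → ℝ) (g : ℕ → Fin n → Eu n → ℝ), 0 < K ∧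
      (∀ m k, UniformContinuous (ψ m k)) ∧ (∀ m k x, |ψ m k x| ≤ K * (1/2) ^ m) ∧
      (∀ m j x, Tendsto (fun t => U (some j) (ψ m (some j)) x t) (nhdsWithin 0 (Ioi 0)) (nhds (g m j x))) ∧
      ∀ m, BMOB (fun x => u x - ∑ i ∈ Finset.range m, (ψ i none x + ∑ j, g i j x)) (b * (1/2) ^ m) := by
  classical
  obtain ⟨C, hC, hstep⟩ := step hn
  have hstep' : ∀ (p : (Eu n → ℝ) × ℝ), ∃ (q : (Option (Fin n) → Eu n → ℝ) × (Fin n → Eu n → ℝ)),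
      0 < p.2 → BMOB p.1 p.2 → VO p.1 → (∀ k, UniformContinuous (q.1 k)) ∧ (∀ k x, |q.1 k x| ≤ C * p.2) ∧
      (∀ j x, Tendsto (fun t => U (some j) (q.1 (some j)) x t) (nhdsWithin 0 (Ioi 0)) (nhds (q.2 j x))) ∧
      BMOB (fun x => p.1 x - (q.1 none x + ∑ j, q.2 j x)) (p.2 / 2) ∧ UniformContinuous (fun x => q.1 none x + ∑ j, q.2 j x) := by
    rintro ⟨u, b⟩
    by_cases h : 0 < b ∧ BMOB u b ∧ VO u
    · obtain ⟨ψ, g, h'⟩ := hstep u b (b / 2) h.1 (half_pos h.1) h.2.1 h.2.2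
      exact ⟨(ψ, g), fun _ _ _ => h'⟩
    · exact ⟨(fun _ _ => 0, fun _ _ => 0), fun h1 h2 h3 => absurd ⟨h1, h2, h3⟩ h⟩
  choose Q hQ using hstep'
  set un : ℕ → Eu n → ℝ := fun m => Nat.rec (motive := fun _ => Eu n → ℝ) u
    (fun m w x => w x - ((Q (w, b * (1/2) ^ m)).1 none x + ∑ j, (Q (w, b * (1/2) ^ m)).2 j x)) m with hun
  have hun0 : un 0 = u := rfl
  have hunS : ∀ m, un (m+1) = fun x => un m x - ((Q (un m, b * (1/2) ^ m)).1 none x + ∑ j, (Q (un m, b * (1/2) ^ m)).2 j x) := fun m => rfl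
  have hbm : ∀ m : ℕ, 0 < b * (1/2) ^ m := fun m => by positivity
  clear_value un
  have inv : ∀ m, BMOB (un m) (b * (1/2) ^ m) ∧ VO (un m) := by
    intro m
    induction m with
    | zero => rw [hun0]; simpa using ⟨hu, hv⟩
    | succ m ih =>
      obtain ⟨_, _, _, h4, h5⟩ := hQ (un m, b * (1/2) ^ m) (hbm m) ih.1 ih.2
      rw [hunS]
      refine ⟨?_, ih.2.sub ih.1.1 h5.continuous.locallyIntegrable (VO.of_uc h5)⟩
      convert h4 using 1
      simp only; ring
  have hP := fun m => hQ (un m, b * (1/2) ^ m) (hbm m) (inv m).1 (inv m).2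
  refine ⟨C * b, fun m => (Q (un m, b * (1/2) ^ m)).1, fun m => (Q (un m, b * (1/2) ^ m)).2, by positivity,
    fun m => (hP m).1, fun m k x => ?_, fun m => (hP m).2.2.1, fun m => ?_⟩
  · rw [mul_assoc]; exact (hP m).2.1 k x
  · have : ∀ m, (fun x => u x - ∑ i ∈ Finset.range m, ((Q (un i, b * (1/2) ^ i)).1 none x + ∑ j, (Q (un i, b * (1/2) ^ i)).2 j x)) = un m := by
      intro m
      induction m with
      | zero => simp [hun0]
      | succ m ih =>
        rw [hunS, ← ih]
        ext x
        simp only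
        rw [ih, Finset.sum_range_succ, ← ih]
        ring
    rw [this m]; exact (inv m).1

theorem WI.U_sum {n : ℕ} (k : Option (Fin n)) (ψ : ℕ → Eu n → ℝ) (h : ∀ i, WI (ψ i)) (m : ℕ) :
    WI (fun x => ∑ i ∈ Finset.range m, ψ i x) ∧ ∀ y s, 0 < s →
      U k (fun x => ∑ i ∈ Finset.range m, ψ i x) y s = ∑ i ∈ Finset.range m, U k (ψ i) y s := by
  induction m with
  | zero =>
    refine ⟨?_, fun y s hs => ?_⟩
    · simpa using (h 0).const_mul 0
    · simp [U]
  | succ m ih =>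
    simp only [Finset.sum_range_succ]
    refine ⟨ih.1.add (h m), fun y s hs => ?_⟩
    rw [ih.1.U_add (h m) k y hs, ih.2 y s hs]

theorem BMOB.sum {n : ℕ} {ι : Type*} (s : Finset ι) {f : ι → Eu n → ℝ} {b : ℝ} (h : ∀ i, BMOB (f i) b) :
    BMOB (fun x => ∑ i ∈ s, f i x) (s.card * b) := by
  classical
  induction s using Finset.induction_on with
  | empty => simpa using BMOB.const (n := n) 0
  | insert a s ha ih =>
    simp only [Finset.sum_insert ha, Finset.card_insert_of_notMem ha]
    refine ((h a).add ih).mono (le_of_eq ?_)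
    push_cast; ring

theorem repr_of_vmo {n : ℕ} (hn : 1 ≤ n) {u : Eu n → ℝ} {b : ℝ} (hb : 0 < b) (hu : BMOB u b) (hv : VO u) :
    ∃ (ψ : Option (Fin n) → Eu n → ℝ) (g : Fin n → Eu n → ℝ) (M : ℝ), (∀ k, UniformContinuous (ψ k)) ∧ (∀ k x, |ψ k x| ≤ M) ∧
      (∀ j, ∀ᵐ x, Tendsto (fun t => U (some j) (ψ (some j)) x t) (nhdsWithin 0 (Ioi 0)) (nhds (g j x))) ∧
      ∀ᵐ x, u x = ψ none x + ∑ j, g j x := by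
  obtain ⟨K, ψ, g, hK, hψu, hψb, hg, hB⟩ := iter hn hb hu hv
  have hsum : ∀ k x, Summable fun m => ψ m k x := fun k x =>
    Summable.of_norm_bounded (summable_geometric_two.mul_left K) fun m => by rw [Real.norm_eq_abs]; exact hψb m k x
  set Ψ : Option (Fin n) → Eu n → ℝ := fun k x => ∑' m, ψ m k x with hΨ
  have hrem : ∀ m k x, |Ψ k x - ∑ i ∈ Finset.range m, ψ i k x| ≤ 2 * K * (1/2) ^ m := by
    intro m k x
    have h1 := (hsum k x).sum_add_tsum_nat_add m
    have h2 : Ψ k x - ∑ i ∈ Finset.range m, ψ i k x = ∑' i, ψ (i + m) k x := by rw [hΨ]; simp only; linarith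
    rw [h2, ← Real.norm_eq_abs]
    have h3 : HasSum (fun i : ℕ => K * (1/2) ^ m * (1/2 : ℝ) ^ i) (K * (1/2) ^ m * 2) := hasSum_geometric_two.mul_left _
    refine (tsum_of_norm_bounded h3 fun i => ?_).trans (le_of_eq (by ring))
    rw [Real.norm_eq_abs]
    refine (hψb (i + m) k x).trans (le_of_eq ?_)
    rw [pow_add]; ring
  have hlim0 : ∀ c : ℝ, Tendsto (fun m : ℕ => c * (1/2 : ℝ) ^ m) atTop (nhds 0) := fun c => by
    simpa using (summable_geometric_two.tendsto_atTop_zero).const_mul c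
  have hΨu : ∀ k, UniformContinuous (Ψ k) := by
    intro k
    have hT : TendstoUniformly (fun (m : ℕ) x => ∑ i ∈ Finset.range m, ψ i k x) (Ψ k) atTop := by
      rw [Metric.tendstoUniformly_iff]
      intro ε hε
      filter_upwards [(hlim0 (2 * K)).eventually_lt_const hε] with m hm x
      rw [Real.dist_eq]
      exact (hrem m k x).trans_lt hm
    refine hT.uniformContinuous (Frequently.of_forall fun m => ?_)
    induction m with
    | zero => simpa using uniformContinuous_const
    | succ m ih => simp only [Finset.sum_range_succ]; exact ih.add (hψu m k)
  have hΨb : ∀ k x, |Ψ k x| ≤ 2 * K := fun k x => by simpa using hrem 0 k x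
  choose G hG using fun j => U_ae_lim j (hΨu (some j)) (hΨb (some j))
  have hΨw : ∀ k, WI (Ψ k) := fun k => WI.of_bdd (hΨu k).continuous.aestronglyMeasurable (hΨb k)
  have hψw : ∀ m k, WI (ψ m k) := fun m k => WI.of_bdd (hψu m k).continuous.aestronglyMeasurable (hψb m k)
  have hSm : ∀ m k, Measurable (fun x => Ψ k x - ∑ i ∈ Finset.range m, ψ i k x) := fun m k =>
    (hΨu k).continuous.measurable.sub (Finset.measurable_fun_sum _ fun i _ => (hψu i k).continuous.measurable)
  have hGb : ∀ m j, BMOB (fun x => G j x - ∑ i ∈ Finset.range m, g i j x) (2 * (cubC n * (2 * K * (1/2) ^ m))) := by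
    intro m j
    refine U_lim_BMOB j (hSm m (some j)) (by positivity) (hrem m (some j)) ?_
    filter_upwards [hG j] with x hx
    have := hx.sub (tendsto_finsetSum (Finset.range m) fun i _ => hg i j x)
    refine this.congr' ?_
    filter_upwards [self_mem_nhdsWithin] with t ht
    obtain ⟨h1, h2⟩ := WI.U_sum (some j) (fun i => ψ i (some j)) (fun i => hψw i (some j)) m
    rw [(hΨw (some j)).U_sub' h1 (some j) x ht, h2 x t ht]
  set F : Eu n → ℝ := fun x => u x - (Ψ none x + ∑ j, G j x) with hF
  have hFb : ∀ m : ℕ, BMOB F ((b + 2 * (2 * K) + n * (2 * (cubC n * (2 * K)))) * (1/2) ^ m) := by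
    intro m
    have h1 := ((hB m).sub (BMOB.of_bdd (hSm m none) (hrem m none))).sub (BMOB.sum Finset.univ (hGb m))
    have e : F = fun x => (u x - ∑ i ∈ Finset.range m, (ψ i none x + ∑ j, g i j x)) - (Ψ none x - ∑ i ∈ Finset.range m, ψ i none x)
        - ∑ j, (G j x - ∑ i ∈ Finset.range m, g i j x) := by
      ext x
      rw [hF, Finset.sum_add_distrib, Finset.sum_sub_distrib, Finset.sum_comm]
      ring
    rw [e]
    refine h1.mono (le_of_eq ?_)
    simp only [Finset.card_univ, Fintype.card_fin]
    ring
  have hF0 : BMOB F 0 := ⟨(hFb 0).1, fun c l hl => ge_of_tendsto' (hlim0 _) fun m => (hFb m).2 c l hl⟩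
  obtain ⟨a, ha⟩ := ae_const_of_osc_zero hF0
  refine ⟨fun k => match k with | none => fun x => Ψ none x + a | some j => Ψ (some j), G, 2 * K + |a|, ?_, ?_, hG, ?_⟩
  · rintro (_ | j)
    · exact (hΨu none).add uniformContinuous_const
    · exact hΨu (some j)
  · rintro (_ | j) x
    · exact (abs_add_le _ _).trans (by have := hΨb none x; linarith)
    · have := hΨb (some j) x; have := abs_nonneg a
      simp only; linarith
  · filter_upwards [ha] with x hx
    rw [hF] at hx
    simp only at hx ⊢
    linarith

theorem vmo_main {n : ℕ} (φ : Eu n → ℝ) (hφ : IsBMO φ) :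
    IsVMO φ ↔
      ∃ (φ₀ : Eu n → ℝ) (ψ g : Fin n → Eu n → ℝ),
        (UniformContinuous φ₀ ∧ ∃ B, ∀ x, |φ₀ x| ≤ B) ∧
        (∀ j, UniformContinuous (ψ j) ∧ ∃ B, ∀ x, |ψ j x| ≤ B) ∧
        (∀ j, IsRieszTransformLinf j (ψ j) (g j)) ∧
        ∀ᵐ x : Eu n, φ x = φ₀ x + ∑ j : Fin n, g j x := by
  constructor
  · rintro ⟨⟨hl, C, hC⟩, hV⟩
    rcases Nat.eq_zero_or_pos n with rfl | hn
    · refine ⟨φ, fun _ _ => 0, fun _ _ => 0, ⟨?_, |φ 0|, fun x => by rw [Subsingleton.elim x 0]⟩, fun j => j.elim0, fun j => j.elim0, by simp⟩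
      rw [Metric.uniformContinuous_iff]
      exact fun ε hε => ⟨1, one_pos, fun {a b} _ => by rw [Subsingleton.elim a b, dist_self]; exact hε⟩
    have hb : BMOB φ (|C| + 1) := ⟨hl, fun c l h => (hC c l h).trans (by linarith [le_abs_self C])⟩
    obtain ⟨ψ, g, M, hu, hM, hg, he⟩ := repr_of_vmo hn (by positivity) hb hV
    have hr := rc_pos n
    set χ : Fin n → Eu n → ℝ := fun j x => (rc n)⁻¹ * ψ (some j) x with hχ
    have hχu : ∀ j, UniformContinuous (χ j) := fun j => (hu (some j)).const_smul (rc n)⁻¹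
    have hχb : ∀ j x, |χ j x| ≤ (rc n)⁻¹ * M := fun j x => by
      rw [hχ]; simp only [abs_mul]
      rw [abs_of_pos (by positivity : 0 < (rc n)⁻¹)]
      have := hM (some j) x
      gcongr
    have hR := fun j => riesz_of_U j (hχu j).continuous (hχb j) (g := fun x => (rc n)⁻¹ * g j x) (by
      filter_upwards [hg j] with x hx
      refine (hx.const_mul (rc n)⁻¹).congr fun t => ?_
      rw [← U_const_mul])
    set a := ∑ j, rc n * rK j (χ j) with ha
    refine ⟨fun x => ψ none x - a, χ, _, ⟨(hu none).sub uniformContinuous_const, M + |a|, fun x => (abs_sub _ _).trans (by have := hM none x; linarith)⟩,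
      fun j => ⟨hχu j, _, hχb j⟩, hR, ?_⟩
    filter_upwards [he] with x hx
    rw [hx, Finset.sum_add_distrib, ← ha]
    have : ∀ j, rc n * ((rc n)⁻¹ * g j x) = g j x := fun j => by field_simp
    simp only [this]; ring
  · rintro ⟨φ₀, ψ, g, h0, hψ, hg, he⟩
    exact vmo_of_repr φ hφ φ₀ ψ g h0.1 hψ hg he

/-- **Representation theorem for `VMO(ℝⁿ)`:** `φ ∈ BMO(ℝⁿ)` belongs to `VMO(ℝⁿ)` iff
`φ = φ₀ + Σ_{j=1}^n R_j(φ_j)` for some bounded uniformly continuous `φ₀, …, φ_n`. -/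
theorem vmo_iff_buc_riesz_representation {n : ℕ} (φ : EuclideanSpace ℝ (Fin n) → ℝ)
    (hφ : IsBMO φ) :
    IsVMO φ ↔
      ∃ (φ₀ : EuclideanSpace ℝ (Fin n) → ℝ)
        (ψ g : Fin n → EuclideanSpace ℝ (Fin n) → ℝ),
        (UniformContinuous φ₀ ∧ ∃ B, ∀ x, |φ₀ x| ≤ B) ∧
        (∀ j, UniformContinuous (ψ j) ∧ ∃ B, ∀ x, |ψ j x| ≤ B) ∧
        (∀ j, IsRieszTransformLinf j (ψ j) (g j)) ∧
        ∀ᵐ x : EuclideanSpace ℝ (Fin n), φ x = φ₀ x + ∑ j : Fin n, g j x := by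
  exact vmo_main φ hφ
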